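/- Fix an odd prime power q with q ≡ 3 (mod 4) and an integer r ≥ 0. For d ≥ 1, let N(d) be the number of monic squarefree polynomials f of degree d over F_q, and let N_r(d) be the number of such f for which the subgroup {g ∈ Cl(R_f) : there exists h ∈ Cl(R_f) with h^4 = 1 and g = h^2} of the ideal class group Cl(R_f) of R_f = F_q[x][Y]/(Y^2 − f) has cardinality exactly 2^r. Then the ratio N_r(d)/N(d) converges, as d tends to infinity through odd integers, to μ_CL(r) := (1/#GL_r(F_2)) · ∏_{i=r+1}^∞ (1 − 2^{−i}). -/

import Mathlib

open Polynomial Matrix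

/-- The coordinate ring `F_q[x][Y]/(Y² - f)` of the affine hyperelliptic curve `y² = f(x)`. -/
noncomputable abbrev hyperellipticRing {F : Type} [Field F] (f : F[X]) : Type :=
  AdjoinRoot ((X : (F[X])[X]) ^ 2 - Polynomial.C f)

/-- The subgroup `2·Cl(R_f)[4] = {g : ∃ h, h⁴ = 1 ∧ g = h²}` of the ideal class group of
`R_f = F_q[x][Y]/(Y² - f)` has cardinality exactly `2 ^ r`.  (The `IsDomain` hypothesis is
automatically satisfied for squarefree `f` of degree `≥ 1`.) -/
def fourRankEq {F : Type} [Field F] (f : F[X]) (r : ℕ) : Prop :=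
  ∀ [IsDomain (hyperellipticRing f)],
    Nat.card {g : ClassGroup (hyperellipticRing f) |
      ∃ h : ClassGroup (hyperellipticRing f), h ^ 4 = 1 ∧ g = h ^ 2} = 2 ^ r

section Counting
open scoped Classical

variable {F : Type} [Field F] [Fintype F]

/-- The finite set of monic polynomials of degree `k`. -/
noncomputable def monics (F : Type) [Field F] [Fintype F] (k : ℕ) : Finset F[X] :=
  Finset.univ.image fun c : Fin k → F =>
    (((monicEquivDegreeLT k).trans (degreeLTEquiv F k).toEquiv).symm c).1

lemma mem_monics {k : ℕ} {f : F[X]} : f ∈ monics F k ↔ f.Monic ∧ f.natDegree = k := by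
  unfold monics
  rw [Finset.mem_image]
  constructor
  · rintro ⟨c, -, rfl⟩
    exact (((monicEquivDegreeLT k).trans (degreeLTEquiv F k).toEquiv).symm c).2
  · intro h
    exact ⟨((monicEquivDegreeLT k).trans (degreeLTEquiv F k).toEquiv) ⟨f, h⟩, Finset.mem_univ _,
      by simp⟩

lemma card_monics (k : ℕ) : (monics F k).card = Fintype.card F ^ k := by
  unfold monics
  rw [Finset.card_image_of_injective]
  · simp
  · intro a b h
    exact (Equiv.injective _) (Subtype.ext h)

lemma monics_disjoint {k l : ℕ} (h : k ≠ l) : Disjoint (monics F k) (monics F l) := by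
  rw [Finset.disjoint_left]
  intro f hf hfl
  rw [mem_monics] at hf hfl
  exact h (hf.2.symm.trans hfl.2)

/-- Monic squarefree polynomials of degree `k`. -/
noncomputable def sqfrees (F : Type) [Field F] [Fintype F] (k : ℕ) : Finset F[X] :=
  (monics F k).filter Squarefree

/-- Monic irreducible polynomials of degree `k`. -/
noncomputable def primes (F : Type) [Field F] [Fintype F] (k : ℕ) : Finset F[X] :=
  (monics F k).filter Irreducible

lemma mem_sqfrees {k : ℕ} {f : F[X]} :
    f ∈ sqfrees F k ↔ f.Monic ∧ f.natDegree = k ∧ Squarefree f := by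
  simp [sqfrees, mem_monics, and_assoc]

lemma mem_primes {k : ℕ} {f : F[X]} :
    f ∈ primes F k ↔ f.Monic ∧ f.natDegree = k ∧ Irreducible f := by
  simp [primes, mem_monics, and_assoc]

lemma card_primes_le (k : ℕ) : k * (primes F k).card ≤ Fintype.card F ^ k := by
  rcases Nat.eq_zero_or_pos k with rfl | hk
  · simp
  have h1 : (∏ P ∈ primes F k, P) ∣ X ^ Fintype.card F ^ k - X := by
    apply Finset.prod_dvd_of_coprime
    · intro P hP Q hQ hne
      have hP := mem_primes.1 hP
      have hQ := mem_primes.1 hQ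
      refine (hP.2.2.coprime_iff_not_dvd).2 fun hd => hne ?_
      exact eq_of_monic_of_associated hP.1 hQ.1 ((hP.2.2.associated_of_dvd hQ.2.2 hd))
    · intro P hP
      have hP := mem_primes.1 hP
      have := (hP.2.2.natDegree_dvd_iff_dvd_X_pow_card_pow_sub_X (n := k)).1 (by rw [hP.2.1])
      simpa [Nat.card_eq_fintype_card] using this
  have h2 := natDegree_le_of_dvd h1
    (FiniteField.X_pow_card_pow_sub_X_ne_zero F hk.ne' Fintype.one_lt_card)
  rw [FiniteField.X_pow_card_pow_sub_X_natDegree_eq F hk.ne' Fintype.one_lt_card,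
    natDegree_prod_of_monic _ _ (fun P hP => (mem_primes.1 hP).1),
    Finset.sum_congr rfl (fun P hP => (mem_primes.1 hP).2.1)] at h2
  simpa [mul_comm] using h2

/-- Each non-squarefree monic polynomial is divisible by the square of a monic polynomial
of positive degree. -/
lemma card_sqfrees_ge (hq : 3 ≤ Fintype.card F) (d : ℕ) :
    Fintype.card F ^ d ≤ 2 * (sqfrees F d).card := by
  set q := Fintype.card F with hqdef
  have key : (monics F d) ⊆ sqfrees F d ∪ (Finset.Icc 1 (d / 2)).biUnion (fun k =>
      (monics F k ×ˢ monics F (d - 2 * k)).image fun p => p.1 ^ 2 * p.2) := by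
    intro f hf
    have hf' := mem_monics.1 hf
    by_cases hs : Squarefree f
    · exact Finset.mem_union_left _ (Finset.mem_filter.2 ⟨hf, hs⟩)
    · refine Finset.mem_union_right _ ?_
      have : ∃ x : F[X], x * x ∣ f ∧ ¬ IsUnit x := by
        simpa [Squarefree] using hs
      obtain ⟨x, hx, hxu⟩ := this
      have hx0 : x ≠ 0 := by
        rintro rfl
        rw [zero_mul, zero_dvd_iff] at hx
        exact hf'.1.ne_zero hx
      set P := normalize x with hP
      have hPm : P.Monic := monic_normalize hx0
      have hPx : Associated P x := normalize_associated x
      have hPf : P ^ 2 ∣ f := by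
        rw [sq]; exact ((hPx.mul_mul hPx).dvd).trans hx
      obtain ⟨g, hg⟩ := hPf
      have hgm : g.Monic := by
        have h1 := hf'.1
        rw [hg] at h1
        exact (hPm.pow 2).of_mul_monic_left h1
      have hdeg : 2 * P.natDegree + g.natDegree = d := by
        rw [← hf'.2, hg, (hPm.pow 2).natDegree_mul hgm, hPm.natDegree_pow]
      have hPpos : 1 ≤ P.natDegree := by
        rw [Nat.one_le_iff_ne_zero]
        intro h0
        have := eq_one_of_monic_natDegree_zero hPm h0
        rw [this] at hPx
        exact hxu (hPx.isUnit isUnit_one)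
      rw [Finset.mem_biUnion]
      refine ⟨P.natDegree, Finset.mem_Icc.2 ⟨hPpos, by omega⟩, ?_⟩
      rw [Finset.mem_image]
      refine ⟨(P, g), Finset.mem_product.2 ⟨mem_monics.2 ⟨hPm, rfl⟩, mem_monics.2 ⟨hgm, ?_⟩⟩, hg.symm⟩
      show g.natDegree = _
      omega
  have h1 : q ^ d ≤ (sqfrees F d).card + ∑ k ∈ Finset.Icc 1 (d / 2), q ^ (d - k) := by
    rw [← card_monics (F := F) d]
    refine (Finset.card_le_card key).trans ((Finset.card_union_le _ _).trans ?_)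
    gcongr
    refine Finset.card_biUnion_le.trans (Finset.sum_le_sum fun k hk => ?_)
    rw [Finset.mem_Icc] at hk
    refine Finset.card_image_le.trans ?_
    rw [Finset.card_product, card_monics, card_monics, ← pow_add]
    apply le_of_eq; congr 1; omega
  have h2 : ∀ n, n ≤ d → 2 * ∑ k ∈ Finset.Icc 1 n, q ^ (d - k) + q ^ (d - n) ≤ q ^ d := by
    intro n
    induction n with
    | zero => intro _; simp
    | succ n ih =>
      intro hn
      rw [Finset.sum_Icc_succ_top (by omega)]
      have h3 := ih (by omega)
      have h4 : q ^ (d - n) = q * q ^ (d - (n + 1)) := by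
        rw [← pow_succ']; congr 1; omega
      rw [h4] at h3
      have : 3 * q ^ (d - (n + 1)) ≤ q * q ^ (d - (n+1)) := Nat.mul_le_mul_right _ hq
      omega
  have h3 := h2 (d / 2) (by omega)
  omega

end Counting

section LegendreSymbol
open scoped Classical

lemma resultant_monic_deg {R : Type*} [CommRing R] {B : R[X]} (hB : B.Monic) (A : R[X]) {n : ℕ}
    (hn : A.natDegree ≤ n) : resultant B A B.natDegree n = resultant B A := by
  obtain ⟨k, rfl⟩ := Nat.exists_eq_add_of_le hn
  rw [resultant_add_right_deg _ _ _ _ _ le_rfl, coeff_natDegree, hB.leadingCoeff, one_pow, one_mul]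

lemma resultant_monic_mul_right {R : Type*} [CommRing R] {B : R[X]} (hB : B.Monic) (A₁ A₂ : R[X]) :
    resultant B (A₁ * A₂) = resultant B A₁ * resultant B A₂ := by
  rw [← resultant_monic_deg hB _ natDegree_mul_le, resultant_mul_right _ _ _ _ le_rfl]

lemma resultant_monic_congr {R : Type*} [CommRing R] {B : R[X]} (hB : B.Monic) (A p : R[X]) :
    resultant B (A + B * p) = resultant B A := by
  set n := max A.natDegree (p.natDegree + B.natDegree)
  have h1 : (A + B * p).natDegree ≤ n := by
    refine (natDegree_add_le _ _).trans (max_le (le_max_left _ _) ?_)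
    refine natDegree_mul_le.trans ((by rw [add_comm]; exact le_max_right _ _))
  rw [← resultant_monic_deg hB _ h1, resultant_add_mul_right _ _ _ _ _ (le_max_right _ _) le_rfl,
    resultant_monic_deg hB _ (le_max_left _ _)]

variable {F : Type} [Field F] [Fintype F]

/-- The Legendre–Jacobi symbol `(A / B)` for polynomials over a finite field. -/
noncomputable def leg (A B : F[X]) : ℤ := quadraticChar F (B.resultant A)

lemma leg_mul_left (A₁ A₂ : F[X]) {B : F[X]} (hB : B.Monic) :
    leg (A₁ * A₂) B = leg A₁ B * leg A₂ B := by
  rw [leg, resultant_monic_mul_right hB, map_mul]; rfl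

lemma leg_mul_right (A : F[X]) {B₁ B₂ : F[X]} (h1 : B₁.Monic) (h2 : B₂.Monic) :
    leg A (B₁ * B₂) = leg A B₁ * leg A B₂ := by
  simp only [leg]
  rw [h1.natDegree_mul h2, resultant_mul_left _ _ _ _ le_rfl, map_mul]

lemma leg_congr {A A' B : F[X]} (hB : B.Monic) (h : B ∣ A - A') : leg A B = leg A' B := by
  obtain ⟨p, hp⟩ := h
  rw [sub_eq_iff_eq_add'.1 hp, leg, resultant_monic_congr hB, leg]

lemma leg_one_right (A : F[X]) : leg A 1 = 1 := by
  simp [leg]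

lemma leg_one_left (B : F[X]) : leg 1 B = 1 := by
  simp [leg]

lemma leg_C (c : F) (B : F[X]) :
    leg (C c) B = quadraticChar F c ^ B.natDegree := by
  rw [leg, natDegree_C, resultant_C_right, pow_zero, one_mul, map_pow]

lemma leg_eq_zero_iff {A B : F[X]} (hB : B.Monic) : leg A B = 0 ↔ ¬ IsCoprime A B := by
  rw [leg, quadraticChar_eq_zero_iff, resultant_eq_zero_iff, isCoprime_comm]
  simp [hB.ne_zero]

lemma leg_cases (A B : F[X]) : leg A B = 0 ∨ leg A B = 1 ∨ leg A B = -1 := by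
  by_cases h : B.resultant A = 0
  · left; simp [leg, h]
  · right; exact quadraticChar_dichotomy h

lemma leg_of_coprime {A B : F[X]} (hB : B.Monic) (h : IsCoprime A B) :
    leg A B = 1 ∨ leg A B = -1 := by
  rcases leg_cases A B with h0 | h0
  · exact absurd h ((leg_eq_zero_iff hB).1 h0)
  · exact h0

lemma quadraticChar_neg_one_of_three_mod_four (hq : Fintype.card F % 4 = 3) :
    quadraticChar F (-1) = -1 := by
  have h2 : ringChar F ≠ 2 := by
    intro h
    have := FiniteField.even_card_of_char_two h
    omega
  rw [quadraticChar_neg_one h2, ZMod.χ₄_nat_three_mod_four hq]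

/-- Quadratic reciprocity over a field with `q ≡ 3 (mod 4)` elements. -/
lemma leg_reciprocity (hq : Fintype.card F % 4 = 3) (A B : F[X]) :
    leg A B = (-1) ^ (A.natDegree * B.natDegree) * leg B A := by
  simp only [leg]
  rw [resultant_comm, map_mul, map_pow, quadraticChar_neg_one_of_three_mod_four hq, mul_comm A.natDegree]

lemma leg_prod_right {ι : Type*} (A : F[X]) (s : Finset ι) (B : ι → F[X])
    (hB : ∀ i ∈ s, (B i).Monic) : leg A (∏ i ∈ s, B i) = ∏ i ∈ s, leg A (B i) := by
  induction s using Finset.induction_on with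
  | empty => simp [leg_one_right]
  | insert a s ha ih =>
    rw [Finset.prod_insert ha, Finset.prod_insert ha,
      leg_mul_right _ (hB a (by simp)) (monic_prod_of_monic _ _ fun i hi => hB i (by simp [hi])),
      ih fun i hi => hB i (by simp [hi])]

lemma leg_prod_left {ι : Type*} {B : F[X]} (hB : B.Monic) (s : Finset ι) (A : ι → F[X]) :
    leg (∏ i ∈ s, A i) B = ∏ i ∈ s, leg (A i) B := by
  induction s using Finset.induction_on with
  | empty => simp [leg_one_left]
  | insert a s ha ih =>
    rw [Finset.prod_insert ha, Finset.prod_insert ha, leg_mul_left _ _ hB, ih]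

lemma resultant_eq_norm {P : F[X]} (hP : P.Monic) (hI : Irreducible P) (A : F[X]) :
    P.resultant A = Algebra.norm F (AdjoinRoot.mk P A) := by
  haveI : Fact (Irreducible P) := ⟨hI⟩
  let E := AlgebraicClosure F
  apply (algebraMap F E).injective
  haveI : FiniteDimensional F (AdjoinRoot P) := (AdjoinRoot.powerBasis hI.ne_zero).finite
  rw [Algebra.norm_eq_prod_embeddings]
  have hmin : minpoly F (AdjoinRoot.powerBasis hI.ne_zero).gen = P := by
    rw [AdjoinRoot.minpoly_powerBasis_gen_of_monic hP]
  rw [← resultant_map_map]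
  have hsp : (P.map (algebraMap F E)).Splits := IsAlgClosed.splits _
  have hd : (P.map (algebraMap F E)).natDegree = P.natDegree := natDegree_map _
  conv_lhs => rw [← hd]
  rw [resultant_eq_prod_eval _ _ _ natDegree_map_le hsp,
    (hP.map _).leadingCoeff, one_pow, one_mul]
  have hsep : P.Separable := PerfectField.separable_of_irreducible hI
  have hnd : (P.map (algebraMap F E)).roots.Nodup := nodup_roots hsep.map
  rw [Fintype.prod_equiv (AdjoinRoot.powerBasis hI.ne_zero).liftEquiv' _
    (fun y => (A.map (algebraMap F E)).eval y.1)]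
  · rw [hmin, aroots]
    have : (P.map (algebraMap F E)).roots = (P.map (algebraMap F E)).roots.toFinset.val := by
      rw [Multiset.toFinset_val, hnd.dedup]
    rw [this]
    change ∏ y ∈ (P.map (algebraMap F E)).roots.toFinset, _ = _
    rw [← Finset.prod_coe_sort]
    refine Fintype.prod_equiv (Equiv.subtypeEquivRight fun x => ?_) _ _ ?_
    · rw [Multiset.toFinset_val, hnd.dedup, Multiset.mem_toFinset]
    · intro x; rfl
  · intro σ
    simp only [PowerBasis.liftEquiv'_apply_coe, AdjoinRoot.powerBasis_gen]
    rw [eval_map_algebraMap, aeval_algHom_apply, AdjoinRoot.aeval_eq]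

lemma ringChar_ne_two_of_mod (hq : Fintype.card F % 4 = 3) : ringChar F ≠ 2 := by
  intro h
  have := FiniteField.even_card_of_char_two h
  omega

/-- Euler's criterion: `(A / P) = 1` iff `A` is a nonzero square modulo the prime `P`. -/
lemma leg_prime_eq_one_iff (h2 : ringChar F ≠ 2) {P : F[X]} (hP : P.Monic) (hI : Irreducible P)
    {A : F[X]} (hA : ¬ P ∣ A) : leg A P = 1 ↔ ∃ B : F[X], P ∣ A - B ^ 2 := by
  haveI : Fact (Irreducible P) := ⟨hI⟩
  haveI : FiniteDimensional F (AdjoinRoot P) := (AdjoinRoot.powerBasis hI.ne_zero).finite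
  haveI : Finite (AdjoinRoot P) := Module.finite_of_finite F
  haveI := Fintype.ofFinite (AdjoinRoot P)
  have hK2 : ringChar (AdjoinRoot P) ≠ 2 := by
    rw [← Algebra.ringChar_eq F (AdjoinRoot P)]; exact h2
  have hx : AdjoinRoot.mk P A ≠ 0 := by rwa [Ne, AdjoinRoot.mk_eq_zero]
  have e1 : quadraticChar F (P.resultant A) = quadraticChar (AdjoinRoot P) (AdjoinRoot.mk P A) := by
    have hN : P.resultant A ≠ 0 := by
      rw [resultant_eq_norm hP hI]; exact Algebra.norm_ne_zero_iff.2 hx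
    have h3 : ((quadraticChar F (P.resultant A) : ℤ) : AdjoinRoot P)
        = (quadraticChar (AdjoinRoot P) (AdjoinRoot.mk P A) : ℤ) := by
      rw [quadraticChar_eq_pow_of_char_ne_two' hK2]
      have h4 := quadraticChar_eq_pow_of_char_ne_two' h2 (P.resultant A)
      have h5 := congrArg (algebraMap F (AdjoinRoot P)) h4
      rw [map_intCast] at h5
      rw [h5, map_pow, resultant_eq_norm hP hI, FiniteField.algebraMap_norm_eq_pow, ← pow_mul]
      congr 1
      rw [Nat.card_eq_fintype_card, Nat.card_eq_fintype_card]
      have hodd := FiniteField.odd_card_of_char_ne_two h2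
      have hodd' := FiniteField.odd_card_of_char_ne_two hK2
      obtain ⟨m, hm⟩ : (Fintype.card F - 1) ∣ (Fintype.card (AdjoinRoot P) - 1) := by
        rw [Module.card_eq_pow_finrank (K := F) (V := AdjoinRoot P)]
        simpa using Nat.sub_dvd_pow_sub_pow (Fintype.card F) 1
          (Module.finrank F (AdjoinRoot P))
      have h1 : 1 < Fintype.card F := Fintype.one_lt_card
      rw [hm, Nat.mul_div_cancel_left _ (by omega)]
      have e2 : Fintype.card F / 2 * 2 = Fintype.card F - 1 := by omega
      have e3 : Fintype.card (AdjoinRoot P) / 2 * 2 = Fintype.card (AdjoinRoot P) - 1 := by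
        omega
      have : (m * (Fintype.card F / 2)) * 2 = Fintype.card (AdjoinRoot P) / 2 * 2 := by
        rw [mul_assoc, e2, e3, hm, mul_comm]
      omega
    rcases quadraticChar_dichotomy hN with h | h <;>
    rcases quadraticChar_dichotomy hx with h' | h' <;> rw [h, h'] at h3 ⊢ <;> exfalso
    · exact Ring.neg_one_ne_one_of_char_ne_two hK2 (by simpa using h3.symm)
    · exact Ring.neg_one_ne_one_of_char_ne_two hK2 (by simpa using h3)
  rw [leg, e1, quadraticChar_one_iff_isSquare hx]
  constructor
  · rintro ⟨y, hy⟩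
    obtain ⟨B, rfl⟩ := AdjoinRoot.mk_surjective y
    refine ⟨B, ?_⟩
    rw [← AdjoinRoot.mk_eq_zero, map_sub, hy, map_pow, sq, sub_self]
  · rintro ⟨B, hB⟩
    rw [← AdjoinRoot.mk_eq_zero, map_sub, map_pow, sub_eq_zero] at hB
    exact ⟨AdjoinRoot.mk P B, by rw [hB, sq]⟩

lemma exists_leg_prime_eq_neg_one (h2 : ringChar F ≠ 2) {P : F[X]} (hP : P.Monic)
    (hI : Irreducible P) : ∃ A : F[X], leg A P = -1 := by
  haveI : Fact (Irreducible P) := ⟨hI⟩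
  haveI : FiniteDimensional F (AdjoinRoot P) := (AdjoinRoot.powerBasis hI.ne_zero).finite
  haveI : Finite (AdjoinRoot P) := Module.finite_of_finite F
  obtain ⟨a, ha⟩ := quadraticChar_exists_neg_one h2
  obtain ⟨x, hx⟩ := FiniteField.norm_surjective F (AdjoinRoot P) a
  obtain ⟨A, rfl⟩ := AdjoinRoot.mk_surjective x
  exact ⟨A, by rw [leg, resultant_eq_norm hP hI, hx, ha]⟩

end LegendreSymbol

section Orthogonality
open scoped Classical

variable {F : Type} [Field F] [Fintype F]

lemma exists_prime_dvd {D : F[X]} (hD : D.Monic) (h1 : D ≠ 1) :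
    ∃ P : F[X], P.Monic ∧ Irreducible P ∧ P ∣ D := by
  obtain ⟨P, hP, hPD⟩ := WfDvdMonoid.exists_irreducible_factor
    (fun hu => h1 (hD.isUnit_iff.1 hu)) hD.ne_zero
  exact ⟨normalize P, monic_normalize hP.ne_zero,
    (normalize_associated P).irreducible_iff.2 hP, (normalize_associated P).dvd.trans hPD⟩

lemma exists_leg_eq_neg_one (h2 : ringChar F ≠ 2) {D : F[X]} (hD : D.Monic) (hs : Squarefree D)
    (h1 : D ≠ 1) : ∃ A : F[X], leg A D = -1 := by
  obtain ⟨P, hP, hI, D', rfl⟩ := exists_prime_dvd hD h1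
  have hD' : D'.Monic := hP.of_mul_monic_left hD
  have hcop : IsCoprime P D' := by
    refine (hI.coprime_iff_not_dvd).2 fun hd => ?_
    exact hI.not_isUnit (hs P (mul_dvd_mul_left P hd))
  obtain ⟨u, v, huv⟩ := hcop
  obtain ⟨a, ha⟩ := exists_leg_prime_eq_neg_one h2 hP hI
  refine ⟨a * v * D' + u * P, ?_⟩
  rw [leg_mul_right _ hP hD', leg_congr hP (A' := a), leg_congr hD' (A' := 1), ha, leg_one_left]
  · norm_num
  · refine ⟨a * v - v, ?_⟩
    linear_combination huv
  · refine ⟨u - a * u, ?_⟩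
    linear_combination a * huv

lemma sum_leg_eq_zero {D : F[X]} (hD : D.Monic) {A₀ : F[X]} (hA : leg A₀ D = -1) {k : ℕ}
    (hk : D.natDegree ≤ k) : ∑ A ∈ monics F k, leg A D = 0 := by
  set σ : F[X] → F[X] := fun A => D * (A /ₘ D) + (A₀ * A) %ₘ D with hσ
  have hcop : IsCoprime A₀ D := by
    by_contra h
    rw [(leg_eq_zero_iff hD).2 h] at hA
    norm_num at hA
  have hmaps : ∀ A ∈ monics F k, σ A ∈ monics F k := by
    intro A hA'
    rw [mem_monics] at hA' ⊢
    have hle : D.degree ≤ A.degree := by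
      rw [degree_eq_natDegree hD.ne_zero, degree_eq_natDegree hA'.1.ne_zero, hA'.2]
      exact_mod_cast hk
    have hqm : (A /ₘ D).Monic := by
      rw [Monic, leadingCoeff_divByMonic_of_monic hD hle]; exact hA'.1
    have hqd : (A /ₘ D).natDegree = k - D.natDegree := by
      rw [natDegree_divByMonic _ hD, hA'.2]
    have hm : (D * (A /ₘ D)).Monic := hD.mul hqm
    have hmd : (D * (A /ₘ D)).natDegree = k := by
      rw [hD.natDegree_mul hqm, hqd]; omega
    have hlt : ((A₀ * A) %ₘ D).degree < (D * (A /ₘ D)).degree := by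
      refine (degree_modByMonic_lt _ hD).trans_le ?_
      rw [degree_eq_natDegree hD.ne_zero, degree_eq_natDegree hm.ne_zero, hmd]
      exact_mod_cast hk
    exact ⟨hm.add_of_left hlt, by rw [natDegree_add_eq_left_of_degree_lt hlt, hmd]⟩
  have hinj : Set.InjOn σ (monics F k) := by
    intro A _ B _ hAB
    have h1 : A /ₘ D = B /ₘ D := by
      have e : ∀ A, σ A /ₘ D = A /ₘ D := fun A =>
        (div_modByMonic_unique (A /ₘ D) ((A₀ * A) %ₘ D) hD
          ⟨by rw [hσ]; ring, degree_modByMonic_lt _ hD⟩).1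
      rw [← e A, hAB, e B]
    have h2 : (A₀ * A) %ₘ D = (A₀ * B) %ₘ D := by
      have : σ A = σ B := hAB
      simp only [hσ, h1] at this
      exact add_left_cancel this
    have h3 : D ∣ A₀ * (A - B) := by
      rw [mul_sub]
      exact (modByMonic_eq_zero_iff_dvd hD).1 (by rw [sub_modByMonic, h2, sub_self])
    have h4 : D ∣ A - B := hcop.symm.dvd_of_dvd_mul_left h3
    have h5 : A %ₘ D = B %ₘ D := by
      have := (modByMonic_eq_zero_iff_dvd hD).2 h4
      rwa [sub_modByMonic, sub_eq_zero] at this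
    rw [← modByMonic_add_div A D, ← modByMonic_add_div B D, h1, h5]
  have himg : (monics F k).image σ = monics F k := by
    apply Finset.eq_of_subset_of_card_le
    · intro B hB
      obtain ⟨A, hA, rfl⟩ := Finset.mem_image.1 hB
      exact hmaps A hA
    · rw [Finset.card_image_of_injOn hinj]
  have hneg : ∑ A ∈ monics F k, leg A D = -∑ A ∈ monics F k, leg A D := by
    conv_lhs => rw [← himg]
    rw [Finset.sum_image hinj, ← Finset.sum_neg_distrib]
    refine Finset.sum_congr rfl fun A _ => ?_
    rw [leg_congr hD (A' := A₀ * A), leg_mul_left _ _ hD, hA, neg_one_mul]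
    refine ⟨A /ₘ D - (A₀ * A) /ₘ D, ?_⟩
    have := modByMonic_add_div (A₀ * A) D
    rw [hσ]
    simp only
    linear_combination this
  omega

end Orthogonality

section Bilinear
open scoped Classical

variable {F : Type} [Field F] [Fintype F]

lemma eq_of_primes_dvd {P Q : F[X]} (hP : P.Monic) (hPi : Irreducible P) (hQ : Q.Monic)
    (hQi : Irreducible Q) (h : P ∣ Q) : P = Q :=
  eq_of_monic_of_associated hP hQ (hPi.associated_of_dvd hQi h)

lemma card_fiber_mul_primes_le (m : ℕ) (A : F[X]) :
    (((primes F m) ×ˢ (primes F m)).filter fun p => p.1 * p.2 = A).card ≤ 2 := by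
  rcases Finset.eq_empty_or_nonempty
    (((primes F m) ×ˢ (primes F m)).filter fun p => p.1 * p.2 = A) with h | ⟨⟨P₀, Q₀⟩, h⟩
  · rw [h]; simp
  · rw [Finset.mem_filter, Finset.mem_product] at h
    obtain ⟨⟨hP₀, hQ₀⟩, h0⟩ := h
    have hP₀ := mem_primes.1 hP₀
    have hQ₀ := mem_primes.1 hQ₀
    refine (Finset.card_le_card (t := {(P₀, Q₀), (Q₀, P₀)}) ?_).trans Finset.card_le_two
    rintro ⟨P, Q⟩ h
    rw [Finset.mem_filter, Finset.mem_product] at h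
    obtain ⟨⟨hP, hQ⟩, h1⟩ := h
    simp only at h0 h1 hP hQ hP₀ hQ₀
    have hP := mem_primes.1 hP
    have hQ := mem_primes.1 hQ
    have hd : P ∣ P₀ * Q₀ := by rw [h0, ← h1]; exact dvd_mul_right _ _
    rw [Finset.mem_insert, Finset.mem_singleton]
    rcases hP.2.2.prime.dvd_or_dvd hd with h2 | h2
    · have := eq_of_primes_dvd hP.1 hP.2.2 hP₀.1 hP₀.2.2 h2
      subst this
      left
      rw [← h0] at h1
      rw [mul_left_cancel₀ hP.1.ne_zero h1]
    · have := eq_of_primes_dvd hP.1 hP.2.2 hQ₀.1 hQ₀.2.2 h2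
      subst this
      right
      rw [← h0, mul_comm P₀] at h1
      rw [mul_left_cancel₀ hP.1.ne_zero h1]

lemma sum_mul_primes_le (m : ℕ) (g : F[X] → ℝ) (hg : ∀ A, 0 ≤ g A) :
    ∑ P ∈ primes F m, ∑ Q ∈ primes F m, g (P * Q) ≤ 2 * ∑ A ∈ monics F (2 * m), g A := by
  rw [← Finset.sum_product',
    ← Finset.sum_fiberwise_of_maps_to (g := fun p : F[X] × F[X] => p.1 * p.2)
      (t := monics F (2 * m)), Finset.mul_sum]
  · refine Finset.sum_le_sum fun A _ => ?_
    rw [Finset.sum_congr rfl (g := fun _ => g A) fun p hp => by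
      rw [(Finset.mem_filter.1 hp).2], Finset.sum_const, nsmul_eq_mul]
    exact mul_le_mul_of_nonneg_right (by exact_mod_cast card_fiber_mul_primes_le m A) (hg A)
  · rintro ⟨P, Q⟩ h
    rw [Finset.mem_product] at h
    have hP := mem_primes.1 h.1
    have hQ := mem_primes.1 h.2
    exact mem_monics.2 ⟨hP.1.mul hQ.1, by
      rw [hP.1.natDegree_mul hQ.1, hP.2.1, hQ.2.1]; ring⟩

lemma sum_sq_leg_primes_le (h2 : ringChar F ≠ 2) {n k : ℕ} (hk : 2 * n ≤ k) :
    ∑ A ∈ monics F k, (∑ Q ∈ primes F n, (leg A Q : ℝ)) ^ 2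
      ≤ (primes F n).card * (Fintype.card F : ℝ) ^ k := by
  simp_rw [sq, Finset.sum_mul_sum]
  rw [Finset.sum_comm]
  simp_rw [Finset.sum_comm (s := monics F k)]
  rw [← nsmul_eq_mul, ← Finset.sum_const]
  refine Finset.sum_le_sum fun P hP => ?_
  have hP := mem_primes.1 hP
  rw [Finset.sum_eq_single_of_mem P (mem_primes.2 hP)]
  · have hc : ((Fintype.card F : ℝ) ^ k) = ∑ A ∈ monics F k, (1 : ℝ) := by
      rw [Finset.sum_const, card_monics]; simp
    rw [hc]
    refine Finset.sum_le_sum fun A _ => ?_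
    rcases leg_cases A P with h | h | h <;> rw [h] <;> simp
  · intro Q hQ hne
    have hQ := mem_primes.1 hQ
    have hm := hP.1.mul hQ.1
    have hcop : IsRelPrime P Q := by
      refine IsCoprime.isRelPrime ?_
      refine (hP.2.2.coprime_iff_not_dvd).2 fun hd => hne ?_
      exact (eq_of_primes_dvd hP.1 hP.2.2 hQ.1 hQ.2.2 hd).symm
    have hs : Squarefree (P * Q) :=
      (squarefree_mul_iff).2 ⟨hcop, hP.2.2.squarefree, hQ.2.2.squarefree⟩
    obtain ⟨A₀, hA₀⟩ := exists_leg_eq_neg_one h2 hm hs (by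
      intro h
      exact hP.2.2.not_isUnit (IsUnit.of_mul_eq_one _ h))
    have := sum_leg_eq_zero hm hA₀ (k := k) (by
      rw [hP.1.natDegree_mul hQ.1, hP.2.1, hQ.2.1]; omega)
    simp_rw [leg_mul_right _ hP.1 hQ.1] at this
    exact_mod_cast this

lemma card_primes_le_pow (k : ℕ) : ((primes F k).card : ℝ) ≤ (Fintype.card F : ℝ) ^ k := by
  have : (primes F k).card ≤ Fintype.card F ^ k := by
    rw [← card_monics]; exact Finset.card_filter_le _ _
  exact_mod_cast this

lemma bilinear_aux (h2 : ringChar F ≠ 2) {m n y : ℕ} (hmn : n ≤ m) (hn : 4 * y < n)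
    (α β : F[X] → ℝ) (hα : ∀ P, |α P| ≤ 1) (hβ : ∀ P, |β P| ≤ 1) :
    |∑ P ∈ primes F m, ∑ Q ∈ primes F n, α P * β Q * (leg P Q : ℝ)| * (Fintype.card F : ℝ) ^ y
      ≤ 2 * (Fintype.card F : ℝ) ^ (m + n) := by
  set q : ℝ := (Fintype.card F : ℝ) with hq
  have hq1 : 1 ≤ q := by rw [hq]; exact_mod_cast Fintype.card_pos
  set T := ∑ P ∈ primes F m, ∑ Q ∈ primes F n, α P * β Q * (leg P Q : ℝ) with hT
  set NP : ℝ := ((primes F m).card : ℝ) with hNP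
  set NQ : ℝ := ((primes F n).card : ℝ) with hNQ
  have hNP' : NP ≤ q ^ m := card_primes_le_pow m
  have hNQ' : NQ ≤ q ^ n := card_primes_le_pow n
  have hNP0 : 0 ≤ NP := Nat.cast_nonneg _
  have hNQ0 : 0 ≤ NQ := Nat.cast_nonneg _
  set R : F[X] → ℝ := fun A => ∑ Q ∈ primes F n, (leg A Q : ℝ) with hR
  have hsq1 : ∀ x : ℝ, |x| ≤ 1 → x ^ 2 ≤ 1 := fun x hx => by
    rw [← sq_abs]; exact pow_le_one₀ (abs_nonneg _) hx
  have hsq : T ^ 2 ≤ NQ * ∑ P ∈ primes F m, ∑ P' ∈ primes F m, α P * α P' * R (P * P') := by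
    have e1 : T = ∑ Q ∈ primes F n, β Q * ∑ P ∈ primes F m, α P * (leg P Q : ℝ) := by
      rw [hT, Finset.sum_comm]
      refine Finset.sum_congr rfl fun Q _ => ?_
      rw [Finset.mul_sum]
      exact Finset.sum_congr rfl fun P _ => by ring
    rw [e1]
    refine (Finset.sum_mul_sq_le_sq_mul_sq _ _ _).trans ?_
    have e2 : ∑ Q ∈ primes F n, β Q ^ 2 ≤ NQ := by
      refine (Finset.sum_le_sum fun Q _ => hsq1 _ (hβ Q)).trans ?_
      simp [hNQ]
    have e3 : ∑ Q ∈ primes F n, (∑ P ∈ primes F m, α P * (leg P Q : ℝ)) ^ 2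
        = ∑ P ∈ primes F m, ∑ P' ∈ primes F m, α P * α P' * R (P * P') := by
      simp_rw [sq, Finset.sum_mul_sum, hR, Finset.mul_sum]
      rw [Finset.sum_comm]
      refine Finset.sum_congr rfl fun P _ => ?_
      rw [Finset.sum_comm]
      refine Finset.sum_congr rfl fun P' _ => ?_
      refine Finset.sum_congr rfl fun Q hQ => ?_
      rw [leg_mul_left _ _ (mem_primes.1 hQ).1]
      push_cast; ring
    rw [← e3]
    exact mul_le_mul_of_nonneg_right e2 (Finset.sum_nonneg fun _ _ => sq_nonneg _)
  have hcs : (∑ P ∈ primes F m, ∑ P' ∈ primes F m, α P * α P' * R (P * P')) ^ 2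
      ≤ NP ^ 2 * (2 * (NQ * q ^ (2 * m))) := by
    rw [← Finset.sum_product']
    refine (Finset.sum_mul_sq_le_sq_mul_sq _ (fun p : F[X] × F[X] => α p.1 * α p.2)
      (fun p => R (p.1 * p.2))).trans ?_
    refine mul_le_mul ?_ ?_ (Finset.sum_nonneg fun _ _ => sq_nonneg _) (sq_nonneg _)
    · refine (Finset.sum_le_sum fun p _ => hsq1 _ (?_ : |α p.1 * α p.2| ≤ 1)).trans ?_
      · rw [abs_mul]; exact mul_le_one₀ (hα _) (abs_nonneg _) (hα _)
      · rw [Finset.sum_const, Finset.card_product]; simp [sq, hNP]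
    · rw [Finset.sum_product' (f := fun P Q => R (P * Q) ^ 2)]
      refine (sum_mul_primes_le m (fun A => R A ^ 2) fun A => sq_nonneg _).trans ?_
      gcongr
      exact sum_sq_leg_primes_le h2 (by omega)
  have hfour : T ^ 4 ≤ 2 * q ^ (4 * m + 3 * n) := by
    calc T ^ 4 = (T ^ 2) ^ 2 := by ring
      _ ≤ (NQ * ∑ P ∈ primes F m, ∑ P' ∈ primes F m, α P * α P' * R (P * P')) ^ 2 := by
          gcongr
      _ = NQ ^ 2 * (∑ P ∈ primes F m, ∑ P' ∈ primes F m, α P * α P' * R (P * P')) ^ 2 := by ring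
      _ ≤ NQ ^ 2 * (NP ^ 2 * (2 * (NQ * q ^ (2 * m)))) := by gcongr
      _ ≤ (q ^ n) ^ 2 * ((q ^ m) ^ 2 * (2 * (q ^ n * q ^ (2 * m)))) := by gcongr
      _ = 2 * q ^ (4 * m + 3 * n) := by ring
  have hpow4 : (|T| * q ^ y) ^ 4 ≤ (2 * q ^ (m + n)) ^ 4 := by
    have e : |T| ^ 4 = T ^ 4 := Even.pow_abs (by decide) T
    rw [mul_pow, e]
    calc T ^ 4 * (q ^ y) ^ 4 ≤ 2 * q ^ (4 * m + 3 * n) * q ^ (4 * y) := by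
          rw [← pow_mul, mul_comm y]; gcongr
      _ ≤ 2 * q ^ (4 * m + 3 * n) * q ^ n := by gcongr
      _ = 2 * q ^ (4 * (m + n)) := by ring
      _ ≤ 16 * q ^ (4 * (m + n)) := by gcongr; norm_num
      _ = (2 * q ^ (m + n)) ^ 4 := by ring
  exact (pow_le_pow_iff_left₀ (by positivity) (by positivity) (by norm_num)).1 hpow4

/-- Bilinear large-sieve type estimate for Legendre symbols of primes. -/
lemma bilinear_bound (hq4 : Fintype.card F % 4 = 3) {m n y : ℕ} (hm : 4 * y < m) (hn : 4 * y < n)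
    (α β : F[X] → ℝ) (hα : ∀ P, |α P| ≤ 1) (hβ : ∀ P, |β P| ≤ 1) :
    |∑ P ∈ primes F m, ∑ Q ∈ primes F n, α P * β Q * (leg P Q : ℝ)| * (Fintype.card F : ℝ) ^ y
      ≤ 2 * (Fintype.card F : ℝ) ^ (m + n) := by
  have h2 := ringChar_ne_two_of_mod hq4
  rcases le_total n m with h | h
  · exact bilinear_aux h2 h hn α β hα hβ
  · have := bilinear_aux h2 h hm β α hβ hα
    rw [add_comm n m] at this
    convert this using 2
    have e : ∑ P ∈ primes F m, ∑ Q ∈ primes F n, α P * β Q * (leg P Q : ℝ)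
        = (-1) ^ (m * n) * ∑ P ∈ primes F n, ∑ Q ∈ primes F m, β P * α Q * (leg P Q : ℝ) := by
      rw [Finset.sum_comm, Finset.mul_sum]
      refine Finset.sum_congr rfl fun Q hQ => ?_
      rw [Finset.mul_sum]
      refine Finset.sum_congr rfl fun P hP => ?_
      rw [leg_reciprocity hq4 P Q, (mem_primes.1 hP).2.1, (mem_primes.1 hQ).2.1]
      push_cast; ring
    rw [e, abs_mul, abs_pow, abs_neg, abs_one, one_pow, one_mul]

end Bilinear

section PrimeFactors
open scoped Classical

variable {F : Type} [Field F] [Fintype F]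

/-- The set of monic irreducible divisors of a nonzero polynomial. -/
noncomputable def pf (f : F[X]) : Finset F[X] :=
  ((Finset.range (f.natDegree + 1)).biUnion (primes F)).filter (· ∣ f)

lemma mem_pf {f P : F[X]} (hf : f ≠ 0) : P ∈ pf f ↔ P.Monic ∧ Irreducible P ∧ P ∣ f := by
  simp only [pf, Finset.mem_filter, Finset.mem_biUnion, Finset.mem_range, mem_primes]
  constructor
  · rintro ⟨⟨k, -, h1, -, h2⟩, h3⟩; exact ⟨h1, h2, h3⟩
  · rintro ⟨h1, h2, h3⟩
    exact ⟨⟨_, Nat.lt_succ_of_le (natDegree_le_of_dvd h3 hf), h1, rfl, h2⟩, h3⟩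

lemma pf_monic {f P : F[X]} (h : P ∈ pf f) : P.Monic := by
  simp only [pf, Finset.mem_filter, Finset.mem_biUnion, mem_primes] at h
  obtain ⟨⟨k, -, h1, -, h2⟩, h3⟩ := h
  exact h1

lemma pf_irreducible {f P : F[X]} (h : P ∈ pf f) : Irreducible P := by
  simp only [pf, Finset.mem_filter, Finset.mem_biUnion, mem_primes] at h
  obtain ⟨⟨k, -, h1, -, h2⟩, h3⟩ := h
  exact h2

lemma pf_dvd {f P : F[X]} (h : P ∈ pf f) : P ∣ f := (Finset.mem_filter.1 h).2

lemma pf_one : pf (1 : F[X]) = ∅ := by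
  ext P
  rw [mem_pf one_ne_zero]
  simp only [Finset.notMem_empty, iff_false]
  rintro ⟨-, h, hd⟩
  exact h.not_isUnit (isUnit_of_dvd_one hd)

lemma pf_prime_mul {P g : F[X]} (hP : P.Monic) (hI : Irreducible P) (hg : g ≠ 0) :
    pf (P * g) = insert P (pf g) := by
  ext Q
  rw [mem_pf (mul_ne_zero hP.ne_zero hg), Finset.mem_insert, mem_pf hg]
  constructor
  · rintro ⟨h1, h2, h3⟩
    rcases h2.prime.dvd_or_dvd h3 with h | h
    · left; exact eq_of_primes_dvd h1 h2 hP hI h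
    · right; exact ⟨h1, h2, h⟩
  · rintro (rfl | ⟨h1, h2, h3⟩)
    · exact ⟨hP, hI, dvd_mul_right _ _⟩
    · exact ⟨h1, h2, h3.mul_left _⟩

lemma pf_prod (S : Finset F[X]) (hS : ∀ P ∈ S, P.Monic ∧ Irreducible P) : pf (∏ P ∈ S, P) = S := by
  induction S using Finset.induction_on with
  | empty => simp [pf_one]
  | insert a s ha ih =>
    rw [Finset.prod_insert ha, pf_prime_mul (hS a (by simp)).1 (hS a (by simp)).2
      (monic_prod_of_monic _ _ fun i hi => (hS i (by simp [hi])).1).ne_zero,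
      ih fun P hP => hS P (by simp [hP])]

lemma squarefree_prod (S : Finset F[X]) (hS : ∀ P ∈ S, P.Monic ∧ Irreducible P) :
    Squarefree (∏ P ∈ S, P) := by
  induction S using Finset.induction_on with
  | empty => simp
  | insert a s ha ih =>
    rw [Finset.prod_insert ha, squarefree_mul_iff]
    refine ⟨IsCoprime.isRelPrime ?_, (hS a (by simp)).2.squarefree,
      ih fun P hP => hS P (by simp [hP])⟩
    refine ((hS a (by simp)).2.coprime_iff_not_dvd).2 fun hd => ha ?_
    obtain ⟨i, hi, hd⟩ := (hS a (by simp)).2.prime.exists_mem_finset_dvd hd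
    rw [eq_of_primes_dvd (hS a (by simp)).1 (hS a (by simp)).2 (hS i (by simp [hi])).1
      (hS i (by simp [hi])).2 hd]
    exact hi

lemma not_dvd_of_squarefree_mul {P g : F[X]} (hI : Irreducible P) (h : Squarefree (P * g)) :
    ¬ P ∣ g := fun hd => hI.not_isUnit (h P (mul_dvd_mul_left P hd))

lemma prod_pf {f : F[X]} (hf : f.Monic) (hs : Squarefree f) : ∏ P ∈ pf f, P = f := by
  induction hn : f.natDegree using Nat.strong_induction_on generalizing f with
  | _ n ih =>
    by_cases h1 : f = 1
    · subst h1; simp [pf_one]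
    · obtain ⟨P, hP, hI, g, rfl⟩ := exists_prime_dvd hf h1
      have hg : g.Monic := hP.of_mul_monic_left hf
      have hlt : g.natDegree < n := by
        rw [← hn, hP.natDegree_mul hg]
        have := hI.natDegree_pos
        omega
      have hnd := not_dvd_of_squarefree_mul hI hs
      rw [pf_prime_mul hP hI hg.ne_zero, Finset.prod_insert, ih _ hlt hg hs.of_mul_right rfl]
      intro hmem
      exact hnd (pf_dvd hmem)

lemma sum_natDegree_pf {f : F[X]} (hf : f.Monic) (hs : Squarefree f) :
    ∑ P ∈ pf f, P.natDegree = f.natDegree := by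
  conv_rhs => rw [← prod_pf hf hs]
  rw [natDegree_prod_of_monic _ _ fun P hP => pf_monic hP]

lemma pf_injOn {f g : F[X]} (hf : f.Monic) (hfs : Squarefree f) (hg : g.Monic)
    (hgs : Squarefree g) (h : pf f = pf g) : f = g := by
  rw [← prod_pf hf hfs, ← prod_pf hg hgs, h]

lemma pf_subset_of_dvd {D f : F[X]} (hf : f ≠ 0) (h : D ∣ f) : pf D ⊆ pf f := by
  intro P hP
  exact (mem_pf hf).2 ⟨pf_monic hP, pf_irreducible hP, (pf_dvd hP).trans h⟩

/-- Monic irreducible polynomials of degree less than `d`. -/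
noncomputable def primesLT (F : Type) [Field F] [Fintype F] (d : ℕ) : Finset F[X] :=
  (Finset.range d).biUnion (primes F)

lemma mem_primesLT {d : ℕ} {P : F[X]} :
    P ∈ primesLT F d ↔ P.Monic ∧ Irreducible P ∧ P.natDegree < d := by
  simp only [primesLT, Finset.mem_biUnion, Finset.mem_range, mem_primes]
  constructor
  · rintro ⟨k, hk, h1, rfl, h2⟩; exact ⟨h1, h2, hk⟩
  · rintro ⟨h1, h2, h3⟩; exact ⟨_, h3, h1, rfl, h2⟩

lemma sum_primesLT (d : ℕ) (g : F[X] → ℝ) :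
    ∑ P ∈ primesLT F d, g P = ∑ k ∈ Finset.range d, ∑ P ∈ primes F k, g P := by
  rw [primesLT, Finset.sum_biUnion]
  intro i _ j _ hij
  exact (monics_disjoint hij).mono (Finset.filter_subset _ _) (Finset.filter_subset _ _)

/-- The norm `|f| = q ^ deg f` as a real number. -/
noncomputable def pnorm (f : F[X]) : ℝ := (Fintype.card F : ℝ) ^ f.natDegree

lemma pnorm_pos (f : F[X]) : 0 < pnorm f := by
  unfold pnorm
  have : 0 < Fintype.card F := Fintype.card_pos
  positivity

lemma pnorm_mul {f g : F[X]} (hf : f.Monic) (hg : g.Monic) :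
    pnorm (f * g) = pnorm f * pnorm g := by
  rw [pnorm, hf.natDegree_mul hg, pow_add, pnorm, pnorm]

lemma prod_pnorm_pf {f : F[X]} (hf : f.Monic) (hs : Squarefree f) :
    ∏ P ∈ pf f, (pnorm P)⁻¹ = (pnorm f)⁻¹ := by
  rw [Finset.prod_inv_distrib]
  unfold pnorm
  rw [Finset.prod_pow_eq_pow_sum, sum_natDegree_pf hf hs]

lemma card_primes_div_le (k : ℕ) :
    ∑ P ∈ primes F k, (pnorm P)⁻¹ ≤ (k : ℝ)⁻¹ := by
  have hq : (0 : ℝ) < (Fintype.card F : ℝ) ^ k := by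
    have : 0 < Fintype.card F := Fintype.card_pos
    positivity
  rw [Finset.sum_congr rfl (g := fun _ => ((Fintype.card F : ℝ) ^ k)⁻¹) fun P hP => by
    rw [pnorm, (mem_primes.1 hP).2.1], Finset.sum_const, nsmul_eq_mul]
  rcases Nat.eq_zero_or_pos k with rfl | hk
  · have : primes F 0 = ∅ := by
      ext P
      simp only [mem_primes, Finset.notMem_empty, iff_false]
      rintro ⟨-, h, hI⟩
      exact (hI.natDegree_pos).ne' h
    simp [this]
  · have h := card_primes_le (F := F) k
    have h' : (k : ℝ) * ((primes F k).card : ℝ) ≤ (Fintype.card F : ℝ) ^ k := by exact_mod_cast h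
    have hk' : (0 : ℝ) < k := by exact_mod_cast hk
    rw [← div_eq_mul_inv, div_le_iff₀ hq, inv_mul_eq_div, le_div_iff₀ hk']
    linarith

/-- Squarefree monic polynomials of degree less than `d`. -/
noncomputable def sqfreesLT (F : Type) [Field F] [Fintype F] (d : ℕ) : Finset F[X] :=
  (Finset.range d).biUnion (sqfrees F)

lemma mem_sqfreesLT {d : ℕ} {f : F[X]} :
    f ∈ sqfreesLT F d ↔ f.Monic ∧ Squarefree f ∧ f.natDegree < d := by
  simp only [sqfreesLT, Finset.mem_biUnion, Finset.mem_range, mem_sqfrees]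
  constructor
  · rintro ⟨k, hk, h1, rfl, h2⟩; exact ⟨h1, h2, hk⟩
  · rintro ⟨h1, h2, h3⟩; exact ⟨_, h3, h1, rfl, h2⟩

lemma sum_sqfreesLT (d : ℕ) (g : F[X] → ℝ) :
    ∑ P ∈ sqfreesLT F d, g P = ∑ k ∈ Finset.range d, ∑ P ∈ sqfrees F k, g P := by
  rw [sqfreesLT, Finset.sum_biUnion]
  intro i _ j _ hij
  exact (monics_disjoint hij).mono (Finset.filter_subset _ _) (Finset.filter_subset _ _)

/-- Euler product bound over squarefree polynomials with prime factors in a finite set. -/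
lemma euler_product_bound (PP : Finset F[X]) (M : Finset F[X])
    (hM : ∀ m ∈ M, m.Monic ∧ Squarefree m ∧ pf m ⊆ PP) (g : F[X] → ℝ) (hg : ∀ P, 0 ≤ g P) :
    ∑ m ∈ M, ∏ P ∈ pf m, g P ≤ Real.exp (∑ P ∈ PP, g P) := by
  calc ∑ m ∈ M, ∏ P ∈ pf m, g P = ∑ S ∈ M.image pf, ∏ P ∈ S, g P := by
        rw [Finset.sum_image]
        intro a ha b hb h
        exact pf_injOn (hM a ha).1 (hM a ha).2.1 (hM b hb).1 (hM b hb).2.1 h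
    _ ≤ ∑ S ∈ PP.powerset, ∏ P ∈ S, g P := by
        refine Finset.sum_le_sum_of_subset_of_nonneg ?_ fun S _ _ =>
          Finset.prod_nonneg fun P _ => hg P
        intro S hS
        obtain ⟨m, hm, rfl⟩ := Finset.mem_image.1 hS
        exact Finset.mem_powerset.2 (hM m hm).2.2
    _ = ∏ P ∈ PP, (1 + g P) := by rw [Finset.prod_one_add]
    _ ≤ ∏ P ∈ PP, Real.exp (g P) := by
        refine Finset.prod_le_prod (fun P _ => by have := hg P; linarith) fun P _ => ?_
        rw [add_comm]; exact Real.add_one_le_exp _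
    _ = Real.exp (∑ P ∈ PP, g P) := by rw [Real.exp_sum]

/-- Multiples of a prime among squarefree polynomials of degree `d`. -/
lemma sum_sqfrees_dvd_le {P : F[X]} (hP : P.Monic) (hI : Irreducible P) {d : ℕ}
    (φ ψ : F[X] → ℝ) (hψ : ∀ f, 0 ≤ ψ f)
    (h : ∀ m : F[X], m.Monic → Squarefree (P * m) → φ (P * m) ≤ ψ m) :
    ∑ f ∈ (sqfrees F d).filter (P ∣ ·), φ f ≤ ∑ m ∈ sqfrees F (d - P.natDegree), ψ m := by
  have key : ∀ f ∈ (sqfrees F d).filter (P ∣ ·), ∃ m, m ∈ sqfrees F (d - P.natDegree) ∧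
      Squarefree (P * m) ∧ P * m = f := by
    intro f hf
    rw [Finset.mem_filter, mem_sqfrees] at hf
    obtain ⟨⟨h1, h2, h3⟩, m, rfl⟩ := hf
    have hm := hP.of_mul_monic_left h1
    refine ⟨m, mem_sqfrees.2 ⟨hm, ?_, h3.of_mul_right⟩, h3, rfl⟩
    rw [hP.natDegree_mul hm] at h2
    omega
  have hsub : (sqfrees F d).filter (P ∣ ·) ⊆
      ((sqfrees F (d - P.natDegree)).filter fun m => Squarefree (P * m)).image (P * ·) := by
    intro f hf
    obtain ⟨m, h1, h2, h3⟩ := key f hf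
    exact Finset.mem_image.2 ⟨m, Finset.mem_filter.2 ⟨h1, h2⟩, h3⟩
  calc ∑ f ∈ (sqfrees F d).filter (P ∣ ·), φ f
      ≤ ∑ f ∈ (sqfrees F d).filter (P ∣ ·), ψ (f /ₘ P) := by
        refine Finset.sum_le_sum fun f hf => ?_
        obtain ⟨m, h1, h2, rfl⟩ := key f hf
        rw [mul_divByMonic_cancel_left _ hP]
        exact h m (mem_sqfrees.1 h1).1 h2
    _ ≤ ∑ f ∈ ((sqfrees F (d - P.natDegree)).filter fun m => Squarefree (P * m)).image (P * ·),
          ψ (f /ₘ P) := Finset.sum_le_sum_of_subset_of_nonneg hsub fun _ _ _ => hψ _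
    _ = ∑ m ∈ (sqfrees F (d - P.natDegree)).filter fun m => Squarefree (P * m), ψ m := by
        rw [Finset.sum_image fun a _ b _ h => mul_left_cancel₀ hP.ne_zero h]
        exact Finset.sum_congr rfl fun m _ => by rw [mul_divByMonic_cancel_left _ hP]
    _ ≤ _ := Finset.sum_le_sum_of_subset_of_nonneg (Finset.filter_subset _ _) fun _ _ _ => hψ _

lemma sum_pf_eq {d : ℕ} {f : F[X]} (hf : f ∈ sqfrees F d) (g : F[X] → ℝ) :
    ∑ P ∈ pf f, g P = ∑ P ∈ (primesLT F (d + 1)).filter (· ∣ f), g P := by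
  rw [pf, (mem_sqfrees.1 hf).2.1]; rfl

lemma sum_sum_pf (d : ℕ) (φ g : F[X] → ℝ) :
    ∑ f ∈ sqfrees F d, φ f * ∑ P ∈ pf f, g P
      = ∑ P ∈ primesLT F (d + 1), g P * ∑ f ∈ (sqfrees F d).filter (P ∣ ·), φ f := by
  rw [Finset.sum_congr rfl fun f hf => by rw [sum_pf_eq hf]]
  simp_rw [Finset.mul_sum, Finset.sum_filter]
  rw [Finset.sum_comm]
  refine Finset.sum_congr rfl fun P _ => Finset.sum_congr rfl fun f _ => ?_
  split_ifs <;> ring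

/-- Elementary upper-bound sieve inequality (Hall–Tenenbaum). -/
lemma hall_tenenbaum (d : ℕ) (φ : F[X] → ℝ) (h0 : ∀ f, 0 ≤ φ f)
    (h : ∀ P m : F[X], P.Monic → Irreducible P → m.Monic → Squarefree (P * m) → φ (P * m) ≤ φ m) :
    (d : ℝ) * ∑ f ∈ sqfrees F d, φ f
      ≤ (Fintype.card F : ℝ) ^ d * ∑ m ∈ sqfreesLT F d, φ m * (pnorm m)⁻¹ := by
  set q : ℝ := (Fintype.card F : ℝ) with hq
  have hq0 : 0 < q := by rw [hq]; exact_mod_cast Fintype.card_pos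
  have e1 : (d : ℝ) * ∑ f ∈ sqfrees F d, φ f
      = ∑ f ∈ sqfrees F d, φ f * ∑ P ∈ pf f, (P.natDegree : ℝ) := by
    rw [Finset.mul_sum]
    refine Finset.sum_congr rfl fun f hf => ?_
    have := mem_sqfrees.1 hf
    rw [← Nat.cast_sum, sum_natDegree_pf this.1 this.2.2, this.2.1, mul_comm]
  rw [e1, sum_sum_pf, sum_primesLT, Finset.sum_range_succ']
  have e0 : ∑ P ∈ primes F 0, (P.natDegree : ℝ) * ∑ f ∈ (sqfrees F d).filter (P ∣ ·), φ f = 0 :=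
    Finset.sum_eq_zero fun P hP => by rw [(mem_primes.1 hP).2.1]; simp
  rw [e0, add_zero, sum_sqfreesLT, Finset.mul_sum, ← Finset.sum_range_reflect]
  refine Finset.sum_le_sum fun k hk => ?_
  rw [Finset.mem_range] at hk
  have hdk : d - (d - 1 - k + 1) = k := by omega
  have hdk' : d - 1 - k + 1 = d - k := by omega
  calc _ ≤ ∑ P ∈ primes F (d - 1 - k + 1), ((d - k : ℕ) : ℝ) * ∑ m ∈ sqfrees F k, φ m := by
        refine Finset.sum_le_sum fun P hP => ?_
        have hP := mem_primes.1 hP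
        rw [hP.2.1, ← hdk']
        refine mul_le_mul_of_nonneg_left ?_ (Nat.cast_nonneg _)
        have := sum_sqfrees_dvd_le hP.1 hP.2.2 (d := d) φ φ h0 fun m hm hs => h P m hP.1 hP.2.2 hm hs
        rwa [hP.2.1, hdk] at this
    _ = ((d - k : ℕ) * ((primes F (d - k)).card : ℝ)) * ∑ m ∈ sqfrees F k, φ m := by
        rw [Finset.sum_const, nsmul_eq_mul, hdk']; ring
    _ ≤ q ^ (d - k) * ∑ m ∈ sqfrees F k, φ m := by
        refine mul_le_mul_of_nonneg_right ?_ (Finset.sum_nonneg fun _ _ => h0 _)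
        have := card_primes_le (F := F) (d - k)
        rw [hq]
        exact_mod_cast this
    _ = q ^ d * ∑ m ∈ sqfrees F k, φ m * (pnorm m)⁻¹ := by
        rw [Finset.mul_sum, Finset.mul_sum]
        refine Finset.sum_congr rfl fun m hm => ?_
        have e : q ^ d = q ^ (d - k) * q ^ k := by rw [← pow_add]; congr 1; omega
        rw [pnorm, (mem_sqfrees.1 hm).2.1, e, ← hq]
        field_simp

end PrimeFactors

section Sieve
open scoped Classical

variable {F : Type} [Field F] [Fintype F]

/-- Number of prime factors of `f` whose degree satisfies `K`. -/
noncomputable def omegaDeg (K : ℕ → Prop) (f : F[X]) : ℕ :=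
  ((pf f).filter fun P => K P.natDegree).card

lemma sum_inv_range_le (n : ℕ) : ∑ k ∈ Finset.range (n + 1), ((k : ℝ))⁻¹ ≤ 1 + Real.log n := by
  have h := harmonic_le_one_add_log n
  rw [Finset.sum_range_succ']
  simp only [Nat.cast_zero, _root_.inv_zero, add_zero]
  rw [harmonic] at h
  push_cast at h ⊢
  exact h

lemma sum_inv_norm_primesLT_le (n : ℕ) :
    ∑ P ∈ primesLT F (n + 1), (pnorm P)⁻¹ ≤ 1 + Real.log n := by
  rw [sum_primesLT]
  exact (Finset.sum_le_sum fun k _ => card_primes_div_le k).trans (sum_inv_range_le n)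

lemma card_sqfrees_le (d : ℕ) : ((sqfrees F d).card : ℝ) ≤ (Fintype.card F : ℝ) ^ d := by
  have : (sqfrees F d).card ≤ Fintype.card F ^ d := by
    rw [← card_monics]; exact Finset.card_filter_le _ _
  exact_mod_cast this

lemma sum_omegaDeg_le (K : ℕ → Prop) {d n : ℕ} (hK : ∀ k ≤ d, K k → k ≤ n) :
    ∑ f ∈ sqfrees F d, (omegaDeg K f : ℝ) ≤ (Fintype.card F : ℝ) ^ d * (1 + Real.log n) := by
  set q : ℝ := (Fintype.card F : ℝ) with hq
  have hq0 : 0 < q := by rw [hq]; exact_mod_cast Fintype.card_pos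
  have e1 : ∀ f : F[X], (omegaDeg K f : ℝ) = 1 * ∑ P ∈ pf f, if K P.natDegree then (1 : ℝ) else 0 := by
    intro f
    rw [omegaDeg, one_mul, Finset.sum_ite, Finset.sum_const_zero, add_zero, Finset.sum_const]
    simp
  simp_rw [e1]
  rw [sum_sum_pf d (fun _ => 1)]
  calc _ ≤ ∑ P ∈ primesLT F (d + 1), (if P.natDegree ≤ n then 1 else 0) * (q ^ d * (pnorm P)⁻¹) := by
        refine Finset.sum_le_sum fun P hP => ?_
        have hP := mem_primesLT.1 hP
        have h1 := sum_sqfrees_dvd_le hP.1 hP.2.1 (d := d) (fun _ => 1) (fun _ => 1)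
          (fun _ => zero_le_one) fun _ _ _ => le_rfl
        have h2 : ∑ m ∈ sqfrees F (d - P.natDegree), (1 : ℝ) ≤ q ^ d * (pnorm P)⁻¹ := by
          rw [Finset.sum_const, nsmul_eq_mul, mul_one]
          refine (card_sqfrees_le _).trans (le_of_eq ?_)
          have e : q ^ d = q ^ (d - P.natDegree) * q ^ P.natDegree := by
            rw [← pow_add]; congr 1; omega
          rw [pnorm, e, ← hq]
          field_simp
        by_cases hk : K P.natDegree
        · rw [if_pos hk, if_pos (hK _ (by omega) hk), one_mul, one_mul]
          exact h1.trans h2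
        · rw [if_neg hk, zero_mul]
          have := pnorm_pos P
          positivity
    _ = q ^ d * ∑ P ∈ (primesLT F (d + 1)).filter (fun P => P.natDegree ≤ n), (pnorm P)⁻¹ := by
        rw [Finset.mul_sum, Finset.sum_filter]
        exact Finset.sum_congr rfl fun P _ => by split_ifs <;> simp
    _ ≤ q ^ d * (1 + Real.log n) := by
        gcongr
        refine le_trans ?_ (sum_inv_norm_primesLT_le (F := F) n)
        refine Finset.sum_le_sum_of_subset_of_nonneg ?_ fun P _ _ => (inv_pos.2 (pnorm_pos P)).le
        intro P hP
        rw [Finset.mem_filter, mem_primesLT] at hP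
        exact mem_primesLT.2 ⟨hP.1.1, hP.1.2.1, by omega⟩

lemma card_omegaDeg_gt_le (K : ℕ → Prop) {d n : ℕ} (hK : ∀ k ≤ d, K k → k ≤ n) (t : ℕ) :
    (((sqfrees F d).filter fun f => t < omegaDeg K f).card : ℝ) * t
      ≤ (Fintype.card F : ℝ) ^ d * (1 + Real.log n) := by
  refine le_trans ?_ (sum_omegaDeg_le (F := F) K hK)
  rw [← nsmul_eq_mul, ← Finset.sum_const]
  refine (Finset.sum_le_sum fun f hf => ?_).trans
    (Finset.sum_le_sum_of_subset_of_nonneg (Finset.filter_subset _ _) fun _ _ _ => Nat.cast_nonneg _)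
  exact_mod_cast (Finset.mem_filter.1 hf).2.le

/-- Multiplicative weights on squarefree polynomials. -/
lemma prod_pf_prime_mul {P m : F[X]} (hP : P.Monic) (hI : Irreducible P) (hm : m.Monic)
    (hs : Squarefree (P * m)) (a : F[X] → ℝ) :
    ∏ Q ∈ pf (P * m), a Q = a P * ∏ Q ∈ pf m, a Q := by
  rw [pf_prime_mul hP hI hm.ne_zero, Finset.prod_insert]
  exact fun h => not_dvd_of_squarefree_mul hI hs (pf_dvd h)

lemma hall_tenenbaum_prod (d : ℕ) (a : F[X] → ℝ) (h0 : ∀ P, 0 ≤ a P) (h1 : ∀ P, a P ≤ 1) :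
    (d : ℝ) * ∑ f ∈ sqfrees F d, ∏ P ∈ pf f, a P
      ≤ (Fintype.card F : ℝ) ^ d * ∑ m ∈ sqfreesLT F d, ∏ P ∈ pf m, (a P * (pnorm P)⁻¹) := by
  refine (hall_tenenbaum d (fun f => ∏ P ∈ pf f, a P) (fun f => Finset.prod_nonneg fun P _ => h0 P)
    ?_).trans (le_of_eq ?_)
  · intro P m hP hI hm hs
    rw [prod_pf_prime_mul hP hI hm hs]
    exact mul_le_of_le_one_left (Finset.prod_nonneg fun P _ => h0 P) (h1 P)
  · congr 1
    refine Finset.sum_congr rfl fun m hm => ?_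
    have hm := mem_sqfreesLT.1 hm
    rw [Finset.prod_mul_distrib, prod_pnorm_pf hm.1 hm.2.1]

lemma sum_even_inv_le (d : ℕ) :
    ∑ k ∈ Finset.range (d + 1), (if Even k then ((k : ℝ))⁻¹ else 0) ≤ (1 + Real.log d) / 2 := by
  have h : ∑ k ∈ Finset.range (d + 1), (if Even k then ((k : ℝ))⁻¹ else 0)
      ≤ ∑ k ∈ (Finset.range (d + 1)).image (fun j : ℕ => 2 * j), ((k : ℝ))⁻¹ := by
    rw [← Finset.sum_filter]
    refine Finset.sum_le_sum_of_subset_of_nonneg ?_ fun _ _ _ => by positivity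
    intro k hk
    rw [Finset.mem_filter, Finset.mem_range] at hk
    obtain ⟨j, hj⟩ := hk.2
    exact Finset.mem_image.2 ⟨j, Finset.mem_range.2 (by omega), by omega⟩
  refine h.trans ?_
  rw [Finset.sum_image fun a _ b _ h => by simpa using h]
  have := sum_inv_range_le d
  calc _ = (∑ k ∈ Finset.range (d + 1), ((k : ℝ))⁻¹) / 2 := by
        rw [Finset.sum_div]
        refine Finset.sum_congr rfl fun k _ => ?_
        push_cast; rw [mul_inv]; ring
    _ ≤ _ := by linarith

/-- Few squarefree polynomials have few large prime factors of odd degree. -/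
lemma card_few_odd_large_le (y d t : ℕ) :
    (((sqfrees F d).filter fun f => omegaDeg (fun k => y < k ∧ Odd k) f < t).card : ℝ) * d
      ≤ (Fintype.card F : ℝ) ^ d * 2 ^ t *
        Real.exp (5 / 4 + Real.log y / 2 + 3 / 4 * Real.log d) := by
  set q : ℝ := (Fintype.card F : ℝ) with hq
  have hq0 : 0 < q := by rw [hq]; exact_mod_cast Fintype.card_pos
  rcases Nat.eq_zero_or_pos d with rfl | hd
  · simp only [Nat.cast_zero, mul_zero]; positivity
  set K : ℕ → Prop := fun k => y < k ∧ Odd k with hK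
  set a : F[X] → ℝ := fun P => if K P.natDegree then 1 / 2 else 1 with ha
  have ha0 : ∀ P, 0 ≤ a P := fun P => by simp only [ha]; split_ifs <;> norm_num
  have ha1 : ∀ P, a P ≤ 1 := fun P => by simp only [ha]; split_ifs <;> norm_num
  have hφ : ∀ f : F[X], ∏ P ∈ pf f, a P = (1 / 2) ^ omegaDeg K f := by
    intro f
    simp only [ha]
    rw [Finset.prod_ite, Finset.prod_const_one, mul_one, Finset.prod_const, omegaDeg]
    congr!
  have h1 := hall_tenenbaum_prod d a ha0 ha1
  have h2 := euler_product_bound (primesLT F d) (sqfreesLT F d) (fun m hm => by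
    have hm := mem_sqfreesLT.1 hm
    refine ⟨hm.1, hm.2.1, fun P hP => mem_primesLT.2 ⟨pf_monic hP, pf_irreducible hP, ?_⟩⟩
    exact (natDegree_le_of_dvd (pf_dvd hP) hm.1.ne_zero).trans_lt hm.2.2)
    (fun P => a P * (pnorm P)⁻¹) fun P => mul_nonneg (ha0 P) (inv_pos.2 (pnorm_pos P)).le
  have h3 : ∑ P ∈ primesLT F d, a P * (pnorm P)⁻¹
      ≤ 5 / 4 + Real.log y / 2 + 3 / 4 * Real.log d := by
    calc _ ≤ ∑ P ∈ primesLT F (d + 1), a P * (pnorm P)⁻¹ := by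
          refine Finset.sum_le_sum_of_subset_of_nonneg ?_ fun P _ _ =>
            mul_nonneg (ha0 P) (inv_pos.2 (pnorm_pos P)).le
          intro P hP
          rw [mem_primesLT] at hP ⊢
          exact ⟨hP.1, hP.2.1, by omega⟩
      _ ≤ ∑ k ∈ Finset.range (d + 1), (1 / 2 * (k : ℝ)⁻¹ + 1 / 2 * (if k ≤ y then (k : ℝ)⁻¹ else 0)
          + 1 / 2 * (if Even k then (k : ℝ)⁻¹ else 0)) := by
          rw [sum_primesLT]
          refine Finset.sum_le_sum fun k _ => ?_
          have e : ∑ P ∈ primes F k, a P * (pnorm P)⁻¹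
              = (if K k then 1 / 2 else 1) * ∑ P ∈ primes F k, (pnorm P)⁻¹ := by
            rw [Finset.mul_sum]
            refine Finset.sum_congr rfl fun P hP => ?_
            simp only [ha, (mem_primes.1 hP).2.1]
          rw [e]
          have hk0 : (0 : ℝ) ≤ (k : ℝ)⁻¹ := by positivity
          have hc := card_primes_div_le (F := F) k
          have hc' : (if K k then (1 / 2 : ℝ) else 1) * ∑ P ∈ primes F k, (pnorm P)⁻¹
              ≤ (if K k then (1 / 2 : ℝ) else 1) * (k : ℝ)⁻¹ :=
            mul_le_mul_of_nonneg_left hc (by split_ifs <;> norm_num)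
          refine hc'.trans ?_
          by_cases h1 : k ≤ y
          · have : ¬ K k := fun h => by have := h.1; omega
            rw [if_neg this, if_pos h1]
            split_ifs <;> linarith
          · by_cases h2 : Even k
            · rw [if_pos h2, if_neg h1]
              split_ifs <;> linarith
            · have : K k := ⟨by omega, Nat.not_even_iff_odd.1 h2⟩
              rw [if_pos this, if_neg h1, if_neg h2]
              linarith
      _ ≤ _ := by
          rw [Finset.sum_add_distrib, Finset.sum_add_distrib, ← Finset.mul_sum, ← Finset.mul_sum,
            ← Finset.mul_sum]
          have e1 := sum_inv_range_le d
          have e2 := sum_even_inv_le d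
          have e3 : ∑ k ∈ Finset.range (d + 1), (if k ≤ y then (k : ℝ)⁻¹ else 0)
              ≤ 1 + Real.log y := by
            refine le_trans ?_ (sum_inv_range_le y)
            rw [← Finset.sum_filter]
            refine Finset.sum_le_sum_of_subset_of_nonneg ?_ fun _ _ _ => by positivity
            intro k hk
            rw [Finset.mem_filter] at hk
            exact Finset.mem_range.2 (by omega)
          linarith
  have h4 : (((sqfrees F d).filter fun f => omegaDeg K f < t).card : ℝ) * (1 / 2) ^ t
      ≤ ∑ f ∈ sqfrees F d, ∏ P ∈ pf f, a P := by
    rw [← nsmul_eq_mul, ← Finset.sum_const]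
    refine (Finset.sum_le_sum fun f hf => ?_).trans
      (Finset.sum_le_sum_of_subset_of_nonneg (Finset.filter_subset _ _) fun f _ _ =>
        Finset.prod_nonneg fun P _ => ha0 P)
    rw [hφ]
    exact pow_le_pow_of_le_one (by norm_num) (by norm_num) (Finset.mem_filter.1 hf).2.le
  have h5 : (d : ℝ) * ((((sqfrees F d).filter fun f => omegaDeg K f < t).card : ℝ) * (1 / 2) ^ t)
      ≤ q ^ d * Real.exp (5 / 4 + Real.log y / 2 + 3 / 4 * Real.log d) := by
    refine (mul_le_mul_of_nonneg_left h4 (Nat.cast_nonneg d)).trans (h1.trans ?_)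
    gcongr
    exact h2.trans (Real.exp_le_exp.2 h3)
  have h6 : (1 / 2 : ℝ) ^ t * 2 ^ t = 1 := by rw [← mul_pow]; norm_num
  calc _ = (d : ℝ) * ((((sqfrees F d).filter fun f => omegaDeg K f < t).card : ℝ) * (1 / 2) ^ t)
        * 2 ^ t := by
        rw [mul_assoc, mul_assoc, h6]; ring
    _ ≤ q ^ d * Real.exp (5 / 4 + Real.log y / 2 + 3 / 4 * Real.log d) * 2 ^ t := by gcongr
    _ = _ := by ring

end Sieve

section Characters
open scoped Classical

variable {F : Type} [Field F] [Fintype F]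

/-- A real, completely multiplicative function on monic polynomials whose sums over
polynomials of a fixed degree vanish from degree `Z` on. -/
structure IsQuadChar (χ : F[X] → ℤ) (Z : ℕ) : Prop where
  one : χ 1 = 1
  mul : ∀ a b : F[X], a.Monic → b.Monic → χ (a * b) = χ a * χ b
  cases : ∀ a : F[X], a.Monic → χ a = 0 ∨ χ a = 1 ∨ χ a = -1
  sum_eq_zero : ∀ k, Z ≤ k → ∑ A ∈ monics F k, χ A = 0

/-- Monic divisors of a polynomial. -/
noncomputable def mdiv (m : F[X]) : Finset F[X] :=
  ((Finset.range (m.natDegree + 1)).biUnion (monics F)).filter (· ∣ m)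

lemma mem_mdiv {m e : F[X]} (hm : m ≠ 0) : e ∈ mdiv m ↔ e.Monic ∧ e ∣ m := by
  simp only [mdiv, Finset.mem_filter, Finset.mem_biUnion, Finset.mem_range, mem_monics]
  constructor
  · rintro ⟨⟨k, -, h1, -⟩, h3⟩; exact ⟨h1, h3⟩
  · rintro ⟨h1, h3⟩
    exact ⟨⟨_, Nat.lt_succ_of_le (natDegree_le_of_dvd h3 hm), h1, rfl⟩, h3⟩

lemma IsQuadChar.pow {χ : F[X] → ℤ} {Z : ℕ} (h : IsQuadChar χ Z) {a : F[X]} (ha : a.Monic)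
    (n : ℕ) : χ (a ^ n) = χ a ^ n := by
  induction n with
  | zero => simp [h.one]
  | succ n ih => rw [pow_succ, h.mul _ _ (ha.pow n) ha, ih, pow_succ]

lemma exists_pow_mul {P m : F[X]} (hI : Irreducible P) (hP : P.Monic) (hm : m.Monic) :
    ∃ (i : ℕ) (m' : F[X]), m'.Monic ∧ ¬ P ∣ m' ∧ m = P ^ i * m' := by
  have hfin : FiniteMultiplicity P m := FiniteMultiplicity.of_not_isUnit hI.not_isUnit hm.ne_zero
  obtain ⟨c, hc, hnd⟩ := hfin.exists_eq_pow_mul_and_not_dvd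
  refine ⟨_, c, ?_, hnd, hc⟩
  rw [hc] at hm
  exact (hP.pow _).of_mul_monic_left hm

lemma geom_sum_nonneg_of_cases {x : ℤ} (hx : x = 0 ∨ x = 1 ∨ x = -1) (i : ℕ) :
    0 ≤ ∑ j ∈ Finset.range i, x ^ j := by
  rcases hx with rfl | rfl | rfl
  · exact Finset.sum_nonneg fun j _ => pow_nonneg le_rfl j
  · simp
  · rw [neg_one_geom_sum]; split_ifs <;> norm_num

lemma sum_mdiv_nonneg {χ : F[X] → ℤ} {Z : ℕ} (h : IsQuadChar χ Z) {m : F[X]} (hm : m.Monic) :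
    0 ≤ ∑ e ∈ mdiv m, χ e := by
  induction hn : m.natDegree using Nat.strong_induction_on generalizing m with
  | _ n ih =>
    by_cases h1 : m = 1
    · subst h1
      have : mdiv (1 : F[X]) = {1} := by
        ext e
        rw [mem_mdiv one_ne_zero, Finset.mem_singleton]
        constructor
        · rintro ⟨h1, h2⟩; exact h1.isUnit_iff.1 (isUnit_of_dvd_one h2)
        · rintro rfl; exact ⟨monic_one, dvd_rfl⟩
      rw [this, Finset.sum_singleton, h.one]; norm_num
    · obtain ⟨P, hP, hI, hPm⟩ := exists_prime_dvd hm h1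
      obtain ⟨i, m', hm', hnd, rfl⟩ := exists_pow_mul hI hP hm
      have hi : i ≠ 0 := by rintro rfl; rw [pow_zero, one_mul] at hPm; exact hnd hPm
      have hlt : m'.natDegree < n := by
        rw [← hn, (hP.pow i).natDegree_mul hm', hP.natDegree_pow]
        have := Nat.mul_pos (Nat.pos_of_ne_zero hi) hI.natDegree_pos
        omega
      have himg : mdiv (P ^ i * m') =
          ((Finset.range (i + 1)) ×ˢ mdiv m').image fun p => P ^ p.1 * p.2 := by
        ext e
        rw [mem_mdiv hm.ne_zero, Finset.mem_image]
        constructor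
        · rintro ⟨he, hd⟩
          obtain ⟨j, e', he', hnde, rfl⟩ := exists_pow_mul hI hP he
          refine ⟨(j, e'), Finset.mem_product.2 ⟨Finset.mem_range.2 ?_, (mem_mdiv hm'.ne_zero).2
            ⟨he', ?_⟩⟩, rfl⟩
          · have h3 : P ^ j ∣ P ^ i * m' := (dvd_mul_right _ _).trans hd
            have h4 : P ^ j ∣ P ^ i :=
              (IsCoprime.pow_left ((hI.coprime_iff_not_dvd).2 hnd)).dvd_of_dvd_mul_right h3
            have := (pow_dvd_pow_iff hP.ne_zero hI.not_isUnit).1 h4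
            simp only; omega
          · have h3 : e' ∣ P ^ i * m' := (dvd_mul_left _ _).trans hd
            exact (IsCoprime.pow_left ((hI.coprime_iff_not_dvd).2 hnde)).symm.dvd_of_dvd_mul_left h3
        · rintro ⟨⟨j, e'⟩, hje, rfl⟩
          rw [Finset.mem_product, Finset.mem_range, mem_mdiv hm'.ne_zero] at hje
          exact ⟨(hP.pow j).mul hje.2.1, mul_dvd_mul (pow_dvd_pow _
            (by have := hje.1; simp only at this ⊢; omega)) hje.2.2⟩
      have hinj : Set.InjOn (fun p : ℕ × F[X] => P ^ p.1 * p.2)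
          ((Finset.range (i + 1)) ×ˢ mdiv m' : Finset (ℕ × F[X])) := by
        rintro ⟨j, e⟩ hje ⟨j', e'⟩ hje' heq
        rw [Finset.mem_coe, Finset.mem_product, mem_mdiv hm'.ne_zero] at hje hje'
        simp only at heq hje hje'
        have hne : ¬ P ∣ e := fun hd => hnd (hd.trans hje.2.2)
        have hne' : ¬ P ∣ e' := fun hd => hnd (hd.trans hje'.2.2)
        have key : ∀ (j j' : ℕ) (e e' : F[X]), ¬ P ∣ e' → P ^ j * e = P ^ j' * e' → j ≤ j' := by
          intro j j' e e' hne' heq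
          have h4 : P ^ j ∣ P ^ j' :=
              (IsCoprime.pow_left ((hI.coprime_iff_not_dvd).2 hne')).dvd_of_dvd_mul_right
                (heq ▸ dvd_mul_right _ _)
          exact (pow_dvd_pow_iff hP.ne_zero hI.not_isUnit).1 h4
        have hjj : j = j' := le_antisymm (key _ _ _ _ hne' heq) (key _ _ _ _ hne heq.symm)
        subst hjj
        rw [mul_left_cancel₀ (pow_ne_zero _ hP.ne_zero) heq]
      rw [himg, Finset.sum_image hinj, Finset.sum_product]
      have e1 : ∑ j ∈ Finset.range (i + 1), ∑ e ∈ mdiv m', χ (P ^ j * e)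
          = (∑ j ∈ Finset.range (i + 1), χ P ^ j) * ∑ e ∈ mdiv m', χ e := by
        rw [Finset.sum_mul_sum]
        refine Finset.sum_congr rfl fun j _ => Finset.sum_congr rfl fun e he => ?_
        rw [h.mul _ _ (hP.pow j) ((mem_mdiv hm'.ne_zero).1 he).1, h.pow hP]
      rw [e1]
      exact mul_nonneg (geom_sum_nonneg_of_cases (h.cases P hP) _) (ih _ hlt hm' rfl)

lemma IsQuadChar.eq_one_of_primes {χ : F[X] → ℤ} {Z : ℕ} (h : IsQuadChar χ Z) {e : F[X]}
    (he : e.Monic) (hp : ∀ P : F[X], P.Monic → Irreducible P → P ∣ e → χ P = 1) : χ e = 1 := by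
  induction hn : e.natDegree using Nat.strong_induction_on generalizing e with
  | _ n ih =>
    by_cases h1 : e = 1
    · rw [h1, h.one]
    · obtain ⟨P, hP, hI, e', rfl⟩ := exists_prime_dvd he h1
      have he' : e'.Monic := hP.of_mul_monic_left he
      have hlt : e'.natDegree < n := by
        rw [← hn, hP.natDegree_mul he']
        have := hI.natDegree_pos
        omega
      rw [h.mul _ _ hP he', hp P hP hI (dvd_mul_right _ _), one_mul]
      exact ih _ hlt he' (fun Q hQ hQI hd => hp Q hQ hQI (hd.mul_left _)) rfl

lemma card_monics_dvd {e : F[X]} (he : e.Monic) {n : ℕ} (hn : e.natDegree ≤ n) :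
    ((monics F n).filter (e ∣ ·)).card = Fintype.card F ^ (n - e.natDegree) := by
  rw [← card_monics, ← Finset.card_image_of_injective (monics F (n - e.natDegree))
    (mul_right_injective₀ he.ne_zero)]
  congr 1
  ext m
  rw [Finset.mem_filter, Finset.mem_image, mem_monics]
  constructor
  · rintro ⟨⟨h1, h2⟩, m', rfl⟩
    have hm' := he.of_mul_monic_left h1
    refine ⟨m', mem_monics.2 ⟨hm', ?_⟩, rfl⟩
    rw [he.natDegree_mul hm'] at h2; omega
  · rintro ⟨m', hm', rfl⟩
    rw [mem_monics] at hm'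
    exact ⟨⟨he.mul hm'.1, by rw [he.natDegree_mul hm'.1]; omega⟩, dvd_mul_right _ _⟩

lemma sum_sum_mdiv_le {χ : F[X] → ℤ} {Z : ℕ} (h : IsQuadChar χ Z) (n : ℕ) :
    ∑ m ∈ monics F n, ∑ e ∈ mdiv m, (χ e : ℝ) ≤ Z * (Fintype.card F : ℝ) ^ n := by
  set q : ℝ := (Fintype.card F : ℝ) with hq
  have hq0 : 0 < q := by rw [hq]; exact_mod_cast Fintype.card_pos
  have e1 : ∑ m ∈ monics F n, ∑ e ∈ mdiv m, (χ e : ℝ)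
      = ∑ a ∈ Finset.range (n + 1), ∑ e ∈ monics F a, (χ e : ℝ) * q ^ (n - a) := by
    have : ∀ m ∈ monics F n, ∑ e ∈ mdiv m, (χ e : ℝ)
        = ∑ a ∈ Finset.range (n + 1), ∑ e ∈ monics F a, if e ∣ m then (χ e : ℝ) else 0 := by
      intro m hm
      rw [mdiv, (mem_monics.1 hm).2, Finset.sum_filter, Finset.sum_biUnion]
      intro i _ j _ hij
      exact monics_disjoint hij
    rw [Finset.sum_congr rfl this, Finset.sum_comm]
    refine Finset.sum_congr rfl fun a ha => ?_
    rw [Finset.sum_comm]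
    refine Finset.sum_congr rfl fun e he => ?_
    have he := mem_monics.1 he
    rw [Finset.mem_range] at ha
    rw [← Finset.sum_filter, Finset.sum_const, card_monics_dvd he.1 (by omega), he.2, nsmul_eq_mul,
      mul_comm]
    push_cast; rfl
  rw [e1]
  have e2 : ∀ a ∈ Finset.range (n + 1), ∑ e ∈ monics F a, (χ e : ℝ) * q ^ (n - a)
      ≤ if a < Z then q ^ n else 0 := by
    intro a ha
    rw [Finset.mem_range] at ha
    rw [← Finset.sum_mul]
    split_ifs with haz
    · have : ∑ e ∈ monics F a, (χ e : ℝ) ≤ q ^ a := by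
        have : ((monics F a).card : ℝ) = q ^ a := by rw [card_monics]; push_cast; rfl
        rw [← this, ← mul_one ((monics F a).card : ℝ), ← nsmul_eq_mul, ← Finset.sum_const]
        refine Finset.sum_le_sum fun e he => ?_
        rcases h.cases e (mem_monics.1 he).1 with h | h | h <;> rw [h] <;> norm_num
      calc _ ≤ q ^ a * q ^ (n - a) := by gcongr
        _ = q ^ n := by rw [← pow_add]; congr 1; omega
    · have := h.sum_eq_zero a (by omega)
      have h3 : ∑ e ∈ monics F a, (χ e : ℝ) = 0 := by exact_mod_cast this
      rw [h3, zero_mul]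
  refine (Finset.sum_le_sum e2).trans ?_
  rw [← Finset.sum_filter, Finset.sum_const, nsmul_eq_mul]
  gcongr
  calc ((Finset.range (n + 1)).filter (· < Z)).card ≤ (Finset.range Z).card := by
        refine Finset.card_le_card fun a ha => ?_
        rw [Finset.mem_filter] at ha
        exact Finset.mem_range.2 ha.2
    _ = Z := Finset.card_range Z

lemma sq_sum_char_le {χ : F[X] → ℤ} {Z : ℕ} (h : IsQuadChar χ Z) (d : ℕ) (M : Finset F[X])
    (hM : ∀ m ∈ M, m.Monic ∧ m.natDegree < d ∧ ∀ P ∈ pf m, χ P = 1) :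
    (∑ m ∈ M, (pnorm m)⁻¹) ^ 2 ≤ 2 * d * Z := by
  have hr : ∀ m : F[X], m.Monic → (0 : ℝ) ≤ ∑ e ∈ mdiv m, (χ e : ℝ) := fun m hm => by
    exact_mod_cast sum_mdiv_nonneg h hm
  set T := (Finset.range (2 * d)).biUnion (monics F) with hT
  have hmaps : ∀ p ∈ M ×ˢ M, p.1 * p.2 ∈ T := by
    rintro ⟨a, b⟩ hp
    rw [Finset.mem_product] at hp
    have ha := hM a hp.1
    have hb := hM b hp.2
    rw [hT, Finset.mem_biUnion]
    refine ⟨a.natDegree + b.natDegree, Finset.mem_range.2 (by omega), mem_monics.2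
      ⟨ha.1.mul hb.1, ha.1.natDegree_mul hb.1⟩⟩
  have hTm : ∀ m ∈ T, m.Monic := fun m hm => by
    rw [hT, Finset.mem_biUnion] at hm
    obtain ⟨k, -, hk⟩ := hm
    exact (mem_monics.1 hk).1
  have hfib : ∀ m ∈ T, (((M ×ˢ M).filter fun p => p.1 * p.2 = m).card : ℝ)
      ≤ ∑ e ∈ mdiv m, (χ e : ℝ) := by
    intro m hm
    rcases Finset.eq_empty_or_nonempty ((M ×ˢ M).filter fun p => p.1 * p.2 = m) with h0 | ⟨⟨a, b⟩, h0⟩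
    · rw [h0, Finset.card_empty, Nat.cast_zero]; exact hr m (hTm m hm)
    · rw [Finset.mem_filter, Finset.mem_product] at h0
      have ha := hM a h0.1.1
      have hb := hM b h0.1.2
      have hm0 := (hTm m hm).ne_zero
      have h1 : ∀ e ∈ mdiv m, (χ e : ℝ) = 1 := by
        intro e he
        rw [mem_mdiv hm0] at he
        have : χ e = 1 := by
          refine h.eq_one_of_primes he.1 fun P hP hI hd => ?_
          have hd' : P ∣ a * b := by
            have := h0.2
            simp only at this
            rw [this]; exact hd.trans he.2
          rcases hI.prime.dvd_or_dvd hd' with h2 | h2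
          · exact ha.2.2 P ((mem_pf ha.1.ne_zero).2 ⟨hP, hI, h2⟩)
          · exact hb.2.2 P ((mem_pf hb.1.ne_zero).2 ⟨hP, hI, h2⟩)
        exact_mod_cast this
      rw [Finset.sum_congr rfl h1, Finset.sum_const, nsmul_eq_mul, mul_one]
      have : ((M ×ˢ M).filter fun p => p.1 * p.2 = m).card ≤ (mdiv m).card := by
        refine Finset.card_le_card_of_injOn Prod.fst ?_ ?_
        · rintro ⟨a, b⟩ hab
          rw [Finset.mem_coe, Finset.mem_filter, Finset.mem_product] at hab
          exact (mem_mdiv hm0).2 ⟨(hM a hab.1.1).1, hab.2 ▸ dvd_mul_right _ _⟩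
        · rintro ⟨a, b⟩ hab ⟨a', b'⟩ hab' heq
          rw [Finset.mem_coe, Finset.mem_filter, Finset.mem_product] at hab hab'
          simp only at heq hab hab'
          subst heq
          have := hab.2.trans hab'.2.symm
          rw [mul_left_cancel₀ (hM a hab.1.1).1.ne_zero this]
      exact_mod_cast this
  have hq0 : 0 < (Fintype.card F : ℝ) := by exact_mod_cast Fintype.card_pos
  calc (∑ m ∈ M, (pnorm m)⁻¹) ^ 2 = ∑ p ∈ M ×ˢ M, (pnorm (p.1 * p.2))⁻¹ := by
        rw [sq, Finset.sum_mul_sum, ← Finset.sum_product']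
        refine Finset.sum_congr rfl fun p hp => ?_
        rw [Finset.mem_product] at hp
        rw [pnorm_mul (hM _ hp.1).1 (hM _ hp.2).1, mul_inv]
    _ = ∑ m ∈ T, (((M ×ˢ M).filter fun p => p.1 * p.2 = m).card : ℝ) * (pnorm m)⁻¹ := by
        rw [← Finset.sum_fiberwise_of_maps_to hmaps]
        refine Finset.sum_congr rfl fun m _ => ?_
        rw [Finset.sum_congr rfl (g := fun _ => (pnorm m)⁻¹) fun p hp => by
          rw [(Finset.mem_filter.1 hp).2], Finset.sum_const, nsmul_eq_mul]
    _ ≤ ∑ m ∈ T, (∑ e ∈ mdiv m, (χ e : ℝ)) * (pnorm m)⁻¹ := by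
        refine Finset.sum_le_sum fun m hm => ?_
        exact mul_le_mul_of_nonneg_right (hfib m hm) (inv_pos.2 (pnorm_pos m)).le
    _ = ∑ n ∈ Finset.range (2 * d), (∑ m ∈ monics F n, ∑ e ∈ mdiv m, (χ e : ℝ)) *
          ((Fintype.card F : ℝ) ^ n)⁻¹ := by
        rw [hT, Finset.sum_biUnion fun i _ j _ hij => monics_disjoint hij]
        refine Finset.sum_congr rfl fun n _ => ?_
        rw [Finset.sum_mul]
        refine Finset.sum_congr rfl fun m hm => ?_
        rw [pnorm, (mem_monics.1 hm).2]
    _ ≤ ∑ n ∈ Finset.range (2 * d), (Z : ℝ) := by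
        refine Finset.sum_le_sum fun n _ => ?_
        rw [← div_eq_mul_inv, div_le_iff₀ (by positivity)]
        exact sum_sum_mdiv_le h n
    _ = 2 * d * Z := by
        rw [Finset.sum_const, Finset.card_range, nsmul_eq_mul]; push_cast; ring

end Characters

section SmoothParts
open scoped Classical

variable {F : Type} [Field F] [Fintype F]

lemma mem_filt {α : Type*} {p : α → Prop} {inst : DecidablePred p} {s : Finset α} {a : α} :
    a ∈ @Finset.filter α p inst s ↔ a ∈ s ∧ p a := Finset.mem_filter

lemma sum_filt {α M : Type*} [AddCommMonoid M] {p : α → Prop} {inst : DecidablePred p}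
    {s : Finset α} {f : α → M} :
    ∑ a ∈ @Finset.filter α p inst s, f a = ∑ a ∈ s, if p a then f a else 0 := by
  rw [Finset.sum_filter]

/-- The product of the prime factors of degree at most `y`. -/
noncomputable def smoothPart (y : ℕ) (f : F[X]) : F[X] :=
  ∏ P ∈ (pf f).filter (fun P => P.natDegree ≤ y), P

/-- The product of the prime factors of degree larger than `y`. -/
noncomputable def roughPart (y : ℕ) (f : F[X]) : F[X] :=
  ∏ P ∈ (pf f).filter (fun P => ¬ P.natDegree ≤ y), P

lemma smoothPart_mul_roughPart (y : ℕ) {f : F[X]} (hf : f.Monic) (hs : Squarefree f) :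
    smoothPart y f * roughPart y f = f := by
  rw [smoothPart, roughPart, Finset.prod_filter_mul_prod_filter_not, prod_pf hf hs]

lemma pf_smoothPart (y : ℕ) (f : F[X]) :
    pf (smoothPart y f) = (pf f).filter (fun P => P.natDegree ≤ y) :=
  pf_prod _ fun P hP => ⟨pf_monic (mem_filt.1 hP).1, pf_irreducible (mem_filt.1 hP).1⟩

lemma pf_roughPart (y : ℕ) (f : F[X]) :
    pf (roughPart y f) = (pf f).filter (fun P => ¬ P.natDegree ≤ y) :=
  pf_prod _ fun P hP => ⟨pf_monic (mem_filt.1 hP).1, pf_irreducible (mem_filt.1 hP).1⟩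

lemma smoothPart_monic (y : ℕ) (f : F[X]) : (smoothPart y f).Monic :=
  monic_prod_of_monic _ _ fun P hP => pf_monic (mem_filt.1 hP).1

lemma roughPart_monic (y : ℕ) (f : F[X]) : (roughPart y f).Monic :=
  monic_prod_of_monic _ _ fun P hP => pf_monic (mem_filt.1 hP).1

lemma smoothPart_squarefree (y : ℕ) (f : F[X]) : Squarefree (smoothPart y f) :=
  squarefree_prod _ fun P hP => ⟨pf_monic (mem_filt.1 hP).1, pf_irreducible (mem_filt.1 hP).1⟩

lemma roughPart_squarefree (y : ℕ) (f : F[X]) : Squarefree (roughPart y f) :=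
  squarefree_prod _ fun P hP => ⟨pf_monic (mem_filt.1 hP).1, pf_irreducible (mem_filt.1 hP).1⟩

lemma sum_char_smooth_rough_le {χ : F[X] → ℤ} {Z : ℕ} (h : IsQuadChar χ Z) (y d : ℕ) :
    ∑ m ∈ sqfreesLT F d, ∏ P ∈ pf m,
        ((if y < P.natDegree ∧ χ P ≠ 1 then 0 else 1) * (pnorm P)⁻¹)
      ≤ Real.exp (1 + Real.log y) * Real.sqrt (2 * d * Z) := by
  set M1 := (sqfreesLT F d).filter fun m => ∀ P ∈ pf m, P.natDegree ≤ y with hM1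
  set M2 := (sqfreesLT F d).filter fun m => ∀ P ∈ pf m, χ P = 1 with hM2
  set M := (sqfreesLT F d).filter fun m => ∀ P ∈ pf m, y < P.natDegree → χ P = 1 with hM
  have e1 : ∑ m ∈ sqfreesLT F d, ∏ P ∈ pf m,
        ((if y < P.natDegree ∧ χ P ≠ 1 then 0 else 1) * (pnorm P)⁻¹)
      = ∑ m ∈ M, (∏ P ∈ pf (smoothPart y m), (pnorm P)⁻¹) * (pnorm (roughPart y m))⁻¹ := by
    rw [hM, sum_filt]
    refine Finset.sum_congr rfl fun m hm => ?_
    split_ifs with hc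
    · rw [← prod_pnorm_pf (roughPart_monic y m) (roughPart_squarefree y m), pf_smoothPart,
        pf_roughPart, Finset.prod_filter_mul_prod_filter_not]
      refine Finset.prod_congr rfl fun P hP => ?_
      rw [if_neg, one_mul]
      rintro ⟨h1, h2⟩
      exact h2 (hc P hP h1)
    · push Not at hc
      obtain ⟨P, hP, h1, h2⟩ := hc
      refine Finset.prod_eq_zero hP ?_
      rw [if_pos ⟨h1, h2⟩, zero_mul]
  rw [e1]
  have e2 : ∑ m ∈ M, (∏ P ∈ pf (smoothPart y m), (pnorm P)⁻¹) * (pnorm (roughPart y m))⁻¹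
      ≤ ∑ p ∈ M1 ×ˢ M2, (∏ P ∈ pf p.1, (pnorm P)⁻¹) * (pnorm p.2)⁻¹ := by
    rw [← Finset.sum_image (s := M) (g := fun m => (smoothPart y m, roughPart y m))
      (f := fun p : F[X] × F[X] => (∏ P ∈ pf p.1, (pnorm P)⁻¹) * (pnorm p.2)⁻¹)]
    · refine Finset.sum_le_sum_of_subset_of_nonneg ?_ fun p _ _ =>
        mul_nonneg (Finset.prod_nonneg fun P _ => (inv_pos.2 (pnorm_pos P)).le)
          (inv_pos.2 (pnorm_pos _)).le
      intro p hp
      obtain ⟨m, hm, rfl⟩ := Finset.mem_image.1 hp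
      rw [hM, mem_filt, mem_sqfreesLT] at hm
      obtain ⟨⟨h1, h2, h3⟩, h4⟩ := hm
      have hdeg : (smoothPart y m).natDegree + (roughPart y m).natDegree < d := by
        rw [← (smoothPart_monic y m).natDegree_mul (roughPart_monic y m),
          smoothPart_mul_roughPart y h1 h2]; exact h3
      rw [Finset.mem_product, hM1, hM2, mem_filt, mem_filt, mem_sqfreesLT,
        mem_sqfreesLT, pf_smoothPart, pf_roughPart]
      refine ⟨⟨⟨smoothPart_monic y m, smoothPart_squarefree y m, by simp only; omega⟩, fun P hP =>
        (mem_filt.1 hP).2⟩, ⟨roughPart_monic y m, roughPart_squarefree y m, by simp only; omega⟩,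
        fun P hP => ?_⟩
      rw [mem_filt] at hP
      exact h4 P hP.1 (not_le.1 hP.2)
    · intro a ha b hb hab
      rw [hM, Finset.mem_coe, mem_filt, mem_sqfreesLT] at ha hb
      simp only [Prod.mk.injEq] at hab
      rw [← smoothPart_mul_roughPart y ha.1.1 ha.1.2.1, hab.1, hab.2,
        smoothPart_mul_roughPart y hb.1.1 hb.1.2.1]
  refine e2.trans ?_
  rw [Finset.sum_product]
  simp only
  rw [← Finset.sum_mul_sum]
  refine mul_le_mul ?_ ?_ (Finset.sum_nonneg fun m _ => (inv_pos.2 (pnorm_pos _)).le)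
    (Real.exp_pos _).le
  · refine (euler_product_bound (primesLT F (y + 1)) M1 ?_ (fun P => (pnorm P)⁻¹)
      fun P => (inv_pos.2 (pnorm_pos P)).le).trans (Real.exp_le_exp.2 (sum_inv_norm_primesLT_le y))
    intro m hm
    rw [hM1, mem_filt, mem_sqfreesLT] at hm
    refine ⟨hm.1.1, hm.1.2.1, fun P hP => mem_primesLT.2 ⟨pf_monic hP, pf_irreducible hP, ?_⟩⟩
    have := hm.2 P hP
    omega
  · refine Real.le_sqrt_of_sq_le (sq_sum_char_le h d M2 fun m hm => ?_)
    rw [hM2, mem_filt, mem_sqfreesLT] at hm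
    exact ⟨hm.1.1, hm.1.2.2, hm.2⟩

lemma card_char_eq_one_le {χ : F[X] → ℤ} {Z : ℕ} (h : IsQuadChar χ Z) (y d : ℕ) :
    (((sqfrees F d).filter fun f => ∀ P ∈ pf f, y < P.natDegree → χ P = 1).card : ℝ) * d
      ≤ (Fintype.card F : ℝ) ^ d * (Real.exp (1 + Real.log y) * Real.sqrt (2 * d * Z)) := by
  have h1 := hall_tenenbaum_prod (F := F) d
    (fun P => if y < P.natDegree ∧ χ P ≠ 1 then 0 else 1)
    (fun P => by split_ifs <;> norm_num) (fun P => by split_ifs <;> norm_num)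
  have h2 : (((sqfrees F d).filter fun f => ∀ P ∈ pf f, y < P.natDegree → χ P = 1).card : ℝ)
      ≤ ∑ f ∈ sqfrees F d, ∏ P ∈ pf f, (if y < P.natDegree ∧ χ P ≠ 1 then (0 : ℝ) else 1) := by
    rw [Finset.card_eq_sum_ones, sum_filt]
    push_cast
    refine Finset.sum_le_sum fun f _ => ?_
    split_ifs with hc
    · rw [Finset.prod_eq_one]
      intro P hP
      rw [if_neg]
      rintro ⟨h1, h2⟩
      exact h2 (hc P hP h1)
    · exact Finset.prod_nonneg fun P _ => by split_ifs <;> norm_num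
  calc _ ≤ (d : ℝ) * ∑ f ∈ sqfrees F d, ∏ P ∈ pf f,
        (if y < P.natDegree ∧ χ P ≠ 1 then (0 : ℝ) else 1) := by
        rw [mul_comm]; exact mul_le_mul_of_nonneg_left h2 (Nat.cast_nonneg _)
    _ ≤ _ := h1
    _ ≤ _ := by
        refine mul_le_mul_of_nonneg_left (sum_char_smooth_rough_le h y d) (by positivity)

set_option maxHeartbeats 1000000 in
lemma card_exists_smooth_dvd_le (χ : F[X] → F[X] → ℤ)
    (hχ : ∀ D : F[X], D.Monic → Squarefree D → D ≠ 1 → IsQuadChar (χ D) D.natDegree)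
    {y s d : ℕ} (hd : 2 * (s * y) ≤ d) (hd0 : 0 < d) :
    (((sqfrees F d).filter fun f => omegaDeg (· ≤ y) f ≤ s ∧ ∃ D : F[X], D.Monic ∧ D ≠ 1 ∧ D ∣ f ∧
        (∀ P ∈ pf D, P.natDegree ≤ y) ∧ ∀ P ∈ pf f, y < P.natDegree → χ D P = 1).card : ℝ)
      ≤ (Fintype.card F : ℝ) ^ d *
        (Real.exp (2 * (1 + Real.log y)) * Real.sqrt (4 * (s * y) / d)) := by
  set q : ℝ := (Fintype.card F : ℝ) with hq
  have hq0 : 0 < q := by rw [hq]; exact_mod_cast Fintype.card_pos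
  set DD := (sqfreesLT F (s * y + 1)).filter fun D => D ≠ 1 ∧ ∀ P ∈ pf D, P.natDegree ≤ y with hDD
  set A : F[X] → Finset F[X] := fun D => (sqfrees F (d - D.natDegree)).filter
    fun f => ∀ P ∈ pf f, y < P.natDegree → χ D P = 1 with hA
  have hsub : ((sqfrees F d).filter fun f => omegaDeg (· ≤ y) f ≤ s ∧ ∃ D : F[X], D.Monic ∧ D ≠ 1 ∧
      D ∣ f ∧ (∀ P ∈ pf D, P.natDegree ≤ y) ∧ ∀ P ∈ pf f, y < P.natDegree → χ D P = 1)
      ⊆ DD.biUnion fun D => (A D).image (D * ·) := by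
    intro f hf
    rw [mem_filt, mem_sqfrees] at hf
    obtain ⟨⟨h1, h2, h3⟩, h4, D, h5, h6, ⟨E, rfl⟩, h8, h9⟩ := hf
    have hE : E.Monic := h5.of_mul_monic_left h1
    have hDs : Squarefree D := h3.squarefree_of_dvd (dvd_mul_right _ _)
    have hsub : pf D ⊆ pf (D * E) := pf_subset_of_dvd h1.ne_zero (dvd_mul_right _ _)
    have hsubE : pf E ⊆ pf (D * E) := pf_subset_of_dvd h1.ne_zero (dvd_mul_left _ _)
    have hdeg : D.natDegree ≤ s * y := by
      rw [← sum_natDegree_pf h5 hDs]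
      calc ∑ P ∈ pf D, P.natDegree ≤ (pf D).card * y := Finset.sum_le_card_nsmul _ _ _ h8
        _ ≤ s * y := by
          refine Nat.mul_le_mul_right _ (le_trans (Finset.card_le_card ?_) h4)
          intro P hP
          exact mem_filt.2 ⟨hsub hP, h8 P hP⟩
    rw [h5.natDegree_mul hE] at h2
    rw [Finset.mem_biUnion]
    refine ⟨D, ?_, Finset.mem_image.2 ⟨E, ?_, rfl⟩⟩
    · rw [hDD, mem_filt, mem_sqfreesLT]
      exact ⟨⟨h5, hDs, by omega⟩, h6, h8⟩
    · rw [hA, mem_filt, mem_sqfrees]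
      exact ⟨⟨hE, by omega, h3.squarefree_of_dvd (dvd_mul_left _ _)⟩, fun P hP => h9 P (hsubE hP)⟩
  have hcard : ∀ D ∈ DD, ((A D).card : ℝ) ≤ (∏ P ∈ pf D, (pnorm P)⁻¹) *
      (q ^ d * (Real.exp (1 + Real.log y) * Real.sqrt (4 * (s * y) / d))) := by
    intro D hD
    rw [hDD, mem_filt, mem_sqfreesLT] at hD
    obtain ⟨⟨h1, h2, h3⟩, h4, -⟩ := hD
    have hle : D.natDegree ≤ d := by omega
    have key : ((A D).card : ℝ) * ((d - D.natDegree : ℕ) : ℝ) ≤ q ^ (d - D.natDegree) *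
        (Real.exp (1 + Real.log y) *
          Real.sqrt (2 * ((d - D.natDegree : ℕ) : ℝ) * D.natDegree)) := by
      rw [hq]
      convert card_char_eq_one_le (hχ D h1 h2 h4) y (d - D.natDegree)
    have hdpos : (0 : ℝ) < ((d - D.natDegree : ℕ) : ℝ) := by
      have : 0 < d - D.natDegree := by omega
      exact_mod_cast this
    have hsq : Real.sqrt (2 * ((d - D.natDegree : ℕ) : ℝ) * D.natDegree)
        ≤ Real.sqrt (4 * (s * y) / d) * ((d - D.natDegree : ℕ) : ℝ) := by
      refine Real.sqrt_le_iff.2 ⟨by positivity, ?_⟩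
      rw [mul_pow, Real.sq_sqrt (by positivity)]
      have hd0' : (0 : ℝ) < d := by exact_mod_cast hd0
      have h5 : (D.natDegree : ℝ) ≤ s * y := by exact_mod_cast Nat.lt_succ_iff.1 h3
      have h6 : (d : ℝ) ≤ 2 * ((d - D.natDegree : ℕ) : ℝ) := by
        have : d ≤ 2 * (d - D.natDegree) := by omega
        exact_mod_cast this
      rw [div_mul_eq_mul_div, le_div_iff₀ hd0']
      generalize ((d - D.natDegree : ℕ) : ℝ) = z at *
      have h7 : (D.natDegree : ℝ) * d ≤ (s * y) * (2 * z) :=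
        mul_le_mul h5 h6 (Nat.cast_nonneg _) (by positivity)
      nlinarith [mul_le_mul_of_nonneg_left h7 hdpos.le]
    have hqd : q ^ (d - D.natDegree) = q ^ d * ∏ P ∈ pf D, (pnorm P)⁻¹ := by
      rw [prod_pnorm_pf h1 h2, pnorm, ← hq, pow_sub₀ _ hq0.ne' hle]
    have h8 : ((A D).card : ℝ) * ((d - D.natDegree : ℕ) : ℝ) ≤ (∏ P ∈ pf D, (pnorm P)⁻¹) *
        (q ^ d * (Real.exp (1 + Real.log y) * Real.sqrt (4 * (s * y) / d)))
          * ((d - D.natDegree : ℕ) : ℝ) := by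
      refine key.trans ?_
      rw [hqd]
      calc _ ≤ (q ^ d * ∏ P ∈ pf D, (pnorm P)⁻¹) * (Real.exp (1 + Real.log y) *
            (Real.sqrt (4 * (s * y) / d) * ((d - D.natDegree : ℕ) : ℝ))) := by
            refine mul_le_mul_of_nonneg_left (mul_le_mul_of_nonneg_left hsq (Real.exp_pos _).le) ?_
            rw [← hqd]; positivity
        _ = _ := by ring
    exact le_of_mul_le_mul_right h8 hdpos
  calc _ ≤ ((DD.biUnion fun D => (A D).image (D * ·)).card : ℝ) := by
        exact_mod_cast Finset.card_le_card hsub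
    _ ≤ ∑ D ∈ DD, ((A D).card : ℝ) := by
        refine le_trans (Nat.cast_le.2 Finset.card_biUnion_le) ?_
        push_cast
        exact Finset.sum_le_sum fun D _ => by exact_mod_cast Finset.card_image_le
    _ ≤ ∑ D ∈ DD, (∏ P ∈ pf D, (pnorm P)⁻¹) *
      (q ^ d * (Real.exp (1 + Real.log y) * Real.sqrt (4 * (s * y) / d))) :=
        Finset.sum_le_sum hcard
    _ = (∑ D ∈ DD, ∏ P ∈ pf D, (pnorm P)⁻¹) *
      (q ^ d * (Real.exp (1 + Real.log y) * Real.sqrt (4 * (s * y) / d))) := by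
        rw [Finset.sum_mul]
    _ ≤ Real.exp (1 + Real.log y) *
      (q ^ d * (Real.exp (1 + Real.log y) * Real.sqrt (4 * (s * y) / d))) := by
        refine mul_le_mul_of_nonneg_right ?_ (by positivity)
        refine (euler_product_bound (primesLT F (y + 1)) DD ?_ (fun P => (pnorm P)⁻¹)
          fun P => (inv_pos.2 (pnorm_pos P)).le).trans
            (Real.exp_le_exp.2 (sum_inv_norm_primesLT_le y))
        intro m hm
        rw [hDD, mem_filt, mem_sqfreesLT] at hm
        refine ⟨hm.1.1, hm.1.2.1, fun P hP => mem_primesLT.2 ⟨pf_monic hP, pf_irreducible hP, ?_⟩⟩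
        have := hm.2.2 P hP
        omega
    _ = _ := by
        rw [two_mul (1 + Real.log y), Real.exp_add (1 + Real.log y) (1 + Real.log y)]; ring

lemma isQuadChar_leg_left (hq4 : Fintype.card F % 4 = 3) {D : F[X]} (hD : D.Monic)
    (hs : Squarefree D) (h1 : D ≠ 1) : IsQuadChar (fun A => leg A D) D.natDegree where
  one := leg_one_left D
  mul a b _ _ := leg_mul_left a b hD
  cases a _ := leg_cases a D
  sum_eq_zero k hk := by
    obtain ⟨A, hA⟩ := exists_leg_eq_neg_one (ringChar_ne_two_of_mod hq4) hD hs h1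
    exact sum_leg_eq_zero hD hA hk

lemma isQuadChar_leg_right (hq4 : Fintype.card F % 4 = 3) {D : F[X]} (hD : D.Monic)
    (hs : Squarefree D) (h1 : D ≠ 1) : IsQuadChar (fun A => leg D A) D.natDegree where
  one := leg_one_right D
  mul a b ha hb := leg_mul_right D ha hb
  cases a _ := leg_cases D a
  sum_eq_zero k hk := by
    obtain ⟨A, hA⟩ := exists_leg_eq_neg_one (ringChar_ne_two_of_mod hq4) hD hs h1
    have h : ∀ B ∈ monics F k, leg D B = (-1) ^ (D.natDegree * k) * leg B D := fun B hB => by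
      rw [leg_reciprocity hq4 D B, (mem_monics.1 hB).2]
    rw [Finset.sum_congr rfl h, ← Finset.mul_sum, sum_leg_eq_zero hD hA hk, mul_zero]

end SmoothParts

section Moments
open Filter Topology

/-- `∏_{l < j} (x - 2 ^ l)`. -/
noncomputable def injPoly (j : ℕ) (x : ℝ) : ℝ := ∏ l ∈ Finset.range j, (x - 2 ^ l)

/-- `∏_{1 ≤ l ≤ i} (2 ^ l - 1)`. -/
noncomputable def mersProd (i : ℕ) : ℝ := ∏ l ∈ Finset.range i, ((2 : ℝ) ^ (l + 1) - 1)

lemma mersProd_succ (i : ℕ) : mersProd (i + 1) = mersProd i * ((2 : ℝ) ^ (i + 1) - 1) :=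
  Finset.prod_range_succ _ _

lemma two_pow_sub_one_pos (i : ℕ) : (0 : ℝ) < (2 : ℝ) ^ (i + 1) - 1 := by
  have : (1 : ℝ) < 2 ^ (i + 1) := one_lt_pow₀ (by norm_num) (by omega)
  linarith

lemma mersProd_pos (i : ℕ) : 0 < mersProd i :=
  Finset.prod_pos fun l _ => two_pow_sub_one_pos l

lemma two_pow_le_mersProd (i : ℕ) : (2 : ℝ) ^ i ≤ 2 * mersProd i := by
  induction i with
  | zero => simp [mersProd]
  | succ i ih =>
    rw [mersProd_succ, pow_succ]
    rcases Nat.eq_zero_or_pos i with rfl | hi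
    · simp [mersProd]; norm_num
    · have : (2 : ℝ) ≤ 2 ^ (i + 1) - 1 := by
        have : (2 : ℝ) ^ 2 ≤ 2 ^ (i + 1) := pow_le_pow_right₀ (by norm_num) (by omega)
        linarith
      have h0 := mersProd_pos i
      rw [← mul_assoc]
      exact mul_le_mul ih this (by norm_num) (by positivity)

lemma injPoly_succ (j : ℕ) (x : ℝ) : injPoly (j + 1) x = injPoly j x * (x - 2 ^ j) :=
  Finset.prod_range_succ _ _

lemma injPoly_add (r i : ℕ) (z : ℝ) :
    injPoly (r + i) (2 ^ r * z) = injPoly r (2 ^ r * z) * 2 ^ (r * i) * injPoly i z := by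
  induction i with
  | zero => simp [injPoly]
  | succ i ih =>
    rw [← add_assoc, injPoly_succ, ih, injPoly_succ, mul_add, pow_add, pow_add]
    ring

lemma alternating_sum_eq (t : ℕ) (z : ℝ) :
    ∑ i ∈ Finset.range (t + 1), (-1) ^ i * injPoly i z / mersProd i
      = (-1) ^ t * (∏ l ∈ Finset.range t, (z - 2 ^ (l + 1))) / mersProd t := by
  induction t with
  | zero => simp [injPoly, mersProd]
  | succ t ih =>
    rw [Finset.sum_range_succ, ih, injPoly, Finset.prod_range_succ' _ t, mersProd_succ,
      Finset.prod_range_succ _ t]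
    have h0 := (mersProd_pos t).ne'
    have h1 := (two_pow_sub_one_pos t).ne'
    generalize ∏ l ∈ Finset.range t, (z - 2 ^ (l + 1)) = B at *
    field_simp
    ring

lemma injPoly_eq_zero {j n : ℕ} (h : n < j) : injPoly j (2 ^ n) = 0 :=
  Finset.prod_eq_zero (Finset.mem_range.2 h) (sub_self _)

lemma injPoly_pos {j n : ℕ} (h : j ≤ n) : 0 < injPoly j (2 ^ n) :=
  Finset.prod_pos fun l hl => by
    have : (2 : ℝ) ^ l < 2 ^ n :=
      pow_lt_pow_right₀ (by norm_num) ((Finset.mem_range.1 hl).trans_le h)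
    linarith

/-- Bonferroni-type inequality for the rank. -/
lemma bonferroni (r t n : ℕ) :
    0 ≤ (-1) ^ t * (∑ i ∈ Finset.range (t + 1),
        (-1) ^ i * ((2 : ℝ) ^ (r * i))⁻¹ / mersProd i * injPoly (r + i) (2 ^ n)
      - injPoly r (2 ^ r) * if n = r then 1 else 0) := by
  rcases lt_or_ge n r with h | h
  · rw [if_neg h.ne, mul_zero, sub_zero, Finset.sum_eq_zero, mul_zero]
    intro i _
    rw [injPoly_eq_zero (by omega), mul_zero]
  · obtain ⟨k, rfl⟩ := Nat.exists_eq_add_of_le h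
    have e1 : ∑ i ∈ Finset.range (t + 1),
        (-1) ^ i * ((2 : ℝ) ^ (r * i))⁻¹ / mersProd i * injPoly (r + i) (2 ^ (r + k))
        = injPoly r (2 ^ (r + k)) * ((-1) ^ t *
          (∏ l ∈ Finset.range t, ((2 : ℝ) ^ k - 2 ^ (l + 1))) / mersProd t) := by
      rw [← alternating_sum_eq, Finset.mul_sum]
      refine Finset.sum_congr rfl fun i _ => ?_
      rw [pow_add, injPoly_add]
      have : (2 : ℝ) ^ (r * i) ≠ 0 := by positivity
      field_simp
    rw [e1]
    have hs : ((-1 : ℝ) ^ t) * (-1) ^ t = 1 := by rw [← mul_pow]; simp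
    rcases Nat.eq_zero_or_pos k with rfl | hk
    · simp only [add_zero, if_true, mul_one, pow_zero]
      have : (∏ l ∈ Finset.range t, ((1 : ℝ) - 2 ^ (l + 1))) = (-1) ^ t * mersProd t := by
        have h1 : ((-1 : ℝ)) ^ t = ∏ _l ∈ Finset.range t, (-1 : ℝ) := by simp
        rw [mersProd, h1, ← Finset.prod_mul_distrib]
        exact Finset.prod_congr rfl fun l _ => by ring
      rw [this, ← mul_assoc ((-1 : ℝ) ^ t), hs, one_mul, div_self (mersProd_pos t).ne', mul_one,
        sub_self, mul_zero]
    · rw [if_neg (by omega), mul_zero, sub_zero]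
      have e2 : (-1) ^ t * (injPoly r (2 ^ (r + k)) * ((-1) ^ t *
          (∏ l ∈ Finset.range t, ((2 : ℝ) ^ k - 2 ^ (l + 1))) / mersProd t))
          = (((-1 : ℝ) ^ t) * (-1) ^ t) * (injPoly r (2 ^ (r + k)) *
          (∏ l ∈ Finset.range t, ((2 : ℝ) ^ k - 2 ^ (l + 1))) / mersProd t) := by ring
      rw [e2, hs, one_mul]
      refine div_nonneg (mul_nonneg (injPoly_pos (by omega)).le ?_) (mersProd_pos t).le
      rcases le_or_gt k t with hkt | hkt
      · obtain ⟨k', rfl⟩ : ∃ k', k = k' + 1 := ⟨k - 1, by omega⟩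
        rw [Finset.prod_eq_zero (Finset.mem_range.2 (show k' < t by omega)) (sub_self _)]
      · refine Finset.prod_nonneg fun l hl => ?_
        have : (2 : ℝ) ^ (l + 1) ≤ 2 ^ k :=
          pow_le_pow_right₀ (by norm_num) (by rw [Finset.mem_range] at hl; omega)
        linarith

/-- The alternating series whose value is `∏_{l > r} (1 - 2 ^ {-l})`. -/
noncomputable def clTerm (r i : ℕ) : ℝ := (-1) ^ i * ((2 : ℝ) ^ (r * i))⁻¹ / mersProd i

lemma abs_clTerm_le (r i : ℕ) : |clTerm r i| ≤ 2 * ((2 : ℝ) ^ ((r + 1) * i))⁻¹ := by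
  rw [clTerm, abs_div, abs_mul, abs_pow, abs_neg, abs_one, one_pow, one_mul,
    abs_of_pos (mersProd_pos i), abs_of_pos (by positivity), div_le_iff₀ (mersProd_pos i),
    add_mul, one_mul, pow_add, mul_inv]
  have h := two_pow_le_mersProd i
  have h2 : (0 : ℝ) < ((2 : ℝ) ^ (r * i))⁻¹ := by positivity
  have h3 : 1 ≤ ((2 : ℝ) ^ i)⁻¹ * (2 * mersProd i) := by
    rw [inv_mul_eq_div, one_le_div (by positivity)]; exact h
  nlinarith

lemma summable_clTerm_bound (r : ℕ) : Summable fun i : ℕ => 2 * ((2 : ℝ) ^ ((r + 1) * i))⁻¹ := by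
  have : Summable fun i : ℕ => ((2 : ℝ) ^ (r + 1))⁻¹ ^ i :=
    summable_geometric_of_lt_one (by positivity)
      (inv_lt_one_of_one_lt₀ (one_lt_pow₀ (by norm_num) (by omega)))
  refine (this.mul_left 2).congr fun i => ?_
  rw [pow_mul, inv_pow]

lemma summable_clTerm (r : ℕ) : Summable (clTerm r) :=
  Summable.of_norm_bounded (summable_clTerm_bound r) fun i => abs_clTerm_le r i

lemma tsum_clTerm_rec (r : ℕ) :
    ∑' i, clTerm r i = (1 - ((2 : ℝ) ^ (r + 1))⁻¹) * ∑' i, clTerm (r + 1) i := by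
  have h : ∑' i, (clTerm r i - clTerm (r + 1) i) = -((2 : ℝ) ^ (r + 1))⁻¹ * ∑' i, clTerm (r + 1) i := by
    rw [((summable_clTerm r).sub (summable_clTerm (r + 1))).tsum_eq_zero_add, ← tsum_mul_left]
    have h0 : clTerm r 0 - clTerm (r + 1) 0 = 0 := by simp [clTerm]
    rw [h0, zero_add]
    refine tsum_congr fun i => ?_
    rw [clTerm, clTerm, clTerm, mersProd_succ]
    have h1 := (mersProd_pos i).ne'
    have h2 := (two_pow_sub_one_pos i).ne'
    have e1 : (2 : ℝ) ^ ((r + 1) * (i + 1)) = 2 ^ (r * (i + 1)) * 2 ^ (i + 1) := by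
      rw [← pow_add]; ring_nf
    have e2 : (2 : ℝ) ^ (r * (i + 1)) * 2 ^ (i + 1) = 2 ^ ((r + 1) * i) * 2 ^ (r + 1) := by
      rw [← pow_add, ← pow_add]; ring_nf
    have e3 : ((2 : ℝ) ^ (r * (i + 1)))⁻¹ = (2 ^ ((r + 1) * i) * 2 ^ (r + 1))⁻¹ * 2 ^ (i + 1) := by
      rw [← e2]; field_simp
    rw [e1, e2, e3, pow_succ (-1 : ℝ)]
    field_simp
    ring
  rw [(summable_clTerm r).tsum_sub (summable_clTerm (r + 1))] at h
  linarith

lemma tendsto_tsum_clTerm : Tendsto (fun r => ∑' i, clTerm r i) atTop (𝓝 1) := by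
  have hb : ∀ r i, clTerm r (i + 1) = (2⁻¹ : ℝ) ^ r * (clTerm r (i + 1) * 2 ^ r) := fun r i => by
    rw [inv_pow]; field_simp
  have h : ∀ r, |∑' i, clTerm r i - 1| ≤ (2⁻¹ : ℝ) ^ r * 4 := by
    intro r
    rw [(summable_clTerm r).tsum_eq_zero_add]
    have h0 : clTerm r 0 = 1 := by simp [clTerm, mersProd]
    rw [h0, add_sub_cancel_left]
    have hle : ∀ i, ‖clTerm r (i + 1)‖ ≤ (2⁻¹ : ℝ) ^ r * 2 * (2⁻¹ : ℝ) ^ i := by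
      intro i
      refine (abs_clTerm_le r (i + 1)).trans ?_
      rw [inv_pow, inv_pow, mul_comm _ (2 : ℝ), mul_assoc]
      refine mul_le_mul_of_nonneg_left ?_ (by norm_num)
      rw [← mul_inv, ← pow_add]
      refine inv_anti₀ (by positivity) (pow_le_pow_right₀ (by norm_num) ?_)
      nlinarith
    have hs : Summable fun i : ℕ => (2⁻¹ : ℝ) ^ r * 2 * (2⁻¹ : ℝ) ^ i :=
      (summable_geometric_of_lt_one (by norm_num) (by norm_num)).mul_left _
    refine (tsum_of_norm_bounded hs.hasSum hle).trans (le_of_eq ?_)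
    rw [tsum_mul_left, tsum_geometric_of_lt_one (by norm_num) (by norm_num)]
    norm_num
    ring
  rw [tendsto_iff_norm_sub_tendsto_zero]
  refine squeeze_zero (fun _ => norm_nonneg _) h ?_
  rw [← zero_mul (4 : ℝ)]
  exact (tendsto_pow_atTop_nhds_zero_of_lt_one (by norm_num) (by norm_num)).mul_const 4

lemma tsum_clTerm_eq (r : ℕ) :
    ∑' i, clTerm r i = ∏' i : ℕ, (1 - ((2 : ℝ) ^ (r + 1 + i))⁻¹) := by
  have hm : Multipliable fun i : ℕ => (1 - ((2 : ℝ) ^ (r + 1 + i))⁻¹) := by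
    simp_rw [sub_eq_add_neg]
    refine multipliable_one_add_of_summable ?_
    have : Summable fun i : ℕ => ((2 : ℝ) ^ (r + 1))⁻¹ * (2⁻¹ : ℝ) ^ i :=
      (summable_geometric_of_lt_one (by norm_num) (by norm_num)).mul_left _
    refine this.congr fun i => ?_
    rw [norm_neg, Real.norm_of_nonneg (by positivity), pow_add 2 (r + 1) i, mul_inv, inv_pow]
  have h1 := hm.tendsto_prod_tprod_nat
  have h2 : ∀ N, ∑' i, clTerm r i = (∏ i ∈ Finset.range N, (1 - ((2 : ℝ) ^ (r + 1 + i))⁻¹)) *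
      ∑' i, clTerm (r + N) i := by
    intro N
    induction N with
    | zero => simp
    | succ N ih =>
      rw [ih, tsum_clTerm_rec (r + N), Finset.prod_range_succ, ← add_assoc r N 1,
        add_right_comm r 1 N]
      ring
  have h3 : Tendsto (fun N => ∑' i, clTerm (r + N) i) atTop (𝓝 1) :=
    tendsto_tsum_clTerm.comp (tendsto_add_atTop_nat r |>.congr fun n => add_comm n r)
  have h4 := h1.mul h3
  rw [mul_one] at h4
  exact tendsto_nhds_unique (tendsto_const_nhds.congr h2) h4

lemma card_GL_two (r : ℕ) : (Nat.card (GL (Fin r) (ZMod 2)) : ℝ) = injPoly r (2 ^ r) := by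
  haveI : Fact (Nat.Prime 2) := ⟨Nat.prime_two⟩
  have h := Matrix.card_GL_field (𝔽 := ZMod 2) r
  rw [h, ZMod.card, injPoly, Finset.prod_range, Nat.cast_prod]
  refine Finset.prod_congr rfl fun i _ => ?_
  rw [Nat.cast_sub (Nat.pow_le_pow_right (by norm_num) i.2.le)]
  push_cast; rfl

/-- Convergence of the moments `E ∏_{i < j} (2 ^ rk - 2 ^ i)` to `1` forces the rank to follow
the Cohen–Lenstra distribution. -/
lemma tendsto_of_moments {ι : Type*} (l : Filter ℕ) (S : ℕ → Finset ι) (rk : ι → ℕ) (c : ℕ → ℝ)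
    (hc : ∀ d, 0 ≤ c d)
    (h : ∀ j, Tendsto (fun d => c d * ∑ f ∈ S d, injPoly j (2 ^ rk f)) l (𝓝 1)) (r : ℕ) :
    Tendsto (fun d => c d * ∑ f ∈ S d, if rk f = r then (1 : ℝ) else 0) l
      (𝓝 ((Nat.card (GL (Fin r) (ZMod 2)) : ℝ)⁻¹ * ∏' i : ℕ, (1 - ((2 : ℝ) ^ (r + 1 + i))⁻¹))) := by
  rw [card_GL_two, ← tsum_clTerm_eq]
  set g := injPoly r (2 ^ r) with hg
  have hg0 : 0 < g := injPoly_pos le_rfl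
  set p : ℕ → ℝ := fun d => c d * ∑ f ∈ S d, if rk f = r then (1 : ℝ) else 0 with hp
  have hpart := (summable_clTerm r).hasSum.tendsto_sum_nat
  have hB : ∀ t d, 0 ≤ (-1) ^ t * (∑ i ∈ Finset.range (t + 1),
      clTerm r i * (c d * ∑ f ∈ S d, injPoly (r + i) (2 ^ rk f)) - g * p d) := by
    intro t d
    have h1 : 0 ≤ c d * ∑ f ∈ S d, (-1) ^ t * (∑ i ∈ Finset.range (t + 1),
        (-1) ^ i * ((2 : ℝ) ^ (r * i))⁻¹ / mersProd i * injPoly (r + i) (2 ^ rk f)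
      - injPoly r (2 ^ r) * if rk f = r then 1 else 0) :=
      mul_nonneg (hc d) (Finset.sum_nonneg fun f _ => bonferroni r t (rk f))
    refine h1.trans (le_of_eq ?_)
    rw [← Finset.mul_sum, mul_left_comm, Finset.sum_sub_distrib, Finset.sum_comm,
      ← Finset.mul_sum, mul_sub, Finset.mul_sum]
    congr 1
    rw [hp, hg]
    congr 1
    · refine Finset.sum_congr rfl fun i _ => ?_
      rw [← Finset.mul_sum, clTerm]; ring
    · ring
  have hT : ∀ t, Tendsto (fun d => ∑ i ∈ Finset.range (t + 1),
      clTerm r i * (c d * ∑ f ∈ S d, injPoly (r + i) (2 ^ rk f))) l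
      (𝓝 (∑ i ∈ Finset.range (t + 1), clTerm r i)) := by
    intro t
    refine tendsto_finsetSum _ fun i _ => ?_
    simpa using (h (r + i)).const_mul (clTerm r i)
  suffices hs : Tendsto (fun d => g * p d) l (𝓝 (∑' i, clTerm r i)) by
    refine (hs.const_mul g⁻¹).congr fun d => ?_
    rw [← mul_assoc, inv_mul_cancel₀ hg0.ne', one_mul]
  rw [tendsto_order]
  have hpart' := (tendsto_order.1 ((tendsto_add_atTop_iff_nat 1).2 hpart))
  constructor
  · intro a ha
    obtain ⟨N, hN⟩ := eventually_atTop.1 (hpart'.1 a ha)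
    have h1 := hN (2 * N + 1) (by omega)
    filter_upwards [(tendsto_order.1 (hT (2 * N + 1))).1 a h1] with d hd
    have h2 := hB (2 * N + 1) d
    rw [pow_succ, pow_mul] at h2
    norm_num at h2
    linarith
  · intro a ha
    obtain ⟨N, hN⟩ := eventually_atTop.1 (hpart'.2 a ha)
    have h1 := hN (2 * N) (by omega)
    filter_upwards [(tendsto_order.1 (hT (2 * N))).2 a h1] with d hd
    have h2 := hB (2 * N) d
    rw [pow_mul] at h2
    norm_num at h2
    linarith

end Moments

section HyperellipticRing

variable {F : Type} [Field F]

/-- The element `a + b Y` of the hyperelliptic ring. -/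
noncomputable def el (f a b : F[X]) : hyperellipticRing f :=
  AdjoinRoot.of _ a + AdjoinRoot.of _ b * AdjoinRoot.root _

variable {f : F[X]}

lemma hyper_root_sq : (AdjoinRoot.root ((X : (F[X])[X]) ^ 2 - Polynomial.C f)) ^ 2
    = AdjoinRoot.of _ f := by
  have h := AdjoinRoot.eval₂_root ((X : (F[X])[X]) ^ 2 - Polynomial.C f)
  rw [eval₂_sub, eval₂_pow, eval₂_X, eval₂_C] at h
  exact sub_eq_zero.1 h

lemma hyper_monic : ((X : (F[X])[X]) ^ 2 - Polynomial.C f).Monic :=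
  monic_X_pow_sub_C f (by norm_num)

lemma el_surj (z : hyperellipticRing f) : ∃ a b, z = el f a b := by
  obtain ⟨p, rfl⟩ := AdjoinRoot.mk_surjective z
  have h1 := modByMonic_add_div p ((X : (F[X])[X]) ^ 2 - Polynomial.C f)
  have h2 : (p %ₘ ((X : (F[X])[X]) ^ 2 - Polynomial.C f)).natDegree < 2 := by
    have := natDegree_modByMonic_lt p (hyper_monic (f := f)) (by
      intro h
      have := congrArg natDegree h
      rw [natDegree_X_pow_sub_C, natDegree_one] at this
      omega)
    rwa [natDegree_X_pow_sub_C] at this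
  obtain ⟨b, a, hab⟩ := exists_eq_X_add_C_of_natDegree_le_one (Nat.lt_succ_iff.1 h2)
  refine ⟨a, b, ?_⟩
  rw [← h1, map_add, map_mul, AdjoinRoot.mk_self, zero_mul, add_zero, hab, map_add, map_mul,
    AdjoinRoot.mk_C, AdjoinRoot.mk_C, AdjoinRoot.mk_X, el, add_comm]

lemma el_eq_zero {a b : F[X]} (h : el f a b = 0) : a = 0 ∧ b = 0 := by
  have h1 : AdjoinRoot.mk ((X : (F[X])[X]) ^ 2 - Polynomial.C f) (C b * X + C a) = 0 := by
    rw [map_add, map_mul, AdjoinRoot.mk_C, AdjoinRoot.mk_C, AdjoinRoot.mk_X, add_comm]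
    exact h
  rw [AdjoinRoot.mk_eq_zero] at h1
  have h2 : C b * X + C a = 0 := by
    refine eq_zero_of_dvd_of_degree_lt h1 ?_
    rw [degree_X_pow_sub_C (by norm_num)]
    exact (degree_linear_le).trans_lt (by norm_num)
  constructor
  · simpa using congrArg (fun p => coeff p 0) h2
  · simpa using congrArg (fun p => coeff p 1) h2

lemma el_add (a b c d : F[X]) : el f a b + el f c d = el f (a + c) (b + d) := by
  simp only [el, map_add]; ring

lemma el_sub (a b c d : F[X]) : el f a b - el f c d = el f (a - c) (b - d) := by
  simp only [el, map_sub]; ring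

lemma el_mul (a b c d : F[X]) :
    el f a b * el f c d = el f (a * c + f * (b * d)) (a * d + b * c) := by
  simp only [el, map_add, map_mul, ← hyper_root_sq]; ring

lemma el_inj {a b c d : F[X]} : el f a b = el f c d ↔ a = c ∧ b = d := by
  constructor
  · intro h
    rw [← sub_eq_zero, el_sub] at h
    have := el_eq_zero h
    exact ⟨sub_eq_zero.1 this.1, sub_eq_zero.1 this.2⟩
  · rintro ⟨rfl, rfl⟩; rfl

lemma el_zero : el f 0 0 = 0 := by simp [el]

lemma el_one : el f 1 0 = 1 := by simp [el]

lemma el_eq_zero_iff {a b : F[X]} : el f a b = 0 ↔ a = 0 ∧ b = 0 := by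
  rw [← el_zero, el_inj]

lemma degree_ne_of_odd (hodd : Odd f.natDegree) {a b : F[X]} (h : a ^ 2 = f * b ^ 2) :
    a = 0 ∧ b = 0 := by
  have hf : f ≠ 0 := by rintro rfl; simp at hodd
  by_cases hb : b = 0
  · subst hb; simpa using h
  · exfalso
    have h1 := congrArg natDegree h
    rw [natDegree_pow, natDegree_mul hf (pow_ne_zero 2 hb), natDegree_pow] at h1
    obtain ⟨k, hk⟩ := hodd
    omega

lemma hyper_isDomain (hodd : Odd f.natDegree) : IsDomain (hyperellipticRing f) := by
  have hnt : Nontrivial (hyperellipticRing f) := ⟨⟨0, 1, fun h => by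
    rw [← el_zero, ← el_one, el_inj] at h
    exact zero_ne_one h.1⟩⟩
  have : NoZeroDivisors (hyperellipticRing f) := ⟨by
    intro z w h
    obtain ⟨a, b, rfl⟩ := el_surj z
    obtain ⟨c, d, rfl⟩ := el_surj w
    have h1 : (el f a (-b) * el f a b) * (el f c (-d) * el f c d) = 0 := by
      rw [mul_mul_mul_comm, h, mul_zero]
    rw [el_mul, el_mul, el_mul, el_eq_zero_iff] at h1
    have h2 : (a ^ 2 - f * b ^ 2) * (c ^ 2 - f * d ^ 2) = 0 := by
      rw [← h1.1]; ring
    rcases mul_eq_zero.1 h2 with h3 | h3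
    · left; rw [el_eq_zero_iff]; exact degree_ne_of_odd hodd (sub_eq_zero.1 h3)
    · right; rw [el_eq_zero_iff]; exact degree_ne_of_odd hodd (sub_eq_zero.1 h3)⟩
  exact NoZeroDivisors.to_isDomain _

/-- The hyperelliptic involution `Y ↦ -Y`. -/
noncomputable def hyperConj (f : F[X]) : hyperellipticRing f →+* hyperellipticRing f :=
  AdjoinRoot.lift (AdjoinRoot.of _) (-AdjoinRoot.root _) (by
    rw [eval₂_sub, eval₂_pow, eval₂_X, eval₂_C, neg_sq, hyper_root_sq, sub_self])

lemma hyperConj_el (a b : F[X]) : hyperConj f (el f a b) = el f a (-b) := by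
  simp [hyperConj, el]

lemma hyperConj_hyperConj (z : hyperellipticRing f) : hyperConj f (hyperConj f z) = z := by
  obtain ⟨a, b, rfl⟩ := el_surj z
  rw [hyperConj_el, hyperConj_el, neg_neg]

lemma mem_map_conj {I : Ideal (hyperellipticRing f)} {z : hyperellipticRing f} :
    z ∈ I.map (hyperConj f) ↔ hyperConj f z ∈ I := by
  have hs : Function.Surjective (hyperConj f) := fun z => ⟨_, hyperConj_hyperConj z⟩
  rw [Ideal.mem_map_iff_of_surjective _ hs]
  constructor
  · rintro ⟨w, hw, rfl⟩; rwa [hyperConj_hyperConj]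
  · intro h; exact ⟨_, h, hyperConj_hyperConj z⟩

lemma map_conj_map_conj (I : Ideal (hyperellipticRing f)) :
    (I.map (hyperConj f)).map (hyperConj f) = I := by
  ext z; rw [mem_map_conj, mem_map_conj, hyperConj_hyperConj]

lemma map_conj_span_singleton (z : hyperellipticRing f) :
    (Ideal.span {z}).map (hyperConj f) = Ideal.span {hyperConj f z} := by
  rw [Ideal.map_span, Set.image_singleton]

/-- Every nonzero ideal is of the form `e (a, b + Y)` with `a ∣ b² - f`. -/
lemma exists_ideal_form {I : Ideal (hyperellipticRing f)} (hI : I ≠ ⊥)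
    (hodd : Odd f.natDegree) :
    ∃ e a b c : F[X], e ≠ 0 ∧ a.Monic ∧ b ^ 2 - f = a * c ∧
      ∀ u v, el f u v ∈ I ↔ ∃ s t, u = e * (a * s + b * t) ∧ v = e * t := by
  have := hyper_isDomain hodd
  have hmul : ∀ (r : F[X]) (u v : F[X]), el f u v ∈ I → el f (r * u) (r * v) ∈ I := by
    intro r u v h
    have := I.mul_mem_left (el f r 0) h
    rw [el_mul] at this
    simpa using this
  have hY : ∀ (u v : F[X]), el f u v ∈ I → el f (f * v) u ∈ I := by
    intro u v h
    have := I.mul_mem_left (el f 0 1) h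
    rw [el_mul] at this
    simpa using this
  -- second coordinates
  let B : Ideal F[X] :=
    { carrier := {v | ∃ u, el f u v ∈ I}
      zero_mem' := ⟨0, by rw [el_zero]; exact I.zero_mem⟩
      add_mem' := by
        rintro v w ⟨u, hu⟩ ⟨u', hu'⟩
        exact ⟨u + u', by rw [← el_add]; exact I.add_mem hu hu'⟩
      smul_mem' := by
        rintro r v ⟨u, hu⟩
        exact ⟨r * u, hmul r u v hu⟩ }
  let A : Ideal F[X] :=
    { carrier := {u | el f u 0 ∈ I}
      zero_mem' := by rw [Set.mem_ofPred_eq, el_zero]; exact I.zero_mem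
      add_mem' := by
        intro v w hv hw
        have := I.add_mem hv hw
        rwa [el_add, add_zero] at this
      smul_mem' := by
        intro r v hv
        have := hmul r v 0 hv
        rwa [mul_zero] at this }
  have hA : ∀ u, u ∈ A ↔ el f u 0 ∈ I := fun u => Iff.rfl
  have hB : ∀ v, v ∈ B ↔ ∃ u, el f u v ∈ I := fun v => Iff.rfl
  obtain ⟨z, hz, hz0⟩ := Submodule.exists_mem_ne_zero_of_ne_bot hI
  have hA0 : ∃ m ∈ A, m ≠ 0 := by
    obtain ⟨u, v, rfl⟩ := el_surj z
    refine ⟨u ^ 2 - f * v ^ 2, ?_, ?_⟩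
    · rw [hA]
      have := I.mul_mem_left (el f u (-v)) hz
      rw [el_mul] at this
      convert this using 2 <;> ring
    · intro h
      rw [Ne, el_eq_zero_iff] at hz0
      exact hz0 (degree_ne_of_odd hodd (sub_eq_zero.1 h))
  obtain ⟨m, hmA, hm0⟩ := hA0
  set e := Submodule.IsPrincipal.generator B with he
  have heB : ∀ v, v ∈ B ↔ e ∣ v := fun v => Submodule.IsPrincipal.mem_iff_generator_dvd B
  have hAB : ∀ u, u ∈ A → e ∣ u := fun u hu => by
    rw [← heB, hB]
    refine ⟨0, ?_⟩
    have := hY u 0 ((hA u).1 hu)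
    rwa [mul_zero] at this
  have he0 : e ≠ 0 := by
    rintro h
    have := hAB m hmA
    rw [h, zero_dvd_iff] at this
    exact hm0 this
  set α := Submodule.IsPrincipal.generator A with hα
  have hαA : ∀ v, v ∈ A ↔ α ∣ v := fun v => Submodule.IsPrincipal.mem_iff_generator_dvd A
  have hα0 : α ≠ 0 := by
    rintro h
    rw [hαA, h, zero_dvd_iff] at hmA
    exact hm0 hmA
  obtain ⟨a', ha'⟩ := hAB α ((hαA α).2 dvd_rfl)
  obtain ⟨c0, hc0⟩ := (hB e).1 ((heB e).2 dvd_rfl)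
  obtain ⟨b, hb⟩ : e ∣ c0 := by
    rw [← heB, hB]
    exact ⟨_, hY _ _ hc0⟩
  have ha'0 : a' ≠ 0 := by rintro rfl; rw [mul_zero] at ha'; exact hα0 ha'
  set a := a' * C a'.leadingCoeff⁻¹ with ha
  have hass : Associated a' a :=
    associated_mul_unit_right a' _ (isUnit_C.2 (inv_ne_zero (leadingCoeff_ne_zero.2 ha'0)).isUnit)
  have haa : ∀ x, e * a ∣ x ↔ α ∣ x := fun x => by
    rw [ha']
    exact (Associated.mul_left e hass.symm).dvd_iff_dvd_left
  have hdvd : a ∣ b ^ 2 - f := by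
    have h1 := I.mul_mem_left (el f b (-1)) hc0
    rw [el_mul, hb] at h1
    have h2 : e * (b ^ 2 - f) ∈ A := by
      rw [hA]
      convert h1 using 2 <;> ring
    rw [hαA, ← haa] at h2
    exact (mul_dvd_mul_iff_left he0).1 h2
  obtain ⟨c, hc⟩ := hdvd
  refine ⟨e, a, b, c, he0, monic_mul_leadingCoeff_inv ha'0, hc, fun u v => ⟨fun h => ?_, ?_⟩⟩
  · obtain ⟨t, ht⟩ := (heB v).1 ((hB v).2 ⟨u, h⟩)
    have h1 : el f (u - t * c0) 0 ∈ I := by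
      have := I.sub_mem h (hmul t _ _ hc0)
      rw [el_sub] at this
      convert this using 2
      rw [ht]; ring
    rw [← hA, hαA, ← haa] at h1
    obtain ⟨s, hs⟩ := h1
    refine ⟨s, t, ?_, ht⟩
    have : u = e * a * s + t * c0 := by rw [← hs]; ring
    rw [this, hb]; ring
  · rintro ⟨s, t, rfl, rfl⟩
    have h1 : el f (e * a * s) 0 ∈ I := by
      rw [← hA, hαA, ← haa]; exact dvd_mul_right _ _
    have h2 := I.add_mem h1 (hmul t _ _ hc0)
    rw [el_add] at h2
    convert h2 using 2
    · rw [hb]; ring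
    · ring

end HyperellipticRing

section Dedekind

variable {F : Type} [Field F] {f : F[X]}

/-- The polynomials `a`, `2 * b`, `c` with `b² - f = ac` generate the unit ideal when `f` is
squarefree. -/
lemma exists_bezout_of_squarefree (h2 : (2 : F) ≠ 0) (hs : Squarefree f) {a b c : F[X]}
    (h : b ^ 2 - f = a * c) : ∃ x y z : F[X], a * x + b * y + c * z = 1 := by
  by_contra hcon
  have hne : Ideal.span {a, b, c} ≠ ⊤ := by
    intro htop
    apply hcon
    have h1 : (1 : F[X]) ∈ Ideal.span {a, b, c} := by rw [htop]; trivial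
    rw [Ideal.mem_span_insert] at h1
    obtain ⟨x, w, hw, h1⟩ := h1
    rw [Ideal.mem_span_pair] at hw
    obtain ⟨y, z, rfl⟩ := hw
    exact ⟨x, y, z, by rw [h1]; ring⟩
  obtain ⟨p, hp⟩ := (Submodule.IsPrincipal.principal (Ideal.span {a, b, c}))
  have hpd : ∀ x ∈ ({a, b, c} : Set F[X]), p ∣ x := by
    intro x hx
    have : x ∈ Ideal.span {a, b, c} := Ideal.subset_span hx
    rw [hp] at this
    exact Ideal.mem_span_singleton.1 this
  have ha := hpd a (by simp)
  have hb := hpd b (by simp)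
  have hc := hpd c (by simp)
  have : p * p ∣ f := by
    have h1 : f = b ^ 2 - a * c := by rw [← h]; ring
    rw [h1, sq]
    exact dvd_sub (mul_dvd_mul hb hb) (mul_dvd_mul ha hc)
  have hu := hs p this
  apply hne
  rw [hp]
  exact Ideal.span_singleton_eq_top.2 hu

lemma mul_map_conj_eq (h2 : (2 : F) ≠ 0) (hs : Squarefree f) (hodd : Odd f.natDegree)
    {I : Ideal (hyperellipticRing f)} (hI : I ≠ ⊥) :
    ∃ n : F[X], n ≠ 0 ∧ I * I.map (hyperConj f) = Ideal.span {el f n 0} := by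
  obtain ⟨e, a, b, c, he, ha, hc, hmem⟩ := exists_ideal_form hI hodd
  refine ⟨e ^ 2 * a, mul_ne_zero (pow_ne_zero 2 he) ha.ne_zero, le_antisymm ?_ ?_⟩
  · rw [Ideal.mul_le]
    intro z hz w hw
    rw [mem_map_conj] at hw
    obtain ⟨u, v, rfl⟩ := el_surj z
    obtain ⟨u', v', rfl⟩ := el_surj w
    rw [hyperConj_el] at hw
    obtain ⟨s, t, rfl, rfl⟩ := (hmem _ _).1 hz
    obtain ⟨s', t', rfl, h'⟩ := (hmem _ _).1 hw
    obtain rfl : v' = -(e * t') := by rw [← h', neg_neg]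
    rw [Ideal.mem_span_singleton]
    refine ⟨el f (a * s * s' + b * s * t' + b * t * s' + c * t * t') (t * s' - s * t'), ?_⟩
    rw [el_mul, el_mul, el_inj]
    have h1 : f = b ^ 2 - a * c := by rw [← hc]; ring
    constructor
    · linear_combination (e ^ 2 * t * t') * (-h1)
    · ring
  · rw [Ideal.span_singleton_le_iff_mem]
    have h2' : (2 : F[X]) * C (2⁻¹ : F) = 1 := by
      rw [show (2 : F[X]) = C (2 : F) from rfl, ← C_mul, mul_inv_cancel₀ h2, C_1]
    obtain ⟨x, y, z, hxyz⟩ := exists_bezout_of_squarefree h2 hs hc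
    have m1 : el f (e * a) 0 ∈ I := (hmem _ _).2 ⟨1, 0, by ring, by ring⟩
    have m2 : el f (e * b) e ∈ I := (hmem _ _).2 ⟨0, 1, by ring, by ring⟩
    have n1 : el f (e * a) 0 ∈ I.map (hyperConj f) := by
      rw [mem_map_conj, hyperConj_el, neg_zero]; exact m1
    have n2 : el f (e * b) (-e) ∈ I.map (hyperConj f) := by
      rw [mem_map_conj, hyperConj_el, neg_neg]; exact m2
    have k1 := Ideal.mul_mem_left _ (el f x 0) (Ideal.mul_mem_mul m1 n1)
    have k2 := Ideal.mul_mem_left _ (el f (y * C (2⁻¹ : F)) 0)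
      (Ideal.add_mem _ (Ideal.mul_mem_mul m1 n2) (Ideal.mul_mem_mul m2 n1))
    have k3 := Ideal.mul_mem_left _ (el f z 0) (Ideal.mul_mem_mul m2 n2)
    have k := Ideal.add_mem _ (Ideal.add_mem _ k1 k2) k3
    convert k using 1
    simp only [el_mul, el_add]
    rw [el_inj]
    have h1 : f = b ^ 2 - a * c := by rw [← hc]; ring
    constructor
    · linear_combination (-e ^ 2 * a) * hxyz - (e ^ 2 * a * b * y) * h2' + e ^ 2 * z * h1
    · ring

lemma hyper_isDedekind (h2 : (2 : F) ≠ 0) (hs : Squarefree f) (hodd : Odd f.natDegree) :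
    letI := hyper_isDomain hodd
    IsDedekindDomain (hyperellipticRing f) := by
  letI := hyper_isDomain hodd
  rw [isDedekindDomain_iff_mul_inv_cancel (K := FractionRing (hyperellipticRing f))]
  intro I hI
  rw [FractionalIdeal.mul_inv_cancel_iff]
  obtain ⟨a, J, ha, rfl⟩ := FractionalIdeal.exists_eq_spanSingleton_mul I
  have hJ : J ≠ ⊥ := by
    rintro rfl
    apply hI
    simp
  obtain ⟨n, hn, hJn⟩ := mul_map_conj_eq h2 hs hodd hJ
  have hn' : el f n 0 ≠ 0 := by
    rw [Ne, el_eq_zero_iff]; exact fun h => hn h.1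
  set K := FractionRing (hyperellipticRing f)
  have hnK : algebraMap _ K (el f n 0) ≠ 0 := by
    rwa [Ne, IsFractionRing.to_map_eq_zero_iff]
  have haK : algebraMap _ K a ≠ 0 := by
    rwa [Ne, IsFractionRing.to_map_eq_zero_iff]
  refine ⟨FractionalIdeal.spanSingleton _ (algebraMap _ K a * (algebraMap _ K (el f n 0))⁻¹) *
    ((J.map (hyperConj f) : Ideal (hyperellipticRing f)) :
      FractionalIdeal (nonZeroDivisors (hyperellipticRing f)) K), ?_⟩
  rw [mul_mul_mul_comm, ← FractionalIdeal.coeIdeal_mul, hJn,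
    FractionalIdeal.spanSingleton_mul_spanSingleton, FractionalIdeal.coeIdeal_span_singleton,
    FractionalIdeal.spanSingleton_mul_spanSingleton]
  rw [← mul_assoc, inv_mul_cancel₀ haK, one_mul, inv_mul_cancel₀ hnK,
    FractionalIdeal.spanSingleton_one]

end Dedekind

section Ambiguous

variable {F : Type} [Field F] {f : F[X]}

/-- The ideal `(D, Y)`. -/
noncomputable def ramIdeal (f D : F[X]) : Ideal (hyperellipticRing f) :=
  Ideal.span {el f D 0, el f 0 1}

lemma mem_ramIdeal {D : F[X]} (hD : D ∣ f) {u v : F[X]} : el f u v ∈ ramIdeal f D ↔ D ∣ u := by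
  rw [ramIdeal, Ideal.mem_span_pair]
  constructor
  · rintro ⟨z, w, h⟩
    obtain ⟨a, b, rfl⟩ := el_surj z
    obtain ⟨c, d, rfl⟩ := el_surj w
    rw [el_mul, el_mul, el_add, el_inj] at h
    rw [← h.1]
    refine dvd_add (dvd_add (dvd_mul_left _ _) ?_) (dvd_add ?_ ?_)
    · simp
    · simp
    · exact Dvd.dvd.mul_right hD _
  · rintro ⟨s, rfl⟩
    refine ⟨el f s 0, el f v 0, ?_⟩
    rw [el_mul, el_mul, el_add, el_inj]
    constructor <;> ring

lemma ramIdeal_ne_bot {D : F[X]} : ramIdeal f D ≠ ⊥ := by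
  intro h
  have h1 : el f 0 1 ∈ ramIdeal f D := Ideal.subset_span (by simp)
  rw [h, Ideal.mem_bot, el_eq_zero_iff] at h1
  exact one_ne_zero h1.2

lemma ramIdeal_mul_self (hs : Squarefree f) {D E : F[X]} (h : f = D * E) :
    ramIdeal f D * ramIdeal f D = Ideal.span {el f D 0} := by
  have hDE : IsCoprime D E := by
    rw [h] at hs
    exact (IsRelPrime.isCoprime (squarefree_mul_iff.1 hs).1)
  have hDf : D ∣ f := ⟨E, h⟩
  refine le_antisymm ?_ ?_
  · rw [Ideal.mul_le]
    intro z hz w hw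
    obtain ⟨a, b, rfl⟩ := el_surj z
    obtain ⟨a', b', rfl⟩ := el_surj w
    obtain ⟨s, rfl⟩ := (mem_ramIdeal hDf).1 hz
    obtain ⟨t, rfl⟩ := (mem_ramIdeal hDf).1 hw
    rw [Ideal.mem_span_singleton]
    refine ⟨el f (D * s * t + E * b * b') (s * b' + b * t), ?_⟩
    rw [el_mul, el_mul, el_inj]
    constructor
    · linear_combination (b * b') * h
    · ring
  · rw [Ideal.span_singleton_le_iff_mem]
    obtain ⟨x, y, hxy⟩ := hDE
    have m1 : el f D 0 ∈ ramIdeal f D := (mem_ramIdeal hDf).2 dvd_rfl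
    have m2 : el f 0 1 ∈ ramIdeal f D := (mem_ramIdeal hDf).2 (dvd_zero _)
    have k := Ideal.add_mem _ (Ideal.mul_mem_left _ (el f x 0) (Ideal.mul_mem_mul m1 m1))
      (Ideal.mul_mem_left _ (el f y 0) (Ideal.mul_mem_mul m2 m2))
    convert k using 1
    simp only [el_mul, el_add]
    rw [el_inj]
    constructor
    · linear_combination (-D) * hxy - y * h
    · ring

lemma ramIdeal_mul_compl (hs : Squarefree f) {D E : F[X]} (h : f = D * E) :
    ramIdeal f D * ramIdeal f E = Ideal.span {el f 0 1} := by
  have hDE : IsCoprime D E := by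
    rw [h] at hs
    exact (IsRelPrime.isCoprime (squarefree_mul_iff.1 hs).1)
  have hDf : D ∣ f := ⟨E, h⟩
  have hEf : E ∣ f := ⟨D, by rw [h, mul_comm]⟩
  refine le_antisymm ?_ ?_
  · rw [Ideal.mul_le]
    intro z hz w hw
    obtain ⟨a, b, rfl⟩ := el_surj z
    obtain ⟨a', b', rfl⟩ := el_surj w
    obtain ⟨s, rfl⟩ := (mem_ramIdeal hDf).1 hz
    obtain ⟨t, rfl⟩ := (mem_ramIdeal hEf).1 hw
    rw [Ideal.mem_span_singleton]
    refine ⟨el f (D * s * b' + b * (E * t)) (s * t + b * b'), ?_⟩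
    rw [el_mul, el_mul, el_inj]
    constructor
    · linear_combination (-s * t) * h
    · ring
  · rw [Ideal.span_singleton_le_iff_mem]
    obtain ⟨x, y, hxy⟩ := hDE
    have m1 : el f D 0 ∈ ramIdeal f D := (mem_ramIdeal hDf).2 dvd_rfl
    have m2 : el f 0 1 ∈ ramIdeal f D := (mem_ramIdeal hDf).2 (dvd_zero _)
    have n1 : el f E 0 ∈ ramIdeal f E := (mem_ramIdeal hEf).2 dvd_rfl
    have n2 : el f 0 1 ∈ ramIdeal f E := (mem_ramIdeal hEf).2 (dvd_zero _)
    have k := Ideal.add_mem _ (Ideal.mul_mem_left _ (el f x 0) (Ideal.mul_mem_mul m1 n2))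
      (Ideal.mul_mem_left _ (el f y 0) (Ideal.mul_mem_mul m2 n1))
    convert k using 1
    simp only [el_mul, el_add]
    rw [el_inj]
    constructor
    · ring
    · linear_combination (-1 : F[X]) * hxy

lemma natDegree_norm_even (hodd : Odd f.natDegree) {a b : F[X]} (hb : b ≠ 0) :
    (a ^ 2).natDegree ≠ (f * b ^ 2).natDegree := by
  have hf : f ≠ 0 := by rintro rfl; simp at hodd
  rw [natDegree_pow, natDegree_mul hf (pow_ne_zero 2 hb), natDegree_pow]
  obtain ⟨k, hk⟩ := hodd
  omega

/-- If the norm of `a + bY` is a constant multiple of a square, then this constant is a square. -/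
lemma norm_eq_const_mul_sq (hodd : Odd f.natDegree) {a b n : F[X]} {c : F} (hc : c ≠ 0)
    (hn : n ≠ 0) (h : a ^ 2 - f * b ^ 2 = C c * n ^ 2) :
    ∃ k : F, k ≠ 0 ∧ c = k ^ 2 ∧ ((f * b ^ 2).natDegree < (a ^ 2).natDegree ∨ b = 0) := by
  have hcn : C c * n ^ 2 ≠ 0 := mul_ne_zero (C_ne_zero.2 hc) (pow_ne_zero 2 hn)
  have hlead : (C c * n ^ 2).leadingCoeff = c * n.leadingCoeff ^ 2 := by
    rw [leadingCoeff_mul, leadingCoeff_C, leadingCoeff_pow]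
  have hn' : n.leadingCoeff ≠ 0 := leadingCoeff_ne_zero.2 hn
  have key : (a ^ 2).leadingCoeff = c * n.leadingCoeff ^ 2 →
      ∃ k : F, k ≠ 0 ∧ c = k ^ 2 := by
    intro h1
    rw [leadingCoeff_pow] at h1
    have h3 : c = (a.leadingCoeff / n.leadingCoeff) ^ 2 := by
      rw [div_pow, eq_div_iff (pow_ne_zero 2 hn'), h1]
    refine ⟨a.leadingCoeff / n.leadingCoeff, ?_, h3⟩
    intro h4
    rw [h4] at h3
    exact hc (by rw [h3]; ring)
  by_cases hb : b = 0
  · subst hb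
    obtain ⟨k, hk, hk'⟩ := key (by rw [← hlead, ← h]; simp)
    exact ⟨k, hk, hk', Or.inr rfl⟩
  rcases lt_or_gt_of_ne (natDegree_norm_even (a := a) hodd hb) with h1 | h1
  · exfalso
    have h3 := congrArg natDegree h
    have hf : f ≠ 0 := by rintro rfl; simp at hodd
    rw [natDegree_sub_eq_right_of_natDegree_lt h1, natDegree_C_mul hc, natDegree_pow,
      natDegree_mul hf (pow_ne_zero 2 hb), natDegree_pow] at h3
    obtain ⟨k, hk⟩ := hodd
    omega
  · obtain ⟨k, hk, hk'⟩ := key (by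
      rw [← hlead, ← h, leadingCoeff_sub_of_degree_lt (degree_lt_degree h1)])
    exact ⟨k, hk, hk', Or.inl h1⟩

lemma hyper_unit (hodd : Odd f.natDegree) {z : hyperellipticRing f} (hz : IsUnit z) :
    ∃ c : F, c ≠ 0 ∧ z = el f (C c) 0 := by
  obtain ⟨w, hw⟩ := isUnit_iff_exists_inv.1 hz
  obtain ⟨a, b, rfl⟩ := el_surj z
  obtain ⟨a', b', rfl⟩ := el_surj w
  have h1 : (el f a (-b) * el f a b) * (el f a' (-b') * el f a' b') = 1 := by
    rw [mul_mul_mul_comm, hw, mul_one, ← hyperConj_el, ← hyperConj_el, ← map_mul, hw, map_one]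
  rw [el_mul, el_mul, el_mul, ← el_one, el_inj] at h1
  have h2 : (a ^ 2 - f * b ^ 2) * (a' ^ 2 - f * b' ^ 2) = 1 := by
    rw [← h1.1]; ring
  obtain ⟨c, hc, hcn⟩ := isUnit_iff.1 (IsUnit.of_mul_eq_one _ h2)
  have hdeg : (a ^ 2 - f * b ^ 2).natDegree = 0 := by rw [← hcn, natDegree_C]
  have hb : b = 0 := by
    by_contra hb
    have hf : f ≠ 0 := by rintro rfl; simp at hodd
    have h3 : 0 < (f * b ^ 2).natDegree := by
      rw [natDegree_mul hf (pow_ne_zero 2 hb)]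
      have := hodd.pos
      omega
    rcases lt_or_gt_of_ne (natDegree_norm_even (a := a) hodd hb) with h4 | h4
    · rw [natDegree_sub_eq_right_of_natDegree_lt h4] at hdeg
      omega
    · rw [natDegree_sub_eq_left_of_natDegree_lt h4] at hdeg
      omega
  subst hb
  have ha : a.natDegree = 0 := by
    have : (a ^ 2).natDegree = 0 := by simpa using hdeg
    rw [natDegree_pow] at this
    omega
  obtain ⟨x, rfl⟩ := natDegree_eq_zero.1 ha
  refine ⟨x, ?_, rfl⟩
  rintro rfl
  simp at h2

lemma span_eq_iff (hodd : Odd f.natDegree) {z w : hyperellipticRing f}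
    (h : Ideal.span {z} = Ideal.span {w}) : ∃ c : F, c ≠ 0 ∧ z = el f (C c) 0 * w := by
  have := hyper_isDomain hodd
  obtain ⟨u, hu⟩ := Ideal.span_singleton_eq_span_singleton.1 h
  obtain ⟨c, hc, hcu⟩ := hyper_unit hodd u⁻¹.isUnit
  refine ⟨c, hc, ?_⟩
  rw [← hcu, ← hu, mul_comm z, ← mul_assoc, Units.inv_mul, one_mul]

lemma eq_of_sq_mul_eq {D D' a n : F[X]} (hD : D.Monic) (hD' : D'.Monic) (hs : Squarefree D)
    (hs' : Squarefree D') {c : F} (hc : c ≠ 0) (hn : n ≠ 0)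
    (h : a ^ 2 * D = C c * n ^ 2 * D') : D = D' := by
  have hcu : IsUnit (C c) := isUnit_C.2 hc.isUnit
  have ha : a ≠ 0 := by
    rintro rfl
    rw [zero_pow two_ne_zero, zero_mul] at h
    exact mul_ne_zero (mul_ne_zero hcu.ne_zero (pow_ne_zero 2 hn)) hD'.ne_zero h.symm
  have h1 : a ^ 2 * (D * D') = C c * (n * D') ^ 2 := by
    rw [← mul_assoc, h]; ring
  have h2 : a ∣ n * D' := by
    have : a ^ 2 ∣ (n * D') ^ 2 := by
      rw [← hcu.dvd_mul_left, ← h1]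
      exact dvd_mul_right _ _
    exact (IsIntegrallyClosed.pow_dvd_pow_iff two_ne_zero).1 this
  obtain ⟨w, hw⟩ := h2
  have h3 : D * D' = C c * w ^ 2 := by
    apply mul_left_cancel₀ (pow_ne_zero 2 ha)
    rw [h1, hw]; ring
  have key : ∀ {A B : F[X]}, A.Monic → Squarefree A → A * B = C c * w ^ 2 → A ∣ B := by
    intro A B hA hsA hAB
    have h4 : A ∣ w := by
      rw [← hsA.dvd_pow_iff_dvd two_ne_zero, ← hcu.dvd_mul_left, ← hAB]
      exact dvd_mul_right _ _
    obtain ⟨x, rfl⟩ := h4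
    refine ⟨C c * x ^ 2, ?_⟩
    apply mul_left_cancel₀ hA.ne_zero
    rw [hAB]; ring
  exact eq_of_monic_of_associated hD hD'
    (associated_of_dvd_dvd (key hD hs h3) (key hD' hs' (by rw [mul_comm, h3])))

/-- The ideal classes of `(D, Y)` and `(D', Y)` agree only if `D' = D` or `D' = f / D`. -/
lemma ramIdeal_class_inj (h2 : (2 : F) ≠ 0) (hs : Squarefree f) (hodd : Odd f.natDegree)
    {D D' E : F[X]} (hD : D.Monic) (hE : E.Monic) (hD' : D'.Monic) (hDE : f = D * E) (hDf : D' ∣ f)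
    {α β : hyperellipticRing f} (hα : α ≠ 0) (hβ : β ≠ 0)
    (h : Ideal.span {α} * ramIdeal f D = Ideal.span {β} * ramIdeal f D') :
    D = D' ∨ E = D' := by
  have := hyper_isDomain hodd
  obtain ⟨E', hE'⟩ := hDf
  have h1 : Ideal.span {α * α * el f D 0} = Ideal.span {β * β * el f D' 0} := by
    simp only [← Ideal.span_singleton_mul_span_singleton, ← ramIdeal_mul_self hs hDE,
      ← ramIdeal_mul_self hs hE']
    rw [mul_mul_mul_comm, h, mul_mul_mul_comm]
  obtain ⟨c, hc, hc'⟩ := span_eq_iff hodd h1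
  obtain ⟨x, y, rfl⟩ := el_surj β
  obtain ⟨a, b, hab⟩ := el_surj (α * el f x (-y))
  set n := x ^ 2 - f * y ^ 2 with hn
  have hβn : el f x y * el f x (-y) = el f n 0 := by
    rw [el_mul, el_inj]; constructor <;> ring
  have hn0 : n ≠ 0 := by
    intro h
    rw [Ne, el_eq_zero_iff] at hβ
    exact hβ (degree_ne_of_odd hodd (sub_eq_zero.1 h))
  have h3 : el f a b * el f a b * el f D 0 = el f (C c) 0 * (el f n 0 * el f n 0 * el f D' 0) := by
    rw [← hab, ← hβn]
    linear_combination (el f x (-y)) ^ 2 * hc'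
  simp only [el_mul] at h3
  rw [el_inj] at h3
  obtain ⟨h4, h5⟩ := h3
  have h6 : (2 : F[X]) * (a * b * D) = 0 := by linear_combination h5
  have h2' : (2 : F[X]) ≠ 0 := by
    rw [show (2 : F[X]) = C (2 : F) from rfl]; exact C_ne_zero.2 h2
  have hsD : Squarefree D := hs.squarefree_of_dvd ⟨E, hDE⟩
  have hsE : Squarefree E := hs.squarefree_of_dvd ⟨D, by rw [hDE, mul_comm]⟩
  have hsD' : Squarefree D' := hs.squarefree_of_dvd ⟨E', hE'⟩
  rcases mul_eq_zero.1 ((mul_eq_zero.1 h6).resolve_left h2') with h7 | h7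
  · rcases mul_eq_zero.1 h7 with h8 | h8
    · right
      refine eq_of_sq_mul_eq (a := D * b) hE hD' hsE hsD' hc hn0 ?_
      subst h8
      linear_combination h4 - D * b ^ 2 * hDE
    · left
      refine eq_of_sq_mul_eq (a := a) hD hD' hsD hsD' hc hn0 ?_
      subst h8
      linear_combination h4
  · exact absurd h7 hD.ne_zero

/-- An ideal fixed by the hyperelliptic involution is a multiple of some `(D, Y)`. -/
lemma exists_ramIdeal_of_map_conj_eq (h2 : (2 : F) ≠ 0) (hodd : Odd f.natDegree)
    {K : Ideal (hyperellipticRing f)} (hK : K ≠ ⊥) (hconj : K.map (hyperConj f) = K) :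
    ∃ D e : F[X], D.Monic ∧ D ∣ f ∧ e ≠ 0 ∧ K = Ideal.span {el f e 0} * ramIdeal f D := by
  have h2' : (2 : F[X]) * C (2⁻¹ : F) = 1 := by
    rw [show (2 : F[X]) = C (2 : F) from rfl, ← C_mul, mul_inv_cancel₀ h2, C_1]
  obtain ⟨e, a, b, c, he, ha, hc, hmem⟩ := exists_ideal_form hK hodd
  have hab : a ∣ b := by
    have m2 : el f (e * b) e ∈ K := (hmem _ _).2 ⟨0, 1, by ring, by ring⟩
    rw [← hconj, mem_map_conj, hyperConj_el] at m2
    obtain ⟨s, t, h3, h4⟩ := (hmem _ _).1 m2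
    have ht : t = -1 := by
      apply mul_left_cancel₀ he; rw [← h4]; ring
    subst ht
    have h5 := mul_left_cancel₀ he h3
    refine ⟨C 2⁻¹ * s, ?_⟩
    linear_combination (-b) * h2' + C 2⁻¹ * h5
  obtain ⟨b', rfl⟩ := hab
  have haf : a ∣ f := ⟨a * b' ^ 2 - c, by linear_combination (-1 : F[X]) * hc⟩
  refine ⟨a, e, ha, haf, he, ?_⟩
  ext z
  obtain ⟨u, v, rfl⟩ := el_surj z
  rw [hmem, Ideal.mem_span_singleton_mul]
  constructor
  · rintro ⟨s, t, rfl, rfl⟩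
    refine ⟨el f (a * s + a * b' * t) t, ?_, ?_⟩
    · rw [mem_ramIdeal haf]
      exact ⟨s + b' * t, by ring⟩
    · rw [el_mul, el_inj]; constructor <;> ring
  · rintro ⟨w, hw, hz⟩
    obtain ⟨u', v', rfl⟩ := el_surj w
    obtain ⟨s, rfl⟩ := (mem_ramIdeal haf).1 hw
    rw [el_mul, el_inj] at hz
    refine ⟨s - b' * v', v', ?_, ?_⟩
    · rw [← hz.1]; ring
    · rw [← hz.2]; ring

lemma exists_map_conj_eq (h2 : (2 : F) ≠ 0) (hs : Squarefree f) (hodd : Odd f.natDegree)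
    {I : Ideal (hyperellipticRing f)} (hI : I ≠ ⊥)
    {α β : hyperellipticRing f} (hβ : β ≠ 0)
    (h : Ideal.span {α} * I = Ideal.span {β} * I.map (hyperConj f)) :
    ∃ δ : hyperellipticRing f, δ ≠ 0 ∧
      (Ideal.span {δ} * I).map (hyperConj f) = Ideal.span {δ} * I := by
  have := hyper_isDomain hodd
  have := hyper_isDedekind h2 hs hodd
  obtain ⟨x, y, rfl⟩ := el_surj β
  obtain ⟨a, b, hab⟩ := el_surj (α * el f x (-y))
  set n := x ^ 2 - f * y ^ 2 with hn
  have hβn : el f x y * el f x (-y) = el f n 0 := by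
    rw [el_mul, el_inj]; constructor <;> ring
  have hn0 : n ≠ 0 := by
    intro h
    rw [Ne, el_eq_zero_iff] at hβ
    exact hβ (degree_ne_of_odd hodd (sub_eq_zero.1 h))
  have hγ : Ideal.span {el f a b} * I = Ideal.span {el f n 0} * I.map (hyperConj f) := by
    rw [← hab, ← hβn, ← Ideal.span_singleton_mul_span_singleton,
      ← Ideal.span_singleton_mul_span_singleton, mul_right_comm, h, mul_right_comm]
  have hγ' : Ideal.span {el f a (-b)} * I.map (hyperConj f) = Ideal.span {el f n 0} * I := by
    have := congrArg (Ideal.map (hyperConj f)) hγ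
    rw [Ideal.map_mul, Ideal.map_mul, map_conj_map_conj, map_conj_span_singleton,
      map_conj_span_singleton, hyperConj_el, hyperConj_el, neg_zero] at this
    exact this
  have hnorm : Ideal.span {el f (a ^ 2 - f * b ^ 2) 0} = Ideal.span {el f (n ^ 2) 0} := by
    apply mul_right_cancel₀ hI
    have e1 : el f (a ^ 2 - f * b ^ 2) 0 = el f a b * el f a (-b) := by
      rw [el_mul, el_inj]; constructor <;> ring
    have e2 : el f (n ^ 2) 0 = el f n 0 * el f n 0 := by
      rw [el_mul, el_inj]; constructor <;> ring
    rw [e1, e2, ← Ideal.span_singleton_mul_span_singleton,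
      ← Ideal.span_singleton_mul_span_singleton, mul_right_comm, hγ, mul_right_comm, mul_assoc,
      hγ', mul_assoc]
  obtain ⟨c, hc, hc'⟩ := span_eq_iff hodd hnorm
  rw [el_mul, el_inj] at hc'
  have hc'' : a ^ 2 - f * b ^ 2 = C c * n ^ 2 := by rw [hc'.1]; ring
  obtain ⟨k, hk, hck, -⟩ := norm_eq_const_mul_sq hodd hc hn0 hc''
  have hkk : C k * C k⁻¹ = 1 := by rw [← C_mul, mul_inv_cancel₀ hk, C_1]
  -- rescaling so that the norm is exactly `n²`
  set a' := C k⁻¹ * a with ha'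
  set b' := C k⁻¹ * b with hb'
  have hspan : ∀ s : F[X], Ideal.span {el f (C k⁻¹ * a) (C k⁻¹ * s)} = Ideal.span {el f a s} := by
    intro s
    have hu : IsUnit (el f (C k⁻¹) 0) := by
      refine isUnit_iff_exists_inv.2 ⟨el f (C k) 0, ?_⟩
      rw [el_mul, ← el_one, el_inj]
      constructor
      · linear_combination hkk
      · ring
    have : el f (C k⁻¹ * a) (C k⁻¹ * s) = el f (C k⁻¹) 0 * el f a s := by
      rw [el_mul, el_inj]; constructor <;> ring
    rw [this, Ideal.span_singleton_mul_left_unit hu]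
  have hg : Ideal.span {el f a' b'} * I = Ideal.span {el f n 0} * I.map (hyperConj f) := by
    rw [ha', hb', hspan, hγ]
  have hnn : a' ^ 2 - f * b' ^ 2 = n ^ 2 := by
    have e1 : (C c : F[X]) = C k ^ 2 := by rw [hck, C_pow]
    rw [e1] at hc''
    rw [ha', hb']
    linear_combination (C k⁻¹) ^ 2 * hc'' + n ^ 2 * (C k * C k⁻¹ + 1) * hkk
  have hnel : el f n 0 ≠ 0 := by rw [Ne, el_eq_zero_iff]; exact fun h => hn0 h.1
  by_cases hδ : el f (n + a') b' = 0
  · refine ⟨1, one_ne_zero, ?_⟩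
    rw [Ideal.span_singleton_one, Ideal.top_mul]
    rw [el_eq_zero_iff] at hδ
    have e1 : el f a' b' = - el f n 0 := by
      rw [← zero_sub, ← el_zero, el_sub, el_inj]
      exact ⟨by linear_combination hδ.1, by rw [hδ.2]; ring⟩
    rw [e1, Ideal.span_singleton_neg] at hg
    exact (mul_left_cancel₀ (by
      rwa [Ne, Ideal.zero_eq_bot, Ideal.span_singleton_eq_bot]) hg).symm
  · refine ⟨_, hδ, ?_⟩
    rw [Ideal.map_mul, map_conj_span_singleton, hyperConj_el]
    apply mul_left_cancel₀ (a := Ideal.span {el f n 0}) (by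
      rwa [Ne, Ideal.zero_eq_bot, Ideal.span_singleton_eq_bot])
    rw [mul_left_comm, ← hg, ← mul_assoc, ← mul_assoc, Ideal.span_singleton_mul_span_singleton,
      Ideal.span_singleton_mul_span_singleton]
    have e3 : el f (n + a') (-b') * el f a' b' = el f n 0 * el f (n + a') b' := by
      rw [el_mul, el_mul, el_inj]
      constructor
      · linear_combination hnn
      · ring
    rw [e3]

/-- Hilbert 90 for ideal classes: an ideal whose class is invariant under the hyperelliptic
involution is equivalent to some `(D, Y)` with `D ∣ f`. -/
lemma exists_ramIdeal_of_conj (h2 : (2 : F) ≠ 0) (hs : Squarefree f) (hodd : Odd f.natDegree)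
    {I : Ideal (hyperellipticRing f)} (hI : I ≠ ⊥)
    {α β : hyperellipticRing f} (hβ : β ≠ 0)
    (h : Ideal.span {α} * I = Ideal.span {β} * I.map (hyperConj f)) :
    ∃ D : F[X], D.Monic ∧ D ∣ f ∧ ∃ x y : hyperellipticRing f, x ≠ 0 ∧ y ≠ 0 ∧
      Ideal.span {x} * I = Ideal.span {y} * ramIdeal f D := by
  have := hyper_isDomain hodd
  have := hyper_isDedekind h2 hs hodd
  obtain ⟨δ, hδ, hconj⟩ := exists_map_conj_eq h2 hs hodd hI hβ h
  have hK : Ideal.span {δ} * I ≠ ⊥ := by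
    rw [← Ideal.zero_eq_bot]
    refine mul_ne_zero ?_ hI
    rwa [Ne, Ideal.zero_eq_bot, Ideal.span_singleton_eq_bot]
  obtain ⟨D, e, hD, hDf, he, hDe⟩ := exists_ramIdeal_of_map_conj_eq h2 hodd hK hconj
  exact ⟨D, hD, hDf, δ, el f e 0, hδ, by rw [Ne, el_eq_zero_iff]; exact fun h => he h.1, hDe⟩

end Ambiguous

section Conic
open scoped Classical

variable {F : Type} [Field F] [Fintype F]

lemma leg_sq_mul {P : F[X]} (hP : P.Monic) (hI : Irreducible P) {A : F[X]} (h : ¬ P ∣ A)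
    (B : F[X]) : leg (B * A ^ 2) P = leg B P := by
  have h1 : IsCoprime A P := (IsCoprime.symm ((irreducible_iff_prime.1 hI).coprime_iff_not_dvd.2 h
    : IsCoprime P A))
  rw [leg_mul_left _ _ hP, sq, leg_mul_left _ _ hP]
  rcases leg_of_coprime hP h1 with h2 | h2 <;> rw [h2] <;> norm_num

/-- A pair of coprime factors `D`, `E` of `f` for which `D u² - E v² = c w²` is everywhere locally
solvable with the right constant. -/
def MutualResidues (D E : F[X]) : Prop :=
  (∀ P : F[X], P.Monic → Irreducible P → P ∣ E → leg P D = 1) ∧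
    ∀ P : F[X], P.Monic → Irreducible P → P ∣ D → leg P E = 1

lemma MutualResidues.symm {D E : F[X]} (h : MutualResidues D E) : MutualResidues E D :=
  ⟨h.2, h.1⟩

lemma exists_primitive {D E u v w : F[X]} {c : F} (hc : c ≠ 0) (hw : w ≠ 0)
    (h : D * u ^ 2 - E * v ^ 2 = C c * w ^ 2) :
    ∃ u' v' w' : F[X], w' ≠ 0 ∧ IsCoprime u' v' ∧ D * u' ^ 2 - E * v' ^ 2 = C c * w' ^ 2 := by
  have hcu : IsUnit (C c) := isUnit_C.2 hc.isUnit
  have huv : u ≠ 0 ∨ v ≠ 0 := by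
    by_contra! hcon
    rw [hcon.1, hcon.2] at h
    apply mul_ne_zero hcu.ne_zero (pow_ne_zero 2 hw)
    rw [← h]; ring
  have hg : EuclideanDomain.gcd u v ≠ 0 := by
    rw [Ne, EuclideanDomain.gcd_eq_zero_iff]; tauto
  obtain ⟨u', hu'⟩ := EuclideanDomain.gcd_dvd_left u v
  obtain ⟨v', hv'⟩ := EuclideanDomain.gcd_dvd_right u v
  have hgcd := EuclideanDomain.gcd_eq_gcd_ab u v
  set g := EuclideanDomain.gcd u v with hgdef
  have h1 : g ∣ w := by
    have : g ^ 2 ∣ w ^ 2 := by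
      rw [← hcu.dvd_mul_left, ← h, hu', hv']
      exact ⟨D * u' ^ 2 - E * v' ^ 2, by ring⟩
    exact (IsIntegrallyClosed.pow_dvd_pow_iff two_ne_zero).1 this
  obtain ⟨w', rfl⟩ := h1
  refine ⟨u', v', w', right_ne_zero_of_mul hw, ?_, ?_⟩
  · refine ⟨EuclideanDomain.gcdA u v, EuclideanDomain.gcdB u v, ?_⟩
    apply mul_left_cancel₀ hg
    linear_combination (-1 : F[X]) * hgcd - EuclideanDomain.gcdA u v * hu' -
      EuclideanDomain.gcdB u v * hv'
  · apply mul_left_cancel₀ (pow_ne_zero 2 hg)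
    rw [hu', hv'] at h
    linear_combination h

/-- In a primitive solution of the conic, no prime of `E` divides `u` or `w`. -/
lemma not_dvd_of_primitive {D E u v w : F[X]} {c : F} (hc : c ≠ 0) (hs : Squarefree (D * E))
    (hcop : IsCoprime u v) (h : D * u ^ 2 - E * v ^ 2 = C c * w ^ 2) {P : F[X]}
    (hI : Irreducible P) (hPE : P ∣ E) : ¬ P ∣ u ∧ ¬ P ∣ w := by
  have hp := irreducible_iff_prime.1 hI
  have hcu : IsUnit (C c) := isUnit_C.2 hc.isUnit
  have hDE : IsRelPrime D E := (squarefree_mul_iff.1 hs).1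
  have hsE : Squarefree E := (squarefree_mul_iff.1 hs).2.2
  have hPD : ¬ P ∣ D := fun h => hI.not_isUnit (hDE h hPE)
  have huw : P ∣ u ↔ P ∣ w := by
    constructor
    · intro hu
      have h1 : P ∣ w ^ 2 := by
        rw [← hcu.dvd_mul_left, ← h]
        exact dvd_sub (Dvd.dvd.mul_left (dvd_pow hu two_ne_zero) _) (Dvd.dvd.mul_right hPE _)
      exact hp.dvd_of_dvd_pow h1
    · intro hw
      have h1 : P ∣ D * u ^ 2 := by
        rw [show D * u ^ 2 = C c * w ^ 2 + E * v ^ 2 by rw [← h]; ring]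
        exact dvd_add (Dvd.dvd.mul_left (dvd_pow hw two_ne_zero) _) (Dvd.dvd.mul_right hPE _)
      exact hp.dvd_of_dvd_pow ((hp.dvd_or_dvd h1).resolve_left hPD)
  have hu : ¬ P ∣ u := by
    intro hu
    have hw := huw.1 hu
    have h1 : P ^ 2 ∣ E * v ^ 2 := by
      rw [show E * v ^ 2 = D * u ^ 2 - C c * w ^ 2 by rw [← h]; ring]
      exact dvd_sub (Dvd.dvd.mul_left (pow_dvd_pow_of_dvd hu 2) _)
        (Dvd.dvd.mul_left (pow_dvd_pow_of_dvd hw 2) _)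
    obtain ⟨E', rfl⟩ := hPE
    have hE' : ¬ P ∣ E' := by
      intro hE'
      exact hI.not_isUnit (hsE P (mul_dvd_mul_left _ hE'))
    rw [sq, mul_assoc] at h1
    have h2 := (mul_dvd_mul_iff_left hp.ne_zero).1 h1
    have h3 := hp.dvd_of_dvd_pow ((hp.dvd_or_dvd h2).resolve_left hE')
    exact hI.not_isUnit (hcop.isUnit_of_dvd' hu h3)
  exact ⟨hu, fun hw => hu (huw.2 hw)⟩

lemma quadChar_pow_eq {c : F} {k : ℕ} (hc : quadraticChar F c = (-1) ^ k) (n : ℕ) :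
    quadraticChar F c ^ n = (-1) ^ (k * n) := by
  rw [hc, pow_mul]

lemma quadraticChar_conic (hq4 : Fintype.card F % 4 = 3) {D E u v w : F[X]} {c : F}
    (hD : D.Monic) (hE : E.Monic) (hodd : Odd (D.natDegree + E.natDegree)) (hc : c ≠ 0)
    (hw : w ≠ 0) (h : D * u ^ 2 - E * v ^ 2 = C c * w ^ 2) :
    quadraticChar F c = (-1) ^ D.natDegree := by
  have hlead : (C c * w ^ 2).leadingCoeff = c * w.leadingCoeff ^ 2 := by
    rw [leadingCoeff_mul, leadingCoeff_C, leadingCoeff_pow]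
  have hdeg : (C c * w ^ 2).natDegree = 2 * w.natDegree := by
    rw [natDegree_C_mul hc, natDegree_pow]
  have hwl : w.leadingCoeff ≠ 0 := leadingCoeff_ne_zero.2 hw
  have hwl2 : quadraticChar F (w.leadingCoeff ^ 2) = 1 := quadraticChar_sq_one' hwl
  have hl : ∀ A B : F[X], A.Monic → (A * B ^ 2).leadingCoeff = B.leadingCoeff ^ 2 := by
    intro A B hA
    rw [leadingCoeff_mul, hA.leadingCoeff, one_mul, leadingCoeff_pow]
  have hdd : ∀ A B : F[X], A.Monic → B ≠ 0 →
      (A * B ^ 2).natDegree = A.natDegree + 2 * B.natDegree := by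
    intro A B hA hB
    rw [natDegree_mul hA.ne_zero (pow_ne_zero 2 hB), natDegree_pow]
  -- the case in which the term with `u` dominates
  have caseU : (D * u ^ 2).leadingCoeff = (C c * w ^ 2).leadingCoeff →
      (D * u ^ 2).natDegree = (C c * w ^ 2).natDegree → u ≠ 0 →
      quadraticChar F c = (-1) ^ D.natDegree := by
    intro h1 h3 hu
    rw [hl _ _ hD, hlead] at h1
    have h4 := congrArg (quadraticChar F) h1
    rw [map_mul, hwl2, mul_one, quadraticChar_sq_one' (leadingCoeff_ne_zero.2 hu)] at h4
    rw [hdd _ _ hD hu, hdeg] at h3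
    have : Even D.natDegree := ⟨w.natDegree - u.natDegree, by omega⟩
    rw [← h4, this.neg_one_pow]
  have caseV : -(E * v ^ 2).leadingCoeff = (C c * w ^ 2).leadingCoeff →
      (E * v ^ 2).natDegree = (C c * w ^ 2).natDegree → v ≠ 0 →
      quadraticChar F c = (-1) ^ D.natDegree := by
    intro h1 h3 hv
    rw [hl _ _ hE, hlead, ← neg_one_mul] at h1
    have h4 := congrArg (quadraticChar F) h1
    rw [map_mul, map_mul, hwl2, mul_one, quadraticChar_sq_one' (leadingCoeff_ne_zero.2 hv), mul_one,
      quadraticChar_neg_one_of_three_mod_four hq4] at h4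
    rw [hdd _ _ hE hv, hdeg] at h3
    have : Odd D.natDegree := by
      rw [Nat.odd_iff] at hodd ⊢
      omega
    rw [← h4, this.neg_one_pow]
  by_cases hu : u = 0
  · have hv : v ≠ 0 := by
      rintro rfl
      rw [hu] at h
      apply mul_ne_zero (C_ne_zero.2 hc) (pow_ne_zero 2 hw)
      rw [← h]; ring
    have h' : -(E * v ^ 2) = C c * w ^ 2 := by rw [← h, hu]; ring
    exact caseV (by rw [← h', leadingCoeff_neg]) (by rw [← h', natDegree_neg]) hv
  by_cases hv : v = 0
  · have h' : D * u ^ 2 = C c * w ^ 2 := by rw [← h, hv]; ring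
    exact caseU (by rw [h']) (by rw [h']) hu
  have hne : (D * u ^ 2).natDegree ≠ (E * v ^ 2).natDegree := by
    rw [hdd _ _ hD hu, hdd _ _ hE hv]
    rw [Nat.odd_iff] at hodd
    omega
  rcases lt_or_gt_of_ne hne with h1 | h1
  · exact caseV (by rw [← h, leadingCoeff_sub_of_degree_lt' (degree_lt_degree h1)])
      (by rw [← h, natDegree_sub_eq_right_of_natDegree_lt h1]) hv
  · exact caseU (by rw [← h, leadingCoeff_sub_of_degree_lt (degree_lt_degree h1)])
      (by rw [← h, natDegree_sub_eq_left_of_natDegree_lt h1]) hu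

lemma mutualResidues_of_conic (hq4 : Fintype.card F % 4 = 3) {D E u v w : F[X]} {c : F}
    (hD : D.Monic) (hE : E.Monic) (hodd : Odd (D.natDegree + E.natDegree))
    (hs : Squarefree (D * E)) (hc : c ≠ 0)
    (hw : w ≠ 0) (h : D * u ^ 2 - E * v ^ 2 = C c * w ^ 2) : MutualResidues D E := by
  have hχ := quadraticChar_conic hq4 hD hE hodd hc hw h
  have hneg1 := quadraticChar_neg_one_of_three_mod_four hq4
  obtain ⟨u, v, w, hw, hcop, h⟩ := exists_primitive hc hw h
  have h' : E * v ^ 2 - D * u ^ 2 = C (-c) * w ^ 2 := by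
    rw [C_neg, neg_mul, ← h]; ring
  constructor
  · intro P hP hI hPE
    obtain ⟨h1, h3⟩ := not_dvd_of_primitive hc hs hcop h hI hPE
    have h4 : leg D P = quadraticChar F c ^ P.natDegree := by
      rw [← leg_sq_mul hP hI h1, leg_congr (A' := C c * w ^ 2) hP, leg_sq_mul hP hI h3, leg_C]
      rw [← h, show D * u ^ 2 - (D * u ^ 2 - E * v ^ 2) = E * v ^ 2 by ring]
      exact Dvd.dvd.mul_right hPE _
    rw [leg_reciprocity hq4, h4, quadChar_pow_eq hχ, ← pow_add, mul_comm D.natDegree]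
    exact Even.neg_one_pow ⟨_, rfl⟩
  · intro P hP hI hPD
    obtain ⟨h1, h3⟩ := not_dvd_of_primitive (neg_ne_zero.2 hc) (by rwa [mul_comm]) hcop.symm h' hI
      hPD
    have hχ' : quadraticChar F (-c) = (-1) ^ (D.natDegree + 1) := by
      rw [← neg_one_mul, map_mul, hneg1, hχ, pow_succ, mul_comm]
    have h4 : leg E P = quadraticChar F (-c) ^ P.natDegree := by
      rw [← leg_sq_mul hP hI h1, leg_congr (A' := C (-c) * w ^ 2) hP, leg_sq_mul hP hI h3, leg_C]
      rw [← h', show E * v ^ 2 - (E * v ^ 2 - D * u ^ 2) = D * u ^ 2 by ring]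
      exact Dvd.dvd.mul_right hPD _
    rw [leg_reciprocity hq4, h4, quadChar_pow_eq hχ', ← pow_add, mul_comm P.natDegree, ← add_mul]
    apply Even.neg_one_pow
    apply Even.mul_right
    rw [Nat.odd_iff] at hodd
    rw [Nat.even_iff]; omega

lemma dvd_of_forall_prime_dvd {f A : F[X]} (hf : f.Monic) (hs : Squarefree f)
    (h : ∀ P : F[X], P.Monic → Irreducible P → P ∣ f → P ∣ A) : f ∣ A := by
  rw [← prod_pf hf hs]
  refine Finset.prod_dvd_of_coprime ?_ fun P hP =>
    h P (pf_monic hP) (pf_irreducible hP) (pf_dvd hP)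
  intro P hP Q hQ hne
  refine (irreducible_iff_prime.1 (pf_irreducible hP)).coprime_iff_not_dvd.2 fun hd => hne ?_
  exact eq_of_primes_dvd (pf_monic hP) (pf_irreducible hP) (pf_monic hQ) (pf_irreducible hQ) hd

/-- Square roots modulo a squarefree polynomial, by the Chinese remainder theorem. -/
lemma exists_sqrt_mod (h2 : ringChar F ≠ 2) {E A : F[X]} (hE : E.Monic) (hs : Squarefree E)
    (h : ∀ P : F[X], P.Monic → Irreducible P → P ∣ E → leg A P = 1) : ∃ B, E ∣ A - B ^ 2 := by
  have h1 : ∀ P ∈ pf E, ∃ B, P ∣ A - B ^ 2 := by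
    intro P hP
    have h3 := h P (pf_monic hP) (pf_irreducible hP) (pf_dvd hP)
    refine (leg_prime_eq_one_iff h2 (pf_monic hP) (pf_irreducible hP) ?_).1 h3
    intro hd
    have h4 : ¬ IsCoprime A P := fun hc =>
      (pf_irreducible hP).not_isUnit (hc.symm.isUnit_of_dvd' dvd_rfl hd)
    rw [← leg_eq_zero_iff (pf_monic hP), h3] at h4
    exact one_ne_zero h4
  choose! b hb using h1
  obtain ⟨B, hB⟩ := Ideal.exists_forall_sub_mem_ideal (ι := pf E)
    (I := fun P => Ideal.span {P.1})
    (by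
      rintro ⟨P, hP⟩ ⟨Q, hQ⟩ hne
      change IsCoprime (Ideal.span {P}) (Ideal.span {Q})
      rw [Ideal.isCoprime_span_singleton_iff]
      refine (irreducible_iff_prime.1 (pf_irreducible hP)).coprime_iff_not_dvd.2 fun hd => hne ?_
      exact Subtype.ext (eq_of_primes_dvd (pf_monic hP) (pf_irreducible hP) (pf_monic hQ)
        (pf_irreducible hQ) hd))
    (fun P => b P.1)
  refine ⟨B, dvd_of_forall_prime_dvd hE hs fun P hP hI hPE => ?_⟩
  have hm : P ∈ pf E := (mem_pf hE.ne_zero).2 ⟨hP, hI, hPE⟩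
  have h3 := Ideal.mem_span_singleton.1 (hB ⟨P, hm⟩)
  rw [show A - B ^ 2 = (A - b P ^ 2) - (B - b P) * (B + b P) by ring]
  exact dvd_sub (hb P hm) (Dvd.dvd.mul_right h3 _)

/-- Pigeonhole principle for polynomials with bounded degrees. -/
lemma exists_small_solution {D E A B : F[X]} (hD : D.Monic) (hE : E.Monic) {a b c : ℕ}
    (h : D.natDegree + E.natDegree < a + b + c) :
    ∃ u v w : F[X], (u ≠ 0 ∨ v ≠ 0 ∨ w ≠ 0) ∧ u.degree < a ∧ v.degree < b ∧ w.degree < c ∧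
      E ∣ w - A * u ∧ D ∣ w - B * v := by
  let V := degreeLT F a × degreeLT F b × degreeLT F c
  let W := degreeLT F E.natDegree × degreeLT F D.natDegree
  have key : ∀ (n : ℕ), Module.finrank F (degreeLT F n) = n := by
    intro n
    rw [(degreeLTEquiv F n).finrank_eq, Module.finrank_fin_fun]
  have hfin : ∀ n : ℕ, Module.Finite F (degreeLT F n) := fun n =>
    Module.Finite.equiv (degreeLTEquiv F n).symm
  let T : V →ₗ[F] W := LinearMap.prod
    (LinearMap.codRestrict (degreeLT F E.natDegree)
      (modByMonicHom E ∘ₗ ((degreeLT F c).subtype ∘ₗ LinearMap.snd F _ _ ∘ₗ LinearMap.snd F _ _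
        - LinearMap.mulLeft F A ∘ₗ (degreeLT F a).subtype ∘ₗ LinearMap.fst F _ _)) (fun x => by
        rw [mem_degreeLT, ← degree_eq_natDegree hE.ne_zero]
        exact degree_modByMonic_lt _ hE))
    (LinearMap.codRestrict (degreeLT F D.natDegree)
      (modByMonicHom D ∘ₗ ((degreeLT F c).subtype ∘ₗ LinearMap.snd F _ _ ∘ₗ LinearMap.snd F _ _
        - LinearMap.mulLeft F B ∘ₗ (degreeLT F b).subtype ∘ₗ LinearMap.fst F _ _ ∘ₗ
          LinearMap.snd F _ _)) (fun x => by
        rw [mem_degreeLT, ← degree_eq_natDegree hD.ne_zero]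
        exact degree_modByMonic_lt _ hD))
  have hlt : Module.finrank F W < Module.finrank F V := by
    rw [Module.finrank_prod, Module.finrank_prod, Module.finrank_prod]
    simp only [key]; omega
  have hker := LinearMap.ker_ne_bot_of_finrank_lt (f := T) hlt
  obtain ⟨x, hx, hx0⟩ := Submodule.exists_mem_ne_zero_of_ne_bot hker
  obtain ⟨⟨u, hu⟩, ⟨v, hv⟩, ⟨w, hw⟩⟩ := x
  rw [LinearMap.mem_ker, Prod.ext_iff] at hx
  have e1 := congrArg Subtype.val hx.1
  have e2 := congrArg Subtype.val hx.2
  refine ⟨u, v, w, ?_, mem_degreeLT.1 hu, mem_degreeLT.1 hv, mem_degreeLT.1 hw, ?_, ?_⟩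
  · by_contra! hcon
    apply hx0
    obtain ⟨rfl, rfl, rfl⟩ := hcon
    rfl
  · exact (modByMonic_eq_zero_iff_dvd hE).1 e1
  · exact (modByMonic_eq_zero_iff_dvd hD).1 e2

lemma exists_conic (hq4 : Fintype.card F % 4 = 3) {D E : F[X]}
    (hD : D.Monic) (hE : E.Monic) (hodd : Odd (D.natDegree + E.natDegree))
    (hs : Squarefree (D * E)) (h : MutualResidues D E) :
    ∃ (u v w : F[X]) (c : F), c ≠ 0 ∧ w ≠ 0 ∧ D * u ^ 2 - E * v ^ 2 = C c * w ^ 2 := by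
  have hneg1 := quadraticChar_neg_one_of_three_mod_four hq4
  have h2 := ringChar_ne_two_of_mod hq4
  have hDE : IsRelPrime D E := (squarefree_mul_iff.1 hs).1
  have hsD : Squarefree D := (squarefree_mul_iff.1 hs).2.1
  have hsE : Squarefree E := (squarefree_mul_iff.1 hs).2.2
  set c : F := (-1) ^ D.natDegree with hc
  have hcc : c * c = 1 := by
    rw [hc, ← pow_add]; exact Even.neg_one_pow ⟨_, rfl⟩
  have hCC : (C c : F[X]) * C c = 1 := by rw [← C_mul, hcc, C_1]
  have hc0 : c ≠ 0 := left_ne_zero_of_mul (hcc ▸ one_ne_zero)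
  have hχ : quadraticChar F c = (-1) ^ D.natDegree := by
    rw [hc, map_pow, hneg1]
  have hχ' : quadraticChar F (-c) = (-1) ^ (D.natDegree + 1) := by
    rw [← neg_one_mul, map_mul, hneg1, hχ, pow_succ, mul_comm]
  obtain ⟨A, hA⟩ := exists_sqrt_mod h2 (A := C c * D) hE hsE (fun P hP hI hPE => by
    have h3 := h.1 P hP hI hPE
    rw [leg_mul_left _ _ hP, leg_C, quadChar_pow_eq hχ, leg_reciprocity hq4, h3, mul_one,
      ← pow_add]
    exact Even.neg_one_pow ⟨_, rfl⟩)
  obtain ⟨B, hB⟩ := exists_sqrt_mod h2 (A := C (-c) * E) hD hsD (fun P hP hI hPD => by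
    have h3 := h.2 P hP hI hPD
    rw [leg_mul_left _ _ hP, leg_C, quadChar_pow_eq hχ', leg_reciprocity hq4, h3, mul_one,
      ← pow_add, ← add_mul]
    apply Even.neg_one_pow
    apply Even.mul_right
    rw [Nat.odd_iff] at hodd
    rw [Nat.even_iff]; omega)
  obtain ⟨u, v, w, hne, hu, hv, hw, hEd, hDd⟩ := exists_small_solution (A := A) (B := B) hD hE
    (a := (E.natDegree + 1) / 2) (b := (D.natDegree + 1) / 2)
    (c := (D.natDegree + E.natDegree + 1) / 2) (by rw [Nat.odd_iff] at hodd; omega)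
  have hEX : E ∣ D * u ^ 2 - E * v ^ 2 - C c * w ^ 2 := by
    have : D * u ^ 2 - E * v ^ 2 - C c * w ^ 2 = C c * u ^ 2 * (C c * D - A ^ 2)
        - E * v ^ 2 - C c * (w + A * u) * (w - A * u) := by
      linear_combination (-D * u ^ 2) * hCC
    rw [this]
    exact dvd_sub (dvd_sub (Dvd.dvd.mul_left hA _) (dvd_mul_right _ _)) (Dvd.dvd.mul_left hEd _)
  have hDX : D ∣ D * u ^ 2 - E * v ^ 2 - C c * w ^ 2 := by
    have : D * u ^ 2 - E * v ^ 2 - C c * w ^ 2 = D * u ^ 2 + C c * v ^ 2 * (C (-c) * E - B ^ 2)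
        - C c * (w + B * v) * (w - B * v) := by
      rw [C_neg]
      linear_combination (E * v ^ 2) * hCC
    rw [this]
    exact dvd_sub (dvd_add (dvd_mul_right _ _) (Dvd.dvd.mul_left hB _)) (Dvd.dvd.mul_left hDd _)
  have hX : D * E ∣ D * u ^ 2 - E * v ^ 2 - C c * w ^ 2 := hDE.mul_dvd hDX hEX
  have hnat : ∀ (x : F[X]) (n k : ℕ), x.degree < (n : ℕ) → (∀ m, m < n → 2 * m < k) →
      (x ^ 2).degree < (k : ℕ) ∨ x = 0 := by
    intro x n k hx hk
    by_cases hx0 : x = 0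
    · exact Or.inr hx0
    · left
      rw [← natDegree_lt_iff_degree_lt hx0] at hx
      rw [← natDegree_lt_iff_degree_lt (pow_ne_zero 2 hx0), natDegree_pow]
      exact hk _ hx
  have hmul : ∀ (A x : F[X]) (k n : ℕ), A.Monic → A.natDegree + k = n →
      ((x ^ 2).degree < (k : ℕ) ∨ x = 0) → (A * x ^ 2).degree < (n : ℕ) := by
    intro A x k n hA hn hx
    rcases hx with hx | rfl
    · rw [degree_mul, degree_eq_natDegree hA.ne_zero, ← hn, Nat.cast_add]
      exact WithBot.add_lt_add_left (WithBot.natCast_ne_bot _) hx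
    · simp
  have hdeg : (D * u ^ 2 - E * v ^ 2 - C c * w ^ 2).degree < (D * E).degree := by
    rw [degree_eq_natDegree (mul_ne_zero hD.ne_zero hE.ne_zero),
      natDegree_mul hD.ne_zero hE.ne_zero]
    have k1 := hmul D u E.natDegree _ hD rfl (hnat u _ _ hu (fun m hm => by omega))
    have k2 := hmul E v D.natDegree _ hE (add_comm _ _) (hnat v _ _ hv (fun m hm => by omega))
    have k3 : (C c * w ^ 2).degree < ((D.natDegree + E.natDegree : ℕ) : WithBot ℕ) := by
      have := hmul 1 w (D.natDegree + E.natDegree) (D.natDegree + E.natDegree) monic_one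
        (by simp) (hnat w _ _ hw
        (fun m hm => by rw [Nat.odd_iff] at hodd; omega))
      rwa [one_mul, ← degree_C_mul hc0] at this
    exact (degree_sub_le _ _).trans_lt (max_lt ((degree_sub_le _ _).trans_lt (max_lt k1 k2)) k3)
  have hzero := eq_zero_of_dvd_of_degree_lt hX hdeg
  have heq : D * u ^ 2 - E * v ^ 2 = C c * w ^ 2 := sub_eq_zero.1 hzero
  refine ⟨u, v, w, c, hc0, ?_, heq⟩
  rintro rfl
  have huv : D * u ^ 2 = E * v ^ 2 := by
    rw [← sub_eq_zero, heq]; ring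
  by_cases hu0 : u = 0
  · have hv0 : v = 0 := by
      rw [hu0, zero_pow two_ne_zero, mul_zero] at huv
      exact pow_eq_zero_iff two_ne_zero |>.1 ((mul_eq_zero.1 huv.symm).resolve_left hE.ne_zero)
    simp [hu0, hv0] at hne
  · have hv0 : v ≠ 0 := by
      rintro rfl
      rw [zero_pow two_ne_zero, mul_zero] at huv
      exact mul_ne_zero hD.ne_zero (pow_ne_zero 2 hu0) huv
    have := congrArg natDegree huv
    rw [natDegree_mul hD.ne_zero (pow_ne_zero 2 hu0), natDegree_mul hE.ne_zero (pow_ne_zero 2 hv0),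
      natDegree_pow, natDegree_pow] at this
    rw [Nat.odd_iff] at hodd
    omega

end Conic

section ClassSquares

variable {F : Type} [Field F] [Fintype F] {f : F[X]}

lemma ramIdeal_map_conj {D : F[X]} (hD : D ∣ f) :
    (ramIdeal f D).map (hyperConj f) = ramIdeal f D := by
  ext z
  obtain ⟨u, v, rfl⟩ := el_surj z
  rw [mem_map_conj, hyperConj_el, mem_ramIdeal hD, mem_ramIdeal hD]

lemma mutualResidues_of_span (hq4 : Fintype.card F % 4 = 3) (hs : Squarefree f)
    (hodd : Odd f.natDegree) {D E : F[X]} (hD : D.Monic) (hE : E.Monic) (hDE : f = D * E)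
    {I : Ideal (hyperellipticRing f)} (hI : I ≠ ⊥) {γ : hyperellipticRing f}
    (h : ramIdeal f D * (I * I) = Ideal.span {γ}) : MutualResidues D E := by
  have h2 : (2 : F) ≠ 0 := Ring.two_ne_zero (ringChar_ne_two_of_mod hq4)
  have hDf : D ∣ f := ⟨E, hDE⟩
  obtain ⟨m, hm, hIm⟩ := mul_map_conj_eq h2 hs hodd hI
  obtain ⟨a, v, rfl⟩ := el_surj γ
  have hγ : el f a v ∈ ramIdeal f D := by
    have : Ideal.span {el f a v} ≤ ramIdeal f D := h ▸ Ideal.mul_le_left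
    exact this (Ideal.mem_span_singleton_self _)
  obtain ⟨u, rfl⟩ := (mem_ramIdeal hDf).1 hγ
  have h' : ramIdeal f D * (I.map (hyperConj f) * I.map (hyperConj f))
      = Ideal.span {el f (D * u) (-v)} := by
    have := congrArg (Ideal.map (hyperConj f)) h
    rwa [Ideal.map_mul, Ideal.map_mul, map_conj_span_singleton, hyperConj_el,
      ramIdeal_map_conj hDf] at this
  have h3 : Ideal.span {el f (D * u) v * el f (D * u) (-v)} =
      Ideal.span {el f D 0 * (el f m 0 * el f m 0)} := by
    rw [← Ideal.span_singleton_mul_span_singleton, ← h, ← h', mul_mul_mul_comm,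
      ramIdeal_mul_self hs hDE, mul_mul_mul_comm I, hIm, Ideal.span_singleton_mul_span_singleton,
      Ideal.span_singleton_mul_span_singleton]
  obtain ⟨c, hc, hc'⟩ := span_eq_iff hodd h3
  simp only [el_mul] at hc'
  rw [el_inj] at hc'
  have h4 : D * u ^ 2 - E * v ^ 2 = C c * m ^ 2 := by
    apply mul_left_cancel₀ hD.ne_zero
    linear_combination hc'.1 + v ^ 2 * hDE
  refine mutualResidues_of_conic hq4 hD hE ?_ (hDE ▸ hs) hc hm h4
  rwa [← natDegree_mul hD.ne_zero hE.ne_zero, ← hDE]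

/-- In a primitive solution of the conic, the ideals attached to `Du + vY` and its conjugate are
coprime away from `D`. -/
lemma prime_contra {D E u v w : F[X]} {c : F} (h2 : (2 : F) ≠ 0) (hs : Squarefree f)
    (hDE : f = D * E) (hc : c ≠ 0) (hw : w ≠ 0) (hcop : IsCoprime u v)
    (h : D * u ^ 2 - E * v ^ 2 = C c * w ^ 2) {M : Ideal (hyperellipticRing f)} (hM : M.IsPrime)
    (hwM : el f w 0 ∈ M) (h1 : el f (D * u) v ∈ M) (h1' : el f (D * u) (-v) ∈ M) : False := by
  set m : Ideal F[X] := M.comap (AdjoinRoot.of ((X : (F[X])[X]) ^ 2 - Polynomial.C f)) with hmdef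
  have hm : m.IsPrime := Ideal.comap_isPrime _ _
  have hmem : ∀ x, x ∈ m ↔ el f x 0 ∈ M := by
    intro x
    rw [hmdef, Ideal.mem_comap, el, map_zero, zero_mul, add_zero]
  have hm0 : m ≠ ⊥ := by
    intro hbot
    have : w ∈ m := (hmem w).2 hwM
    rw [hbot, Ideal.mem_bot] at this
    exact hw this
  obtain ⟨p, hp⟩ := Submodule.IsPrincipal.principal m
  have hp' : m = Ideal.span {p} := hp
  have hp0 : p ≠ 0 := by
    rintro rfl
    apply hm0
    rw [hp']; simp
  have hpp : Prime p := by
    rw [← Ideal.span_singleton_prime hp0, ← hp']; exact hm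
  have hdvd : ∀ x, p ∣ x ↔ el f x 0 ∈ M := by
    intro x
    rw [← hmem, hp', Ideal.mem_span_singleton]
  have hs' : Squarefree (D * E) := hDE ▸ hs
  have hs'' : Squarefree (E * D) := by rwa [mul_comm]
  have h' : E * v ^ 2 - D * u ^ 2 = C (-c) * w ^ 2 := by
    rw [C_neg, neg_mul, ← h]; ring
  have hpw : p ∣ w := (hdvd w).2 hwM
  by_cases hpD : p ∣ D
  · exact (not_dvd_of_primitive (neg_ne_zero.2 hc) hs'' hcop.symm h' hpp.irreducible hpD).2 hpw
  by_cases hpE : p ∣ E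
  · exact (not_dvd_of_primitive hc hs' hcop h hpp.irreducible hpE).2 hpw
  have h2' : (2 : F[X]) * C (2⁻¹ : F) = 1 := by
    rw [show (2 : F[X]) = C (2 : F) from rfl, ← C_mul, mul_inv_cancel₀ h2, C_1]
  have k1 : p ∣ D * u := by
    rw [hdvd]
    have := M.mul_mem_left (el f (C 2⁻¹) 0) (M.add_mem h1 h1')
    rw [el_add, el_mul] at this
    convert this using 2
    · linear_combination (-(D * u)) * h2'
    · ring
  have k2 : p ∣ f * v := by
    rw [hdvd]
    have := M.mul_mem_left (el f 0 (C 2⁻¹)) (M.sub_mem h1 h1')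
    rw [el_sub, el_mul] at this
    convert this using 2
    · linear_combination (-(f * v)) * h2'
    · ring
  have hpu : p ∣ u := (hpp.dvd_or_dvd k1).resolve_left hpD
  have hpv : p ∣ v := by
    refine (hpp.dvd_or_dvd k2).resolve_left ?_
    rw [hDE]
    exact fun h => (hpp.dvd_or_dvd h).elim hpD hpE
  exact hpp.not_unit (hcop.isUnit_of_dvd' hpu hpv)

lemma coprime_of_prime_contra {R : Type} [CommRing R] {J K K' : Ideal R} {w β β' : R}
    (hKK : K * K' = Ideal.span {w} ^ 2) (hK : Ideal.span {β} = J * K)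
    (hK' : Ideal.span {β'} = J * K')
    (h : ∀ M : Ideal R, M.IsPrime → w ∈ M → β ∈ M → β' ∈ M → False) : IsCoprime K K' := by
  rw [Ideal.isCoprime_iff_sup_eq]
  by_contra hne
  obtain ⟨M, hM, hle⟩ := Ideal.exists_le_maximal _ hne
  have e1 : K ≤ M := le_sup_left.trans hle
  have e2 : K' ≤ M := le_sup_right.trans hle
  have hP := hM.isPrime
  refine h M hP ?_ ?_ ?_
  · have : w ^ 2 ∈ K * K' := by
      rw [hKK]; exact Ideal.pow_mem_pow (Ideal.mem_span_singleton_self _) 2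
    exact hP.mem_of_pow_mem 2 (e1 (Ideal.mul_le_left this))
  · have : β ∈ J * K := hK ▸ Ideal.mem_span_singleton_self _
    exact e1 (Ideal.mul_le_right this)
  · have : β' ∈ J * K' := hK' ▸ Ideal.mem_span_singleton_self _
    exact e2 (Ideal.mul_le_right this)

lemma exists_span_of_mutualResidues (hq4 : Fintype.card F % 4 = 3) (hs : Squarefree f)
    (hodd : Odd f.natDegree) {D E : F[X]} (hD : D.Monic) (hE : E.Monic) (hDE : f = D * E)
    (h : MutualResidues D E) :
    ∃ (I : Ideal (hyperellipticRing f)) (γ : hyperellipticRing f), I ≠ ⊥ ∧ γ ≠ 0 ∧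
      ramIdeal f D * (I * I) = Ideal.span {γ} := by
  have h2 : (2 : F) ≠ 0 := Ring.two_ne_zero (ringChar_ne_two_of_mod hq4)
  have hDf : D ∣ f := ⟨E, hDE⟩
  have := hyper_isDomain hodd
  have := hyper_isDedekind h2 hs hodd
  obtain ⟨u, v, w, c, hc, hw, hconic⟩ := exists_conic hq4 hD hE
    (by rwa [← natDegree_mul hD.ne_zero hE.ne_zero, ← hDE]) (hDE ▸ hs) h
  obtain ⟨u, v, w, hw, hcop, hconic⟩ := exists_primitive hc hw hconic
  set β := el f (D * u) v with hβ
  have hN : β * el f (D * u) (-v) = el f (C c) 0 * (el f D 0 * (el f w 0 * el f w 0)) := by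
    rw [hβ]
    simp only [el_mul]
    rw [el_inj]
    constructor
    · linear_combination D * hconic - v ^ 2 * hDE
    · ring
  have hβ0 : β ≠ 0 := by
    intro h0
    rw [h0, zero_mul] at hN
    simp only [el_mul] at hN
    rw [eq_comm, el_eq_zero_iff] at hN
    refine mul_ne_zero (mul_ne_zero (C_ne_zero.2 hc) hD.ne_zero) (pow_ne_zero 2 hw) ?_
    linear_combination hN.1
  have hβJ : β ∈ ramIdeal f D := (mem_ramIdeal hDf).2 (dvd_mul_right _ _)
  obtain ⟨K, hK⟩ : ramIdeal f D ∣ Ideal.span {β} := by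
    rw [Ideal.dvd_iff_le, Ideal.span_singleton_le_iff_mem]; exact hβJ
  have hK' : Ideal.span {el f (D * u) (-v)} = ramIdeal f D * K.map (hyperConj f) := by
    have := congrArg (Ideal.map (hyperConj f)) hK
    rwa [Ideal.map_mul, map_conj_span_singleton, hβ, hyperConj_el, ramIdeal_map_conj hDf] at this
  have hu : IsUnit (el f (C c) 0) := by
    refine isUnit_iff_exists_inv.2 ⟨el f (C c⁻¹) 0, ?_⟩
    rw [el_mul, ← el_one, el_inj, ← C_mul, mul_inv_cancel₀ hc]
    simp
  have hJ0 : ramIdeal f D * ramIdeal f D ≠ 0 := mul_ne_zero ramIdeal_ne_bot ramIdeal_ne_bot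
  have hKK : K * K.map (hyperConj f) = Ideal.span {el f w 0} ^ 2 := by
    apply mul_left_cancel₀ hJ0
    rw [mul_mul_mul_comm, ← hK, ← hK', Ideal.span_singleton_mul_span_singleton, hN,
      Ideal.span_singleton_mul_left_unit hu, ramIdeal_mul_self hs hDE,
      pow_two (Ideal.span {el f w 0}), Ideal.span_singleton_mul_span_singleton,
      Ideal.span_singleton_mul_span_singleton]
  have hKc : IsCoprime K (K.map (hyperConj f)) := by
    refine coprime_of_prime_contra hKK hK hK' fun M hM hwM h1 h1' => ?_
    exact prime_contra h2 hs hDE hc hw hcop hconic hM hwM h1 h1'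
  obtain ⟨I, hI⟩ := exists_eq_pow_of_mul_eq_pow_of_coprime hKc hKK
  refine ⟨I, β, ?_, hβ0, ?_⟩
  · rintro rfl
    rw [← Ideal.zero_eq_bot, zero_pow two_ne_zero] at hI
    rw [hI, mul_zero, Ideal.zero_eq_bot, Ideal.span_singleton_eq_bot] at hK
    exact hβ0 hK
  · rw [← sq, ← hI, hK]

end ClassSquares

section TwoTorsion
open scoped Classical nonZeroDivisors

variable {F : Type} [Field F] [Fintype F] {f : F[X]} [IsDedekindDomain (hyperellipticRing f)]

/-- The class of a nonzero ideal. -/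
noncomputable def idealClass {R : Type} [CommRing R] [IsDedekindDomain R] {I : Ideal R}
    (hI : I ≠ ⊥) : ClassGroup R := ClassGroup.mk0 ⟨I, mem_nonZeroDivisors_of_ne_zero hI⟩

lemma idealClass_mul {R : Type} [CommRing R] [IsDedekindDomain R] {I J : Ideal R}
    (hI : I ≠ ⊥) (hJ : J ≠ ⊥) (hIJ : I * J ≠ ⊥) :
    idealClass hI * idealClass hJ = idealClass hIJ := by
  rw [idealClass, idealClass, idealClass, ← map_mul]
  rfl

lemma idealClass_mul_eq_one {R : Type} [CommRing R] [IsDedekindDomain R] {I J : Ideal R}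
    (hI : I ≠ ⊥) (hJ : J ≠ ⊥) {x : R} (h : I * J = Ideal.span {x}) :
    idealClass hI * idealClass hJ = 1 := by
  rw [idealClass_mul hI hJ (mul_ne_zero hI hJ), idealClass, ClassGroup.mk0_eq_one_iff]
  exact ⟨⟨x, h⟩⟩

lemma idealClass_eq_one {R : Type} [CommRing R] [IsDedekindDomain R] {I : Ideal R}
    (hI : I ≠ ⊥) (h : idealClass hI = 1) : ∃ x, I = Ideal.span {x} := by
  rw [idealClass, ClassGroup.mk0_eq_one_iff] at h
  exact h.principal

lemma exists_idealClass {R : Type} [CommRing R] [IsDedekindDomain R] (g : ClassGroup R) :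
    ∃ (I : Ideal R) (hI : I ≠ ⊥), g = idealClass hI := by
  obtain ⟨I, rfl⟩ := ClassGroup.mk0_surjective g
  exact ⟨I, nonZeroDivisors.coe_ne_zero I, rfl⟩

lemma idealClass_eq_iff {R : Type} [CommRing R] [IsDedekindDomain R] {I J : Ideal R}
    (hI : I ≠ ⊥) (hJ : J ≠ ⊥) : idealClass hI = idealClass hJ ↔
      ∃ x y : R, x ≠ 0 ∧ y ≠ 0 ∧ Ideal.span {x} * I = Ideal.span {y} * J := by
  rw [idealClass, idealClass, ClassGroup.mk0_eq_mk0_iff]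
  constructor
  · rintro ⟨x, y, hx, hy, h⟩; exact ⟨x, y, hx, hy, h⟩
  · rintro ⟨x, y, hx, hy, h⟩; exact ⟨x, y, hx, hy, h⟩

lemma ne_bot_of_dvd_hyper (D : F[X]) : ramIdeal f D ≠ ⊥ := ramIdeal_ne_bot

lemma ramClass_sq (hs : Squarefree f) {D E : F[X]} (hDE : f = D * E) :
    idealClass (ne_bot_of_dvd_hyper (f := f) D) * idealClass (ne_bot_of_dvd_hyper (f := f) D)
      = 1 :=
  idealClass_mul_eq_one _ _ (ramIdeal_mul_self hs hDE)

lemma ramClass_compl (hs : Squarefree f) {D E : F[X]} (hDE : f = D * E) :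
    idealClass (ne_bot_of_dvd_hyper (f := f) D) = idealClass (ne_bot_of_dvd_hyper (f := f) E) := by
  have h1 := ramClass_sq hs hDE
  have h2 := idealClass_mul_eq_one (ne_bot_of_dvd_hyper (f := f) D)
    (ne_bot_of_dvd_hyper (f := f) E) (ramIdeal_mul_compl hs hDE)
  exact mul_left_cancel (h1.trans h2.symm)

lemma ramClass_mem_iff (hq4 : Fintype.card F % 4 = 3) (hs : Squarefree f)
    (hodd : Odd f.natDegree) {D E : F[X]} (hD : D.Monic) (hE : E.Monic) (hDE : f = D * E) :
    (∃ h, h ^ 4 = 1 ∧ idealClass (ne_bot_of_dvd_hyper (f := f) D) = h ^ 2) ↔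
      MutualResidues D E := by
  have h1 := ramClass_sq hs hDE
  constructor
  · rintro ⟨h, h4, hh⟩
    obtain ⟨I, hI, rfl⟩ := exists_idealClass h
    have hII : I * I ≠ ⊥ := mul_ne_zero hI hI
    have e : idealClass (ne_bot_of_dvd_hyper (f := f) D) * idealClass hII = 1 := by
      rw [← idealClass_mul hI hI hII, ← pow_two (idealClass hI), ← hh, h1]
    rw [idealClass_mul _ hII (mul_ne_zero (ne_bot_of_dvd_hyper D) hII)] at e
    obtain ⟨x, hx⟩ := idealClass_eq_one _ e
    exact mutualResidues_of_span hq4 hs hodd hD hE hDE hI hx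
  · intro hMR
    obtain ⟨I, γ, hI, hγ, h⟩ := exists_span_of_mutualResidues hq4 hs hodd hD hE hDE hMR
    have hII : I * I ≠ ⊥ := mul_ne_zero hI hI
    have e := idealClass_mul_eq_one (ne_bot_of_dvd_hyper (f := f) D) hII h
    rw [← idealClass_mul hI hI hII, ← pow_two (idealClass hI)] at e
    have e2 : idealClass (ne_bot_of_dvd_hyper (f := f) D) = idealClass hI ^ 2 :=
      mul_left_cancel (h1.trans e.symm)
    refine ⟨idealClass hI, ?_, e2⟩
    rw [show 4 = 2 * 2 from rfl, pow_mul, ← e2, pow_two (idealClass _), h1]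

lemma exists_ramClass (hq4 : Fintype.card F % 4 = 3) (hs : Squarefree f)
    (hodd : Odd f.natDegree) {g : ClassGroup (hyperellipticRing f)} (hg : g * g = 1) :
    ∃ D : F[X], D.Monic ∧ D ∣ f ∧ g = idealClass (ne_bot_of_dvd_hyper (f := f) D) := by
  have h2 : (2 : F) ≠ 0 := Ring.two_ne_zero (ringChar_ne_two_of_mod hq4)
  obtain ⟨I, hI, rfl⟩ := exists_idealClass g
  obtain ⟨m, hm, hIm⟩ := mul_map_conj_eq h2 hs hodd hI
  have hI' : I.map (hyperConj f) ≠ ⊥ := by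
    intro h
    rw [h, Ideal.mul_bot, eq_comm, Ideal.span_singleton_eq_bot, el_eq_zero_iff] at hIm
    exact hm hIm.1
  have e := idealClass_mul_eq_one hI hI' hIm
  obtain ⟨x, y, hx, hy, hxy⟩ := (idealClass_eq_iff hI hI').1 (mul_left_cancel (hg.trans e.symm))
  obtain ⟨D, hD, hDf, a, b, ha, hb, hab⟩ := exists_ramIdeal_of_conj h2 hs hodd hI hy hxy
  exact ⟨D, hD, hDf, (idealClass_eq_iff hI _).2 ⟨a, b, ha, hb, hab⟩⟩

end TwoTorsion

section FourRank
open scoped Classical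

variable {F : Type} [Field F] [Fintype F] {f : F[X]}

/-- The number of factorisations `f = D * E` with mutual residues, `Q₀` dividing `E`. -/
noncomputable def residueSplits (f Q₀ : F[X]) : Finset (Finset F[X]) :=
  ((pf f).erase Q₀).powerset.filter
    fun S => MutualResidues (∏ P ∈ S, P) (∏ P ∈ pf f \ S, P)

lemma mul_prod_sdiff (hf : f.Monic) (hs : Squarefree f) {S : Finset F[X]} (hS : S ⊆ pf f) :
    f = (∏ P ∈ S, P) * ∏ P ∈ pf f \ S, P := by
  conv_lhs => rw [← prod_pf hf hs]
  rw [mul_comm]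
  exact (Finset.prod_sdiff hS).symm

lemma mem_residueSplits {Q₀ : F[X]} {S : Finset F[X]} : S ∈ residueSplits f Q₀ ↔
    S ⊆ (pf f).erase Q₀ ∧ MutualResidues (∏ P ∈ S, P) (∏ P ∈ pf f \ S, P) := by
  rw [residueSplits, Finset.mem_filter, Finset.mem_powerset]

lemma card_squares_eq [IsDedekindDomain (hyperellipticRing f)] (hq4 : Fintype.card F % 4 = 3)
    (hf : f.Monic) (hs : Squarefree f) (hodd : Odd f.natDegree) {Q₀ : F[X]} (hQ : Q₀ ∈ pf f) :
    Nat.card {g : ClassGroup (hyperellipticRing f) | ∃ h, h ^ 4 = 1 ∧ g = h ^ 2} =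
      (residueSplits f Q₀).card := by
  have h2 : (2 : F) ≠ 0 := Ring.two_ne_zero (ringChar_ne_two_of_mod hq4)
  have hmon : ∀ S ⊆ pf f, (∏ P ∈ S, P).Monic := fun S hS =>
    monic_prod_of_monic _ _ fun P hP => pf_monic (hS hP)
  have hS' : ∀ S ∈ residueSplits f Q₀, S ⊆ pf f := fun S hS =>
    (mem_residueSplits.1 hS).1.trans (Finset.erase_subset _ _)
  let φ : residueSplits f Q₀ →
      {g : ClassGroup (hyperellipticRing f) | ∃ h, h ^ 4 = 1 ∧ g = h ^ 2} := fun S =>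
    ⟨idealClass (ne_bot_of_dvd_hyper (f := f) (∏ P ∈ S.1, P)),
      (ramClass_mem_iff hq4 hs hodd (hmon _ (hS' _ S.2)) (hmon _ Finset.sdiff_subset)
        (mul_prod_sdiff hf hs (hS' _ S.2))).2 (mem_residueSplits.1 S.2).2⟩
  have key : ∀ D : F[X], D.Monic → D ∣ f → Q₀ ∉ pf D →
      (∃ h, h ^ 4 = 1 ∧ idealClass (ne_bot_of_dvd_hyper (f := f) D) = h ^ 2) →
      ∃ S : residueSplits f Q₀, (φ S).1 = idealClass (ne_bot_of_dvd_hyper (f := f) D) := by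
    intro D hD hDf hQD hh
    have hsub : pf D ⊆ pf f := pf_subset_of_dvd hf.ne_zero hDf
    have hDp : ∏ P ∈ pf D, P = D := prod_pf hD (hs.squarefree_of_dvd hDf)
    have hmul := mul_prod_sdiff hf hs hsub
    refine ⟨⟨pf D, mem_residueSplits.2 ⟨?_, ?_⟩⟩, ?_⟩
    · intro P hP
      exact Finset.mem_erase.2 ⟨fun h => hQD (h ▸ hP), hsub hP⟩
    · rw [hDp] at hmul ⊢
      exact (ramClass_mem_iff hq4 hs hodd hD (hmon _ Finset.sdiff_subset) hmul).1 hh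
    · change idealClass (ne_bot_of_dvd_hyper (f := f) (∏ P ∈ pf D, P)) = _
      congr 1
      rw [hDp]
  have hbij : Function.Bijective φ := by
    constructor
    · rintro ⟨S, hS⟩ ⟨T, hT⟩ h
      have h1 := congrArg Subtype.val h
      obtain ⟨x, y, hx, hy, hxy⟩ := (idealClass_eq_iff (ne_bot_of_dvd_hyper (∏ P ∈ S, P))
        (ne_bot_of_dvd_hyper (∏ P ∈ T, P))).1 h1
      have hpS : pf (∏ P ∈ S, P) = S := pf_prod S fun P hP =>
        ⟨pf_monic (hS' S hS hP), pf_irreducible (hS' S hS hP)⟩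
      have hpT : pf (∏ P ∈ T, P) = T := pf_prod T fun P hP =>
        ⟨pf_monic (hS' T hT hP), pf_irreducible (hS' T hT hP)⟩
      have hTf : ∏ P ∈ T, P ∣ f := ⟨_, mul_prod_sdiff hf hs (hS' T hT)⟩
      rcases ramIdeal_class_inj h2 hs hodd (hmon S (hS' S hS)) (hmon _ Finset.sdiff_subset)
        (hmon T (hS' T hT)) (mul_prod_sdiff hf hs (hS' S hS)) hTf hx hy hxy with h | h
      · apply Subtype.ext
        change S = T
        rw [← hpS, h, hpT]
      · exfalso
        have hpE : pf (∏ P ∈ pf f \ S, P) = pf f \ S := pf_prod _ fun P hP =>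
          ⟨pf_monic (Finset.mem_sdiff.1 hP).1, pf_irreducible (Finset.mem_sdiff.1 hP).1⟩
        have h3 : Q₀ ∈ T := by
          rw [← hpT, ← h, hpE]
          refine Finset.mem_sdiff.2 ⟨hQ, fun h4 => ?_⟩
          exact (Finset.mem_erase.1 ((mem_residueSplits.1 hS).1 h4)).1 rfl
        exact (Finset.mem_erase.1 ((mem_residueSplits.1 hT).1 h3)).1 rfl
    · rintro ⟨g, hg⟩
      have hgg : g * g = 1 := by
        obtain ⟨h, h4, rfl⟩ := hg
        rw [← pow_add, h4]
      obtain ⟨D, hD, ⟨E, hDE⟩, rfl⟩ := exists_ramClass hq4 hs hodd hgg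
      have hE : E.Monic := hD.of_mul_monic_left (hDE ▸ hf)
      by_cases hQD : Q₀ ∈ pf D
      · have hQE : Q₀ ∉ pf E := fun h => by
          have h5 : Q₀ * Q₀ ∣ f := hDE ▸ mul_dvd_mul (pf_dvd hQD) (pf_dvd h)
          exact (pf_irreducible hQ).not_isUnit (hs Q₀ h5)
        obtain ⟨S, hS⟩ := key E hE ⟨D, by rw [hDE, mul_comm]⟩ hQE
          (ramClass_compl hs hDE ▸ hg)
        exact ⟨S, Subtype.ext (hS.trans (ramClass_compl hs hDE).symm)⟩
      · obtain ⟨S, hS⟩ := key D hD ⟨E, hDE⟩ hQD hg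
        exact ⟨S, Subtype.ext hS⟩
  rw [← Nat.card_congr (Equiv.ofBijective φ hbij), Nat.card_eq_fintype_card, Fintype.card_coe]

lemma fourRankEq_iff (hq4 : Fintype.card F % 4 = 3) (hf : f.Monic) (hs : Squarefree f)
    (hodd : Odd f.natDegree) {Q₀ : F[X]} (hQ : Q₀ ∈ pf f) (r : ℕ) :
    fourRankEq f r ↔ (residueSplits f Q₀).card = 2 ^ r := by
  have h2 : (2 : F) ≠ 0 := Ring.two_ne_zero (ringChar_ne_two_of_mod hq4)
  have := hyper_isDomain hodd
  have := hyper_isDedekind h2 hs hodd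
  rw [← card_squares_eq hq4 hf hs hodd hQ]
  exact ⟨fun h => h, fun h _ => h⟩

end FourRank

section Signs

/-- The nontrivial additive character of `ZMod 2`. -/
def sgn (a : ZMod 2) : ℝ := if a = 0 then 1 else -1

lemma sgn_zero : sgn 0 = 1 := by simp [sgn]

lemma sgn_one : sgn 1 = -1 := by simp [sgn]

lemma zmod_two_cases (a : ZMod 2) : a = 0 ∨ a = 1 := by
  revert a; decide

lemma zmod_two_add_self (a : ZMod 2) : a + a = 0 := by
  revert a; decide

lemma sgn_add (a b : ZMod 2) : sgn (a + b) = sgn a * sgn b := by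
  rcases zmod_two_cases a with rfl | rfl <;> rcases zmod_two_cases b with rfl | rfl <;>
    simp [sgn_zero, sgn_one, zmod_two_add_self]

lemma sgn_sum {ι : Type*} (s : Finset ι) (g : ι → ZMod 2) :
    sgn (∑ i ∈ s, g i) = ∏ i ∈ s, sgn (g i) := by
  classical
  induction s using Finset.induction_on with
  | empty => simp [sgn_zero]
  | insert a s ha ih => rw [Finset.sum_insert ha, Finset.prod_insert ha, sgn_add, ih]

lemma abs_sgn (a : ZMod 2) : |sgn a| = 1 := by
  rcases zmod_two_cases a with rfl | rfl <;> simp [sgn_zero, sgn_one]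

lemma sum_sgn_eq_zero {V : Type*} [AddCommGroup V] [Fintype V] (φ : V →+ ZMod 2) {x₀ : V}
    (h : φ x₀ ≠ 0) : ∑ x, sgn (φ x) = 0 := by
  have h1 : φ x₀ = 1 := (zmod_two_cases _).resolve_left h
  have h2 : ∑ x, sgn (φ x) = ∑ x, sgn (φ (x + x₀)) :=
    (Equiv.sum_comp (Equiv.addRight x₀) fun x => sgn (φ x)).symm
  simp only [map_add, sgn_add, h1, sgn_one, mul_neg, mul_one, Finset.sum_neg_distrib] at h2
  linarith

lemma sum_sgn_eq_card {V : Type*} [Fintype V] (φ : V → ZMod 2) (h : ∀ x, φ x = 0) :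
    ∑ x, sgn (φ x) = Fintype.card V := by
  simp [h, sgn_zero]

open Classical in
/-- Orthogonality over a power of `ZMod 2`. -/
lemma sum_sgn_dot {E : Type*} [Fintype E] (c : E → ZMod 2) (u : ZMod 2) :
    ∑ t : E → ZMod 2, sgn (u + ∑ e, t e * c e) =
      if ∀ e, c e = 0 then 2 ^ Fintype.card E * sgn u else 0 := by
  simp only [sgn_add, ← Finset.mul_sum]
  split_ifs with h
  · simp [h, sgn_zero, mul_comm]
  · push Not at h
    obtain ⟨e, he⟩ := h
    have := sum_sgn_eq_zero (V := E → ZMod 2)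
      (φ := (⟨⟨fun t => ∑ e, t e * c e, by simp⟩, fun s t => by
        simp [add_mul, Finset.sum_add_distrib]⟩ : (E → ZMod 2) →+ ZMod 2))
      (x₀ := Pi.single e 1) (by simpa [Pi.single_apply] using he)
    rw [show ∑ t : E → ZMod 2, sgn (∑ e, t e * c e) = 0 from this, mul_zero]

end Signs

section Alternating

variable {j m : ℕ}

/-- Symmetric matrices over `ZMod 2` with zero diagonal. -/
def altMatrices (j : ℕ) : Finset (Fin j → Fin j → ZMod 2) :=
  Finset.univ.filter fun Θ => (∀ c, Θ c c = 0) ∧ ∀ c e, Θ c e = Θ e c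

lemma mem_altMatrices {Θ : Fin j → Fin j → ZMod 2} :
    Θ ∈ altMatrices j ↔ (∀ c, Θ c c = 0) ∧ ∀ c e, Θ c e = Θ e c := by
  simp [altMatrices]

lemma card_altMatrices_le : (altMatrices j).card ≤ 2 ^ (j ^ 2) := by
  refine (Finset.card_le_univ _).trans ?_
  simp [← pow_mul, pow_two]

/-- A symmetric matrix with zero diagonal gives an alternating form. -/
lemma alt_form_eq_zero {ι : Type*} [Fintype ι] [LinearOrder ι] (M : ι → ι → ZMod 2)
    (h0 : ∀ i, M i i = 0) (hs : ∀ i k, M i k = M k i) (z : ι → ZMod 2) :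
    ∑ i, ∑ k, z i * z k * M i k = 0 := by
  have : ∑ p : ι × ι, z p.1 * z p.2 * M p.1 p.2 = 0 := by
    refine Finset.sum_involution (fun p _ => (p.2, p.1)) ?_ ?_ ?_ ?_
    · intro p _
      simp only [hs p.2 p.1, mul_comm (z p.2)]
      exact zmod_two_add_self _
    · rintro ⟨i, k⟩ _ h heq
      simp only [Prod.mk.injEq] at heq
      simp [heq.1, h0] at h
    · simp
    · simp
  rw [← this, Fintype.sum_prod_type]

lemma exists_dual {b : Fin j → Fin m → ZMod 2} (hb : LinearIndependent (ZMod 2) b) :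
    ∃ β : Fin j → Fin m → ZMod 2, ∀ c e, ∑ i, b c i * β e i = if c = e then 1 else 0 := by
  have hinj : LinearMap.ker (Fintype.linearCombination (ZMod 2) b) = ⊥ := by
    rw [LinearMap.ker_eq_bot]
    exact linearIndependent_iff_injective_fintypeLinearCombination.1 hb
  obtain ⟨g, hg⟩ := LinearMap.exists_leftInverse_of_injective _ hinj
  refine ⟨fun e i => g (Pi.single i 1) e, fun c e => ?_⟩
  have h1 : g (b c) = Pi.single c 1 := by
    have := LinearMap.congr_fun hg (Pi.single c 1)
    simpa using this
  have h2 : b c = ∑ i, b c i • (Pi.single i 1 : Fin m → ZMod 2) := by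
    ext k
    simp [Finset.sum_apply, Pi.single_apply]
  have h3 := congrArg (fun w => w e) h1
  rw [h2] at h3
  simp only [map_sum, map_smul, Finset.sum_apply, Pi.smul_apply, smul_eq_mul] at h3
  rw [h3, Pi.single_apply]
  simp [eq_comm]

/-- The condition that all the quadratic coefficients vanish. -/
def QuadBalanced (b Y : Fin j → Fin m → ZMod 2) : Prop :=
  (∀ i, ∑ c, Y c i * b c i = 0) ∧ ∀ i k, ∑ c, Y c i * b c k = ∑ c, Y c k * b c i

lemma balanced_of_alt {Θ : Fin j → Fin j → ZMod 2} (hΘ : Θ ∈ altMatrices j)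
    (b : Fin j → Fin m → ZMod 2) : QuadBalanced b (fun c i => ∑ e, Θ c e * b e i) := by
  obtain ⟨h0, hs⟩ := mem_altMatrices.1 hΘ
  constructor
  · intro i
    rw [← alt_form_eq_zero Θ h0 hs (fun c => b c i)]
    refine Finset.sum_congr rfl fun c _ => ?_
    rw [Finset.sum_mul]
    exact Finset.sum_congr rfl fun e _ => by ring
  · intro i k
    simp only [Finset.sum_mul]
    rw [Finset.sum_comm]
    refine Finset.sum_congr rfl fun c _ => Finset.sum_congr rfl fun e _ => ?_
    rw [hs e c]; ring

lemma alt_of_balanced {b Y : Fin j → Fin m → ZMod 2} (hb : LinearIndependent (ZMod 2) b)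
    (h : QuadBalanced b Y) : ∃ Θ ∈ altMatrices j, Y = fun c i => ∑ e, Θ c e * b e i := by
  obtain ⟨β, hβ⟩ := exists_dual hb
  obtain ⟨h0, hs⟩ := h
  have hY : ∀ e i, Y e i = ∑ k, (∑ c, Y c i * b c k) * β e k := by
    intro e i
    simp only [Finset.sum_mul]
    rw [Finset.sum_comm]
    simp only [mul_assoc, ← Finset.mul_sum, hβ]
    simp
  have hΘ : ∀ e c, ∑ k, Y c k * β e k = ∑ k, ∑ l, β e k * β c l * (∑ a, Y a k * b a l) := by
    intro e c
    refine Finset.sum_congr rfl fun k _ => ?_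
    rw [hY c k, Finset.sum_mul]
    exact Finset.sum_congr rfl fun l _ => by ring
  refine ⟨fun e c => ∑ k, Y c k * β e k, mem_altMatrices.2 ⟨fun c => ?_, fun c e => ?_⟩, ?_⟩
  · rw [hΘ]
    exact alt_form_eq_zero _ h0 hs (β c)
  · rw [hΘ, hΘ, Finset.sum_comm]
    refine Finset.sum_congr rfl fun k _ => Finset.sum_congr rfl fun l _ => ?_
    rw [hs l k]; ring
  · ext e i
    rw [hY e i]
    trans ∑ k, ∑ c, Y c k * b c i * β e k
    · exact Finset.sum_congr rfl fun k _ => by rw [hs i k, Finset.sum_mul]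
    · rw [Finset.sum_comm]
      refine Finset.sum_congr rfl fun c _ => ?_
      rw [Finset.sum_mul]
      exact Finset.sum_congr rfl fun k _ => by ring

lemma alt_injective {b : Fin j → Fin m → ZMod 2} (hb : LinearIndependent (ZMod 2) b)
    {Θ Θ' : Fin j → Fin j → ZMod 2}
    (h : (fun c i => ∑ e, Θ c e * b e i) = fun c i => ∑ e, Θ' c e * b e i) : Θ = Θ' := by
  funext c
  apply linearIndependent_iff_injective_fintypeLinearCombination.1 hb
  ext i
  have := congrFun (congrFun h c) i
  simpa [Fintype.linearCombination_apply, Finset.sum_apply] using this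

open Classical in
lemma sum_balanced {b : Fin j → Fin m → ZMod 2} (hb : LinearIndependent (ZMod 2) b)
    (g : (Fin j → Fin m → ZMod 2) → ℝ) :
    ∑ Y, (if QuadBalanced b Y then g Y else 0) =
      ∑ Θ ∈ altMatrices j, g (fun c i => ∑ e, Θ c e * b e i) := by
  rw [← Finset.sum_filter]
  symm
  refine Finset.sum_bij (fun Θ _ => fun c i => ∑ e, Θ c e * b e i) ?_ ?_ ?_ ?_
  · intro Θ hΘ
    exact Finset.mem_filter.2 ⟨Finset.mem_univ _, balanced_of_alt hΘ b⟩
  · intro Θ _ Θ' _ h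
    exact alt_injective hb h
  · intro Y hY
    obtain ⟨Θ, hΘ, h⟩ := alt_of_balanced hb (Finset.mem_filter.1 hY).2
    exact ⟨Θ, hΘ, h.symm⟩
  · intro _ _; rfl

end Alternating

section Moment
open scoped Classical

variable {K : Type} [AddCommGroup K] [Module (ZMod 2) K] [Fintype K] {j m : ℕ}

lemma sum_comb_eq (a : Fin j → ZMod 2) {c₀ : Fin j} (h : a c₀ = 1) (G : K → ℝ) :
    (Fintype.card K : ℝ) * ∑ X : Fin j → K, G (∑ c, a c • X c) =
      (Fintype.card K : ℝ) ^ j * ∑ z, G z := by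
  have h1 : ∀ z : K, ∑ X : Fin j → K, G (∑ c, a c • X c) =
      ∑ X : Fin j → K, G (∑ c, a c • X c + z) := by
    intro z
    rw [← Equiv.sum_comp (Equiv.addRight (Pi.single c₀ z : Fin j → K))]
    refine Finset.sum_congr rfl fun X _ => ?_
    congr 1
    simp only [Equiv.coe_addRight, Pi.add_apply, smul_add, Finset.sum_add_distrib]
    congr 1
    rw [Finset.sum_eq_single c₀ (fun c _ hc => by simp [Pi.single_apply, hc]) (by simp)]
    simp [h]
  have h2 : (Fintype.card K : ℝ) * ∑ X : Fin j → K, G (∑ c, a c • X c) =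
      ∑ z : K, ∑ X : Fin j → K, G (∑ c, a c • X c + z) := by
    rw [Finset.sum_congr rfl fun z _ => (h1 z).symm]
    simp
  rw [h2, Finset.sum_comm]
  have h3 : ∀ w : K, ∑ z, G (w + z) = ∑ z, G z := fun w =>
    Equiv.sum_comp (Equiv.addLeft w) G
  simp [h3]

/-- The alternating form attached to a pair of linear maps. -/
def omegaForm (π h : K →ₗ[ZMod 2] (Fin m → ZMod 2)) (x z : K) : ZMod 2 :=
  ∑ i, (π z i * h x i + π x i * h z i)

/-- The exponent attached to a symmetric matrix. -/
def quadExp (π h : K →ₗ[ZMod 2] (Fin m → ZMod 2)) (Θ : Fin j → Fin j → ZMod 2)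
    (X : Fin j → K) : ZMod 2 :=
  ∑ c, ∑ i, (∑ e, Θ c e * π (X e) i) * h (X c) i

lemma quadExp_add_single (π h : K →ₗ[ZMod 2] (Fin m → ZMod 2)) {Θ : Fin j → Fin j → ZMod 2}
    (hΘ : Θ ∈ altMatrices j) (X : Fin j → K) (c₀ : Fin j) (z : K) :
    quadExp π h Θ (X + Pi.single c₀ z) =
      quadExp π h Θ X + omegaForm π h z (∑ e, Θ c₀ e • X e) := by
  obtain ⟨h0, hs⟩ := mem_altMatrices.1 hΘ
  have hsingle : ∀ (g : K →ₗ[ZMod 2] (Fin m → ZMod 2)) (c : Fin j) (i : Fin m),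
      g ((Pi.single c₀ z : Fin j → K) c) i = if c = c₀ then g z i else 0 := by
    intro g c i
    by_cases hc : c = c₀
    · subst hc; simp
    · simp [hc]
  have e1 : ∀ c i, ∑ e, Θ c e * π ((X + Pi.single c₀ z : Fin j → K) e) i =
      (∑ e, Θ c e * π (X e) i) + Θ c c₀ * π z i := by
    intro c i
    simp only [Pi.add_apply, map_add, mul_add, Finset.sum_add_distrib, hsingle]
    congr 1
    simp
  simp only [quadExp, e1, omegaForm]
  simp only [Pi.add_apply, map_add, hsingle, mul_add, add_mul, Finset.sum_add_distrib,
    mul_ite, mul_zero, map_sum, map_smul, Finset.sum_apply, Pi.smul_apply, smul_eq_mul]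
  have e3 : ∑ c, ∑ i, (if c = c₀ then (∑ e, Θ c e * π (X e) i) * h z i +
      Θ c c₀ * π z i * h z i else 0) = ∑ i, (∑ e, Θ c₀ e * π (X e) i) * h z i := by
    rw [Finset.sum_eq_single c₀ (fun c _ hc => by simp [hc]) (by simp)]
    simp [h0]
  have e4 : ∑ c, ∑ i, Θ c c₀ * π z i * h (X c) i = ∑ i, π z i * ∑ e, Θ c₀ e * h (X e) i := by
    rw [Finset.sum_comm]
    refine Finset.sum_congr rfl fun i _ => ?_
    rw [Finset.mul_sum]
    exact Finset.sum_congr rfl fun c _ => by rw [hs c c₀]; ring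
  rw [e3, e4]
  ring

lemma abs_sum_quadExp_le (π h : K →ₗ[ZMod 2] (Fin m → ZMod 2)) {Θ : Fin j → Fin j → ZMod 2}
    (hΘ : Θ ∈ altMatrices j) (hne : Θ ≠ 0) {ρ : ℕ}
    (hρ : (Finset.univ.filter fun z : K => ∀ x, omegaForm π h x z = 0).card ≤ ρ) :
    (Fintype.card K : ℝ) * |∑ X, sgn (quadExp π h Θ X)| ≤ (Fintype.card K : ℝ) ^ j * ρ := by
  obtain ⟨c₀, hc₀⟩ : ∃ c, Θ c ≠ 0 := by
    by_contra! hall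
    exact hne (funext hall)
  obtain ⟨e₀, he₀⟩ : ∃ e, Θ c₀ e ≠ 0 := by
    by_contra! hall
    exact hc₀ (funext hall)
  have h1 : Θ c₀ e₀ = 1 := (zmod_two_cases _).resolve_left he₀
  have hshift : ∀ z : K, ∑ X, sgn (quadExp π h Θ X) =
      ∑ X, sgn (quadExp π h Θ X) * sgn (omegaForm π h z (∑ e, Θ c₀ e • X e)) := by
    intro z
    rw [← Equiv.sum_comp (Equiv.addRight (Pi.single c₀ z : Fin j → K))]
    refine Finset.sum_congr rfl fun X _ => ?_
    rw [Equiv.coe_addRight, quadExp_add_single π h hΘ, sgn_add]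
  have hsum : ∀ w : K, ∑ z, sgn (omegaForm π h z w) =
      Fintype.card K * (if ∀ x, omegaForm π h x w = 0 then (1 : ℝ) else 0) := by
    intro w
    split_ifs with hw
    · rw [sum_sgn_eq_card _ hw, mul_one]
    · push Not at hw
      obtain ⟨x₀, hx₀⟩ := hw
      rw [mul_zero]
      exact sum_sgn_eq_zero (⟨⟨fun z => omegaForm π h z w, by simp [omegaForm]⟩, fun x y => by
        simp only [omegaForm, map_add, Pi.add_apply, ← Finset.sum_add_distrib]
        exact Finset.sum_congr rfl fun i _ => by ring⟩ : K →+ ZMod 2) hx₀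
  have h2 : (Fintype.card K : ℝ) * ∑ X, sgn (quadExp π h Θ X) =
      ∑ X, sgn (quadExp π h Θ X) * (Fintype.card K *
        (if ∀ x, omegaForm π h x (∑ e, Θ c₀ e • X e) = 0 then (1 : ℝ) else 0)) := by
    calc (Fintype.card K : ℝ) * ∑ X, sgn (quadExp π h Θ X)
        = ∑ z : K, ∑ X, sgn (quadExp π h Θ X) *
            sgn (omegaForm π h z (∑ e, Θ c₀ e • X e)) := by
          rw [Finset.sum_congr rfl fun z _ => (hshift z).symm]
          simp
      _ = _ := by
          rw [Finset.sum_comm]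
          refine Finset.sum_congr rfl fun X _ => ?_
          rw [← Finset.mul_sum, hsum]
  have h3 : |(Fintype.card K : ℝ) * ∑ X, sgn (quadExp π h Θ X)| ≤
      (Fintype.card K : ℝ) * ∑ X : Fin j → K,
        (if ∀ x, omegaForm π h x (∑ e, Θ c₀ e • X e) = 0 then (1 : ℝ) else 0) := by
    rw [h2, Finset.mul_sum]
    refine (Finset.abs_sum_le_sum_abs _ _).trans (Finset.sum_le_sum fun X _ => ?_)
    rw [abs_mul, abs_sgn, one_mul, abs_of_nonneg]
    positivity
  rw [abs_mul, abs_of_nonneg (Nat.cast_nonneg _)] at h3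
  refine h3.trans ?_
  rw [sum_comb_eq (Θ c₀) h1 fun w => if ∀ x, omegaForm π h x w = 0 then (1 : ℝ) else 0]
  refine mul_le_mul_of_nonneg_left ?_ (by positivity)
  rw [Finset.sum_boole]
  exact_mod_cast hρ

lemma card_dependent_le (π : K →ₗ[ZMod 2] (Fin m → ZMod 2)) {t : ℕ}
    (ht : (Finset.univ.filter fun z : K => π z = 0).card ≤ t) :
    (Fintype.card K : ℝ) * ((Finset.univ.filter fun X : Fin j → K =>
      ¬ LinearIndependent (ZMod 2) fun c => π (X c)).card : ℝ) ≤
      2 ^ j * (Fintype.card K : ℝ) ^ j * t := by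
  have h1 : ((Finset.univ.filter fun X : Fin j → K =>
      ¬ LinearIndependent (ZMod 2) fun c => π (X c)).card : ℝ) ≤
      ∑ a ∈ (Finset.univ : Finset (Fin j → ZMod 2)).filter (fun a => a ≠ 0),
        ∑ X : Fin j → K, (if π (∑ c, a c • X c) = 0 then (1 : ℝ) else 0) := by
    rw [Finset.sum_comm, ← Finset.sum_boole]
    refine Finset.sum_le_sum fun X _ => ?_
    have hn : ∀ a ∈ (Finset.univ : Finset (Fin j → ZMod 2)).filter (fun a => a ≠ 0),
        0 ≤ (if π (∑ c, a c • X c) = 0 then (1 : ℝ) else 0) := fun a _ => by positivity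
    by_cases hX : LinearIndependent (ZMod 2) fun c => π (X c)
    swap
    · rw [if_pos hX]
      rw [Fintype.linearIndependent_iff] at hX
      push Not at hX
      obtain ⟨a, ha, c, hc⟩ := hX
      have hmem : a ∈ (Finset.univ : Finset (Fin j → ZMod 2)).filter (fun a => a ≠ 0) :=
        Finset.mem_filter.2 ⟨Finset.mem_univ _, fun h => hc (by rw [h]; rfl)⟩
      refine le_trans ?_ (Finset.single_le_sum hn hmem)
      rw [if_pos]
      rw [map_sum, ← ha]
      simp only [map_smul]
    · rw [if_neg (not_not.2 hX)]
      exact Finset.sum_nonneg hn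
  have h2 : ∀ a ∈ (Finset.univ : Finset (Fin j → ZMod 2)).filter (fun a => a ≠ 0),
      (Fintype.card K : ℝ) * ∑ X : Fin j → K,
        (if π (∑ c, a c • X c) = 0 then (1 : ℝ) else 0) ≤ (Fintype.card K : ℝ) ^ j * t := by
    intro a ha
    obtain ⟨c₀, hc₀⟩ : ∃ c, a c ≠ 0 := by
      by_contra! hall
      exact (Finset.mem_filter.1 ha).2 (funext hall)
    rw [sum_comb_eq a ((zmod_two_cases _).resolve_left hc₀)
      fun w => if π w = 0 then (1 : ℝ) else 0, Finset.sum_boole]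
    exact mul_le_mul_of_nonneg_left (by exact_mod_cast ht) (by positivity)
  calc _ ≤ (Fintype.card K : ℝ) * _ := mul_le_mul_of_nonneg_left h1 (by positivity)
    _ = ∑ a ∈ (Finset.univ : Finset (Fin j → ZMod 2)).filter (fun a => a ≠ 0),
        (Fintype.card K : ℝ) * ∑ X : Fin j → K,
          (if π (∑ c, a c • X c) = 0 then (1 : ℝ) else 0) := Finset.mul_sum _ _ _
    _ ≤ _ := Finset.sum_le_sum h2
    _ ≤ _ := by
      rw [Finset.sum_const, nsmul_eq_mul, mul_assoc]
      refine mul_le_mul_of_nonneg_right ?_ (by positivity)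
      have : ((Finset.univ : Finset (Fin j → ZMod 2)).filter (fun a => a ≠ 0)).card ≤ 2 ^ j := by
        refine (Finset.card_le_univ _).trans ?_
        simp
      exact_mod_cast this

/-- The main term dominates in the moment sum. -/
lemma abs_moment_sub_le (π h : K →ₗ[ZMod 2] (Fin m → ZMod 2)) (hK : Fintype.card K = 2 ^ m)
    {ρ t : ℕ} (hρ : (Finset.univ.filter fun z : K => ∀ x, omegaForm π h x z = 0).card ≤ ρ)
    (ht : (Finset.univ.filter fun z : K => π z = 0).card ≤ t) :
    |∑ X : Fin j → K, (if LinearIndependent (ZMod 2) (fun c => π (X c)) then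
      ∑ Θ ∈ altMatrices j, sgn (quadExp π h Θ X) else 0) - (2 ^ m) ^ j| ≤
      2 ^ (j ^ 2) * ((2 ^ m) ^ j * (ρ + 2 ^ j * t) / 2 ^ m) := by
  have hK' : (Fintype.card K : ℝ) = 2 ^ m := by exact_mod_cast hK
  set Dep := Finset.univ.filter fun X : Fin j → K =>
      ¬ LinearIndependent (ZMod 2) fun c => π (X c) with hDep
  have hdep : (Dep.card : ℝ) ≤ (2 ^ m) ^ j * (2 ^ j * t) / 2 ^ m := by
    have := card_dependent_le (j := j) π ht
    rw [hK'] at this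
    rw [le_div_iff₀ (by positivity)]
    linarith
  have h0mem : (0 : Fin j → Fin j → ZMod 2) ∈ altMatrices j := by simp [mem_altMatrices]
  have hsplit : ∀ Θ : Fin j → Fin j → ZMod 2,
      ∑ X : Fin j → K, (if LinearIndependent (ZMod 2) (fun c => π (X c)) then
        sgn (quadExp π h Θ X) else 0) =
      ∑ X, sgn (quadExp π h Θ X) - ∑ X ∈ Dep, sgn (quadExp π h Θ X) := by
    intro Θ
    rw [hDep, Finset.sum_filter, ← Finset.sum_sub_distrib]
    refine Finset.sum_congr rfl fun X _ => ?_
    split_ifs <;> simp_all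
  have hD : ∀ Θ : Fin j → Fin j → ZMod 2,
      |∑ X ∈ Dep, sgn (quadExp π h Θ X)| ≤ (2 ^ m) ^ j * (2 ^ j * t) / 2 ^ m := by
    intro Θ
    refine (Finset.abs_sum_le_sum_abs _ _).trans ?_
    simpa [abs_sgn] using hdep
  have hterm : ∀ Θ ∈ altMatrices j, |∑ X : Fin j → K,
      (if LinearIndependent (ZMod 2) (fun c => π (X c)) then sgn (quadExp π h Θ X) else 0) -
        (if Θ = 0 then (2 ^ m) ^ j else 0)| ≤ (2 ^ m) ^ j * (ρ + 2 ^ j * t) / 2 ^ m := by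
    intro Θ hΘ
    rw [hsplit]
    have hDΘ := hD Θ
    split_ifs with h0
    · have : ∑ X : Fin j → K, sgn (quadExp π h Θ X) = (2 ^ m) ^ j := by
        rw [sum_sgn_eq_card _ (fun X => by simp [h0, quadExp])]
        simp [hK]
      rw [this, sub_sub_cancel_left, abs_neg]
      refine hDΘ.trans ?_
      gcongr
      simp
    · have h1 := abs_sum_quadExp_le π h hΘ h0 hρ
      rw [hK'] at h1
      have h2 : |∑ X, sgn (quadExp π h Θ X)| ≤ (2 ^ m) ^ j * ρ / 2 ^ m := by
        rw [le_div_iff₀ (by positivity)]; linarith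
      rw [sub_zero]
      refine (abs_sub _ _).trans ((add_le_add h2 hDΘ).trans (le_of_eq ?_))
      ring
  have hswap : ∑ X : Fin j → K, (if LinearIndependent (ZMod 2) (fun c => π (X c)) then
      ∑ Θ ∈ altMatrices j, sgn (quadExp π h Θ X) else 0) =
      ∑ Θ ∈ altMatrices j, ∑ X : Fin j → K,
        (if LinearIndependent (ZMod 2) (fun c => π (X c)) then sgn (quadExp π h Θ X) else 0) := by
    rw [Finset.sum_comm]
    refine Finset.sum_congr rfl fun X _ => ?_
    split_ifs <;> simp
  have hmain : ((2 : ℝ) ^ m) ^ j =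
      ∑ Θ ∈ altMatrices j, (if Θ = 0 then ((2 : ℝ) ^ m) ^ j else 0) := by
    rw [Finset.sum_ite_eq' (altMatrices j) 0, if_pos h0mem]
  conv_lhs => rw [hswap, hmain, ← Finset.sum_sub_distrib]
  refine (Finset.abs_sum_le_sum_abs _ _).trans ((Finset.sum_le_sum hterm).trans ?_)
  rw [Finset.sum_const, nsmul_eq_mul]
  refine mul_le_mul_of_nonneg_right ?_ (by positivity)
  exact_mod_cast card_altMatrices_le

end Moment

section Symbols

variable {σ : Type} [Fintype σ] {m : ℕ}

/-- Pairs of indices in increasing order. -/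
abbrev IncPair (n : ℕ) := {p : Fin n × Fin n // p.1 < p.2}

/-- Prepend a zero coordinate. -/
def consZero (b : Fin m → ZMod 2) : Fin (m + 1) → ZMod 2 := Fin.cons 0 b

@[simp] lemma consZero_zero (b : Fin m → ZMod 2) : consZero b 0 = 0 := rfl

@[simp] lemma consZero_succ (b : Fin m → ZMod 2) (i : Fin m) : consZero b i.succ = b i := rfl

lemma consZero_add (b c : Fin m → ZMod 2) : consZero (b + c) = consZero b + consZero c := by
  ext i
  refine Fin.cases ?_ (fun i => ?_) i <;> simp

lemma consZero_smul (a : ZMod 2) (b : Fin m → ZMod 2) : consZero (a • b) = a • consZero b := by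
  ext i
  refine Fin.cases ?_ (fun i => ?_) i <;> simp

/-- The symbols attached to a squarefree polynomial which do not involve two large primes. -/
structure SymbolData (σ : Type) (m : ℕ) where
  /-- small over small -/
  ss : σ → σ → ZMod 2
  /-- small over large -/
  sl : σ → Fin (m + 1) → ZMod 2
  /-- large over small -/
  ls : Fin (m + 1) → σ → ZMod 2
  /-- parities of degrees -/
  par : Fin (m + 1) → ZMod 2

namespace SymbolData

variable (T : SymbolData σ m)

/-- The symbol of two large primes. -/
def ll (t : IncPair (m + 1) → ZMod 2) (I J : Fin (m + 1)) : ZMod 2 :=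
  if h : I < J then t ⟨(I, J), h⟩ else if h : J < I then t ⟨(J, I), h⟩ + T.par I * T.par J else 0

/-- The row of a small prime. -/
def smallRow (p : σ) (x : (σ → ZMod 2) × (Fin m → ZMod 2)) : ZMod 2 :=
  ∑ p', T.ss p p' * (x.1 p' + x.1 p) + ∑ I, T.sl p I * (consZero x.2 I + x.1 p)

/-- The row of a large prime. -/
def largeRow (t : IncPair (m + 1) → ZMod 2) (i : Fin m)
    (x : (σ → ZMod 2) × (Fin m → ZMod 2)) : ZMod 2 :=
  ∑ p, T.ls i.succ p * (x.1 p + x.2 i) + ∑ J, T.ll t i.succ J * (consZero x.2 J + x.2 i)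

/-- The part of a large row which does not involve symbols of two large primes. -/
def fixedRow : ((σ → ZMod 2) × (Fin m → ZMod 2)) →ₗ[ZMod 2] (Fin m → ZMod 2) where
  toFun x i := ∑ p, T.ls i.succ p * (x.1 p + x.2 i) +
    ∑ J, (if J < i.succ then T.par i.succ * T.par J else 0) * (consZero x.2 J + x.2 i)
  map_add' x y := by
    ext i
    simp only [Prod.fst_add, Prod.snd_add, consZero_add, Pi.add_apply]
    rw [add_add_add_comm, ← Finset.sum_add_distrib, ← Finset.sum_add_distrib]
    congr 1 <;> exact Finset.sum_congr rfl fun _ _ => by ring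
  map_smul' a x := by
    ext i
    simp only [Prod.smul_fst, Prod.smul_snd, consZero_smul, Pi.smul_apply, smul_eq_mul,
      RingHom.id_apply]
    rw [mul_add, Finset.mul_sum, Finset.mul_sum]
    congr 1 <;> exact Finset.sum_congr rfl fun _ _ => by ring

/-- The vectors on which all small rows vanish. -/
def smallKer : Submodule (ZMod 2) ((σ → ZMod 2) × (Fin m → ZMod 2)) where
  carrier := {x | ∀ p, T.smallRow p x = 0}
  zero_mem' p := by
    have : consZero (0 : Fin m → ZMod 2) = 0 := by
      ext i; refine Fin.cases ?_ (fun i => ?_) i <;> simp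
    simp [smallRow, this]
  add_mem' {x y} hx hy p := by
    have h : T.smallRow p (x + y) = T.smallRow p x + T.smallRow p y := by
      simp only [smallRow, Prod.fst_add, Prod.snd_add, consZero_add, Pi.add_apply]
      rw [add_add_add_comm, ← Finset.sum_add_distrib, ← Finset.sum_add_distrib]
      congr 1 <;> exact Finset.sum_congr rfl fun _ _ => by ring
    rw [h, hx p, hy p, add_zero]
  smul_mem' a x hx p := by
    have h : T.smallRow p (a • x) = a * T.smallRow p x := by
      simp only [smallRow, Prod.smul_fst, Prod.smul_snd, consZero_smul, Pi.smul_apply,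
        smul_eq_mul]
      rw [mul_add, Finset.mul_sum, Finset.mul_sum]
      congr 1 <;> exact Finset.sum_congr rfl fun _ _ => by ring
    rw [h, hx p, mul_zero]

lemma mem_smallKer {x : (σ → ZMod 2) × (Fin m → ZMod 2)} :
    x ∈ T.smallKer ↔ ∀ p, T.smallRow p x = 0 := Iff.rfl

lemma smallRow_add (p : σ) (x y : (σ → ZMod 2) × (Fin m → ZMod 2)) :
    T.smallRow p (x + y) = T.smallRow p x + T.smallRow p y := by
  simp only [smallRow, Prod.fst_add, Prod.snd_add, consZero_add, Pi.add_apply]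
  rw [add_add_add_comm, ← Finset.sum_add_distrib, ← Finset.sum_add_distrib]
  congr 1 <;> exact Finset.sum_congr rfl fun _ _ => by ring

lemma smallRow_zero (p : σ) : T.smallRow p 0 = 0 := T.smallKer.zero_mem p

open Classical in
/-- If no combination of the small rows is trivial, their common kernel has the expected size. -/
lemma card_smallKer (h : ∀ y : σ → ZMod 2, y ≠ 0 → ∃ I, ∑ p, y p * T.sl p I ≠ 0) :
    Fintype.card T.smallKer = 2 ^ m := by
  have h1 : ∀ y : σ → ZMod 2, ∑ x : (σ → ZMod 2) × (Fin m → ZMod 2),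
      sgn (∑ p, y p * T.smallRow p x) =
      if y = 0 then (2 : ℝ) ^ (Fintype.card σ) * 2 ^ m else 0 := by
    intro y
    split_ifs with hy
    · subst hy
      rw [sum_sgn_eq_card _ (fun x => by simp)]
      simp
    · obtain ⟨I, hI⟩ := h y hy
      have key : ∃ x : (σ → ZMod 2) × (Fin m → ZMod 2), ∑ p, y p * T.smallRow p x ≠ 0 := by
        rcases Fin.eq_zero_or_eq_succ I with rfl | ⟨i, rfl⟩
        · refine ⟨(1, 1), ?_⟩
          convert hI using 3 with p
          simp [smallRow, Fin.sum_univ_succ, zmod_two_add_self,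
            show (1 : ZMod 2) + 1 = 0 from rfl]
        · refine ⟨(0, Pi.single i 1), ?_⟩
          convert hI using 3 with p
          simp [smallRow, Fin.sum_univ_succ, Pi.single_apply]
      obtain ⟨x₀, hx₀⟩ := key
      exact sum_sgn_eq_zero (⟨⟨fun x => ∑ p, y p * T.smallRow p x, by simp [smallRow_zero]⟩,
        fun a b => by
          simp only [smallRow_add, mul_add, Finset.sum_add_distrib]⟩ :
          (σ → ZMod 2) × (Fin m → ZMod 2) →+ ZMod 2) hx₀
  have h2 : ∑ y : σ → ZMod 2, ∑ x : (σ → ZMod 2) × (Fin m → ZMod 2),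
      sgn (∑ p, y p * T.smallRow p x) = (2 : ℝ) ^ (Fintype.card σ) * 2 ^ m := by
    simp [h1]
  rw [Finset.sum_comm] at h2
  have h3 : ∀ x : (σ → ZMod 2) × (Fin m → ZMod 2), ∑ y : σ → ZMod 2,
      sgn (∑ p, y p * T.smallRow p x) =
      if x ∈ T.smallKer then (2 : ℝ) ^ (Fintype.card σ) else 0 := by
    intro x
    have := sum_sgn_dot (fun p => T.smallRow p x) 0
    simp only [zero_add, sgn_zero, mul_one] at this
    rw [this]
    exact if_congr Iff.rfl rfl rfl
  simp only [h3] at h2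
  rw [← Finset.sum_filter, Finset.sum_const, nsmul_eq_mul, mul_comm] at h2
  have h4 := mul_left_cancel₀ (by positivity) h2
  rw [Fintype.card_subtype]
  exact_mod_cast h4

open Classical in
/-- A vector with vanishing small part in the kernel. -/
lemma card_smallKer_snd_eq_zero : (Finset.univ.filter fun z : T.smallKer => z.1.2 = 0).card ≤
    2 ^ Fintype.card σ := by
  have : (Finset.univ : Finset (σ → ZMod 2)).card = 2 ^ Fintype.card σ := by simp
  rw [← this]
  refine Finset.card_le_card_of_injOn (fun z => z.1.1) (fun _ _ => Finset.mem_univ _) ?_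
  intro z hz w hw hzw
  have hz' := (Finset.mem_filter.1 hz).2
  have hw' := (Finset.mem_filter.1 hw).2
  exact Subtype.ext (Prod.ext hzw (hz'.trans hw'.symm))

end SymbolData

end Symbols

section Radical
open scoped Classical

variable {σ : Type} [Fintype σ] {m : ℕ}

namespace SymbolData

variable (T : SymbolData σ m)

/-- The off-diagonal part of the radical equation. -/
def offDiag (b : Fin m → ZMod 2) (i : Fin m) : ZMod 2 :=
  T.par i.succ * ∑ k, if k = i then 0 else T.par k.succ * b k

/-- The projection of the small kernel to the large coordinates. -/
def proj : T.smallKer →ₗ[ZMod 2] (Fin m → ZMod 2) :=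
  (LinearMap.snd (ZMod 2) (σ → ZMod 2) (Fin m → ZMod 2)).comp T.smallKer.subtype

/-- The fixed rows on the small kernel. -/
def fixedOn : T.smallKer →ₗ[ZMod 2] (Fin m → ZMod 2) := T.fixedRow.comp T.smallKer.subtype

lemma fixedRow_apply (x : (σ → ZMod 2) × (Fin m → ZMod 2)) (i : Fin m) :
    T.fixedRow x i = ∑ p, T.ls i.succ p * x.1 p +
      (∑ p, T.ls i.succ p + ∑ J, if J < i.succ then T.par i.succ * T.par J else 0) * x.2 i +
      ∑ k, (if k < i then T.par i.succ * T.par k.succ * x.2 k else 0) := by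
  have h1 : ∑ J, (if J < i.succ then T.par i.succ * T.par J else 0) * consZero x.2 J =
      ∑ k, (if k < i then T.par i.succ * T.par k.succ * x.2 k else 0) := by
    rw [Fin.sum_univ_succ]
    simp [Fin.succ_lt_succ_iff, ite_mul]
  rw [← h1]
  simp only [fixedRow, LinearMap.coe_mk, AddHom.coe_mk, mul_add, Finset.sum_add_distrib,
    ← Finset.sum_mul]
  ring

lemma omega_eq (b' b : Fin m → ZMod 2) (a : σ → ZMod 2) :
    ∑ i, (b i * T.fixedRow (0, b') i + b' i * T.fixedRow (a, b) i) =
      ∑ i, b' i * (∑ p, T.ls i.succ p * a p + T.offDiag b i) := by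
  have h2 : ∑ i, b i * ∑ k, (if k < i then T.par i.succ * T.par k.succ * b' k else 0) =
      ∑ i, b' i * ∑ k, (if i < k then T.par i.succ * T.par k.succ * b k else 0) := by
    simp only [Finset.mul_sum]
    rw [Finset.sum_comm]
    refine Finset.sum_congr rfl fun i _ => Finset.sum_congr rfl fun k _ => ?_
    split_ifs <;> ring
  have h3 : ∀ i, T.offDiag b i = ∑ k, (if i < k then T.par i.succ * T.par k.succ * b k else 0) +
      ∑ k, (if k < i then T.par i.succ * T.par k.succ * b k else 0) := by
    intro i
    rw [offDiag, Finset.mul_sum, ← Finset.sum_add_distrib]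
    refine Finset.sum_congr rfl fun k _ => ?_
    rcases lt_trichotomy i k with h | h | h
    · simp [h, h.ne', h.not_gt, mul_assoc]
    · simp [h]
    · simp [h, h.ne, h.not_gt, mul_assoc]
  simp only [fixedRow_apply, h3, Finset.sum_add_distrib, mul_add]
  rw [h2]
  have h4 : ∀ g : Fin m → ZMod 2, ∑ i, b i * (g i * b' i) + ∑ i, b' i * (g i * b i) = 0 := by
    intro g
    rw [← Finset.sum_add_distrib]
    refine Finset.sum_eq_zero fun i _ => ?_
    rw [show b i * (g i * b' i) = b' i * (g i * b i) by ring]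
    exact zmod_two_add_self _
  have h5 := h4 fun i => ∑ p, T.ls i.succ p +
    ∑ J, if J < i.succ then T.par i.succ * T.par J else 0
  simp only [Pi.zero_apply, mul_zero, Finset.sum_const_zero, zero_add, ← mul_add]
  linear_combination h5

lemma exists_row_comb (c : Fin m → ZMod 2)
    (h : ∀ b' : Fin m → ZMod 2, (∀ p, ∑ i, T.sl p (Fin.succ i) * b' i = 0) →
      ∑ i, b' i * c i = 0) : ∃ w : σ → ZMod 2, ∀ i, c i = ∑ p, w p * T.sl p i.succ := by
  let dot : (Fin m → ZMod 2) → ((Fin m → ZMod 2) →ₗ[ZMod 2] ZMod 2) := fun c =>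
    ∑ i, c i • LinearMap.proj i
  have hdot : ∀ c b, dot c b = ∑ i, c i * b i := by
    intro c b
    simp [dot]
  have hmem := mem_span_of_iInf_ker_le_ker (L := fun p : σ => dot fun i => T.sl p i.succ)
    (K := dot c) (by
      intro b' hb'
      rw [Submodule.mem_iInf] at hb'
      rw [LinearMap.mem_ker, hdot]
      rw [← h b' fun p => by have := hb' p; rwa [LinearMap.mem_ker, hdot] at this]
      exact Finset.sum_congr rfl fun i _ => mul_comm _ _)
  rw [Submodule.mem_span_range_iff_exists_fun] at hmem
  obtain ⟨w, hw⟩ := hmem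
  refine ⟨w, fun i => ?_⟩
  have := LinearMap.congr_fun hw (Pi.single i 1)
  simp only [LinearMap.sum_apply, LinearMap.smul_apply, hdot, smul_eq_mul, Pi.single_apply,
    mul_ite, mul_one, mul_zero, Finset.sum_ite_eq', Finset.mem_univ, if_true] at this
  exact this.symm

lemma card_offDiag_fiber_le (c : Fin m → ZMod 2) :
    (Finset.univ.filter fun b => ∀ i, T.offDiag b i = c i).card *
      2 ^ (Finset.univ.filter fun i : Fin m => T.par i.succ = 1).card ≤ 2 ^ (m + 1) := by
  set k := (Finset.univ.filter fun i : Fin m => T.par i.succ = 1).card with hk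
  have hk' : k + Fintype.card {i : Fin m // ¬ T.par i.succ = 1} = m := by
    rw [Fintype.card_subtype, hk, Finset.card_filter_add_card_filter_not]
    simp
  have h1 : (Finset.univ.filter fun b => ∀ i, T.offDiag b i = c i).card ≤
      (Finset.univ : Finset (ZMod 2 × ({i : Fin m // ¬ T.par i.succ = 1} → ZMod 2))).card := by
    refine Finset.card_le_card_of_injOn
      (fun b => (∑ k, T.par k.succ * b k, fun i => b i.1)) (fun _ _ => Finset.mem_univ _) ?_
    intro b hb b' hb' h
    have hb := (Finset.mem_filter.1 hb).2
    have hb' := (Finset.mem_filter.1 hb').2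
    simp only [Prod.mk.injEq] at h
    ext i
    by_cases hi : T.par i.succ = 1
    · have e : ∀ b : Fin m → ZMod 2, T.offDiag b i = ∑ k, T.par k.succ * b k + b i := by
        intro b
        have : ∀ k, (if k = i then 0 else T.par k.succ * b k) =
            T.par k.succ * b k + if k = i then b k else 0 := by
          intro k
          split_ifs with hki
          · subst hki
            rw [hi, one_mul, zmod_two_add_self]
          · rw [add_zero]
        rw [offDiag, hi, one_mul, Finset.sum_congr rfl fun k _ => this k, Finset.sum_add_distrib]
        simp
      have := (hb i).trans (hb' i).symm
      rw [e, e, h.1] at this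
      exact add_left_cancel this
    · exact congrFun h.2 ⟨i, hi⟩
  have h2 : (Finset.univ : Finset (ZMod 2 × ({i : Fin m // ¬ T.par i.succ = 1} → ZMod 2))).card =
      2 * 2 ^ Fintype.card {i : Fin m // ¬ T.par i.succ = 1} := by
    simp [Fintype.card_prod]
  rw [h2] at h1
  calc _ ≤ 2 * 2 ^ Fintype.card {i : Fin m // ¬ T.par i.succ = 1} * 2 ^ k := by gcongr
    _ = 2 ^ (m + 1) := by
      have h3 : (2 : ℕ) ^ (m + 1) =
          2 ^ (k + Fintype.card {i : Fin m // ¬ T.par i.succ = 1} + 1) := by rw [hk']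
      rw [h3]
      ring

lemma card_radical_le :
    (Finset.univ.filter fun z : T.smallKer => ∀ x, omegaForm T.proj T.fixedOn x z = 0).card *
      2 ^ (Finset.univ.filter fun i : Fin m => T.par i.succ = 1).card ≤
      2 ^ (2 * Fintype.card σ) * 2 ^ (m + 1) := by
  set k := (Finset.univ.filter fun i : Fin m => T.par i.succ = 1).card with hk
  set Rad := Finset.univ.filter fun z : T.smallKer =>
    ∀ x, omegaForm T.proj T.fixedOn x z = 0 with hRad
  let cst : (σ → ZMod 2) × (σ → ZMod 2) → Fin m → ZMod 2 := fun aw i =>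
    ∑ p, T.ls i.succ p * aw.1 p + ∑ p, aw.2 p * T.sl p i.succ
  have hex : ∀ z ∈ Rad, ∃ w : σ → ZMod 2, ∀ i, T.offDiag z.1.2 i = cst (z.1.1, w) i := by
    intro z hz
    have hz' := (Finset.mem_filter.1 hz).2
    obtain ⟨w, hw⟩ := T.exists_row_comb
      (fun i => ∑ p, T.ls i.succ p * z.1.1 p + T.offDiag z.1.2 i) (by
        intro b' hb'
        rw [← T.omega_eq]
        have hmem : ((0 : σ → ZMod 2), b') ∈ T.smallKer := by
          intro p
          have := hb' p
          simp only [smallRow, Fin.sum_univ_succ]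
          simpa using this
        exact hz' ⟨_, hmem⟩)
    refine ⟨w, fun i => ?_⟩
    have := hw i
    simp only [cst]
    rw [← this, ← add_assoc, zmod_two_add_self, zero_add]
  have h1 : Rad.card ≤ ∑ aw : (σ → ZMod 2) × (σ → ZMod 2),
      (Finset.univ.filter fun b => ∀ i, T.offDiag b i = cst aw i).card := by
    rw [← Finset.card_sigma]
    choose! w hw using hex
    refine Finset.card_le_card_of_injOn
      (fun z => ⟨(z.1.1, w z), z.1.2⟩) ?_ ?_
    · intro z hz
      simp only [Finset.coe_sigma, Set.mem_sigma_iff, Finset.mem_coe, Finset.mem_univ, true_and,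
        Finset.mem_filter]
      exact hw z hz
    · intro z hz z' hz' h
      simp only [Sigma.mk.injEq, Prod.mk.injEq, heq_eq_eq] at h
      exact Subtype.ext (Prod.ext h.1.1 h.2)
  calc Rad.card * 2 ^ k ≤ (∑ aw : (σ → ZMod 2) × (σ → ZMod 2),
      (Finset.univ.filter fun b => ∀ i, T.offDiag b i = cst aw i).card) * 2 ^ k := by gcongr
    _ = ∑ aw : (σ → ZMod 2) × (σ → ZMod 2),
      (Finset.univ.filter fun b => ∀ i, T.offDiag b i = cst aw i).card * 2 ^ k :=
        Finset.sum_mul _ _ _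
    _ ≤ ∑ _aw : (σ → ZMod 2) × (σ → ZMod 2), 2 ^ (m + 1) :=
        Finset.sum_le_sum fun aw _ => T.card_offDiag_fiber_le (cst aw)
    _ = _ := by
      simp [Fintype.card_prod]
      ring

end SymbolData

end Radical

section LargeRows
open scoped Classical

variable {σ : Type} [Fintype σ] {m : ℕ}

/-- A function on increasing pairs, extended by zero. -/
def pairExt {n : ℕ} (t : IncPair n → ZMod 2) (I J : Fin n) : ZMod 2 :=
  if h : I < J then t ⟨(I, J), h⟩ else 0

lemma sum_pairExt_mul {n : ℕ} (t : IncPair n → ZMod 2) (H : Fin n → Fin n → ZMod 2) :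
    ∑ I, ∑ J, pairExt t I J * H I J = ∑ e : IncPair n, t e * H e.1.1 e.1.2 := by
  rw [← Finset.sum_product', Finset.univ_product_univ]
  rw [← Finset.sum_subset (s₁ := Finset.univ.filter fun p : Fin n × Fin n => p.1 < p.2)
    (Finset.filter_subset _ _)]
  · rw [← Finset.sum_subtype_of_mem (p := fun p : Fin n × Fin n => p.1 < p.2)
      (fun p => pairExt t p.1 p.2 * H p.1 p.2) (by simp)]
    refine Finset.sum_congr (by ext e; simpa using e.2) fun e _ => ?_
    rw [pairExt, dif_pos e.2]
  · intro p _ hp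
    rw [Finset.mem_filter] at hp
    rw [pairExt, dif_neg (by simpa using hp), zero_mul]

namespace SymbolData

variable (T : SymbolData σ m)

lemma ll_eq (t : IncPair (m + 1) → ZMod 2) (I J : Fin (m + 1)) :
    T.ll t I J = pairExt t I J + pairExt t J I + if J < I then T.par I * T.par J else 0 := by
  rcases lt_trichotomy I J with h | h | h
  · simp [ll, pairExt, h, h.not_gt]
  · simp [ll, pairExt, h]
  · simp [ll, pairExt, h, h.not_gt]

lemma largeRow_eq (t : IncPair (m + 1) → ZMod 2) (i : Fin m)
    (x : (σ → ZMod 2) × (Fin m → ZMod 2)) :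
    T.largeRow t i x = T.fixedRow x i +
      ∑ J, (pairExt t i.succ J + pairExt t J i.succ) * (consZero x.2 J + x.2 i) := by
  simp only [largeRow, fixedRow, LinearMap.coe_mk, AddHom.coe_mk, ll_eq]
  rw [add_assoc, ← Finset.sum_add_distrib]
  congr 1
  exact Finset.sum_congr rfl fun J _ => by ring

lemma sum_mul_largeRow (t : IncPair (m + 1) → ZMod 2) (y : Fin m → ZMod 2)
    (x : (σ → ZMod 2) × (Fin m → ZMod 2)) :
    ∑ i, y i * T.largeRow t i x = ∑ i, y i * T.fixedRow x i +
      ∑ e : IncPair (m + 1), t e * ((consZero y e.1.1 + consZero y e.1.2) *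
        (consZero x.2 e.1.1 + consZero x.2 e.1.2)) := by
  rw [← sum_pairExt_mul t fun I J => (consZero y I + consZero y J) *
        (consZero x.2 I + consZero x.2 J)]
  simp only [largeRow_eq, mul_add, Finset.sum_add_distrib]
  congr 1
  have h1 : ∀ i : Fin m, y i * ∑ J, (pairExt t i.succ J + pairExt t J i.succ) *
      (consZero x.2 J + x.2 i) = (fun I => consZero y I * ∑ J, (pairExt t I J + pairExt t J I) *
      (consZero x.2 J + consZero x.2 I)) i.succ := fun i => rfl
  have h2 : ∑ i : Fin m, y i * ∑ J, (pairExt t i.succ J + pairExt t J i.succ) *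
      (consZero x.2 J + x.2 i) = ∑ I, consZero y I * ∑ J, (pairExt t I J + pairExt t J I) *
      (consZero x.2 J + consZero x.2 I) := by
    rw [Fin.sum_univ_succ (n := m)]
    simp
  simp only [mul_add, Finset.sum_add_distrib, add_mul, Finset.mul_sum] at h2 ⊢
  rw [h2]
  have h3 : ∀ G : Fin (m + 1) → Fin (m + 1) → ZMod 2,
      ∑ I, ∑ J, G I J = ∑ I, ∑ J, G J I := fun G => Finset.sum_comm
  rw [h3 fun I J => consZero y I * (pairExt t J I * consZero x.2 J),
    h3 fun I J => consZero y I * (pairExt t J I * consZero x.2 I)]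
  simp only [← Finset.sum_add_distrib]
  exact Finset.sum_congr rfl fun I _ => Finset.sum_congr rfl fun J _ => by ring

end SymbolData

lemma quadBalanced_iff {j : ℕ} (b Y : Fin j → Fin m → ZMod 2) :
    (∀ e : IncPair (m + 1), ∑ c, (consZero (Y c) e.1.1 + consZero (Y c) e.1.2) *
      (consZero (b c) e.1.1 + consZero (b c) e.1.2) = 0) ↔ QuadBalanced b Y := by
  have hexp : ∀ i k, ∑ c, (Y c i + Y c k) * (b c i + b c k) =
      ∑ c, Y c i * b c i + ∑ c, Y c k * b c k + (∑ c, Y c i * b c k + ∑ c, Y c k * b c i) := by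
    intro i k
    simp only [← Finset.sum_add_distrib]
    exact Finset.sum_congr rfl fun c _ => by ring
  constructor
  · intro h
    have hd : ∀ i, ∑ c, Y c i * b c i = 0 := by
      intro i
      simpa using h ⟨(0, i.succ), Fin.succ_pos i⟩
    refine ⟨hd, ?_⟩
    have hlt : ∀ i k, i < k → ∑ c, Y c i * b c k = ∑ c, Y c k * b c i := by
      intro i k hik
      have := h ⟨(i.succ, k.succ), Fin.succ_lt_succ_iff.2 hik⟩
      simp only [consZero_succ] at this
      rw [hexp, hd, hd, zero_add, zero_add] at this
      exact CharTwo.add_eq_zero.1 this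
    intro i k
    rcases lt_trichotomy i k with hik | hik | hik
    · exact hlt i k hik
    · rw [hik]
    · exact (hlt k i hik).symm
  · rintro ⟨hd, hs⟩ ⟨⟨I, J⟩, hIJ⟩
    rcases Fin.eq_zero_or_eq_succ J with rfl | ⟨k, rfl⟩
    · exact absurd hIJ (Fin.not_lt_zero I)
    rcases Fin.eq_zero_or_eq_succ I with rfl | ⟨i, rfl⟩
    · simpa using hd k
    · simp only [consZero_succ]
      rw [hexp, hd, hd, hs, zero_add, zero_add, zmod_two_add_self]

lemma sum_sgn_matrix {j : ℕ} (c : Fin j → Fin m → ZMod 2) :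
    ∑ Y : Fin j → Fin m → ZMod 2, sgn (∑ a, ∑ i, Y a i * c a i) =
      if ∀ a i, c a i = 0 then ((2 : ℝ) ^ m) ^ j else 0 := by
  have h := sum_sgn_dot (fun p : Fin j × Fin m => c p.1 p.2) 0
  rw [← Fintype.sum_equiv (Equiv.curry (Fin j) (Fin m) (ZMod 2))
    (fun y => sgn (∑ p : Fin j × Fin m, y p * c p.1 p.2)) _ (fun y => by
      rw [Fintype.sum_prod_type]; rfl)]
  simp only [zero_add, sgn_zero, mul_one, Fintype.card_prod, Fintype.card_fin] at h
  refine Eq.trans ?_ (h.trans ?_)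
  · exact Finset.sum_congr (by ext; simp) fun _ _ => rfl
  by_cases hc : ∀ a i, c a i = 0
  · rw [if_pos hc, if_pos (show ∀ p : Fin j × Fin m, c p.1 p.2 = 0 from fun p => hc p.1 p.2),
      ← pow_mul, mul_comm]
  · rw [if_neg hc, if_neg (fun h' => hc fun a i => h' (a, i))]

namespace SymbolData

variable (T : SymbolData σ m)

lemma sum_largeRow_eq_zero {j : ℕ} (x : Fin j → (σ → ZMod 2) × (Fin m → ZMod 2)) :
    (∑ t : IncPair (m + 1) → ZMod 2, if ∀ c i, T.largeRow t i (x c) = 0 then (1 : ℝ) else 0) *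
      (2 ^ m) ^ j = 2 ^ Fintype.card (IncPair (m + 1)) *
      ∑ Y : Fin j → Fin m → ZMod 2, if QuadBalanced (fun c => (x c).2) Y then
        sgn (∑ c, ∑ i, Y c i * T.fixedRow (x c) i) else 0 := by
  have h1 : ∀ t : IncPair (m + 1) → ZMod 2,
      (if ∀ c i, T.largeRow t i (x c) = 0 then (1 : ℝ) else 0) * (2 ^ m) ^ j =
      ∑ Y : Fin j → Fin m → ZMod 2, sgn (∑ c, ∑ i, Y c i * T.largeRow t i (x c)) := by
    intro t
    rw [sum_sgn_matrix fun c i => T.largeRow t i (x c)]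
    by_cases h : ∀ c i, T.largeRow t i (x c) = 0
    · rw [if_pos h, if_pos h, one_mul]
    · rw [if_neg h, if_neg h, zero_mul]
  rw [Finset.sum_mul, Finset.sum_congr rfl fun t _ => h1 t, Finset.sum_comm, Finset.mul_sum]
  refine Finset.sum_congr rfl fun Y _ => ?_
  have h2 : ∀ t : IncPair (m + 1) → ZMod 2, ∑ c, ∑ i, Y c i * T.largeRow t i (x c) =
      ∑ c, ∑ i, Y c i * T.fixedRow (x c) i + ∑ e : IncPair (m + 1), t e *
        ∑ c, (consZero (Y c) e.1.1 + consZero (Y c) e.1.2) *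
          (consZero (x c).2 e.1.1 + consZero (x c).2 e.1.2) := by
    intro t
    simp only [sum_mul_largeRow, Finset.sum_add_distrib, Finset.mul_sum]
    congr 1
    exact Finset.sum_comm
  rw [Finset.sum_congr rfl fun t _ => by rw [h2 t]]
  refine Eq.trans ?_ ((sum_sgn_dot (fun e : IncPair (m + 1) =>
    ∑ c, (consZero (Y c) e.1.1 + consZero (Y c) e.1.2) *
      (consZero (x c).2 e.1.1 + consZero (x c).2 e.1.2))
    (∑ c, ∑ i, Y c i * T.fixedRow (x c) i)).trans ?_)
  · exact Finset.sum_congr (by ext; simp) fun _ _ => rfl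
  by_cases h : QuadBalanced (fun c => (x c).2) Y
  · rw [if_pos h, if_pos ((quadBalanced_iff _ _).2 h)]
  · rw [if_neg h, if_neg (fun h' => h ((quadBalanced_iff _ _).1 h')), mul_zero]

/-- The number of independent tuples in the kernel of all rows. -/
noncomputable def indepCount (j : ℕ) (t : IncPair (m + 1) → ZMod 2) : ℝ :=
  ∑ x : Fin j → T.smallKer, if LinearIndependent (ZMod 2) (fun c => T.proj (x c)) ∧
    ∀ c i, T.largeRow t i (x c).1 = 0 then (1 : ℝ) else 0

lemma sum_indepCount (j : ℕ) :
    (∑ t, T.indepCount j t) * (2 ^ m) ^ j = 2 ^ Fintype.card (IncPair (m + 1)) *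
      ∑ x : Fin j → T.smallKer, (if LinearIndependent (ZMod 2) (fun c => T.proj (x c)) then
        ∑ Θ ∈ altMatrices j, sgn (quadExp T.proj T.fixedOn Θ x) else 0) := by
  simp only [indepCount]
  rw [Finset.sum_comm, Finset.sum_mul, Finset.mul_sum]
  refine Finset.sum_congr rfl fun x _ => ?_
  by_cases h : LinearIndependent (ZMod 2) (fun c => T.proj (x c))
  · simp only [h, true_and, if_true]
    rw [T.sum_largeRow_eq_zero fun c => (x c).1]
    congr 1
    exact sum_balanced (b := fun c => (x c).1.2) h
      (fun Y => sgn (∑ c, ∑ i, Y c i * T.fixedRow (x c).1 i))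
  · simp [h]

lemma abs_sum_indepCount_sub_le (j : ℕ)
    (h : ∀ y : σ → ZMod 2, y ≠ 0 → ∃ I, ∑ p, y p * T.sl p I ≠ 0) :
    |∑ t, T.indepCount j t - 2 ^ Fintype.card (IncPair (m + 1))| ≤
      2 ^ Fintype.card (IncPair (m + 1)) * (2 ^ (j ^ 2 + j + 2 * Fintype.card σ + 2) /
        2 ^ (Finset.univ.filter fun i : Fin m => T.par i.succ = 1).card) := by
  set k := (Finset.univ.filter fun i : Fin m => T.par i.succ = 1).card with hk
  set s := Fintype.card σ with hs
  set N := Fintype.card (IncPair (m + 1)) with hN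
  have hkm : k ≤ m := (Finset.card_filter_le _ _).trans (by simp)
  have hK := T.card_smallKer h
  have hρ := T.card_radical_le
  rw [← hk] at hρ
  have ht : (Finset.univ.filter fun z : T.smallKer => T.proj z = 0).card ≤ 2 ^ s := by
    exact T.card_smallKer_snd_eq_zero
  have hmom := abs_moment_sub_le (j := j) T.proj T.fixedOn hK le_rfl le_rfl
  set ρ := (Finset.univ.filter fun z : T.smallKer =>
    ∀ x, omegaForm T.proj T.fixedOn x z = 0).card
  set t := (Finset.univ.filter fun z : T.smallKer => T.proj z = 0).card
  have hsum := T.sum_indepCount j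
  rw [← hN] at hsum
  set M := ∑ x : Fin j → T.smallKer, (if LinearIndependent (ZMod 2) (fun c => T.proj (x c)) then
        ∑ Θ ∈ altMatrices j, sgn (quadExp T.proj T.fixedOn Θ x) else 0) with hM
  have hpos : (0 : ℝ) < (2 ^ m) ^ j := by positivity
  have e1 : ∑ t, T.indepCount j t - 2 ^ N = 2 ^ N * ((M - (2 ^ m) ^ j) / (2 ^ m) ^ j) := by
    rw [sub_div, div_self hpos.ne', mul_sub, mul_one, ← mul_div_assoc, ← hsum,
      mul_div_cancel_right₀ _ hpos.ne']
  rw [e1, abs_mul, abs_of_pos (show (0 : ℝ) < 2 ^ N by positivity), abs_div, abs_of_pos hpos]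
  refine mul_le_mul_of_nonneg_left ?_ (by positivity)
  rw [div_le_iff₀ hpos]
  have hρ' : (ρ : ℝ) ≤ 2 ^ (2 * s) * 2 ^ (m + 1) / 2 ^ k := by
    rw [le_div_iff₀ (by positivity)]
    exact_mod_cast hρ
  have ht' : (t : ℝ) ≤ 2 ^ s := by exact_mod_cast ht
  have hkey : ((ρ : ℝ) + 2 ^ j * t) / 2 ^ m ≤ 2 ^ (j + 2 * s + 2) / 2 ^ k := by
    have a1 : (2 : ℝ) ^ k ≤ 2 ^ m := pow_le_pow_right₀ (by norm_num) hkm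
    have a2 : (2 : ℝ) ^ j * t / 2 ^ m ≤ 2 ^ (j + 2 * s + 1) / 2 ^ k := by
      have a3 : (2 : ℝ) ^ j * t ≤ 2 ^ (j + 2 * s + 1) := by
        calc (2 : ℝ) ^ j * t ≤ 2 ^ j * 2 ^ s := by gcongr
          _ = 2 ^ (j + s) := by rw [pow_add]
          _ ≤ _ := pow_le_pow_right₀ (by norm_num) (by omega)
      gcongr
    have a4 : (ρ : ℝ) / 2 ^ m ≤ 2 ^ (j + 2 * s + 1) / 2 ^ k := by
      rw [div_le_div_iff₀ (by positivity) (by positivity)]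
      calc (ρ : ℝ) * 2 ^ k ≤ 2 ^ (2 * s) * 2 ^ (m + 1) := by exact_mod_cast hρ
        _ = 2 ^ (2 * s + 1) * 2 ^ m := by ring
        _ ≤ _ := by
          gcongr
          · norm_num
          · omega
    calc _ = (ρ : ℝ) / 2 ^ m + 2 ^ j * t / 2 ^ m := add_div _ _ _
      _ ≤ 2 ^ (j + 2 * s + 1) / 2 ^ k + 2 ^ (j + 2 * s + 1) / 2 ^ k := add_le_add a4 a2
      _ = _ := by ring
  calc |M - (2 ^ m) ^ j| ≤ 2 ^ (j ^ 2) * ((2 ^ m) ^ j * (ρ + 2 ^ j * t) / 2 ^ m) := hmom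
    _ = 2 ^ (j ^ 2) * (2 ^ m) ^ j * (((ρ : ℝ) + 2 ^ j * t) / 2 ^ m) := by ring
    _ ≤ 2 ^ (j ^ 2) * (2 ^ m) ^ j * (2 ^ (j + 2 * s + 2) / 2 ^ k) := by gcongr
    _ = _ := by ring

lemma indepCount_nonneg (j : ℕ) (t : IncPair (m + 1) → ZMod 2) : 0 ≤ T.indepCount j t :=
  Finset.sum_nonneg fun x _ => by split_ifs <;> norm_num

lemma indepCount_le (j : ℕ) (t : IncPair (m + 1) → ZMod 2) :
    T.indepCount j t ≤ 2 ^ ((Fintype.card σ + m) * j) := by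
  calc T.indepCount j t ≤ ∑ x : Fin j → T.smallKer, (1 : ℝ) :=
        Finset.sum_le_sum fun x _ => by split_ifs <;> norm_num
    _ = (Fintype.card T.smallKer : ℝ) ^ j := by simp
    _ ≤ (2 ^ (Fintype.card σ + m)) ^ j := by
      gcongr
      have : Fintype.card T.smallKer ≤ Fintype.card ((σ → ZMod 2) × (Fin m → ZMod 2)) :=
        Fintype.card_subtype_le _
      have h2 : Fintype.card ((σ → ZMod 2) × (Fin m → ZMod 2)) = 2 ^ (Fintype.card σ + m) := by
        simp [Fintype.card_prod, pow_add]
      rw [h2] at this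
      exact_mod_cast this
    _ = _ := by rw [← pow_mul]

end SymbolData

end LargeRows

section Walsh
open scoped Classical

variable {F : Type} [Field F] [Fintype F]

/-- Negativity of the symbol, as an element of `ZMod 2`. -/
noncomputable def legBit (A B : F[X]) : ZMod 2 := if leg A B = -1 then 1 else 0

lemma sgn_legBit {A B : F[X]} (hB : B.Monic) (h : IsCoprime A B) : sgn (legBit A B) = leg A B := by
  rcases leg_of_coprime hB h with h1 | h1
  · rw [legBit, h1, if_neg (by norm_num), sgn_zero]
    norm_num
  · rw [legBit, h1, if_pos rfl, sgn_one]
    norm_num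

/-- The symbols of the pairs of entries of a tuple. -/
noncomputable def pairBits {n : ℕ} (Q : Fin n → F[X]) (e : IncPair n) : ZMod 2 :=
  legBit (Q e.1.1) (Q e.1.2)

lemma sum_piFinset_split {X : Type*} [Zero X] {n : ℕ} (A : Fin n → Finset X) {i j : Fin n}
    (hij : i ≠ j) (f : (Fin n → X) → ℝ) :
    ∑ Q ∈ Fintype.piFinset A, f Q =
      ∑ R ∈ Fintype.piFinset (Function.update (Function.update A i {0}) j {0}),
        ∑ P ∈ A i, ∑ P' ∈ A j, f (Function.update (Function.update R i P) j P') := by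
  have : ∀ R, ∑ P ∈ A i, ∑ P' ∈ A j, f (Function.update (Function.update R i P) j P') =
      ∑ p ∈ A i ×ˢ A j, f (Function.update (Function.update R i p.1) j p.2) := fun R =>
    (Finset.sum_product' (A i) (A j)
      fun P P' => f (Function.update (Function.update R i P) j P')).symm
  simp only [this]
  rw [← Finset.sum_product' _ _
    fun R (p : X × X) => f (Function.update (Function.update R i p.1) j p.2)]
  symm
  refine Finset.sum_nbij' (fun p => Function.update (Function.update p.1 i p.2.1) j p.2.2)
    (fun Q => (Function.update (Function.update Q i 0) j 0, Q i, Q j)) ?_ ?_ ?_ ?_ ?_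
  · rintro ⟨R, P, P'⟩ h
    simp only [Finset.mem_product, Fintype.mem_piFinset] at h ⊢
    intro k
    by_cases hj : k = j
    · subst hj; simpa using h.2.2
    by_cases hi : k = i
    · subst hi; simpa [hj] using h.2.1
    · simpa [hi, hj] using h.1 k
  · intro Q h
    simp only [Finset.mem_product, Fintype.mem_piFinset] at h ⊢
    refine ⟨fun k => ?_, h i, h j⟩
    by_cases hj : k = j
    · subst hj; simp
    by_cases hi : k = i
    · subst hi; simp [hj]
    · simpa [hi, hj] using h k
  · rintro ⟨R, P, P'⟩ h
    simp only [Finset.mem_product, Fintype.mem_piFinset] at h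
    have hRi : R i = 0 := by simpa [hij] using h.1 i
    have hRj : R j = 0 := by simpa using h.1 j
    simp only [Prod.mk.injEq]
    refine ⟨?_, by simp [hij], by simp⟩
    ext k
    by_cases hj : k = j
    · subst hj; simp [hRj]
    by_cases hi : k = i
    · subst hi; simp [hj, hRi]
    · simp [hi, hj]
  · intro Q h
    ext k
    by_cases hj : k = j
    · subst hj; simp
    by_cases hi : k = i
    · subst hi; simp [hj]
    · simp [hi, hj]
  · intro p _
    rfl

/-- The factor of a pair in a character sum. -/
noncomputable def pairWeight {n : ℕ} (χ : IncPair n → ZMod 2) (Q : Fin n → F[X])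
    (e : IncPair n) : ℝ :=
  if Q e.1.1 = Q e.1.2 then 0 else sgn (χ e * pairBits Q e)

lemma abs_pairWeight_le {n : ℕ} (χ : IncPair n → ZMod 2) (Q : Fin n → F[X]) (e : IncPair n) :
    |pairWeight χ Q e| ≤ 1 := by
  rw [pairWeight]
  split_ifs
  · simp
  · rw [abs_sgn]

lemma pairWeight_congr {n : ℕ} (χ : IncPair n → ZMod 2) {Q Q' : Fin n → F[X]} {e : IncPair n}
    (h1 : Q e.1.1 = Q' e.1.1) (h2 : Q e.1.2 = Q' e.1.2) :
    pairWeight χ Q e = pairWeight χ Q' e := by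
  rw [pairWeight, pairWeight, pairBits, pairBits, h1, h2]

lemma prod_pairWeight {n : ℕ} (χ : IncPair n → ZMod 2) (Q : Fin n → F[X]) :
    ∏ e, pairWeight χ Q e =
      if Function.Injective Q then sgn (∑ e, χ e * pairBits Q e) else 0 := by
  split_ifs with h
  · rw [sgn_sum]
    refine Finset.prod_congr rfl fun e _ => ?_
    rw [pairWeight, if_neg fun h' => e.2.ne (h h')]
  · rw [Function.not_injective_iff] at h
    obtain ⟨a, b, hab, hne⟩ := h
    rcases lt_or_gt_of_ne hne with hlt | hlt
    · exact Finset.prod_eq_zero (i := ⟨(a, b), hlt⟩) (Finset.mem_univ _)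
        (by rw [pairWeight, if_pos hab])
    · exact Finset.prod_eq_zero (i := ⟨(b, a), hlt⟩) (Finset.mem_univ _)
        (by rw [pairWeight, if_pos hab.symm])

lemma abs_prod_pairWeight_le {n : ℕ} (χ : IncPair n → ZMod 2) (Q : Fin n → F[X])
    (s : Finset (IncPair n)) : |∏ e ∈ s, pairWeight χ Q e| ≤ 1 := by
  rw [Finset.abs_prod]
  exact Finset.prod_le_one (fun _ _ => abs_nonneg _) fun e _ => abs_pairWeight_le χ Q e

lemma isCoprime_of_primes_ne {P Q : F[X]} {m n : ℕ} (hP : P ∈ primes F m) (hQ : Q ∈ primes F n)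
    (h : P ≠ Q) : IsCoprime P Q := by
  obtain ⟨hP1, -, hP3⟩ := mem_primes.1 hP
  obtain ⟨hQ1, -, hQ3⟩ := mem_primes.1 hQ
  exact (hP3.coprime_iff_not_dvd).2 fun hd => h (eq_of_primes_dvd hP1 hP3 hQ1 hQ3 hd)

lemma pairWeight_eq_leg {n : ℕ} {χ : IncPair n → ZMod 2} {Q : Fin n → F[X]} {e : IncPair n}
    (he : χ e ≠ 0) {a b : ℕ} (h1 : Q e.1.1 ∈ primes F a) (h2 : Q e.1.2 ∈ primes F b) :
    pairWeight χ Q e = leg (Q e.1.1) (Q e.1.2) := by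
  have hne : (Q e.1.2).Monic := (mem_primes.1 h2).1
  rw [pairWeight]
  split_ifs with h
  · rw [h, (leg_eq_zero_iff hne).2]
    · simp
    · intro hc
      exact (mem_primes.1 h2).2.2.not_isUnit (isCoprime_self.1 hc)
  · rw [(zmod_two_cases (χ e)).resolve_left he, one_mul, pairBits,
      sgn_legBit hne (isCoprime_of_primes_ne h1 h2 h)]

lemma abs_sum_pair_le (hq4 : Fintype.card F % 4 = 3) {n y : ℕ} (d : Fin n → ℕ)
    (hd : ∀ i, 4 * y < d i) (A : Fin n → Finset F[X]) (hA : ∀ i, A i ⊆ primes F (d i))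
    (χ : IncPair n → ZMod 2) (e : IncPair n) (he : χ e ≠ 0) (R : Fin n → F[X]) :
    |∑ P ∈ A e.1.1, ∑ P' ∈ A e.1.2, ∏ e', pairWeight χ
      (Function.update (Function.update R e.1.1 P) e.1.2 P') e'| * (Fintype.card F : ℝ) ^ y ≤
      2 * (Fintype.card F : ℝ) ^ (d e.1.1 + d e.1.2) := by
  obtain ⟨⟨i, j⟩, hij⟩ := e
  simp only at he hij ⊢
  set S : Finset (IncPair n) := Finset.univ.erase ⟨(i, j), hij⟩ with hS
  set α : F[X] → ℝ := fun P => if P ∈ A i then ∏ e' ∈ S.filter (fun e' => e'.1.1 ≠ j ∧ e'.1.2 ≠ j),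
    pairWeight χ (Function.update R i P) e' else 0 with hα
  set β : F[X] → ℝ := fun P => if P ∈ A j then
    ∏ e' ∈ S.filter (fun e' => ¬ (e'.1.1 ≠ j ∧ e'.1.2 ≠ j)),
    pairWeight χ (Function.update R j P) e' else 0 with hβ
  have hb := bilinear_bound hq4 (hd i) (hd j) α β
    (fun P => by
      simp only [hα]
      split_ifs
      · exact abs_prod_pairWeight_le _ _ _
      · simp)
    (fun P => by
      simp only [hβ]
      split_ifs
      · exact abs_prod_pairWeight_le _ _ _
      · simp)
  have hterm : ∀ P ∈ A i, ∀ P' ∈ A j, ∏ e', pairWeight χ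
      (Function.update (Function.update R i P) j P') e' = α P * β P' * (leg P P' : ℝ) := by
    intro P hP P' hP'
    rw [← Finset.mul_prod_erase Finset.univ _ (Finset.mem_univ (⟨(i, j), hij⟩ : IncPair n)),
      pairWeight_eq_leg (a := d i) (b := d j) he (by simpa [hij.ne] using hA i hP)
        (by simpa using hA j hP')]
    simp only [Function.update_self, Function.update_of_ne hij.ne]
    rw [← hS, ← Finset.prod_filter_mul_prod_filter_not S (fun e' => e'.1.1 ≠ j ∧ e'.1.2 ≠ j)]
    simp only [hα, hβ, if_pos hP, if_pos hP']
    rw [mul_comm]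
    congr 2
    · refine Finset.prod_congr rfl fun e' he' => ?_
      obtain ⟨-, h1, h2⟩ := Finset.mem_filter.1 he'
      exact pairWeight_congr χ (Function.update_of_ne h1 _ _) (Function.update_of_ne h2 _ _)
    · refine Finset.prod_congr rfl fun e' he' => ?_
      obtain ⟨h0, h1⟩ := Finset.mem_filter.1 he'
      have hne : e'.1 ≠ (i, j) := fun h => (Finset.mem_erase.1 h0).1 (Subtype.ext h)
      have hlt := e'.2
      have h2 : e'.1.1 ≠ i ∧ e'.1.2 ≠ i := by
        by_cases h : e'.1.1 = j
        · rw [h] at hlt ⊢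
          exact ⟨hij.ne', (hij.trans hlt).ne'⟩
        · have h' : e'.1.2 = j := by
            by_contra h''
            exact h1 ⟨h, h''⟩
          refine ⟨fun h3 => hne (Prod.ext h3 h'), ?_⟩
          rw [h']
          exact hij.ne'
      rw [Function.update_comm hij.ne]
      exact pairWeight_congr χ (Function.update_of_ne h2.1 _ _) (Function.update_of_ne h2.2 _ _)
  have hsum : ∑ P ∈ A i, ∑ P' ∈ A j, ∏ e', pairWeight χ
      (Function.update (Function.update R i P) j P') e' =
      ∑ P ∈ primes F (d i), ∑ P' ∈ primes F (d j), α P * β P' * (leg P P' : ℝ) := by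
    rw [← Finset.sum_subset (hA i) (f := fun P => ∑ P' ∈ primes F (d j),
      α P * β P' * (leg P P' : ℝ))]
    · refine Finset.sum_congr rfl fun P hP => ?_
      rw [← Finset.sum_subset (hA j) (f := fun P' => α P * β P' * (leg P P' : ℝ))]
      · exact Finset.sum_congr rfl fun P' hP' => hterm P hP P' hP'
      · intro P' _ h
        simp [hβ, h]
    · intro P _ h
      simp [hα, h]
  rw [hsum]
  exact hb

lemma abs_sum_char_le (hq4 : Fintype.card F % 4 = 3) {n y : ℕ} (d : Fin n → ℕ)
    (hd : ∀ i, 4 * y < d i) (A : Fin n → Finset F[X]) (hA : ∀ i, A i ⊆ primes F (d i))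
    (χ : IncPair n → ZMod 2) (hχ : χ ≠ 0) :
    |∑ Q ∈ Fintype.piFinset A,
      if Function.Injective Q then sgn (∑ e, χ e * pairBits Q e) else 0| *
        (Fintype.card F : ℝ) ^ y ≤ 2 * (Fintype.card F : ℝ) ^ (∑ i, d i) := by
  obtain ⟨e, he⟩ := Function.ne_iff.1 hχ
  have hij : e.1.1 ≠ e.1.2 := e.2.ne
  simp only [← prod_pairWeight]
  rw [sum_piFinset_split A hij]
  set B := Function.update (Function.update A e.1.1 {0}) e.1.2 {0} with hB
  have hcard : ((Fintype.piFinset B).card : ℝ) * (Fintype.card F : ℝ) ^ (d e.1.1 + d e.1.2) ≤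
      (Fintype.card F : ℝ) ^ (∑ i, d i) := by
    have : (Fintype.card F : ℝ) ^ (d e.1.1 + d e.1.2) =
        ∏ i, ((if i = e.1.1 then (Fintype.card F : ℝ) ^ d e.1.1 else 1) *
          (if i = e.1.2 then (Fintype.card F : ℝ) ^ d e.1.2 else 1)) := by
      rw [Finset.prod_mul_distrib, Finset.prod_ite_eq' , Finset.prod_ite_eq', pow_add]
      simp
    rw [this, Fintype.card_piFinset, Nat.cast_prod, ← Finset.prod_mul_distrib,
      ← Finset.prod_pow_eq_pow_sum]
    refine Finset.prod_le_prod (fun i _ => by positivity) fun i _ => ?_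
    by_cases h2 : i = e.1.2
    · rw [hB, h2]
      simp [hij.symm]
    by_cases h1 : i = e.1.1
    · rw [hB, h1]
      simp [hij]
    · rw [hB]
      simp only [ne_eq, h2, not_false_eq_true, Function.update_of_ne, h1, if_false, mul_one]
      calc ((A i).card : ℝ) ≤ ((primes F (d i)).card : ℝ) := by
            exact_mod_cast Finset.card_le_card (hA i)
        _ ≤ _ := by exact_mod_cast card_primes_le_pow (d i)
  calc _ ≤ (∑ R ∈ Fintype.piFinset B, |∑ P ∈ A e.1.1, ∑ P' ∈ A e.1.2, ∏ e', pairWeight χ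
      (Function.update (Function.update R e.1.1 P) e.1.2 P') e'|) * (Fintype.card F : ℝ) ^ y := by
        gcongr
        exact Finset.abs_sum_le_sum_abs _ _
    _ = ∑ R ∈ Fintype.piFinset B, |∑ P ∈ A e.1.1, ∑ P' ∈ A e.1.2, ∏ e', pairWeight χ
      (Function.update (Function.update R e.1.1 P) e.1.2 P') e'| * (Fintype.card F : ℝ) ^ y :=
        Finset.sum_mul _ _ _
    _ ≤ ∑ R ∈ Fintype.piFinset B, 2 * (Fintype.card F : ℝ) ^ (d e.1.1 + d e.1.2) :=
        Finset.sum_le_sum fun R _ => abs_sum_pair_le hq4 d hd A hA χ e he R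
    _ = 2 * (((Fintype.piFinset B).card : ℝ) * (Fintype.card F : ℝ) ^ (d e.1.1 + d e.1.2)) := by
        rw [Finset.sum_const, nsmul_eq_mul]
        ring
    _ ≤ _ := by gcongr

/-- Fourier inversion over a power of `ZMod 2`. -/
lemma fourier_inversion {E : Type*} [Fintype E] (Φ : (E → ZMod 2) → ℝ) (t : E → ZMod 2) :
    Φ t * 2 ^ Fintype.card E =
      ∑ χ : E → ZMod 2, (∑ u, Φ u * sgn (∑ e, χ e * u e)) * sgn (∑ e, χ e * t e) := by
  simp only [Finset.sum_mul]
  rw [Finset.sum_comm]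
  have h : ∀ u : E → ZMod 2, ∑ χ : E → ZMod 2, Φ u * sgn (∑ e, χ e * u e) *
      sgn (∑ e, χ e * t e) = if u = t then Φ u * 2 ^ Fintype.card E else 0 := by
    intro u
    have h1 := sum_sgn_dot (fun e => u e + t e) 0
    simp only [zero_add, sgn_zero, mul_one] at h1
    have h2 : ∀ χ : E → ZMod 2, Φ u * sgn (∑ e, χ e * u e) * sgn (∑ e, χ e * t e) =
        Φ u * sgn (∑ e, χ e * (u e + t e)) := by
      intro χ
      rw [mul_assoc, ← sgn_add, ← Finset.sum_add_distrib]
      simp only [mul_add]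
    rw [Finset.sum_congr rfl fun χ _ => h2 χ, ← Finset.mul_sum, h1]
    by_cases hut : u = t
    · rw [if_pos hut, if_pos fun e => by rw [hut, zmod_two_add_self]]
    · rw [if_neg hut, if_neg, mul_zero]
      intro h'
      exact hut (funext fun e => CharTwo.add_eq_zero.1 (h' e))
  rw [Finset.sum_congr rfl fun u _ => h u]
  simp

/-- Symbols of tuples of large primes are equidistributed. -/
lemma abs_sum_tuple_sub_le (hq4 : Fintype.card F % 4 = 3) {n y : ℕ} (d : Fin n → ℕ)
    (hd : ∀ i, 4 * y < d i) (A : Fin n → Finset F[X]) (hA : ∀ i, A i ⊆ primes F (d i))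
    (Φ : (IncPair n → ZMod 2) → ℝ) {M : ℝ} (hΦ : ∀ t, |Φ t| ≤ M) :
    |∑ Q ∈ (Fintype.piFinset A).filter Function.Injective,
      (Φ (pairBits Q) - (∑ t, Φ t) / 2 ^ Fintype.card (IncPair n))| *
        (Fintype.card F : ℝ) ^ y ≤
      M * 2 ^ Fintype.card (IncPair n) * (2 * (Fintype.card F : ℝ) ^ (∑ i, d i)) := by
  set N := Fintype.card (IncPair n) with hN
  have hM : 0 ≤ M := (abs_nonneg _).trans (hΦ 0)
  set c : (IncPair n → ZMod 2) → ℝ := fun χ => (∑ u, Φ u * sgn (∑ e, χ e * u e)) / 2 ^ N with hc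
  have hpos : (0 : ℝ) < 2 ^ N := by positivity
  have hcM : ∀ χ, |c χ| ≤ M := by
    intro χ
    rw [hc]
    simp only
    rw [abs_div, abs_of_pos hpos, div_le_iff₀ hpos]
    calc _ ≤ ∑ u, |Φ u * sgn (∑ e, χ e * u e)| := Finset.abs_sum_le_sum_abs _ _
      _ ≤ ∑ _u : IncPair n → ZMod 2, M := Finset.sum_le_sum fun u _ => by
        rw [abs_mul, abs_sgn, mul_one]
        exact hΦ u
      _ = _ := by simp [hN]; ring
  have hexp : ∀ t, Φ t - (∑ t, Φ t) / 2 ^ N =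
      ∑ χ ∈ Finset.univ.erase 0, c χ * sgn (∑ e, χ e * t e) := by
    intro t
    have h := fourier_inversion Φ t
    have h0 : c 0 * sgn (∑ e, (0 : IncPair n → ZMod 2) e * t e) = (∑ t, Φ t) / 2 ^ N := by
      simp [hc, sgn_zero]
    rw [← h0, sub_eq_iff_eq_add', Finset.add_sum_erase _ (fun χ : IncPair n → ZMod 2 =>
      c χ * sgn (∑ e, χ e * t e)) (Finset.mem_univ 0)]
    rw [← hN] at h
    rw [eq_div_of_mul_eq hpos.ne' h, Finset.sum_div]
    refine Finset.sum_congr (by ext; simp) fun χ _ => ?_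
    simp only [hc]
    rw [div_mul_eq_mul_div]
    congr!
  have hswap : ∑ Q ∈ (Fintype.piFinset A).filter Function.Injective,
      (Φ (pairBits Q) - (∑ t, Φ t) / 2 ^ N) = ∑ χ ∈ Finset.univ.erase 0, c χ *
        ∑ Q ∈ Fintype.piFinset A,
          if Function.Injective Q then sgn (∑ e, χ e * pairBits Q e) else 0 := by
    rw [Finset.sum_congr rfl fun Q _ => hexp (pairBits Q), Finset.sum_comm]
    refine Finset.sum_congr rfl fun χ _ => ?_
    rw [← Finset.mul_sum, Finset.sum_filter]
  rw [hswap]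
  calc _ ≤ (∑ χ ∈ Finset.univ.erase 0, |c χ| * |∑ Q ∈ Fintype.piFinset A,
          if Function.Injective Q then sgn (∑ e, χ e * pairBits Q e) else 0|) *
          (Fintype.card F : ℝ) ^ y := by
        gcongr
        refine (Finset.abs_sum_le_sum_abs _ _).trans (le_of_eq ?_)
        exact Finset.sum_congr rfl fun χ _ => abs_mul _ _
    _ = ∑ χ ∈ Finset.univ.erase 0, |c χ| * (|∑ Q ∈ Fintype.piFinset A,
          if Function.Injective Q then sgn (∑ e, χ e * pairBits Q e) else 0| *
          (Fintype.card F : ℝ) ^ y) := by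
        rw [Finset.sum_mul]
        exact Finset.sum_congr rfl fun χ _ => mul_assoc _ _ _
    _ ≤ ∑ χ ∈ Finset.univ.erase (0 : IncPair n → ZMod 2),
          M * (2 * (Fintype.card F : ℝ) ^ (∑ i, d i)) :=
        Finset.sum_le_sum fun χ hχ => mul_le_mul (hcM χ)
          (abs_sum_char_le hq4 d hd A hA χ (Finset.ne_of_mem_erase hχ)) (by positivity) hM
    _ ≤ ∑ χ : IncPair n → ZMod 2, M * (2 * (Fintype.card F : ℝ) ^ (∑ i, d i)) :=
        Finset.sum_le_sum_of_subset_of_nonneg (Finset.erase_subset _ _)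
          fun _ _ _ => by positivity
    _ = _ := by
        simp [hN]
        ring

end Walsh

section Rows
open scoped Classical

variable {F : Type} [Field F] [Fintype F]

lemma isCoprime_of_irreducible_ne {P Q : F[X]} (hP : P.Monic) (hPi : Irreducible P)
    (hQ : Q.Monic) (hQi : Irreducible Q) (h : P ≠ Q) : IsCoprime P Q :=
  (hPi.coprime_iff_not_dvd).2 fun hd => h (eq_of_primes_dvd hP hPi hQ hQi hd)

lemma isCoprime_of_mem_pf_ne {f P Q : F[X]} (hP : P ∈ pf f) (hQ : Q ∈ pf f) (h : P ≠ Q) :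
    IsCoprime P Q :=
  isCoprime_of_irreducible_ne (pf_monic hP) (pf_irreducible hP) (pf_monic hQ) (pf_irreducible hQ) h

lemma sgn_eq_one_iff {a : ZMod 2} : sgn a = 1 ↔ a = 0 := by
  rcases zmod_two_cases a with rfl | rfl
  · simp [sgn_zero]
  · rw [sgn_one]
    norm_num

lemma sgn_injective : Function.Injective sgn := by
  intro a b h
  rcases zmod_two_cases a with rfl | rfl <;> rcases zmod_two_cases b with rfl | rfl <;>
    simp [sgn_zero, sgn_one] at h ⊢ <;> norm_num at h

lemma sgn_natCast (n : ℕ) : sgn (n : ZMod 2) = (-1) ^ n := by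
  induction n with
  | zero => simp [sgn_zero]
  | succ n ih => rw [Nat.cast_succ, sgn_add, ih, sgn_one, pow_succ]

lemma legBit_comm (hq4 : Fintype.card F % 4 = 3) {A B : F[X]} (hA : A.Monic) (hB : B.Monic)
    (h : IsCoprime A B) :
    legBit A B = legBit B A + (A.natDegree : ZMod 2) * (B.natDegree : ZMod 2) := by
  apply sgn_injective
  rw [sgn_add, sgn_legBit hB h, sgn_legBit hA h.symm, ← Nat.cast_mul, sgn_natCast,
    leg_reciprocity hq4 A B]
  push_cast
  ring

lemma leg_prod_eq_sgn {P : F[X]} {S : Finset F[X]} (hS : ∀ Q ∈ S, Q.Monic ∧ IsCoprime P Q) :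
    (leg P (∏ Q ∈ S, Q) : ℝ) = sgn (∑ Q ∈ S, legBit P Q) := by
  rw [leg_prod_right _ _ _ fun Q hQ => (hS Q hQ).1, sgn_sum, Int.cast_prod]
  exact Finset.prod_congr rfl fun Q hQ => (sgn_legBit (hS Q hQ).1 (hS Q hQ).2).symm

lemma leg_prod_eq_one_iff {P : F[X]} {S : Finset F[X]}
    (hS : ∀ Q ∈ S, Q.Monic ∧ IsCoprime P Q) :
    leg P (∏ Q ∈ S, Q) = 1 ↔ ∑ Q ∈ S, legBit P Q = 0 := by
  rw [← sgn_eq_one_iff, ← leg_prod_eq_sgn hS]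
  norm_cast

/-- The row of a prime factor of `f`, evaluated at a vector indexed by polynomials. -/
noncomputable def splitRow (f : F[X]) (z : F[X] → ZMod 2) (P : F[X]) : ZMod 2 :=
  ∑ P' ∈ pf f, legBit P P' * (z P' + z P)

/-- The prime factors at which a vector is nonzero. -/
noncomputable def supp (f : F[X]) (z : F[X] → ZMod 2) : Finset F[X] :=
  (pf f).filter fun P => z P = 1

lemma splitRow_of_not_mem {f : F[X]} {z : F[X] → ZMod 2} {P : F[X]} (hz : z P = 0) :
    splitRow f z P = ∑ Q ∈ supp f z, legBit P Q := by
  rw [splitRow, supp, Finset.sum_filter]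
  refine Finset.sum_congr rfl fun Q _ => ?_
  rw [hz, add_zero]
  rcases zmod_two_cases (z Q) with h | h <;> simp [h]

lemma splitRow_of_mem {f : F[X]} {z : F[X] → ZMod 2} {P : F[X]} (hz : z P = 1) :
    splitRow f z P = ∑ Q ∈ pf f \ supp f z, legBit P Q := by
  have : pf f \ supp f z = (pf f).filter fun P => ¬ z P = 1 := by
    ext Q
    simp only [supp, Finset.mem_sdiff, Finset.mem_filter]
    tauto
  rw [splitRow, this, Finset.sum_filter]
  refine Finset.sum_congr rfl fun Q _ => ?_
  rw [hz]
  rcases zmod_two_cases (z Q) with h | h <;> simp [h, zmod_two_add_self]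

lemma dvd_prod_iff_mem {f P : F[X]} {S : Finset F[X]} (hS : S ⊆ pf f) :
    (P.Monic ∧ Irreducible P ∧ P ∣ ∏ Q ∈ S, Q) ↔ P ∈ S := by
  have h0 : ∏ Q ∈ S, Q ≠ 0 := (monic_prod_of_monic _ _ fun Q hQ => pf_monic (hS hQ)).ne_zero
  rw [← mem_pf h0, pf_prod S fun Q hQ => ⟨pf_monic (hS hQ), pf_irreducible (hS hQ)⟩]

lemma leg_supp_eq_one_iff {f P : F[X]} {z : F[X] → ZMod 2} (hP : P ∈ pf f) (hz : z P = 0) :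
    leg P (∏ Q ∈ supp f z, Q) = 1 ↔ splitRow f z P = 0 := by
  rw [splitRow_of_not_mem hz]
  refine leg_prod_eq_one_iff fun Q hQ => ?_
  obtain ⟨hQ1, hQ2⟩ := Finset.mem_filter.1 hQ
  refine ⟨pf_monic hQ1, isCoprime_of_mem_pf_ne hP hQ1 ?_⟩
  rintro rfl
  rw [hz] at hQ2
  exact zero_ne_one hQ2

lemma leg_compl_supp_eq_one_iff {f P : F[X]} {z : F[X] → ZMod 2} (hP : P ∈ pf f) (hz : z P = 1) :
    leg P (∏ Q ∈ pf f \ supp f z, Q) = 1 ↔ splitRow f z P = 0 := by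
  rw [splitRow_of_mem hz]
  refine leg_prod_eq_one_iff fun Q hQ => ?_
  obtain ⟨hQ1, hQ2⟩ := Finset.mem_sdiff.1 hQ
  refine ⟨pf_monic hQ1, isCoprime_of_mem_pf_ne hP hQ1 ?_⟩
  rintro rfl
  exact hQ2 (Finset.mem_filter.2 ⟨hP, hz⟩)

lemma mutualResidues_supp_iff (f : F[X]) (z : F[X] → ZMod 2) :
    MutualResidues (∏ P ∈ supp f z, P) (∏ P ∈ pf f \ supp f z, P) ↔
      ∀ P ∈ pf f, splitRow f z P = 0 := by
  have hS : supp f z ⊆ pf f := Finset.filter_subset _ _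
  constructor
  · rintro ⟨h1, h2⟩ P hP
    rcases zmod_two_cases (z P) with h | h
    · have hm : P ∈ pf f \ supp f z := Finset.mem_sdiff.2 ⟨hP, fun h' => by
        have := (Finset.mem_filter.1 h').2
        rw [h] at this
        exact zero_ne_one this⟩
      obtain ⟨a, b, c⟩ := (dvd_prod_iff_mem Finset.sdiff_subset).2 hm
      exact (leg_supp_eq_one_iff hP h).1 (h1 P a b c)
    · have hm : P ∈ supp f z := Finset.mem_filter.2 ⟨hP, h⟩
      obtain ⟨a, b, c⟩ := (dvd_prod_iff_mem hS).2 hm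
      exact (leg_compl_supp_eq_one_iff hP h).1 (h2 P a b c)
  · intro h
    refine ⟨fun P a b c => ?_, fun P a b c => ?_⟩
    · have hm := (dvd_prod_iff_mem Finset.sdiff_subset).1 ⟨a, b, c⟩
      obtain ⟨hP, hP'⟩ := Finset.mem_sdiff.1 hm
      refine (leg_supp_eq_one_iff hP ((zmod_two_cases _).resolve_right fun h' => hP' ?_)).2 (h P hP)
      exact Finset.mem_filter.2 ⟨hP, h'⟩
    · have hm := (dvd_prod_iff_mem hS).1 ⟨a, b, c⟩
      obtain ⟨hP, hP'⟩ := Finset.mem_filter.1 hm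
      exact (leg_compl_supp_eq_one_iff hP hP').2 (h P hP)

/-- One of the rows is implied by the others. -/
lemma splitRow_eq_zero_of_others (hq4 : Fintype.card F % 4 = 3) {f : F[X]} (hf : f.Monic)
    (hs : Squarefree f) (hodd : Odd f.natDegree) {z : F[X] → ZMod 2} {Q₀ : F[X]} (hQ : Q₀ ∈ pf f)
    (hz : z Q₀ = 0) (h : ∀ P ∈ pf f, P ≠ Q₀ → splitRow f z P = 0) : splitRow f z Q₀ = 0 := by
  have hS : supp f z ⊆ pf f := Finset.filter_subset _ _
  set D := ∏ P ∈ supp f z, P with hD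
  set E := ∏ P ∈ pf f \ supp f z, P with hE
  have hDm : D.Monic := monic_prod_of_monic _ _ fun P hP => pf_monic (hS hP)
  have hEm : E.Monic := monic_prod_of_monic _ _ fun P hP => pf_monic (Finset.sdiff_subset hP)
  have hDE : D * E = f := by
    rw [hD, hE, mul_comm, Finset.prod_sdiff hS]
    exact prod_pf hf hs
  rw [← leg_supp_eq_one_iff hQ hz, ← hD]
  have h1 : leg D E = 1 := by
    rw [hD, leg_prod_left hEm]
    refine Finset.prod_eq_one fun P hP => ?_
    obtain ⟨hP1, hP2⟩ := Finset.mem_filter.1 hP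
    refine (leg_compl_supp_eq_one_iff hP1 hP2).2 (h P hP1 ?_)
    rintro rfl
    rw [hz] at hP2
    exact zero_ne_one hP2
  have h2 : leg E D = leg Q₀ D := by
    have hm : Q₀ ∈ pf f \ supp f z := Finset.mem_sdiff.2 ⟨hQ, fun h' => by
      have := (Finset.mem_filter.1 h').2
      rw [hz] at this
      exact zero_ne_one this⟩
    rw [hE, leg_prod_left hDm, Finset.prod_eq_single_of_mem Q₀ hm]
    intro P hP hne
    obtain ⟨hP1, hP2⟩ := Finset.mem_sdiff.1 hP
    refine (leg_supp_eq_one_iff hP1 ((zmod_two_cases _).resolve_right fun h' => hP2 ?_)).2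
      (h P hP1 hne)
    exact Finset.mem_filter.2 ⟨hP1, h'⟩
  have h3 : Even (E.natDegree * D.natDegree) := by
    rw [← hDE, hDm.natDegree_mul hEm, Nat.odd_add] at hodd
    rw [Nat.even_mul]
    by_cases hd : Odd D.natDegree
    · exact Or.inl (hodd.1 hd)
    · exact Or.inr (Nat.not_odd_iff_even.1 hd)
  rw [← h2, leg_reciprocity hq4 E D, h3.neg_one_pow, one_mul, h1]

lemma supp_mem_residueSplits_iff (hq4 : Fintype.card F % 4 = 3) {f : F[X]} (hf : f.Monic)
    (hs : Squarefree f) (hodd : Odd f.natDegree) {z : F[X] → ZMod 2} {Q₀ : F[X]} (hQ : Q₀ ∈ pf f)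
    (hz : z Q₀ = 0) : supp f z ∈ residueSplits f Q₀ ↔
      ∀ P ∈ pf f, P ≠ Q₀ → splitRow f z P = 0 := by
  rw [mem_residueSplits, mutualResidues_supp_iff]
  constructor
  · exact fun h P hP _ => h.2 P hP
  · intro h
    refine ⟨fun P hP => ?_, fun P hP => ?_⟩
    · obtain ⟨hP1, hP2⟩ := Finset.mem_filter.1 hP
      refine Finset.mem_erase.2 ⟨?_, hP1⟩
      rintro rfl
      rw [hz] at hP2
      exact zero_ne_one hP2
    · by_cases hne : P = Q₀
      · rw [hne]
        exact splitRow_eq_zero_of_others hq4 hf hs hodd hQ hz h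
      · exact h P hP hne

end Rows

section Tuples
open scoped Classical

variable {F : Type} [Field F] [Fintype F]

/-- A tuple of distinct primes not dividing the squarefree polynomial `g`. -/
structure CoprimeTuple (g : F[X]) {n : ℕ} (Q : Fin n → F[X]) : Prop where
  monic : g.Monic
  squarefree : Squarefree g
  monic_tuple : ∀ i, (Q i).Monic
  irreducible : ∀ i, Irreducible (Q i)
  injective : Function.Injective Q
  not_dvd : ∀ i, ¬ Q i ∣ g

namespace CoprimeTuple

variable {g : F[X]} {n : ℕ} {Q : Fin n → F[X]}

lemma not_mem (h : CoprimeTuple g Q) (i : Fin n) : Q i ∉ pf g := fun hm => h.not_dvd i (pf_dvd hm)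

lemma disjoint (h : CoprimeTuple g Q) : Disjoint (pf g) (Finset.univ.image Q) := by
  rw [Finset.disjoint_right]
  intro P hP
  obtain ⟨i, -, rfl⟩ := Finset.mem_image.1 hP
  exact h.not_mem i

lemma prod_eq (h : CoprimeTuple g Q) :
    g * ∏ i, Q i = ∏ P ∈ pf g ∪ Finset.univ.image Q, P := by
  rw [Finset.prod_union h.disjoint, prod_pf h.monic h.squarefree,
    Finset.prod_image fun i _ j _ hij => h.injective hij]

lemma mem_union (h : CoprimeTuple g Q) :
    ∀ P ∈ pf g ∪ Finset.univ.image Q, P.Monic ∧ Irreducible P := by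
  intro P hP
  rcases Finset.mem_union.1 hP with hP | hP
  · exact ⟨pf_monic hP, pf_irreducible hP⟩
  · obtain ⟨i, -, rfl⟩ := Finset.mem_image.1 hP
    exact ⟨h.monic_tuple i, h.irreducible i⟩

lemma pf_mul (h : CoprimeTuple g Q) : pf (g * ∏ i, Q i) = pf g ∪ Finset.univ.image Q := by
  rw [h.prod_eq, pf_prod _ h.mem_union]

lemma squarefree_mul (h : CoprimeTuple g Q) : Squarefree (g * ∏ i, Q i) := by
  rw [h.prod_eq]
  exact squarefree_prod _ h.mem_union

lemma monic_mul (h : CoprimeTuple g Q) : (g * ∏ i, Q i).Monic :=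
  h.monic.mul (monic_prod_of_monic _ _ fun i _ => h.monic_tuple i)

lemma sum_pf_mul {M : Type*} [AddCommMonoid M] (h : CoprimeTuple g Q) (G : F[X] → M) :
    ∑ P ∈ pf (g * ∏ i, Q i), G P = ∑ p : {x // x ∈ pf g}, G p.1 + ∑ i, G (Q i) := by
  rw [h.pf_mul, Finset.sum_union h.disjoint,
    Finset.sum_image fun i _ j _ hij => h.injective hij, ← Finset.sum_coe_sort]

lemma mem_left (h : CoprimeTuple g Q) {p : F[X]} (hp : p ∈ pf g) : p ∈ pf (g * ∏ i, Q i) := by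
  rw [h.pf_mul]
  exact Finset.mem_union_left _ hp

lemma mem_right (h : CoprimeTuple g Q) (i : Fin n) : Q i ∈ pf (g * ∏ i, Q i) := by
  rw [h.pf_mul]
  exact Finset.mem_union_right _ (Finset.mem_image_of_mem _ (Finset.mem_univ i))

lemma cases_mem (h : CoprimeTuple g Q) {P : F[X]} (hP : P ∈ pf (g * ∏ i, Q i)) :
    P ∈ pf g ∨ ∃ i, Q i = P := by
  rw [h.pf_mul] at hP
  rcases Finset.mem_union.1 hP with hP | hP
  · exact Or.inl hP
  · obtain ⟨i, -, hi⟩ := Finset.mem_image.1 hP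
    exact Or.inr ⟨i, hi⟩

lemma isCoprime (h : CoprimeTuple g Q) {i j : Fin n} (hij : i ≠ j) : IsCoprime (Q i) (Q j) :=
  isCoprime_of_irreducible_ne (h.monic_tuple i) (h.irreducible i) (h.monic_tuple j)
    (h.irreducible j) fun h' => hij (h.injective h')

lemma isCoprime_left (h : CoprimeTuple g Q) {p : F[X]} (hp : p ∈ pf g) (i : Fin n) :
    IsCoprime (Q i) p :=
  isCoprime_of_mem_pf_ne (h.mem_right i) (h.mem_left hp) fun h' => h.not_mem i (h' ▸ hp)

end CoprimeTuple

variable {m : ℕ}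

/-- The symbols of a tuple, relative to the prime factors of `g`. -/
noncomputable def tupleSymbols (g : F[X]) (Q : Fin (m + 1) → F[X]) :
    SymbolData {x // x ∈ pf g} m where
  ss p p' := legBit p.1 p'.1
  sl p i := legBit p.1 (Q i)
  ls i p := legBit (Q i) p.1
  par i := (Q i).natDegree

/-- The function on polynomials attached to a vector of coordinates. -/
noncomputable def vecFun (g : F[X]) (Q : Fin (m + 1) → F[X])
    (x : ({x // x ∈ pf g} → ZMod 2) × (Fin m → ZMod 2)) (P : F[X]) : ZMod 2 :=
  if h : P ∈ pf g then x.1 ⟨P, h⟩ else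
    if h : ∃ i, Q i = P then consZero x.2 h.choose else 0

lemma vecFun_left (g : F[X]) (Q : Fin (m + 1) → F[X])
    (x : ({x // x ∈ pf g} → ZMod 2) × (Fin m → ZMod 2)) (p : {x // x ∈ pf g}) :
    vecFun g Q x p.1 = x.1 p := by
  rw [vecFun, dif_pos p.2]

namespace CoprimeTuple

variable {g : F[X]} {Q : Fin (m + 1) → F[X]}

lemma vecFun_right (h : CoprimeTuple g Q)
    (x : ({x // x ∈ pf g} → ZMod 2) × (Fin m → ZMod 2)) (i : Fin (m + 1)) :
    vecFun g Q x (Q i) = consZero x.2 i := by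
  have he : ∃ k, Q k = Q i := ⟨i, rfl⟩
  rw [vecFun, dif_neg (h.not_mem i), dif_pos he, h.injective he.choose_spec]

lemma ll_tupleSymbols (hq4 : Fintype.card F % 4 = 3) (h : CoprimeTuple g Q) {i k : Fin (m + 1)}
    (hik : i ≠ k) : (tupleSymbols g Q).ll (pairBits Q) i k = legBit (Q i) (Q k) := by
  rcases lt_or_gt_of_ne hik with hlt | hlt
  · simp [SymbolData.ll, hlt, pairBits]
  · rw [SymbolData.ll, dif_neg hlt.not_gt, dif_pos hlt,
      legBit_comm hq4 (h.monic_tuple i) (h.monic_tuple k) (h.isCoprime hik)]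
    rfl

lemma smallRow_eq (h : CoprimeTuple g Q)
    (x : ({x // x ∈ pf g} → ZMod 2) × (Fin m → ZMod 2)) (p : {x // x ∈ pf g}) :
    (tupleSymbols g Q).smallRow p x = splitRow (g * ∏ i, Q i) (vecFun g Q x) p.1 := by
  rw [splitRow, h.sum_pf_mul]
  simp only [vecFun_left, h.vecFun_right]
  rfl

lemma largeRow_eq (hq4 : Fintype.card F % 4 = 3) (h : CoprimeTuple g Q)
    (x : ({x // x ∈ pf g} → ZMod 2) × (Fin m → ZMod 2)) (i : Fin m) :
    (tupleSymbols g Q).largeRow (pairBits Q) i x =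
      splitRow (g * ∏ i, Q i) (vecFun g Q x) (Q i.succ) := by
  rw [splitRow, h.sum_pf_mul]
  simp only [vecFun_left, h.vecFun_right, consZero_succ]
  rw [SymbolData.largeRow]
  congr 1
  refine Finset.sum_congr rfl fun J _ => ?_
  by_cases hJ : i.succ = J
  · rw [← hJ, consZero_succ, zmod_two_add_self, mul_zero, mul_zero]
  · rw [h.ll_tupleSymbols hq4 hJ]

end CoprimeTuple

end Tuples

section FullKernel
open scoped Classical

variable {σ : Type} [Fintype σ] {m : ℕ}

namespace SymbolData

variable (T : SymbolData σ m) (t : IncPair (m + 1) → ZMod 2)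

lemma largeRow_add (i : Fin m) (x y : (σ → ZMod 2) × (Fin m → ZMod 2)) :
    T.largeRow t i (x + y) = T.largeRow t i x + T.largeRow t i y := by
  simp only [largeRow, Prod.fst_add, Prod.snd_add, consZero_add, Pi.add_apply]
  rw [add_add_add_comm, ← Finset.sum_add_distrib, ← Finset.sum_add_distrib]
  congr 1 <;> exact Finset.sum_congr rfl fun _ _ => by ring

lemma largeRow_smul (i : Fin m) (a : ZMod 2) (x : (σ → ZMod 2) × (Fin m → ZMod 2)) :
    T.largeRow t i (a • x) = a * T.largeRow t i x := by
  simp only [largeRow, Prod.smul_fst, Prod.smul_snd, consZero_smul, Pi.smul_apply, smul_eq_mul]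
  rw [mul_add, Finset.mul_sum, Finset.mul_sum]
  congr 1 <;> exact Finset.sum_congr rfl fun _ _ => by ring

/-- The vectors on which all rows vanish. -/
def fullKer : Submodule (ZMod 2) ((σ → ZMod 2) × (Fin m → ZMod 2)) where
  carrier := {x | x ∈ T.smallKer ∧ ∀ i, T.largeRow t i x = 0}
  zero_mem' := by
    refine ⟨T.smallKer.zero_mem, fun i => ?_⟩
    have := T.largeRow_smul t i 0 0
    rwa [zero_smul, zero_mul] at this
  add_mem' {x y} hx hy :=
    ⟨T.smallKer.add_mem hx.1 hy.1, fun i => by rw [largeRow_add, hx.2, hy.2, add_zero]⟩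
  smul_mem' a x hx :=
    ⟨T.smallKer.smul_mem a hx.1, fun i => by rw [largeRow_smul, hx.2, mul_zero]⟩

lemma mem_fullKer {x : (σ → ZMod 2) × (Fin m → ZMod 2)} :
    x ∈ T.fullKer t ↔ (∀ p, T.smallRow p x = 0) ∧ ∀ i, T.largeRow t i x = 0 := Iff.rfl

lemma indepCount_eq_card (j : ℕ) (h : ∀ x ∈ T.fullKer t, x.2 = 0 → x = 0) :
    T.indepCount j t =
      Nat.card {X : Fin j → T.fullKer t // LinearIndependent (ZMod 2) X} := by
  have hle : T.fullKer t ≤ T.smallKer := fun x hx => hx.1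
  have hker : LinearMap.ker (T.proj.comp (Submodule.inclusion hle)) = ⊥ := by
    rw [LinearMap.ker_eq_bot']
    intro x hx
    exact Subtype.ext (h x.1 x.2 hx)
  have hLI : ∀ X : Fin j → T.fullKer t, LinearIndependent (ZMod 2) X ↔
      LinearIndependent (ZMod 2) fun c => T.proj (Submodule.inclusion hle (X c)) := fun X =>
    (LinearMap.linearIndependent_iff (T.proj.comp (Submodule.inclusion hle)) hker).symm
  rw [indepCount, ← Finset.sum_filter, Finset.sum_const, nsmul_eq_mul, mul_one,
    Nat.card_eq_fintype_card, Fintype.card_subtype]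
  norm_cast
  symm
  refine Finset.card_bij (fun X _ c => Submodule.inclusion hle (X c)) ?_ ?_ ?_
  · intro X hX
    refine Finset.mem_filter.2 ⟨Finset.mem_univ _, (hLI X).1 (Finset.mem_filter.1 hX).2, ?_⟩
    exact fun c i => (X c).2.2 i
  · intro X _ Y _ hXY
    ext1 c
    exact Submodule.inclusion_injective hle (congrFun hXY c)
  · intro x hx
    obtain ⟨-, hx1, hx2⟩ := Finset.mem_filter.1 hx
    let X : Fin j → T.fullKer t := fun c => ⟨(x c).1, (x c).2, hx2 c⟩
    exact ⟨X, Finset.mem_filter.2 ⟨Finset.mem_univ _, (hLI X).2 hx1⟩, rfl⟩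

end SymbolData

lemma card_linearIndependent_eq_injPoly {V : Type} [AddCommGroup V] [Module (ZMod 2) V] [Fintype V]
    (j : ℕ) : (Nat.card {X : Fin j → V // LinearIndependent (ZMod 2) X} : ℝ) =
      injPoly j (Fintype.card V) := by
  have hV : Fintype.card V = 2 ^ Module.finrank (ZMod 2) V := by
    rw [Module.card_eq_pow_finrank (K := ZMod 2)]
    simp
  rw [hV]
  by_cases hj : j ≤ Module.finrank (ZMod 2) V
  · rw [card_linearIndependent hj, ZMod.card, injPoly, Nat.cast_prod, Fin.prod_univ_eq_prod_range
      (fun i => (((2 ^ Module.finrank (ZMod 2) V - 2 ^ i : ℕ) : ℕ) : ℝ)) j]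
    refine Finset.prod_congr rfl fun i hi => ?_
    rw [Nat.cast_sub (Nat.pow_le_pow_right (by norm_num)
      ((Finset.mem_range.1 hi).le.trans hj))]
    push_cast
    rfl
  · rw [injPoly, Finset.prod_eq_zero (Finset.mem_range.2 (not_le.1 hj))]
    · rw [Nat.cast_eq_zero, Nat.card_eq_zero]
      left
      refine ⟨fun X => hj ?_⟩
      simpa using X.2.fintype_card_le_finrank
    · push_cast
      exact sub_self _

lemma SymbolData.indepCount_eq_injPoly (T : SymbolData σ m) (t : IncPair (m + 1) → ZMod 2) (j : ℕ)
    (h : ∀ x ∈ T.fullKer t, x.2 = 0 → x = 0) :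
    T.indepCount j t = injPoly j (Fintype.card (T.fullKer t)) := by
  rw [T.indepCount_eq_card t j h, card_linearIndependent_eq_injPoly]

end FullKernel

section TupleKernel
open scoped Classical

variable {F : Type} [Field F] [Fintype F] {m : ℕ}

namespace CoprimeTuple

variable {g : F[X]} {Q : Fin (m + 1) → F[X]}

lemma mem_fullKer_iff (hq4 : Fintype.card F % 4 = 3) (h : CoprimeTuple g Q)
    (x : ({x // x ∈ pf g} → ZMod 2) × (Fin m → ZMod 2)) :
    x ∈ (tupleSymbols g Q).fullKer (pairBits Q) ↔
      ∀ P ∈ pf (g * ∏ i, Q i), P ≠ Q 0 → splitRow (g * ∏ i, Q i) (vecFun g Q x) P = 0 := by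
  rw [SymbolData.mem_fullKer]
  constructor
  · rintro ⟨h1, h2⟩ P hP hne
    rcases h.cases_mem hP with hP | ⟨i, rfl⟩
    · rw [← h.smallRow_eq x ⟨P, hP⟩]
      exact h1 _
    · rcases Fin.eq_zero_or_eq_succ i with rfl | ⟨i, rfl⟩
      · exact absurd rfl hne
      · rw [← h.largeRow_eq hq4]
        exact h2 i
  · intro h1
    refine ⟨fun p => ?_, fun i => ?_⟩
    · rw [h.smallRow_eq]
      exact h1 _ (h.mem_left p.2) fun h' => h.not_mem 0 (h' ▸ p.2)
    · rw [h.largeRow_eq hq4]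
      exact h1 _ (h.mem_right _) fun h' => Fin.succ_ne_zero i (h.injective h')

lemma card_fullKer (hq4 : Fintype.card F % 4 = 3) (h : CoprimeTuple g Q)
    (hodd : Odd (g * ∏ i, Q i).natDegree) :
    Fintype.card ((tupleSymbols g Q).fullKer (pairBits Q)) =
      (residueSplits (g * ∏ i, Q i) (Q 0)).card := by
  have hz : ∀ x, vecFun g Q x (Q 0) = 0 := fun x => by rw [h.vecFun_right, consZero_zero]
  have hmem : ∀ x, supp (g * ∏ i, Q i) (vecFun g Q x) ∈ residueSplits (g * ∏ i, Q i) (Q 0) ↔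
      x ∈ (tupleSymbols g Q).fullKer (pairBits Q) := fun x => by
    rw [supp_mem_residueSplits_iff hq4 h.monic_mul h.squarefree_mul hodd (h.mem_right 0) (hz x),
      h.mem_fullKer_iff hq4]
  rw [← Finset.card_univ]
  refine Finset.card_bij (fun x _ => supp (g * ∏ i, Q i) (vecFun g Q x.1))
    (fun x _ => (hmem x.1).2 x.2) ?_ ?_
  · intro x _ y _ hxy
    have key : ∀ P ∈ pf (g * ∏ i, Q i), vecFun g Q x.1 P = vecFun g Q y.1 P := by
      intro P hP
      have h1 : vecFun g Q x.1 P = 1 ↔ vecFun g Q y.1 P = 1 := by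
        have := Finset.ext_iff.1 hxy P
        simpa [supp, hP] using this
      rcases zmod_two_cases (vecFun g Q x.1 P) with h2 | h2 <;>
        rcases zmod_two_cases (vecFun g Q y.1 P) with h3 | h3 <;> rw [h2, h3] at h1 ⊢ <;>
        simp at h1
    refine Subtype.ext (Prod.ext (funext fun p => ?_) (funext fun i => ?_))
    · rw [← vecFun_left g Q, ← vecFun_left g Q]
      exact key _ (h.mem_left p.2)
    · have := key _ (h.mem_right i.succ)
      rwa [h.vecFun_right, h.vecFun_right, consZero_succ, consZero_succ] at this
  · intro S hS
    have hS1 := (mem_residueSplits.1 hS).1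
    let x : ({x // x ∈ pf g} → ZMod 2) × (Fin m → ZMod 2) :=
      (fun p => if p.1 ∈ S then 1 else 0, fun i => if Q i.succ ∈ S then 1 else 0)
    have hx : supp (g * ∏ i, Q i) (vecFun g Q x) = S := by
      ext P
      rw [supp, Finset.mem_filter]
      constructor
      · rintro ⟨hP, hP1⟩
        rcases h.cases_mem hP with hP | ⟨i, rfl⟩
        · rw [vecFun_left g Q x ⟨P, hP⟩] at hP1
          by_contra hPS
          simp [x, hPS] at hP1
        · rw [h.vecFun_right] at hP1
          rcases Fin.eq_zero_or_eq_succ i with rfl | ⟨i, rfl⟩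
          · simp at hP1
          · rw [consZero_succ] at hP1
            by_contra hPS
            simp [x, hPS] at hP1
      · intro hPS
        obtain ⟨hne, hP⟩ := Finset.mem_erase.1 (hS1 hPS)
        refine ⟨hP, ?_⟩
        rcases h.cases_mem hP with hP | ⟨i, rfl⟩
        · rw [vecFun_left g Q x ⟨P, hP⟩]
          simp [x, hPS]
        · rw [h.vecFun_right]
          rcases Fin.eq_zero_or_eq_succ i with rfl | ⟨i, rfl⟩
          · exact absurd rfl hne
          · simp [x, hPS]
    exact ⟨⟨x, (hmem x).1 (hx ▸ hS)⟩, Finset.mem_univ _, hx⟩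

/-- The vectors in the kernel are determined by their large part. -/
lemma eq_zero_of_snd_eq_zero (hq4 : Fintype.card F % 4 = 3) (h : CoprimeTuple g Q)
    (hodd : Odd (g * ∏ i, Q i).natDegree)
    (hT : ∀ S ⊆ pf g, S.Nonempty → ∃ i, leg (Q i) (∏ p ∈ S, p) ≠ 1)
    (x : ({x // x ∈ pf g} → ZMod 2) × (Fin m → ZMod 2))
    (hx : x ∈ (tupleSymbols g Q).fullKer (pairBits Q)) (hx2 : x.2 = 0) : x = 0 := by
  have hz : ∀ i, vecFun g Q x (Q i) = 0 := fun i => by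
    rw [h.vecFun_right, hx2]
    rcases Fin.eq_zero_or_eq_succ i with rfl | ⟨i, rfl⟩ <;> simp
  have hsupp := (mem_residueSplits.1 ((supp_mem_residueSplits_iff hq4 h.monic_mul h.squarefree_mul
    hodd (h.mem_right 0) (hz 0)).2 ((h.mem_fullKer_iff hq4 x).1 hx))).2
  rw [mutualResidues_supp_iff] at hsupp
  have hsub : supp (g * ∏ i, Q i) (vecFun g Q x) ⊆ pf g := by
    intro P hP
    obtain ⟨hP1, hP2⟩ := Finset.mem_filter.1 hP
    rcases h.cases_mem hP1 with hP | ⟨i, rfl⟩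
    · exact hP
    · rw [hz i] at hP2
      exact absurd hP2 zero_ne_one
  have hempty : ¬ (supp (g * ∏ i, Q i) (vecFun g Q x)).Nonempty := by
    intro hne
    obtain ⟨i, hi⟩ := hT _ hsub hne
    exact hi ((leg_supp_eq_one_iff (h.mem_right i) (hz i)).2 (hsupp _ (h.mem_right i)))
  refine Prod.ext (funext fun p => ?_) hx2
  rw [← vecFun_left g Q]
  refine (zmod_two_cases _).resolve_right fun h1 => hempty ⟨p.1, ?_⟩
  exact Finset.mem_filter.2 ⟨h.mem_left p.2, h1⟩

lemma indepCount_eq (hq4 : Fintype.card F % 4 = 3) (h : CoprimeTuple g Q)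
    (hodd : Odd (g * ∏ i, Q i).natDegree)
    (hT : ∀ S ⊆ pf g, S.Nonempty → ∃ i, leg (Q i) (∏ p ∈ S, p) ≠ 1) (j : ℕ) :
    (tupleSymbols g Q).indepCount j (pairBits Q) =
      injPoly j (residueSplits (g * ∏ i, Q i) (Q 0)).card := by
  rw [SymbolData.indepCount_eq_injPoly _ _ _ (h.eq_zero_of_snd_eq_zero hq4 hodd hT),
    ← h.card_fullKer hq4 hodd]
  congr!

/-- The nondegeneracy condition needed to count the kernel of the small rows. -/
lemma exists_sum_sl_ne_zero (h : CoprimeTuple g Q)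
    (hT : ∀ S ⊆ pf g, S.Nonempty → ∃ i, leg (∏ p ∈ S, p) (Q i) ≠ 1)
    (y : {x // x ∈ pf g} → ZMod 2) (hy : y ≠ 0) :
    ∃ i, ∑ p, y p * (tupleSymbols g Q).sl p i ≠ 0 := by
  set S : Finset F[X] := (Finset.univ.filter fun p => y p = 1).image Subtype.val with hS
  have hSsub : S ⊆ pf g := by
    intro P hP
    obtain ⟨p, -, rfl⟩ := Finset.mem_image.1 hP
    exact p.2
  have hne : S.Nonempty := by
    obtain ⟨p, hp⟩ := Function.ne_iff.1 hy
    exact ⟨p.1, Finset.mem_image_of_mem _ (Finset.mem_filter.2 ⟨Finset.mem_univ _,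
      (zmod_two_cases _).resolve_left hp⟩)⟩
  obtain ⟨i, hi⟩ := hT S hSsub hne
  refine ⟨i, fun h0 => hi ?_⟩
  have h1 : (leg (∏ p ∈ S, p) (Q i) : ℝ) = sgn (∑ p, y p * (tupleSymbols g Q).sl p i) := by
    rw [leg_prod_left (h.monic_tuple i), hS, Finset.prod_image fun a _ b _ hab => Subtype.ext hab,
      sgn_sum, Finset.prod_filter, Int.cast_prod]
    refine Finset.prod_congr rfl fun p _ => ?_
    rcases zmod_two_cases (y p) with hp | hp
    · simp [hp, sgn_zero]
    · rw [hp, one_mul, if_pos rfl]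
      exact (sgn_legBit (h.monic_tuple i) (h.isCoprime_left p.2 i).symm).symm
  rw [h0, sgn_zero] at h1
  exact_mod_cast h1

end CoprimeTuple

end TupleKernel

section Classes
open scoped Classical

variable {F : Type} [Field F] [Fintype F] {g : F[X]} {n m : ℕ}

/-- The degrees of a tuple together with its symbols over the prime factors of `g`. -/
noncomputable def labelKey (g : F[X]) (Q : Fin n → F[X]) :
    (Fin n → ℕ) × (Fin n → {x // x ∈ pf g} → ZMod 2) :=
  (fun i => (Q i).natDegree, fun i p => legBit (Q i) p.1)

lemma natDegree_of_labelKey_eq {Q Q' : Fin n → F[X]} (h : labelKey g Q = labelKey g Q')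
    (i : Fin n) : (Q i).natDegree = (Q' i).natDegree := congrFun (congrArg Prod.fst h) i

lemma legBit_of_labelKey_eq {Q Q' : Fin n → F[X]} (h : labelKey g Q = labelKey g Q')
    (i : Fin n) {p : F[X]} (hp : p ∈ pf g) : legBit (Q i) p = legBit (Q' i) p :=
  congrFun (congrFun (congrArg Prod.snd h) i) ⟨p, hp⟩

/-- The tuples with prescribed degrees and symbols over the prime factors of `g`. -/
noncomputable def keyPrimes (g : F[X]) (Q : Fin n → F[X]) (i : Fin n) : Finset F[X] :=
  (primes F (Q i).natDegree).filter fun P =>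
    ∀ p : {x // x ∈ pf g}, legBit P p.1 = legBit (Q i) p.1

namespace CoprimeTuple

lemma leg_of_labelKey_eq {Q Q' : Fin n → F[X]} (h : CoprimeTuple g Q) (h' : CoprimeTuple g Q')
    (hk : labelKey g Q = labelKey g Q') (i : Fin n) {p : F[X]} (hp : p ∈ pf g) :
    leg (Q i) p = leg (Q' i) p := by
  have h1 := sgn_legBit (pf_monic hp) (h.isCoprime_left hp i)
  have h2 := sgn_legBit (pf_monic hp) (h'.isCoprime_left hp i)
  rw [legBit_of_labelKey_eq hk i hp, h2] at h1
  exact_mod_cast h1.symm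

lemma leg_prod_of_labelKey_eq {Q Q' : Fin n → F[X]} (h : CoprimeTuple g Q)
    (h' : CoprimeTuple g Q') (hk : labelKey g Q = labelKey g Q') (i : Fin n)
    {S : Finset F[X]} (hS : S ⊆ pf g) :
    leg (Q i) (∏ p ∈ S, p) = leg (Q' i) (∏ p ∈ S, p) := by
  rw [leg_prod_right _ _ _ fun p hp => pf_monic (hS hp),
    leg_prod_right _ _ _ fun p hp => pf_monic (hS hp)]
  exact Finset.prod_congr rfl fun p hp => h.leg_of_labelKey_eq h' hk i (hS hp)

lemma prod_leg_of_labelKey_eq (hq4 : Fintype.card F % 4 = 3) {Q Q' : Fin n → F[X]}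
    (h : CoprimeTuple g Q)
    (h' : CoprimeTuple g Q') (hk : labelKey g Q = labelKey g Q') (i : Fin n)
    {S : Finset F[X]} (hS : S ⊆ pf g) :
    leg (∏ p ∈ S, p) (Q i) = leg (∏ p ∈ S, p) (Q' i) := by
  rw [leg_reciprocity hq4 _ (Q i), leg_reciprocity hq4 _ (Q' i), natDegree_of_labelKey_eq hk i,
    h.leg_prod_of_labelKey_eq h' hk i hS]

lemma tupleSymbols_of_labelKey_eq (hq4 : Fintype.card F % 4 = 3) {Q Q' : Fin (m + 1) → F[X]}
    (h : CoprimeTuple g Q) (h' : CoprimeTuple g Q') (hk : labelKey g Q = labelKey g Q') :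
    tupleSymbols g Q = tupleSymbols g Q' := by
  have h1 : ∀ i (p : {x // x ∈ pf g}), legBit (Q i) p.1 = legBit (Q' i) p.1 := fun i p =>
    legBit_of_labelKey_eq hk i p.2
  have h2 : ∀ (p : {x // x ∈ pf g}) i, legBit p.1 (Q i) = legBit p.1 (Q' i) := fun p i => by
    rw [legBit_comm hq4 (pf_monic p.2) (h.monic_tuple i) (h.isCoprime_left p.2 i).symm,
      legBit_comm hq4 (pf_monic p.2) (h'.monic_tuple i) (h'.isCoprime_left p.2 i).symm,
      h1, natDegree_of_labelKey_eq hk i]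
  simp only [tupleSymbols, h1, h2, natDegree_of_labelKey_eq hk]

lemma natDegree_mul {Q : Fin n → F[X]} (h : CoprimeTuple g Q) :
    (g * ∏ i, Q i).natDegree = g.natDegree + ∑ i, (Q i).natDegree := by
  rw [h.monic.natDegree_mul (monic_prod_of_monic _ _ fun i _ => h.monic_tuple i),
    natDegree_prod_of_monic _ _ fun i _ => h.monic_tuple i]

lemma of_mem_keyPrimes {y : ℕ} {Q Q' : Fin n → F[X]} (h : CoprimeTuple g Q)
    (hg : ∀ p ∈ pf g, p.natDegree ≤ y) (hQ : ∀ i, y < (Q i).natDegree)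
    (h' : Q' ∈ (Fintype.piFinset (keyPrimes g Q)).filter Function.Injective) :
    CoprimeTuple g Q' ∧ labelKey g Q' = labelKey g Q := by
  obtain ⟨h1, h2⟩ := Finset.mem_filter.1 h'
  have h3 : ∀ i, Q' i ∈ primes F (Q i).natDegree ∧
      ∀ p : {x // x ∈ pf g}, legBit (Q' i) p.1 = legBit (Q i) p.1 := fun i =>
    mem_filt.1 (Fintype.mem_piFinset.1 h1 i)
  have h4 := fun i => mem_primes.1 (h3 i).1
  refine ⟨⟨h.monic, h.squarefree, fun i => (h4 i).1, fun i => (h4 i).2.2, h2, fun i hd => ?_⟩, ?_⟩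
  · have := hg _ ((mem_pf h.monic.ne_zero).2 ⟨(h4 i).1, (h4 i).2.2, hd⟩)
    rw [(h4 i).2.1] at this
    exact absurd (hQ i) (not_lt.2 this)
  · exact Prod.ext (funext fun i => (h4 i).2.1) (funext fun i => funext fun p => (h3 i).2 p)

/-- The moments over a class of tuples. -/
theorem abs_sum_class_le (hq4 : Fintype.card F % 4 = 3) {y k j : ℕ} {Q : Fin (m + 1) → F[X]}
    (h : CoprimeTuple g Q) (hg : ∀ p ∈ pf g, p.natDegree ≤ 4 * y)
    (hQ : ∀ i, 4 * y < (Q i).natDegree) (hodd : Odd (g * ∏ i, Q i).natDegree)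
    (hk : k + 1 ≤ (Finset.univ.filter fun i => Odd (Q i).natDegree).card)
    (hT1 : ∀ S ⊆ pf g, S.Nonempty → ∃ i, leg (Q i) (∏ p ∈ S, p) ≠ 1)
    (hT2 : ∀ S ⊆ pf g, S.Nonempty → ∃ i, leg (∏ p ∈ S, p) (Q i) ≠ 1) :
    |∑ R ∈ (Fintype.piFinset (keyPrimes g Q)).filter Function.Injective,
      (injPoly j (residueSplits (g * ∏ i, R i) (R 0)).card - 1)| ≤
      ((Fintype.piFinset (keyPrimes g Q)).filter Function.Injective).card *
        (2 ^ (j ^ 2 + j + 2 * (pf g).card + 2) / 2 ^ k) +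
      2 ^ (((pf g).card + m) * j) * 2 ^ Fintype.card (IncPair (m + 1)) *
        (2 * (Fintype.card F : ℝ) ^ (∑ i, (Q i).natDegree)) / (Fintype.card F : ℝ) ^ y := by
  set T := tupleSymbols g Q with hT
  set C := (Fintype.piFinset (keyPrimes g Q)).filter Function.Injective with hC
  set N := Fintype.card (IncPair (m + 1)) with hN
  have hσ : Fintype.card {x // x ∈ pf g} = (pf g).card := Fintype.card_coe _
  have hqpos : (0 : ℝ) < (Fintype.card F : ℝ) ^ y :=
    pow_pos (by exact_mod_cast Fintype.card_pos) _
  have hval : ∀ R ∈ C, injPoly j (residueSplits (g * ∏ i, R i) (R 0)).card =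
      T.indepCount j (pairBits R) := by
    intro R hR
    obtain ⟨hR1, hR2⟩ := h.of_mem_keyPrimes hg hQ hR
    rw [hT, ← hR1.tupleSymbols_of_labelKey_eq hq4 h hR2, hR1.indepCount_eq hq4]
    · rwa [hR1.natDegree_mul, Finset.sum_congr rfl fun i _ => natDegree_of_labelKey_eq hR2 i,
        ← h.natDegree_mul]
    · intro S hS hne
      obtain ⟨i, hi⟩ := hT1 S hS hne
      exact ⟨i, by rwa [hR1.leg_prod_of_labelKey_eq h hR2 i hS]⟩
  have hmain := T.abs_sum_indepCount_sub_le j (h.exists_sum_sl_ne_zero hT2)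
  have hW := abs_sum_tuple_sub_le hq4 (fun i => (Q i).natDegree) hQ (keyPrimes g Q)
    (fun i => Finset.filter_subset _ _) (T.indepCount j) (M := 2 ^ (((pf g).card + m) * j))
    fun t => by
      rw [abs_of_nonneg (T.indepCount_nonneg j t), ← hσ]
      exact T.indepCount_le j t
  have hk' : k ≤ (Finset.univ.filter fun i : Fin m => T.par i.succ = 1).card := by
    have h1 : (Finset.univ.filter fun i : Fin (m + 1) => Odd (Q i).natDegree) ⊆
        insert 0 ((Finset.univ.filter fun i : Fin m => T.par i.succ = 1).image Fin.succ) := by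
      intro i hi
      rcases Fin.eq_zero_or_eq_succ i with rfl | ⟨i, rfl⟩
      · exact Finset.mem_insert_self _ _
      · refine Finset.mem_insert_of_mem (Finset.mem_image_of_mem _
          (Finset.mem_filter.2 ⟨Finset.mem_univ _, ?_⟩))
        exact ZMod.natCast_eq_one_iff_odd.2 (Finset.mem_filter.1 hi).2
    have h2 := (Finset.card_le_card h1).trans (Finset.card_insert_le _ _)
    have h3 := Finset.card_image_le (s := Finset.univ.filter fun i : Fin m => T.par i.succ = 1)
      (f := Fin.succ)
    omega
  have hE : |(∑ t, T.indepCount j t) / 2 ^ N - 1| ≤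
      2 ^ (j ^ 2 + j + 2 * (pf g).card + 2) / 2 ^ k := by
    have h2N : (0 : ℝ) < 2 ^ N := by positivity
    rw [div_sub_one h2N.ne', abs_div, abs_of_pos h2N, div_le_iff₀ h2N, mul_comm]
    refine hmain.trans ?_
    rw [hσ]
    gcongr
    norm_num
  have hsplit : ∑ R ∈ C, (injPoly j (residueSplits (g * ∏ i, R i) (R 0)).card - 1) =
      C.card * ((∑ t, T.indepCount j t) / 2 ^ N - 1) +
      ∑ R ∈ C, (T.indepCount j (pairBits R) - (∑ t, T.indepCount j t) / 2 ^ N) := by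
    rw [← nsmul_eq_mul, ← Finset.sum_const, ← Finset.sum_add_distrib]
    refine Finset.sum_congr rfl fun R hR => ?_
    rw [hval R hR]
    ring
  rw [hsplit]
  refine (abs_add_le _ _).trans (add_le_add ?_ ?_)
  · rw [abs_mul, Nat.abs_cast]
    gcongr
  · rw [le_div_iff₀ hqpos]
    refine Eq.trans_le ?_ hW
    congr!

end CoprimeTuple

end Classes

section Ranks
open scoped Classical

variable {F : Type} [Field F] [Fintype F] {f g : F[X]} {n m : ℕ}

lemma exists_coprimeTuple_one (hf : f.Monic) (hs : Squarefree f) (hn : (pf f).card = n) :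
    ∃ Q : Fin n → F[X], CoprimeTuple 1 Q ∧ 1 * ∏ i, Q i = f := by
  let e := (pf f).equivFinOfCardEq hn
  refine ⟨fun i => (e.symm i).1, ⟨monic_one, squarefree_one, fun i => pf_monic (e.symm i).2,
    fun i => pf_irreducible (e.symm i).2, fun i j hij => e.symm.injective (Subtype.ext hij),
    fun i hd => (pf_irreducible (e.symm i).2).not_isUnit (isUnit_of_dvd_one hd)⟩, ?_⟩
  rw [one_mul, Equiv.prod_comp e.symm (fun p : {x // x ∈ pf f} => p.1),
    Finset.prod_coe_sort (pf f) (fun p => p), prod_pf hf hs]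

lemma pf_nonempty_of_odd (hf : f.Monic) (hodd : Odd f.natDegree) : (pf f).Nonempty := by
  obtain ⟨P, hP, hPi, hd⟩ := exists_prime_dvd hf fun h => by simp [h] at hodd
  exact ⟨P, (mem_pf hf.ne_zero).2 ⟨hP, hPi, hd⟩⟩

lemma exists_fourRankEq (hq4 : Fintype.card F % 4 = 3) (hf : f.Monic) (hs : Squarefree f)
    (hodd : Odd f.natDegree) : ∃ r, fourRankEq f r := by
  obtain ⟨m, hm⟩ := Nat.exists_eq_succ_of_ne_zero
    (Finset.card_pos.2 (pf_nonempty_of_odd hf hodd)).ne'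
  obtain ⟨Q, hQ, rfl⟩ := exists_coprimeTuple_one hf hs hm
  refine ⟨Module.finrank (ZMod 2) ((tupleSymbols 1 Q).fullKer (pairBits Q)), ?_⟩
  rw [fourRankEq_iff hq4 hf hs hodd (hQ.mem_right 0), ← hQ.card_fullKer hq4 hodd,
    Module.card_eq_pow_finrank (K := ZMod 2), ZMod.card]

/-- The exponent of the number of residue splittings. -/
noncomputable def splitRank (f : F[X]) : ℕ :=
  if h : ∃ r, fourRankEq f r then h.choose else 0

lemma fourRankEq_splitRank (hq4 : Fintype.card F % 4 = 3) (hf : f.Monic) (hs : Squarefree f)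
    (hodd : Odd f.natDegree) : fourRankEq f (splitRank f) := by
  have h := exists_fourRankEq hq4 hf hs hodd
  have h2 : splitRank f = h.choose := dif_pos h
  rw [h2]
  intro _
  exact h.choose_spec

lemma card_residueSplits (hq4 : Fintype.card F % 4 = 3) (hf : f.Monic) (hs : Squarefree f)
    (hodd : Odd f.natDegree) {Q₀ : F[X]} (hQ : Q₀ ∈ pf f) :
    (residueSplits f Q₀).card = 2 ^ splitRank f :=
  (fourRankEq_iff hq4 hf hs hodd hQ _).1 (fourRankEq_splitRank hq4 hf hs hodd)

lemma fourRankEq_iff_splitRank (hq4 : Fintype.card F % 4 = 3) (hf : f.Monic) (hs : Squarefree f)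
    (hodd : Odd f.natDegree) (r : ℕ) : fourRankEq f r ↔ splitRank f = r := by
  obtain ⟨Q₀, hQ⟩ := pf_nonempty_of_odd hf hodd
  rw [fourRankEq_iff hq4 hf hs hodd hQ, card_residueSplits hq4 hf hs hodd hQ]
  exact Nat.pow_right_inj one_lt_two

/-- The conditions on the factorization of a polynomial under which the moments are computed:
few prime factors, sufficiently many of which have large odd degree, and all nontrivial smooth
divisors separated from `1` by the large prime factors. -/
structure Typical (y N s k : ℕ) (f : F[X]) : Prop where
  large_le : omegaDeg (y < ·) f ≤ N
  small_le : omegaDeg (· ≤ y) f ≤ s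
  odd_ge : k ≤ omegaDeg (fun e => y < e ∧ Odd e) f
  left : ∀ D : F[X], D.Monic → D ≠ 1 → D ∣ f → (∀ P ∈ pf D, P.natDegree ≤ y) →
    ∃ P ∈ pf f, y < P.natDegree ∧ leg P D ≠ 1
  right : ∀ D : F[X], D.Monic → D ≠ 1 → D ∣ f → (∀ P ∈ pf D, P.natDegree ≤ y) →
    ∃ P ∈ pf f, y < P.natDegree ∧ leg D P ≠ 1

lemma omegaDeg_eq_zero {K : ℕ → Prop} (h : ∀ p ∈ pf g, ¬ K p.natDegree) : omegaDeg K g = 0 := by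
  rw [omegaDeg, Finset.card_eq_zero]
  ext p
  rw [mem_filt]
  simpa using h p

lemma omegaDeg_eq_card {K : ℕ → Prop} (h : ∀ p ∈ pf g, K p.natDegree) :
    omegaDeg K g = (pf g).card := by
  rw [omegaDeg]
  congr 1
  ext p
  rw [mem_filt]
  exact and_iff_left_of_imp (h p)

namespace CoprimeTuple

variable {Q : Fin n → F[X]} {y : ℕ}

lemma omegaDeg_mul (h : CoprimeTuple g Q) (K : ℕ → Prop) :
    omegaDeg K (g * ∏ i, Q i) =
      omegaDeg K g + (Finset.univ.filter fun i => K (Q i).natDegree).card := by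
  rw [omegaDeg, omegaDeg, Finset.card_filter, Finset.card_filter, Finset.card_filter,
    h.sum_pf_mul, Finset.sum_coe_sort (pf g) fun p => if K p.natDegree then 1 else 0]

lemma separated_iff (h : CoprimeTuple g Q) (hg : ∀ p ∈ pf g, p.natDegree ≤ y)
    (hQ : ∀ i, y < (Q i).natDegree) (R : F[X] → F[X] → Prop) :
    (∀ D : F[X], D.Monic → D ≠ 1 → D ∣ g * ∏ i, Q i → (∀ P ∈ pf D, P.natDegree ≤ y) →
      ∃ P ∈ pf (g * ∏ i, Q i), y < P.natDegree ∧ R D P) ↔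
    ∀ S ⊆ pf g, S.Nonempty → ∃ i, R (∏ p ∈ S, p) (Q i) := by
  constructor
  · intro hD S hS hne
    have hS' : ∀ P ∈ S, P.Monic ∧ Irreducible P := fun P hP =>
      ⟨pf_monic (hS hP), pf_irreducible (hS hP)⟩
    obtain ⟨P, hP, hy, hR⟩ := hD (∏ p ∈ S, p)
      (monic_prod_of_monic _ _ fun p hp => (hS' p hp).1)
      (fun h1 => by
        have := pf_prod S hS'
        rw [h1, pf_one] at this
        exact hne.ne_empty this.symm)
      ((Finset.prod_dvd_prod_of_subset _ _ _ hS).trans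
        (by rw [prod_pf h.monic h.squarefree]; exact dvd_mul_right _ _))
      (by rw [pf_prod S hS']; exact fun P hP => hg P (hS hP))
    rcases h.cases_mem hP with hP | ⟨i, rfl⟩
    · exact absurd hy (not_lt.2 (hg P hP))
    · exact ⟨i, hR⟩
  · intro hS D hD hD1 hdvd hDs
    have hDsq : Squarefree D := h.squarefree_mul.squarefree_of_dvd hdvd
    have hsub : pf D ⊆ pf g := by
      intro P hP
      rcases h.cases_mem (pf_subset_of_dvd h.monic_mul.ne_zero hdvd hP) with hP' | ⟨i, rfl⟩
      · exact hP'
      · exact absurd (hQ i) (not_lt.2 (hDs _ hP))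
    obtain ⟨i, hi⟩ := hS (pf D) hsub (by
      obtain ⟨P, hP, hPi, hd⟩ := exists_prime_dvd hD hD1
      exact ⟨P, (mem_pf hD.ne_zero).2 ⟨hP, hPi, hd⟩⟩)
    rw [prod_pf hD hDsq] at hi
    exact ⟨Q i, h.mem_right i, hQ i, hi⟩

lemma typical_iff (h : CoprimeTuple g Q) (hg : ∀ p ∈ pf g, p.natDegree ≤ y)
    (hQ : ∀ i, y < (Q i).natDegree) (N s k : ℕ) :
    Typical y N s k (g * ∏ i, Q i) ↔ n ≤ N ∧ (pf g).card ≤ s ∧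
      k ≤ (Finset.univ.filter fun i => Odd (Q i).natDegree).card ∧
      (∀ S ⊆ pf g, S.Nonempty → ∃ i, leg (Q i) (∏ p ∈ S, p) ≠ 1) ∧
      ∀ S ⊆ pf g, S.Nonempty → ∃ i, leg (∏ p ∈ S, p) (Q i) ≠ 1 := by
  have h1 : omegaDeg (y < ·) (g * ∏ i, Q i) = n := by
    rw [h.omegaDeg_mul, omegaDeg_eq_zero fun p hp => not_lt.2 (hg p hp)]
    simp [hQ]
  have h2 : omegaDeg (· ≤ y) (g * ∏ i, Q i) = (pf g).card := by
    rw [h.omegaDeg_mul, omegaDeg_eq_card hg]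
    simp [fun i => not_le.2 (hQ i)]
  have h3 : omegaDeg (fun e => y < e ∧ Odd e) (g * ∏ i, Q i) =
      (Finset.univ.filter fun i => Odd (Q i).natDegree).card := by
    rw [h.omegaDeg_mul, omegaDeg_eq_zero fun p hp hh => not_lt.2 (hg p hp) hh.1]
    simp [hQ]
  rw [← h.separated_iff hg hQ fun D P => leg P D ≠ 1,
    ← h.separated_iff hg hQ fun D P => leg D P ≠ 1]
  constructor
  · intro hT
    exact ⟨h1 ▸ hT.large_le, h2 ▸ hT.small_le, h3 ▸ hT.odd_ge, hT.left, hT.right⟩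
  · rintro ⟨a, b, c, d, e⟩
    exact ⟨h1.symm ▸ a, h2.symm ▸ b, h3.symm ▸ c, d, e⟩

lemma typical_of_labelKey_eq (hq4 : Fintype.card F % 4 = 3) {Q' : Fin n → F[X]}
    (h : CoprimeTuple g Q) (h' : CoprimeTuple g Q') (hk : labelKey g Q = labelKey g Q')
    (hg : ∀ p ∈ pf g, p.natDegree ≤ y) (hQ : ∀ i, y < (Q i).natDegree) {N s k : ℕ}
    (hT : Typical y N s k (g * ∏ i, Q i)) : Typical y N s k (g * ∏ i, Q' i) := by
  have hQ' : ∀ i, y < (Q' i).natDegree := fun i => natDegree_of_labelKey_eq hk i ▸ hQ i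
  obtain ⟨a, b, c, d, e⟩ := (h.typical_iff hg hQ N s k).1 hT
  refine (h'.typical_iff hg hQ' N s k).2 ⟨a, b, ?_, fun S hS hne => ?_, fun S hS hne => ?_⟩
  · simpa only [natDegree_of_labelKey_eq hk] using c
  · obtain ⟨i, hi⟩ := d S hS hne
    exact ⟨i, by rwa [← h.leg_prod_of_labelKey_eq h' hk i hS]⟩
  · obtain ⟨i, hi⟩ := e S hS hne
    exact ⟨i, by rwa [← h.prod_leg_of_labelKey_eq hq4 h' hk i hS]⟩

end CoprimeTuple

end Ranks

section Groups
open scoped Classical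

variable {F : Type} [Field F] [Fintype F] {f g : F[X]} {m : ℕ}

lemma card_injective_piFinset {α : Type} (R : Finset α) (n : ℕ) :
    ((Fintype.piFinset fun _ : Fin n => R).filter Function.Injective).card =
      R.card.descFactorial n := by
  have h := Fintype.card_embedding_eq (α := Fin n) (β := {x // x ∈ R})
  rw [Fintype.card_coe, Fintype.card_fin] at h
  rw [← h, ← Finset.card_univ]
  symm
  refine Finset.card_bij (fun e _ i => (e i).1) ?_ ?_ ?_
  · intro e _
    exact Finset.mem_filter.2 ⟨Fintype.mem_piFinset.2 fun i => (e i).2,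
      fun i j hij => e.injective (Subtype.ext hij)⟩
  · intro e _ e' _ h
    ext i
    exact congrFun h i
  · intro Q hQ
    obtain ⟨h1, h2⟩ := Finset.mem_filter.1 hQ
    rw [Fintype.mem_piFinset] at h1
    exact ⟨⟨fun i => ⟨Q i, h1 i⟩, fun i j hij => h2 (congrArg Subtype.val hij)⟩,
      Finset.mem_univ _, rfl⟩

/-- The squarefree polynomials of degree `d` with smooth part `g` and `n` large prime factors. -/
noncomputable def sqfreesOf (y d : ℕ) (g : F[X]) (n : ℕ) : Finset F[X] :=
  (sqfrees F d).filter fun f => smoothPart y f = g ∧ omegaDeg (y < ·) f = n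

lemma mem_sqfreesOf {y d n : ℕ} : f ∈ sqfreesOf y d g n ↔
    f ∈ sqfrees F d ∧ smoothPart y f = g ∧ omegaDeg (y < ·) f = n := mem_filt

/-- The ordered tuples of large primes complementary to `g`. -/
noncomputable def tuplesOf (y d : ℕ) (g : F[X]) (n : ℕ) : Finset (Fin n → F[X]) :=
  (Fintype.piFinset fun _ => primesLT F (d + 1)).filter fun Q =>
    Function.Injective Q ∧ (∀ i, y < (Q i).natDegree) ∧
      g.natDegree + ∑ i, (Q i).natDegree = d

lemma mem_tuplesOf {y d n : ℕ} {Q : Fin n → F[X]} : Q ∈ tuplesOf y d g n ↔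
    (∀ i, (Q i).Monic ∧ Irreducible (Q i)) ∧ Function.Injective Q ∧
      (∀ i, y < (Q i).natDegree) ∧ g.natDegree + ∑ i, (Q i).natDegree = d := by
  rw [tuplesOf, mem_filt, Fintype.mem_piFinset]
  simp only [mem_primesLT]
  constructor
  · rintro ⟨h1, h2⟩
    exact ⟨fun i => ⟨(h1 i).1, (h1 i).2.1⟩, h2⟩
  · rintro ⟨h1, h2, h3, h4⟩
    refine ⟨fun i => ⟨(h1 i).1, (h1 i).2, ?_⟩, h2, h3, h4⟩
    have := Finset.single_le_sum (f := fun i => (Q i).natDegree) (fun i _ => Nat.zero_le _)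
      (Finset.mem_univ i)
    omega

variable {y d n : ℕ}

lemma coprimeTuple_of_mem (hg : g.Monic) (hs : Squarefree g) (hy : ∀ p ∈ pf g, p.natDegree ≤ y)
    {Q : Fin n → F[X]} (hQ : Q ∈ tuplesOf y d g n) : CoprimeTuple g Q := by
  obtain ⟨h1, h2, h3, -⟩ := mem_tuplesOf.1 hQ
  exact ⟨hg, hs, fun i => (h1 i).1, fun i => (h1 i).2, h2, fun i hd =>
    absurd (h3 i) (not_lt.2 (hy _ ((mem_pf hg.ne_zero).2 ⟨(h1 i).1, (h1 i).2, hd⟩)))⟩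

lemma natDegree_of_mem_tuplesOf (hg : g.Monic) (hs : Squarefree g)
    (hy : ∀ p ∈ pf g, p.natDegree ≤ y) {Q : Fin n → F[X]} (hQ : Q ∈ tuplesOf y d g n) :
    (g * ∏ i, Q i).natDegree = d :=
  (coprimeTuple_of_mem hg hs hy hQ).natDegree_mul.trans (mem_tuplesOf.1 hQ).2.2.2

lemma pf_filter_le (hy : ∀ p ∈ pf g, p.natDegree ≤ y) {Q : Fin n → F[X]}
    (h : CoprimeTuple g Q) (hQ : ∀ i, y < (Q i).natDegree) :
    (pf (g * ∏ i, Q i)).filter (fun P => P.natDegree ≤ y) = pf g := by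
  ext P
  rw [mem_filt]
  constructor
  · rintro ⟨h1, h2⟩
    rcases h.cases_mem h1 with h3 | ⟨i, rfl⟩
    · exact h3
    · exact absurd (hQ i) (not_lt.2 h2)
  · exact fun hP => ⟨h.mem_left hP, hy P hP⟩

lemma mul_mem_sqfreesOf (hg : g.Monic) (hs : Squarefree g) (hy : ∀ p ∈ pf g, p.natDegree ≤ y)
    {Q : Fin n → F[X]} (hQ : Q ∈ tuplesOf y d g n) : g * ∏ i, Q i ∈ sqfreesOf y d g n := by
  have h := coprimeTuple_of_mem hg hs hy hQ
  have h3 := (mem_tuplesOf.1 hQ).2.2.1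
  refine mem_sqfreesOf.2 ⟨mem_sqfrees.2 ⟨h.monic_mul, natDegree_of_mem_tuplesOf hg hs hy hQ,
    h.squarefree_mul⟩, ?_, ?_⟩
  · rw [smoothPart, pf_filter_le hy h h3, prod_pf hg hs]
  · rw [h.omegaDeg_mul, omegaDeg_eq_zero fun p hp => not_lt.2 (hy p hp)]
    simp [h3]

lemma card_fiber (hg : g.Monic) (hs : Squarefree g) (hy : ∀ p ∈ pf g, p.natDegree ≤ y)
    (hf : f ∈ sqfreesOf y d g n) :
    ((tuplesOf y d g n).filter fun Q => g * ∏ i, Q i = f).card = n.factorial := by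
  obtain ⟨hf1, hfg, hfn⟩ := mem_sqfreesOf.1 hf
  obtain ⟨hfm, hfd, hfs⟩ := mem_sqfrees.1 hf1
  set R := (pf f).filter fun P => y < P.natDegree with hR
  have hRn : R.card = n := by
    rw [← hfn, hR, omegaDeg]
    congr!
  have hR' : ∏ P ∈ R, P = roughPart y f := by
    rw [roughPart]
    refine Finset.prod_congr ?_ fun _ _ => rfl
    ext P
    rw [hR, mem_filt, mem_filt, not_le]
  have hgf : g * ∏ P ∈ R, P = f := by rw [hR', ← hfg, smoothPart_mul_roughPart y hfm hfs]
  have key : ((tuplesOf y d g n).filter fun Q => g * ∏ i, Q i = f) =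
      (Fintype.piFinset fun _ : Fin n => R).filter Function.Injective := by
    ext Q
    rw [Finset.mem_filter, Finset.mem_filter, Fintype.mem_piFinset]
    constructor
    · rintro ⟨hQ, hQf⟩
      have h := coprimeTuple_of_mem hg hs hy hQ
      refine ⟨fun i => mem_filt.2 ⟨hQf ▸ h.mem_right i, (mem_tuplesOf.1 hQ).2.2.1 i⟩, h.injective⟩
    · rintro ⟨hQ, hinj⟩
      have hQ' := fun i => mem_filt.1 (hQ i)
      have himg : Finset.univ.image Q = R := by
        refine Finset.eq_of_subset_of_card_le (Finset.image_subset_iff.2 fun i _ => hQ i) ?_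
        rw [Finset.card_image_of_injective _ hinj, hRn, Finset.card_univ, Fintype.card_fin]
      have hprod : ∏ i, Q i = ∏ P ∈ R, P := by
        rw [← himg, Finset.prod_image fun i _ j _ hij => hinj hij]
      have hQf : g * ∏ i, Q i = f := by rw [hprod, hgf]
      refine ⟨mem_tuplesOf.2 ⟨fun i => ⟨pf_monic (hQ' i).1, pf_irreducible (hQ' i).1⟩, hinj,
        fun i => (hQ' i).2, ?_⟩, hQf⟩
      rw [← hfd, ← hQf, hg.natDegree_mul
        (monic_prod_of_monic _ _ fun i _ => pf_monic (hQ' i).1),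
        natDegree_prod_of_monic _ _ fun i _ => pf_monic (hQ' i).1]
  have h := card_injective_piFinset R n
  rw [hRn, Nat.descFactorial_self] at h
  rw [key, ← h]
  congr!

lemma sum_tuplesOf (hg : g.Monic) (hs : Squarefree g) (hy : ∀ p ∈ pf g, p.natDegree ≤ y)
    (ψ : F[X] → ℝ) :
    ∑ Q ∈ tuplesOf y d g n, ψ (g * ∏ i, Q i) =
      n.factorial * ∑ f ∈ sqfreesOf y d g n, ψ f := by
  rw [← Finset.sum_fiberwise_of_maps_to (t := sqfreesOf y d g n)
    (g := fun Q => g * ∏ i, Q i) (fun Q hQ => by exact mul_mem_sqfreesOf hg hs hy hQ), Finset.mul_sum]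
  refine Finset.sum_congr rfl fun f hf => ?_
  rw [Finset.sum_congr rfl fun Q hQ => by rw [(Finset.mem_filter.1 hQ).2], Finset.sum_const,
    card_fiber hg hs hy hf, nsmul_eq_mul]

end Groups

section TypicalSums
open scoped Classical

variable {F : Type} [Field F] [Fintype F] {f g : F[X]} {y d n N s k j : ℕ}

/-- The centred moment of a typical polynomial. -/
noncomputable def typWeight (y N s k j : ℕ) (f : F[X]) : ℝ :=
  if Typical y N s k f then injPoly j (2 ^ splitRank f) - 1 else 0

lemma typWeight_of_not (h : ¬ Typical y N s k f) : typWeight y N s k j f = 0 := if_neg h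

lemma filter_labelKey_eq (hg : g.Monic) (hs : Squarefree g) (hy : ∀ p ∈ pf g, p.natDegree ≤ y)
    {Q : Fin n → F[X]} (hQ : Q ∈ tuplesOf y d g n) :
    (tuplesOf y d g n).filter (fun R => labelKey g R = labelKey g Q) =
      (Fintype.piFinset (keyPrimes g Q)).filter Function.Injective := by
  have h := coprimeTuple_of_mem hg hs hy hQ
  have hQ' := mem_tuplesOf.1 hQ
  ext R
  rw [Finset.mem_filter]
  constructor
  · rintro ⟨hR, hk⟩
    have hR' := mem_tuplesOf.1 hR
    refine Finset.mem_filter.2 ⟨Fintype.mem_piFinset.2 fun i => mem_filt.2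
      ⟨mem_primes.2 ⟨(hR'.1 i).1, natDegree_of_labelKey_eq hk i, (hR'.1 i).2⟩, fun p =>
        legBit_of_labelKey_eq hk i p.2⟩, hR'.2.1⟩
  · intro hR
    obtain ⟨h1, h2⟩ := h.of_mem_keyPrimes hy hQ'.2.2.1 hR
    refine ⟨mem_tuplesOf.2 ⟨fun i => ⟨h1.monic_tuple i, h1.irreducible i⟩, h1.injective,
      fun i => ?_, ?_⟩, h2⟩
    · rw [natDegree_of_labelKey_eq h2 i]
      exact hQ'.2.2.1 i
    · rw [Finset.sum_congr rfl fun i _ => natDegree_of_labelKey_eq h2 i]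
      exact hQ'.2.2.2

lemma card_incPair_le (n : ℕ) : Fintype.card (IncPair n) ≤ n ^ 2 := by
  refine (Fintype.card_subtype_le _).trans ?_
  rw [Fintype.card_prod, Fintype.card_fin, sq]

lemma abs_sum_filter_labelKey_le (hq4 : Fintype.card F % 4 = 3) (hd : Odd d) (hg : g.Monic)
    (hs : Squarefree g) (hy : ∀ p ∈ pf g, p.natDegree ≤ 4 * y)
    (hn : 0 < n) (κ : (Fin n → ℕ) × (Fin n → {x // x ∈ pf g} → ZMod 2)) :
    |∑ Q ∈ (tuplesOf (4 * y) d g n).filter (fun R => labelKey g R = κ),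
      typWeight (4 * y) N s (k + 1) j (g * ∏ i, Q i)| ≤
      ((tuplesOf (4 * y) d g n).filter (fun R => labelKey g R = κ)).card *
        (2 ^ (j ^ 2 + j + 2 * s + 2) / 2 ^ k : ℝ) +
      2 ^ ((s + N) * j) * 2 ^ (N ^ 2) *
        (2 * (Fintype.card F : ℝ) ^ (d - g.natDegree)) / (Fintype.card F : ℝ) ^ y := by
  by_cases hex : ∃ Q ∈ tuplesOf (4 * y) d g n, labelKey g Q = κ ∧
      Typical (4 * y) N s (k + 1) (g * ∏ i, Q i)
  · obtain ⟨Q, hQ, rfl, hT⟩ := hex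
    obtain ⟨m, rfl⟩ := Nat.exists_eq_succ_of_ne_zero hn.ne'
    have h := coprimeTuple_of_mem hg hs hy hQ
    have hQ' := mem_tuplesOf.1 hQ
    obtain ⟨hN, hs', hk, hT1, hT2⟩ := (h.typical_iff hy hQ'.2.2.1 N s (k + 1)).1 hT
    have hval : ∀ R ∈ (tuplesOf (4 * y) d g (m + 1)).filter
        (fun R => labelKey g R = labelKey g Q),
        typWeight (4 * y) N s (k + 1) j (g * ∏ i, R i) =
          injPoly j (residueSplits (g * ∏ i, R i) (R 0)).card - 1 := by
      intro R hR
      obtain ⟨hR1, hR2⟩ := Finset.mem_filter.1 hR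
      have hR := coprimeTuple_of_mem hg hs hy hR1
      rw [typWeight, if_pos (h.typical_of_labelKey_eq hq4 hR hR2.symm hy hQ'.2.2.1 hT),
        card_residueSplits hq4 hR.monic_mul hR.squarefree_mul
          (by rwa [natDegree_of_mem_tuplesOf hg hs hy hR1]) (hR.mem_right 0)]
      norm_cast
    rw [Finset.sum_congr rfl hval, filter_labelKey_eq hg hs hy hQ]
    refine (h.abs_sum_class_le hq4 hy hQ'.2.2.1
      (by rwa [natDegree_of_mem_tuplesOf hg hs hy hQ]) hk hT1 hT2).trans ?_
    have hdeg : ∑ i, (Q i).natDegree = d - g.natDegree := by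
      have := hQ'.2.2.2
      omega
    have hinc : Fintype.card (IncPair (m + 1)) ≤ N ^ 2 :=
      (card_incPair_le _).trans (Nat.pow_le_pow_left hN 2)
    rw [hdeg]
    gcongr
    · norm_num
    · norm_num
    · omega
    · norm_num
  · rw [Finset.sum_eq_zero fun Q hQ => typWeight_of_not fun hT =>
      hex ⟨Q, (Finset.mem_filter.1 hQ).1, (Finset.mem_filter.1 hQ).2, hT⟩, abs_zero]
    positivity

lemma card_image_labelKey_le :
    ((tuplesOf y d g n).image (labelKey g)).card ≤ (d + 1) ^ n * 2 ^ (n * (pf g).card) := by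
  have hsub : (tuplesOf y d g n).image (labelKey g) ⊆
      (Fintype.piFinset fun _ : Fin n => Finset.range (d + 1)) ×ˢ
        (Finset.univ : Finset (Fin n → {x // x ∈ pf g} → ZMod 2)) := by
    intro κ hκ
    obtain ⟨Q, hQ, rfl⟩ := Finset.mem_image.1 hκ
    refine Finset.mem_product.2 ⟨Fintype.mem_piFinset.2 fun i => Finset.mem_range.2 ?_,
      Finset.mem_univ _⟩
    have h1 := (mem_tuplesOf.1 hQ).2.2.2
    have h2 := Finset.single_le_sum (f := fun i => (Q i).natDegree) (fun i _ => Nat.zero_le _)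
      (Finset.mem_univ i)
    change (Q i).natDegree < d + 1
    omega
  refine (Finset.card_le_card hsub).trans (le_of_eq ?_)
  rw [Finset.card_product, Fintype.card_piFinset, Finset.card_univ]
  simp [← pow_mul, mul_comm]

/-- The bound for the contribution of one class of tuples. -/
noncomputable def classBound (q : ℝ) (y d N s j : ℕ) : ℝ :=
  (d + 1) ^ N * 2 ^ (N * s) * (2 ^ ((s + N) * j) * 2 ^ (N ^ 2) * (2 * q ^ d) / q ^ y)

lemma abs_sum_sqfreesOf_le (hq4 : Fintype.card F % 4 = 3) (hd : Odd d) (hgd : g.natDegree ≤ d) :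
    |∑ f ∈ sqfreesOf (4 * y) d g n, typWeight (4 * y) N s (k + 1) j f| ≤
      (sqfreesOf (4 * y) d g n).card * (2 ^ (j ^ 2 + j + 2 * s + 2) / 2 ^ k : ℝ) +
      classBound (Fintype.card F) y d N s j * (pnorm g)⁻¹ := by
  set q : ℝ := (Fintype.card F : ℝ) with hq
  have hq0 : 0 < q := by rw [hq]; exact_mod_cast Fintype.card_pos
  have hp : 0 < pnorm g := pnorm_pos g
  have hB : 0 ≤ classBound q y d N s j * (pnorm g)⁻¹ := by
    rw [classBound]
    positivity
  by_cases hex : ∃ f ∈ sqfreesOf (4 * y) d g n, Typical (4 * y) N s (k + 1) f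
  · obtain ⟨f, hf, hT⟩ := hex
    obtain ⟨hf1, hfg, hfn⟩ := mem_sqfreesOf.1 hf
    obtain ⟨hfm, hfd, hfs⟩ := mem_sqfrees.1 hf1
    have hg : g.Monic := hfg ▸ smoothPart_monic (4 * y) f
    have hs : Squarefree g := hfg ▸ smoothPart_squarefree (4 * y) f
    have hpf : pf g = (pf f).filter fun P => P.natDegree ≤ 4 * y := by
      rw [← hfg, pf_smoothPart]
    have hy : ∀ p ∈ pf g, p.natDegree ≤ 4 * y := fun p hp => by
      rw [hpf] at hp
      exact (mem_filt.1 hp).2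
    have hcard : (pf g).card ≤ s := by
      refine le_trans (le_of_eq ?_) hT.small_le
      rw [hpf, omegaDeg]
      congr!
    have hnN : n ≤ N := hfn ▸ hT.large_le
    have hn : 0 < n := by
      have h1 := hT.odd_ge
      have h2 : omegaDeg (fun e => 4 * y < e ∧ Odd e) f ≤ omegaDeg (4 * y < ·) f := by
        rw [omegaDeg, omegaDeg]
        refine Finset.card_le_card fun P hP => ?_
        rw [mem_filt] at hP ⊢
        exact ⟨hP.1, hP.2.1⟩
      omega
    set ε : ℝ := 2 ^ (j ^ 2 + j + 2 * s + 2) / 2 ^ k with hε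
    set M : ℝ := 2 ^ ((s + N) * j) * 2 ^ (N ^ 2) * (2 * q ^ (d - g.natDegree)) / q ^ y with hM
    have hM0 : 0 ≤ M := by rw [hM]; positivity
    have hsum : |∑ Q ∈ tuplesOf (4 * y) d g n,
        typWeight (4 * y) N s (k + 1) j (g * ∏ i, Q i)| ≤
        (tuplesOf (4 * y) d g n).card * ε + ((d + 1) ^ N * 2 ^ (N * s)) * M := by
      have hmaps : ∀ Q ∈ tuplesOf (4 * y) d g n,
          labelKey g Q ∈ (tuplesOf (4 * y) d g n).image (labelKey g) := fun Q hQ =>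
        Finset.mem_image_of_mem _ hQ
      rw [← Finset.sum_fiberwise_of_maps_to hmaps, Finset.card_eq_sum_card_fiberwise hmaps]
      refine (Finset.abs_sum_le_sum_abs _ _).trans ((Finset.sum_le_sum fun κ _ =>
        abs_sum_filter_labelKey_le hq4 hd hg hs hy hn κ).trans ?_)
      rw [Finset.sum_add_distrib, ← Finset.sum_mul, Finset.sum_const, nsmul_eq_mul]
      push_cast
      gcongr
      have h1 := card_image_labelKey_le (y := 4 * y) (d := d) (g := g) (n := n)
      have h2 : (d + 1) ^ n * 2 ^ (n * (pf g).card) ≤ (d + 1) ^ N * 2 ^ (N * s) := by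
        gcongr
        · omega
        · norm_num
      exact_mod_cast h1.trans h2
    have h1 := sum_tuplesOf (d := d) (n := n) hg hs hy (typWeight (4 * y) N s (k + 1) j)
    have h2 := sum_tuplesOf (d := d) (n := n) hg hs hy fun _ => 1
    rw [Finset.sum_const, Finset.sum_const, nsmul_one, nsmul_one] at h2
    have hfac : (1 : ℝ) ≤ n.factorial := by exact_mod_cast n.factorial_pos
    rw [h1, h2, abs_mul, Nat.abs_cast] at hsum
    have hBM : classBound q y d N s j * (pnorm g)⁻¹ = ((d + 1) ^ N * 2 ^ (N * s)) * M := by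
      rw [classBound, hM, pnorm, pow_sub₀ _ hq0.ne' hgd]
      ring
    rw [hBM]
    have hK : 0 ≤ ((d + 1) ^ N * 2 ^ (N * s)) * M := by positivity
    refine le_of_mul_le_mul_left (hsum.trans ?_) (zero_lt_one.trans_le hfac)
    nlinarith
  · rw [Finset.sum_eq_zero fun f hf => typWeight_of_not fun hT => hex ⟨f, hf, hT⟩, abs_zero]
    positivity

lemma sum_sqfreesLT_inv_pnorm_le (d : ℕ) :
    ∑ g ∈ sqfreesLT F d, (pnorm g)⁻¹ ≤ d := by
  have hq0 : (0 : ℝ) < Fintype.card F := by exact_mod_cast Fintype.card_pos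
  rw [sum_sqfreesLT]
  calc _ ≤ ∑ e ∈ Finset.range d, (1 : ℝ) := Finset.sum_le_sum fun e _ => by
        rw [Finset.sum_congr rfl fun g hg => by rw [pnorm, (mem_sqfrees.1 hg).2.1],
          Finset.sum_const, nsmul_eq_mul, mul_inv_le_iff₀ (pow_pos hq0 e), one_mul]
        exact card_sqfrees_le e
    _ = d := by simp

/-- The centred moments over the typical polynomials are small. -/
theorem abs_sum_typWeight_le (hq4 : Fintype.card F % 4 = 3) (hd : Odd d) (y N s k j : ℕ) :
    |∑ f ∈ sqfrees F d, typWeight (4 * y) N s (k + 1) j f| ≤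
      (Fintype.card F : ℝ) ^ d * (2 ^ (j ^ 2 + j + 2 * s + 2) / 2 ^ k : ℝ) +
      classBound (Fintype.card F) y d N s j * ((d + 1) * (N + 1)) := by
  have hq0 : (0 : ℝ) < Fintype.card F := by exact_mod_cast Fintype.card_pos
  have hB : 0 ≤ classBound (Fintype.card F) y d N s j := by
    rw [classBound]
    positivity
  set Tp := (sqfrees F d).filter fun f => Typical (4 * y) N s (k + 1) f with hTp
  set A := (sqfrees F d).filter fun f => omegaDeg (4 * y < ·) f ≤ N with hA
  have hAsum : ∑ f ∈ sqfrees F d, typWeight (4 * y) N s (k + 1) j f =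
      ∑ f ∈ A, typWeight (4 * y) N s (k + 1) j f := by
    refine (Finset.sum_subset (Finset.filter_subset _ _) fun f hf hfA => ?_).symm
    exact typWeight_of_not fun hT => hfA (mem_filt.2 ⟨hf, hT.large_le⟩)
  set I := sqfreesLT F (d + 1) ×ˢ Finset.range (N + 1) with hI
  have hmaps : ∀ f ∈ A, (smoothPart (4 * y) f, omegaDeg (4 * y < ·) f) ∈ I := by
    intro f hf
    obtain ⟨h1, h2⟩ := mem_filt.1 hf
    obtain ⟨hm, hdeg, hs⟩ := mem_sqfrees.1 h1
    refine Finset.mem_product.2 ⟨mem_sqfreesLT.2 ⟨smoothPart_monic _ _, smoothPart_squarefree _ _,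
      ?_⟩, Finset.mem_range.2 (Nat.lt_succ_of_le h2)⟩
    have hdvd : smoothPart (4 * y) f ∣ f :=
      ⟨roughPart (4 * y) f, (smoothPart_mul_roughPart _ hm hs).symm⟩
    exact Nat.lt_succ_of_le ((natDegree_le_of_dvd hdvd hm.ne_zero).trans hdeg.le)
  have hfib : ∀ p ∈ I, A.filter (fun f => (smoothPart (4 * y) f, omegaDeg (4 * y < ·) f) = p) =
      sqfreesOf (4 * y) d p.1 p.2 := by
    intro p hp
    have hp2 := Finset.mem_range.1 (Finset.mem_product.1 hp).2
    ext f
    rw [Finset.mem_filter, mem_sqfreesOf, hA, mem_filt, Prod.ext_iff]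
    constructor
    · rintro ⟨⟨h1, -⟩, h3⟩
      exact ⟨h1, h3⟩
    · rintro ⟨h1, h2, h3⟩
      exact ⟨⟨h1, by omega⟩, h2, h3⟩
  have hcard : ∑ p ∈ I, ((sqfreesOf (4 * y) d p.1 p.2).card : ℝ) ≤ (Fintype.card F : ℝ) ^ d := by
    have h1 := Finset.card_eq_sum_card_fiberwise hmaps
    rw [Finset.sum_congr rfl fun p hp => by rw [hfib p hp]] at h1
    rw [← Nat.cast_sum, ← h1]
    exact le_trans (by exact_mod_cast Finset.card_filter_le _ _) (card_sqfrees_le d)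
  rw [hAsum, ← Finset.sum_fiberwise_of_maps_to hmaps]
  refine (Finset.abs_sum_le_sum_abs _ _).trans ?_
  calc _ ≤ ∑ p ∈ I, ((sqfreesOf (4 * y) d p.1 p.2).card *
          (2 ^ (j ^ 2 + j + 2 * s + 2) / 2 ^ k : ℝ) +
          classBound (Fintype.card F) y d N s j * (pnorm p.1)⁻¹) :=
        Finset.sum_le_sum fun p hp => by
          rw [hfib p hp]
          refine abs_sum_sqfreesOf_le hq4 hd ?_
          have := (mem_sqfreesLT.1 (Finset.mem_product.1 hp).1).2.2
          omega
    _ ≤ _ := by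
        rw [Finset.sum_add_distrib, ← Finset.sum_mul, ← Finset.mul_sum]
        gcongr
        rw [hI, Finset.sum_product]
        simp only [Finset.sum_const, Finset.card_range, nsmul_eq_mul]
        rw [← Finset.mul_sum, mul_comm]
        have := sum_sqfreesLT_inv_pnorm_le (F := F) (d + 1)
        push_cast at this ⊢
        gcongr

end TypicalSums

section Nontypical
open scoped Classical

variable {F : Type} [Field F] [Fintype F]

lemma not_typical_cases {y N s k : ℕ} {f : F[X]} (h : ¬ Typical y N s k f) :
    N < omegaDeg (y < ·) f ∨ s < omegaDeg (· ≤ y) f ∨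
      omegaDeg (fun e => y < e ∧ Odd e) f < k ∨
      (omegaDeg (· ≤ y) f ≤ s ∧ ∃ D : F[X], D.Monic ∧ D ≠ 1 ∧ D ∣ f ∧
        (∀ P ∈ pf D, P.natDegree ≤ y) ∧ ∀ P ∈ pf f, y < P.natDegree → leg P D = 1) ∨
      (omegaDeg (· ≤ y) f ≤ s ∧ ∃ D : F[X], D.Monic ∧ D ≠ 1 ∧ D ∣ f ∧
        (∀ P ∈ pf D, P.natDegree ≤ y) ∧ ∀ P ∈ pf f, y < P.natDegree → leg D P = 1) := by
  by_contra! hcon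
  obtain ⟨h1, h2, h3, h4, h5⟩ := hcon
  exact h ⟨h1, h2, h3, h4 h2, h5 h2⟩

/-- Few squarefree polynomials are not typical. -/
theorem card_not_typical_le (hq4 : Fintype.card F % 4 = 3) {y N s k d : ℕ} (hN : 0 < N)
    (hs : 0 < s) (hd : 2 * (s * y) ≤ d) (hd0 : 0 < d) :
    (((sqfrees F d).filter fun f => ¬ Typical y N s k f).card : ℝ) ≤
      (Fintype.card F : ℝ) ^ d * ((1 + Real.log d) / N + (1 + Real.log y) / s +
        2 ^ k * Real.exp (5 / 4 + Real.log y / 2 + 3 / 4 * Real.log d) / d +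
        2 * (Real.exp (2 * (1 + Real.log y)) * Real.sqrt (4 * (s * y) / d))) := by
  set q : ℝ := (Fintype.card F : ℝ) with hq
  have hN' : (0 : ℝ) < N := by exact_mod_cast hN
  have hs' : (0 : ℝ) < s := by exact_mod_cast hs
  have hd' : (0 : ℝ) < d := by exact_mod_cast hd0
  have b1 := card_omegaDeg_gt_le (F := F) (y < ·) (d := d) (n := d) (fun k hk _ => hk) N
  have b2 := card_omegaDeg_gt_le (F := F) (· ≤ y) (d := d) (n := y) (fun k _ hk => hk) s
  have b3 := card_few_odd_large_le (F := F) y d k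
  have b4 := card_exists_smooth_dvd_le (F := F) (fun D A => leg A D)
    (fun D h1 h2 h3 => isQuadChar_leg_left hq4 h1 h2 h3) hd hd0
  have b5 := card_exists_smooth_dvd_le (F := F) (fun D A => leg D A)
    (fun D h1 h2 h3 => isQuadChar_leg_right hq4 h1 h2 h3) hd hd0
  rw [← le_div_iff₀ hN'] at b1
  rw [← le_div_iff₀ hs'] at b2
  rw [← le_div_iff₀ hd'] at b3
  set A1 := (sqfrees F d).filter fun f => N < omegaDeg (y < ·) f with hA1
  set A2 := (sqfrees F d).filter fun f => s < omegaDeg (· ≤ y) f with hA2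
  set A3 := (sqfrees F d).filter fun f => omegaDeg (fun e => y < e ∧ Odd e) f < k with hA3
  set A4 := (sqfrees F d).filter fun f => omegaDeg (· ≤ y) f ≤ s ∧ ∃ D : F[X], D.Monic ∧ D ≠ 1 ∧
    D ∣ f ∧ (∀ P ∈ pf D, P.natDegree ≤ y) ∧ ∀ P ∈ pf f, y < P.natDegree → leg P D = 1 with hA4
  set A5 := (sqfrees F d).filter fun f => omegaDeg (· ≤ y) f ≤ s ∧ ∃ D : F[X], D.Monic ∧ D ≠ 1 ∧
    D ∣ f ∧ (∀ P ∈ pf D, P.natDegree ≤ y) ∧ ∀ P ∈ pf f, y < P.natDegree → leg D P = 1 with hA5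
  have hsub : ((sqfrees F d).filter fun f => ¬ Typical y N s k f) ⊆
      A1 ∪ (A2 ∪ (A3 ∪ (A4 ∪ A5))) := by
    intro f hf
    obtain ⟨h1, h2⟩ := Finset.mem_filter.1 hf
    simp only [Finset.mem_union]
    rcases not_typical_cases h2 with h | h | h | h | h
    · exact Or.inl (mem_filt.2 ⟨h1, h⟩)
    · exact Or.inr (Or.inl (mem_filt.2 ⟨h1, h⟩))
    · exact Or.inr (Or.inr (Or.inl (mem_filt.2 ⟨h1, h⟩)))
    · exact Or.inr (Or.inr (Or.inr (Or.inl (mem_filt.2 ⟨h1, h⟩))))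
    · exact Or.inr (Or.inr (Or.inr (Or.inr (mem_filt.2 ⟨h1, h⟩))))
  have hcard : ((sqfrees F d).filter fun f => ¬ Typical y N s k f).card ≤
      A1.card + (A2.card + (A3.card + (A4.card + A5.card))) := by
    refine (Finset.card_le_card hsub).trans ((Finset.card_union_le _ _).trans ?_)
    gcongr
    refine (Finset.card_union_le _ _).trans ?_
    gcongr
    refine (Finset.card_union_le _ _).trans ?_
    gcongr
    exact Finset.card_union_le _ _
  have hcard' : (((sqfrees F d).filter fun f => ¬ Typical y N s k f).card : ℝ) ≤
      A1.card + (A2.card + (A3.card + (A4.card + A5.card))) := by exact_mod_cast hcard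
  refine hcard'.trans ?_
  calc _ ≤ _ := add_le_add b1 (add_le_add b2 (add_le_add b3 (add_le_add b4 b5)))
    _ = _ := by ring

end Nontypical

section Estimates
open Filter Topology

/-- The parameter governing the size of all the cutoffs. -/
def cutLevel (d : ℕ) : ℕ := Nat.log 2 d / 64

lemma tendsto_cutLevel : Tendsto cutLevel atTop atTop := by
  refine tendsto_atTop.2 fun b => ?_
  filter_upwards [eventually_ge_atTop (2 ^ (64 * b))] with d hd
  have h1 : 64 * b ≤ Nat.log 2 d := Nat.le_log_of_pow_le one_lt_two hd
  rw [cutLevel]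
  omega

lemma two_pow_cutLevel_le {d : ℕ} (hd : 0 < d) : 2 ^ (64 * cutLevel d) ≤ d :=
  (Nat.pow_le_pow_right (by norm_num) (Nat.mul_div_le _ _)).trans (Nat.pow_log_le_self 2 hd.ne')

lemma succ_le_two_pow_cutLevel (d : ℕ) : d + 1 ≤ 2 ^ (64 * (cutLevel d + 1)) := by
  refine (Nat.lt_pow_succ_log_self one_lt_two d).trans_le (Nat.pow_le_pow_right (by norm_num) ?_)
  rw [cutLevel]
  omega

/-- The proportion of polynomials which are not typical. -/
noncomputable def atypicalBound (l : ℕ) : ℝ :=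
  (1 + 64 * (l + 1)) / (l ^ 2 : ℕ) + (1 + Real.log (4 * l ^ 5 : ℕ)) / l +
    8 * Real.exp (5 / 4) * (l ^ 5 / 2 ^ l) + 512 * Real.exp 2 * (l ^ 16 / 2 ^ l)

lemma tendsto_atypicalBound : Tendsto atypicalBound atTop (𝓝 0) := by
  have hinv : Tendsto (fun l : ℕ => ((l : ℝ))⁻¹) atTop (𝓝 0) := tendsto_inv_atTop_nhds_zero_nat
  have h1 : Tendsto (fun l : ℕ => (1 + 64 * ((l : ℝ) + 1)) / (l ^ 2 : ℕ)) atTop (𝓝 0) := by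
    have h : Tendsto (fun l : ℕ => 65 * ((l : ℝ)⁻¹ * (l : ℝ)⁻¹) + 64 * (l : ℝ)⁻¹) atTop (𝓝 0) := by
      simpa using ((hinv.mul hinv).const_mul 65).add (hinv.const_mul 64)
    refine h.congr' ?_
    filter_upwards [eventually_gt_atTop 0] with l hl
    have : (0 : ℝ) < l := by exact_mod_cast hl
    push_cast
    field_simp
    ring
  have hlog : Tendsto (fun l : ℕ => Real.log l / (l : ℝ)) atTop (𝓝 0) :=
    (Real.isLittleO_log_id_atTop.tendsto_div_nhds_zero).comp tendsto_natCast_atTop_atTop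
  have h2 : Tendsto (fun l : ℕ => (1 + Real.log (4 * l ^ 5 : ℕ)) / (l : ℝ)) atTop (𝓝 0) := by
    have h : Tendsto (fun l : ℕ => (1 + Real.log 4) * (l : ℝ)⁻¹ + 5 * (Real.log l / (l : ℝ)))
        atTop (𝓝 0) := by
      simpa using (hinv.const_mul (1 + Real.log 4)).add (hlog.const_mul 5)
    refine h.congr' ?_
    filter_upwards [eventually_gt_atTop 0] with l hl
    have : (0 : ℝ) < l := by exact_mod_cast hl
    push_cast
    rw [Real.log_mul (by norm_num) (by positivity), Real.log_pow]
    push_cast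
    field_simp
    ring
  have h3 := (tendsto_pow_const_div_const_pow_of_one_lt 5 (one_lt_two (α := ℝ))).const_mul
    (8 * Real.exp (5 / 4))
  have h4 := (tendsto_pow_const_div_const_pow_of_one_lt 16 (one_lt_two (α := ℝ))).const_mul
    (512 * Real.exp 2)
  have h := ((h1.add h2).add h3).add h4
  simp only [mul_zero, add_zero] at h
  exact h

lemma eight_mul_pow_le {l d : ℕ} (hl : 0 < l) (hd : 2 ^ (64 * l) ≤ d) :
    2 * (l * (4 * l ^ 5)) ≤ d := by
  have h1 : l ^ 6 ≤ 2 ^ (6 * l) := by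
    rw [mul_comm 6 l, pow_mul]
    exact Nat.pow_le_pow_left (Nat.lt_two_pow_self).le 6
  calc 2 * (l * (4 * l ^ 5)) = 2 ^ 3 * l ^ 6 := by ring
    _ ≤ 2 ^ (3 * l) * 2 ^ (6 * l) := Nat.mul_le_mul (Nat.pow_le_pow_right (by norm_num) (by omega)) h1
    _ = 2 ^ (9 * l) := by rw [← pow_add]; ring_nf
    _ ≤ 2 ^ (64 * l) := Nat.pow_le_pow_right (by norm_num) (by omega)
    _ ≤ d := hd

lemma two_mul_exp_mul_sqrt_le {l d : ℕ} {Y : ℝ} (hl : 0 < l) (hd : (2 : ℝ) ^ (64 * l) ≤ d)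
    (hY : 1 ≤ Y) :
    2 * (Real.exp (2 * (1 + Real.log Y)) * Real.sqrt (4 * (l * Y) / d)) ≤
      2 * (Real.exp 2 * Y ^ 2 * (4 * (l * Y) / 2 ^ l)) := by
  have hl1 : (1 : ℝ) ≤ l := by exact_mod_cast hl
  have hY0 : 0 < Y := by linarith
  have h1 : Real.exp (2 * (1 + Real.log Y)) = Real.exp 2 * Y ^ 2 := by
    rw [mul_add, mul_one, Real.exp_add, two_mul (Real.log Y), Real.exp_add, Real.exp_log hY0, sq]
  have hp : (0 : ℝ) < 2 ^ l := by positivity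
  have h2 : Real.sqrt (4 * (l * Y) / d) ≤ 4 * (l * Y) / 2 ^ l := by
    have hx0 : 1 ≤ l * Y := one_le_mul_of_one_le_of_one_le hl1 hY
    have hx : 1 ≤ 4 * (l * Y) := by linarith
    generalize 4 * (l * Y) = x at hx
    have h3 : ((2 : ℝ) ^ l) ^ 2 ≤ d := by
      rw [← pow_mul]
      exact (pow_le_pow_right₀ (by norm_num) (by omega)).trans hd
    have hx' : 0 ≤ x := by linarith
    refine (Real.sqrt_le_left (by positivity)).2 ?_
    rw [div_pow]
    exact div_le_div₀ (by positivity) (by nlinarith) (by positivity) h3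
  rw [h1]
  exact mul_le_mul_of_nonneg_left (mul_le_mul_of_nonneg_left h2 (by positivity)) (by norm_num)

set_option maxHeartbeats 800000 in
lemma atypical_le {l d : ℕ} (hl : 0 < l) (hd : 2 ^ (64 * l) ≤ d) (hd' : d + 1 ≤ 2 ^ (64 * (l + 1))) :
    (1 + Real.log d) / (l ^ 2 : ℕ) + (1 + Real.log (4 * l ^ 5 : ℕ)) / l +
        2 ^ (8 * l + 1) * Real.exp (5 / 4 + Real.log (4 * l ^ 5 : ℕ) / 2 + 3 / 4 * Real.log d) / d +
        2 * (Real.exp (2 * (1 + Real.log (4 * l ^ 5 : ℕ))) *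
          Real.sqrt (4 * (l * (4 * l ^ 5 : ℕ)) / d)) ≤ atypicalBound l := by
  have hl1 : (1 : ℝ) ≤ l := by exact_mod_cast hl
  have hdp : (2 : ℝ) ^ (64 * l) ≤ d := by exact_mod_cast hd
  have hd0 : (0 : ℝ) < d := lt_of_lt_of_le (by positivity) hdp
  have hdu : (d : ℝ) ≤ 2 ^ (64 * (l + 1)) := by
    have : d ≤ 2 ^ (64 * (l + 1)) := by omega
    exact_mod_cast this
  have hlog2 : Real.log 2 ≤ 1 := by
    have := Real.log_le_sub_one_of_pos (x := 2) (by norm_num)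
    linarith
  have hlogd : Real.log d ≤ 64 * (l + 1) := by
    have h1 := Real.log_le_log hd0 hdu
    rw [Real.log_pow] at h1
    push_cast at h1
    have h2 : (64 * ((l : ℝ) + 1)) * Real.log 2 ≤ 64 * (l + 1) * 1 := by gcongr
    linarith
  set Y : ℝ := ((4 * l ^ 5 : ℕ) : ℝ) with hY
  have hYe : Y = 4 * (l : ℝ) ^ 5 := by rw [hY]; push_cast; ring
  have hY1 : 1 ≤ Y := by
    rw [hYe]
    have := one_le_pow₀ hl1 (n := 5)
    linarith
  have hY0 : 0 < Y := by linarith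
  have hlogY : 0 ≤ Real.log Y := Real.log_nonneg hY1
  have hp : (0 : ℝ) < 2 ^ l := by positivity
  rw [atypicalBound]
  refine add_le_add (add_le_add (add_le_add ?_ le_rfl) ?_) ?_
  · gcongr
  · have h1 : Real.exp (3 / 4 * Real.log d) / d ≤ ((2 : ℝ) ^ (16 * l))⁻¹ := by
      have h2 : Real.log d ≥ (64 * l : ℕ) * Real.log 2 := by
        rw [← Real.log_pow]
        exact Real.log_le_log (by positivity) hdp
      have h3 : ((2 : ℝ) ^ (16 * l))⁻¹ = Real.exp (-((16 * l : ℕ) * Real.log 2)) := by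
        rw [Real.exp_neg, ← Real.log_pow, Real.exp_log (by positivity)]
      have h4 : Real.exp (3 / 4 * Real.log d) / d = Real.exp (-(1 / 4 * Real.log d)) := by
        nth_rw 2 [← Real.exp_log hd0]
        rw [← Real.exp_sub]
        ring_nf
      rw [h3, h4]
      refine Real.exp_le_exp.2 ?_
      push_cast at h2 ⊢
      linarith
    have h5 : Real.exp (Real.log Y / 2) ≤ Y := by
      refine (Real.exp_le_exp.2 (by linarith : Real.log Y / 2 ≤ Real.log Y)).trans ?_
      rw [Real.exp_log hY0]
    have h6 : (2 : ℝ) ^ (8 * l + 1) * ((2 : ℝ) ^ (16 * l))⁻¹ ≤ 2 * (2 ^ l)⁻¹ := by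
      rw [← div_eq_mul_inv, ← div_eq_mul_inv, div_le_div_iff₀ (by positivity) hp, ← pow_add,
        ← pow_succ']
      exact pow_le_pow_right₀ (by norm_num) (by omega)
    calc 2 ^ (8 * l + 1) * Real.exp (5 / 4 + Real.log Y / 2 + 3 / 4 * Real.log d) / d
        = 2 ^ (8 * l + 1) * (Real.exp (3 / 4 * Real.log d) / d) * Real.exp (5 / 4) *
          Real.exp (Real.log Y / 2) := by
          rw [Real.exp_add, Real.exp_add]
          ring
      _ ≤ 2 ^ (8 * l + 1) * ((2 : ℝ) ^ (16 * l))⁻¹ * Real.exp (5 / 4) * Y := by gcongr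
      _ ≤ 2 * (2 ^ l)⁻¹ * Real.exp (5 / 4) * Y := by gcongr
      _ = _ := by
          rw [hYe]
          ring
  · refine (two_mul_exp_mul_sqrt_le hl hdp hY1).trans (le_of_eq ?_)
    rw [hYe]
    ring

lemma exponent_le {l j : ℕ} (h : 400 + 2 * j ≤ l) :
    64 * (l + 1) * (l ^ 2 + 1) + l ^ 2 * l + ((l + l ^ 2) * j + ((l ^ 2) ^ 2 + 1)) + l ^ 2 + l ≤
      l ^ 5 := by
  have h1 : 1 ≤ l := by omega
  have h2 : l ≤ l ^ 4 := Nat.le_self_pow (by norm_num) l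
  have h3 : l ^ 2 ≤ l ^ 4 := Nat.pow_le_pow_right h1 (by norm_num)
  have h4 : l ^ 3 ≤ l ^ 4 := Nat.pow_le_pow_right h1 (by norm_num)
  have h5 : 1 ≤ l ^ 4 := Nat.one_le_pow _ _ h1
  have h6 : l * j ≤ l ^ 4 * j := Nat.mul_le_mul_right j h2
  have h7 : l ^ 2 * j ≤ l ^ 4 * j := Nat.mul_le_mul_right j h3
  have h8 : (400 + 2 * j) * l ^ 4 ≤ l * l ^ 4 := Nat.mul_le_mul_right _ h
  have e1 : 64 * (l + 1) * (l ^ 2 + 1) = 64 * l ^ 3 + 64 * l ^ 2 + 64 * l + 64 := by ring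
  have e2 : l ^ 2 * l = l ^ 3 := by ring
  have e3 : (l + l ^ 2) * j = l * j + l ^ 2 * j := by ring
  have e4 : (l ^ 2) ^ 2 = l ^ 4 := by ring
  have e5 : (400 + 2 * j) * l ^ 4 = 400 * l ^ 4 + 2 * (l ^ 4 * j) := by ring
  have e6 : l * l ^ 4 = l ^ 5 := by ring
  rw [e1, e2, e3, e4]
  rw [e5, e6] at h8
  omega

lemma classBound_mul_le {q Q B : ℝ} {y d N s j A : ℕ} (hq : 0 < q) (hd : (d : ℝ) + 1 ≤ 2 ^ A)
    (hB : B ≤ 2 ^ N) (hB0 : 0 ≤ B)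
    (hQ : (2 : ℝ) ^ (A * (N + 1) + N * s + ((s + N) * j + (N ^ 2 + 1)) + N) * Q ≤ q ^ y)
    (hQ0 : 0 < Q) : classBound q y d N s j * ((d + 1) * B) ≤ q ^ d * Q⁻¹ := by
  have h1 : classBound q y d N s j * ((d + 1) * B) =
      q ^ d * ((((d : ℝ) + 1) ^ (N + 1) * 2 ^ (N * s) *
        (2 ^ ((s + N) * j) * 2 ^ (N ^ 2 + 1)) * B) / q ^ y) := by
    rw [classBound, pow_succ ((d : ℝ) + 1), pow_succ (2 : ℝ) (N ^ 2)]
    ring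
  rw [h1]
  refine mul_le_mul_of_nonneg_left ?_ (by positivity)
  rw [← one_div, div_le_div_iff₀ (by positivity) hQ0, one_mul]
  refine le_trans (mul_le_mul_of_nonneg_right ?_ hQ0.le) hQ
  rw [pow_add _ _ N, pow_add _ (A * (N + 1) + N * s), pow_add _ (A * (N + 1)),
    pow_add _ ((s + N) * j), pow_mul _ A]
  have h2 : ((d : ℝ) + 1) ^ (N + 1) ≤ (2 ^ A) ^ (N + 1) := pow_le_pow_left₀ (by positivity) hd _
  gcongr

lemma classBound_le {l d j : ℕ} {q : ℝ} (hq : 2 ≤ q) (h : 400 + 2 * j ≤ l)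
    (hd' : d + 1 ≤ 2 ^ (64 * (l + 1))) :
    classBound q (l ^ 5) d (l ^ 2) l j * ((d + 1) * ((l ^ 2 : ℕ) + 1)) ≤ q ^ d * (2 ^ l)⁻¹ := by
  have hd2 : (d : ℝ) + 1 ≤ 2 ^ (64 * (l + 1)) := by exact_mod_cast hd'
  clear hd'
  have hN : (((l ^ 2 : ℕ) : ℝ) + 1) ≤ 2 ^ (l ^ 2) := by
    generalize l ^ 2 = m
    have : m + 1 ≤ 2 ^ m := Nat.succ_le_of_lt Nat.lt_two_pow_self
    exact_mod_cast this
  refine classBound_mul_le (by linarith) hd2 hN (Nat.cast_add_one_pos _).le ?_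
    (pow_pos two_pos l)
  rw [← pow_add]
  exact (pow_le_pow_right₀ (by norm_num) (exponent_le h)).trans
    (pow_le_pow_left₀ (by norm_num) hq _)

end Estimates

section Assembly
open scoped Classical
open Filter Topology
variable {F : Type} [Field F] [Fintype F]

/-- The squarefree polynomials of degree `d` which are typical for the cutoffs attached to `d`. -/
noncomputable def typicals (F : Type) [Field F] [Fintype F] (d : ℕ) : Finset F[X] :=
  (sqfrees F d).filter (Typical (4 * cutLevel d ^ 5) (cutLevel d ^ 2) (cutLevel d) (8 * cutLevel d + 1))

lemma typicals_subset (d : ℕ) : typicals F d ⊆ sqfrees F d := Finset.filter_subset _ _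

lemma card_sdiff_typicals_le (hq4 : Fintype.card F % 4 = 3) {d : ℕ} (hd : 0 < d)
    (hl : 0 < cutLevel d) : ((sqfrees F d \ typicals F d).card : ℝ) ≤
      (Fintype.card F : ℝ) ^ d * atypicalBound (cutLevel d) := by
  have hd2 := two_pow_cutLevel_le hd
  have hd3 := succ_le_two_pow_cutLevel d
  have h := card_not_typical_le (F := F) hq4 (y := 4 * cutLevel d ^ 5) (N := cutLevel d ^ 2)
    (s := cutLevel d) (k := 8 * cutLevel d + 1) (d := d) (pow_pos hl 2) hl
    (eight_mul_pow_le hl hd2) hd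
  have hset : sqfrees F d \ typicals F d = (sqfrees F d).filter fun f =>
      ¬ Typical (4 * cutLevel d ^ 5) (cutLevel d ^ 2) (cutLevel d) (8 * cutLevel d + 1) f := by
    rw [typicals, Finset.filter_not]
  rw [hset]
  exact h.trans (mul_le_mul_of_nonneg_left (atypical_le hl hd2 hd3) (by positivity))

lemma abs_sum_typicals_le (hq4 : Fintype.card F % 4 = 3) {d j : ℕ} (hd : Odd d)
    (hl : 400 + 2 * j ≤ cutLevel d) :
    |∑ f ∈ typicals F d, (injPoly j (2 ^ splitRank f) - 1)| ≤
      (Fintype.card F : ℝ) ^ d * ((2 ^ (j ^ 2 + j + 2) + 1) * (2 ^ cutLevel d)⁻¹) := by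
  have hd3 := succ_le_two_pow_cutLevel d
  have h := abs_sum_typWeight_le (F := F) hq4 hd (cutLevel d ^ 5) (cutLevel d ^ 2) (cutLevel d)
    (8 * cutLevel d) j
  have hq2 : (2 : ℝ) ≤ Fintype.card F := by
    have : 2 ≤ Fintype.card F := by omega
    exact_mod_cast this
  have hc := classBound_le (d := d) hq2 hl hd3
  have hsum : ∑ f ∈ typicals F d, (injPoly j (2 ^ splitRank f) - 1) = ∑ f ∈ sqfrees F d,
      typWeight (4 * cutLevel d ^ 5) (cutLevel d ^ 2) (cutLevel d) (8 * cutLevel d + 1) j f := by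
    rw [typicals, Finset.sum_filter]
    rfl
  rw [hsum]
  refine h.trans ((add_le_add_right hc _).trans ?_)
  have hp : (2 : ℝ) ^ (j ^ 2 + j + 2 * cutLevel d + 2) / 2 ^ (8 * cutLevel d) ≤
      2 ^ (j ^ 2 + j + 2) * (2 ^ cutLevel d)⁻¹ := by
    rw [← div_eq_mul_inv, div_le_div_iff₀ (by positivity) (by positivity), ← pow_add, ← pow_add]
    exact pow_le_pow_right₀ (by norm_num) (by omega)
  have := mul_le_mul_of_nonneg_left hp (by positivity : (0 : ℝ) ≤ (Fintype.card F : ℝ) ^ d)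
  linarith

lemma inv_card_sqfrees_mul_le (hq4 : Fintype.card F % 4 = 3) (d : ℕ) {x e : ℝ} (hx : 0 ≤ x)
    (h : x ≤ (Fintype.card F : ℝ) ^ d * e) : ((sqfrees F d).card : ℝ)⁻¹ * x ≤ 2 * e := by
  have hq : (0 : ℝ) < (Fintype.card F : ℝ) ^ d := pow_pos (by exact_mod_cast Fintype.card_pos) _
  have he : 0 ≤ e := by
    by_contra hne
    have := mul_neg_of_pos_of_neg hq (not_le.1 hne)
    linarith
  have h1 : (Fintype.card F : ℝ) ^ d ≤ 2 * ((sqfrees F d).card : ℝ) := by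
    exact_mod_cast card_sqfrees_ge (F := F) (by omega) d
  have h2 : (0 : ℝ) < (sqfrees F d).card := by linarith
  rw [inv_mul_le_iff₀ h2]
  have := mul_le_mul_of_nonneg_right h1 he
  linarith

lemma card_sqfrees_pos (hq4 : Fintype.card F % 4 = 3) (d : ℕ) : 0 < (sqfrees F d).card := by
  have h1 := card_sqfrees_ge (F := F) (by omega) d
  have h2 : 0 < Fintype.card F ^ d := pow_pos Fintype.card_pos d
  omega

lemma tendsto_moment_typicals (hq4 : Fintype.card F % 4 = 3) (j : ℕ) :
    Tendsto (fun d => ((sqfrees F d).card : ℝ)⁻¹ *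
      ∑ f ∈ typicals F d, injPoly j (2 ^ splitRank f)) (atTop ⊓ 𝓟 {d | Odd d}) (𝓝 1) := by
  have hL : Tendsto cutLevel (atTop ⊓ 𝓟 {d | Odd d}) atTop := tendsto_cutLevel.mono_left inf_le_left
  have hpow : Tendsto (fun l : ℕ => ((2 : ℝ) ^ l)⁻¹) atTop (𝓝 0) :=
    (tendsto_pow_atTop_atTop_of_one_lt (one_lt_two (α := ℝ))).inv_tendsto_atTop
  have hB : Tendsto (fun l : ℕ => 2 * ((2 ^ (j ^ 2 + j + 2) + 1) * ((2 : ℝ) ^ l)⁻¹) +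
      2 * atypicalBound l) atTop (𝓝 0) := by
    simpa using ((hpow.const_mul _).const_mul 2).add (tendsto_atypicalBound.const_mul 2)
  rw [tendsto_iff_norm_sub_tendsto_zero]
  refine squeeze_zero' (Eventually.of_forall fun _ => norm_nonneg _) ?_ (hB.comp hL)
  filter_upwards [hL.eventually_ge_atTop (400 + 2 * j), mem_inf_of_right (mem_principal_self _)]
    with d hl hd
  have h1 := inv_card_sqfrees_mul_le hq4 d (abs_nonneg _) (abs_sum_typicals_le (F := F) hq4 hd hl)
  have h2 := inv_card_sqfrees_mul_le hq4 d (Nat.cast_nonneg _)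
    (card_sdiff_typicals_le (F := F) hq4 (Odd.pos hd) (by omega))
  have hpos : (0 : ℝ) < (sqfrees F d).card := by exact_mod_cast card_sqfrees_pos hq4 d
  have hcard : ((sqfrees F d \ typicals F d).card : ℝ) + (typicals F d).card =
      (sqfrees F d).card := by
    exact_mod_cast Finset.card_sdiff_add_card_eq_card (typicals_subset d)
  have key : ((sqfrees F d).card : ℝ)⁻¹ * ∑ f ∈ typicals F d, injPoly j (2 ^ splitRank f) - 1 =
      ((sqfrees F d).card : ℝ)⁻¹ * ∑ f ∈ typicals F d, (injPoly j (2 ^ splitRank f) - 1) -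
      ((sqfrees F d).card : ℝ)⁻¹ * ((sqfrees F d \ typicals F d).card : ℝ) := by
    rw [Finset.sum_sub_distrib, Finset.sum_const, nsmul_eq_mul, mul_one,
      eq_sub_of_add_eq hcard, mul_sub, mul_sub, inv_mul_cancel₀ hpos.ne']
    ring
  rw [Real.norm_eq_abs, key]
  refine (abs_sub _ _).trans ?_
  rw [abs_mul, abs_mul, abs_of_pos (inv_pos.2 hpos), Nat.abs_cast]
  exact add_le_add h1 h2

lemma tendsto_proportion_splitRank (hq4 : Fintype.card F % 4 = 3) (r : ℕ) :
    Tendsto (fun d => (((sqfrees F d).filter fun f => splitRank f = r).card : ℝ) /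
      (sqfrees F d).card) (atTop ⊓ 𝓟 {d | Odd d})
      (𝓝 ((Nat.card (GL (Fin r) (ZMod 2)) : ℝ)⁻¹ * ∏' i : ℕ, (1 - ((2 : ℝ) ^ (r + 1 + i))⁻¹))) := by
  have hL : Tendsto cutLevel (atTop ⊓ 𝓟 {d | Odd d}) atTop := tendsto_cutLevel.mono_left inf_le_left
  have hmain := tendsto_of_moments (atTop ⊓ 𝓟 {d | Odd d}) (typicals F) splitRank
    (fun d => ((sqfrees F d).card : ℝ)⁻¹) (fun d => by positivity)
    (tendsto_moment_typicals hq4) r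
  have hB : Tendsto (fun l : ℕ => 2 * atypicalBound l) atTop (𝓝 0) := by
    simpa using tendsto_atypicalBound.const_mul 2
  have hdiff : Tendsto (fun d => ((sqfrees F d).card : ℝ)⁻¹ *
      ∑ f ∈ sqfrees F d \ typicals F d, if splitRank f = r then (1 : ℝ) else 0)
      (atTop ⊓ 𝓟 {d | Odd d}) (𝓝 0) := by
    refine squeeze_zero' (Eventually.of_forall fun d => ?_) ?_ (hB.comp hL)
    · exact mul_nonneg (by positivity) (Finset.sum_nonneg fun f _ => by split_ifs <;> norm_num)
    filter_upwards [hL.eventually_gt_atTop 0, mem_inf_of_right (mem_principal_self _)] with d hl hd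
    refine inv_card_sqfrees_mul_le hq4 d
      (Finset.sum_nonneg fun f _ => by split_ifs <;> norm_num) (le_trans ?_
      (card_sdiff_typicals_le (F := F) hq4 (Odd.pos hd) hl))
    rw [Finset.card_eq_sum_ones, Nat.cast_sum]
    exact Finset.sum_le_sum fun f _ => by split_ifs <;> norm_num
  have h := hdiff.add hmain
  rw [zero_add] at h
  refine h.congr fun d => ?_
  rw [← mul_add, Finset.sum_sdiff (typicals_subset d), div_eq_inv_mul, Finset.card_filter]
  push_cast
  rfl

lemma natCard_sqfrees (d : ℕ) :
    Nat.card {f : F[X] // f.Monic ∧ Squarefree f ∧ f.natDegree = d} = (sqfrees F d).card := by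
  refine Nat.subtype_card _ fun f => ?_
  rw [mem_sqfrees, and_comm (a := f.natDegree = d)]

lemma natCard_fourRankEq (hq4 : Fintype.card F % 4 = 3) {d : ℕ} (hd : Odd d) (r : ℕ) :
    Nat.card {f : F[X] // f.Monic ∧ Squarefree f ∧ f.natDegree = d ∧ fourRankEq f r} =
      ((sqfrees F d).filter fun f => splitRank f = r).card := by
  refine Nat.subtype_card _ fun f => ?_
  rw [mem_filt, mem_sqfrees]
  constructor
  · rintro ⟨⟨h1, h2, h3⟩, h4⟩
    exact ⟨h1, h3, h2, (fourRankEq_iff_splitRank hq4 h1 h3 (h2 ▸ hd) r).2 h4⟩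
  · rintro ⟨h1, h3, h2, h4⟩
    exact ⟨⟨h1, h2, h3⟩, (fourRankEq_iff_splitRank hq4 h1 h3 (h2 ▸ hd) r).1 h4⟩

end Assembly

/-- **Distribution of the 4-rank for `q ≡ 3 (mod 4)`.**  Among monic squarefree polynomials
`f` of degree `d` over `F_q`, the proportion of those whose ideal class group of
`F_q[x][Y]/(Y² - f)` satisfies `#(2·Cl[4]) = 2^r` tends, as `d → ∞` through odd integers, to
`μ_CL(r) = (1 / #GL_r(F_2)) · ∏_{i=r+1}^∞ (1 - 2^{-i})`. -/
theorem fourRank_distribution_three_mod_four (q : ℕ) (F : Type) [Field F] [Fintype F]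
    (hq : Fintype.card F = q) (hq4 : q % 4 = 3) (r : ℕ) :
    Filter.Tendsto
      (fun d : ℕ =>
        (Nat.card {f : F[X] // f.Monic ∧ Squarefree f ∧ f.natDegree = d ∧ fourRankEq f r} : ℝ) /
          (Nat.card {f : F[X] // f.Monic ∧ Squarefree f ∧ f.natDegree = d} : ℝ))
      (Filter.atTop ⊓ Filter.principal {d : ℕ | Odd d})
      (nhds ((Nat.card (GL (Fin r) (ZMod 2)) : ℝ)⁻¹ *
        ∏' i : ℕ, (1 - ((2 : ℝ) ^ (r + 1 + i))⁻¹))) := by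
  subst hq
  refine (tendsto_proportion_splitRank (F := F) hq4 r).congr' ?_
  filter_upwards [Filter.mem_inf_of_right (Filter.mem_principal_self _)] with d hd
  rw [natCard_sqfrees, natCard_fourRankEq hq4 hd]
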